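/- Let (K,v) and (L,w) be equicharacteristic henselian valued fields with v and w nontrivial. Then (K,v) and (L,w) satisfy the same existential sentences in the language of valued fields if and only if the residue fields Kv and Lw satisfy the same existential sentences in the language of rings. -/

import Mathlib

open FirstOrder Ring Language IsLocalRing

/-- Relation symbols of the auxiliary divisibility language: one binary relation `O`, with
`O(a, b)` meant to express `v a ≥ v b`. -/
inductive DivRel : ℕ → Type
  | o : DivRel 2

/-- The (one-sorted) first-order language of valued fields: the language of rings together with
a binary relation `O`, where `O(a, b)` is interpreted as `v a ≥ v b`. -/
def vfLang : FirstOrder.Language := Language.ring.sum ⟨fun _ => Empty, DivRel⟩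

/-- The `vfLang`-structure on a valued field `(K, O)`: the ring structure together with the
relation `O(a, b) ↔ v a ≥ v b` (equivalently, `a ∈ b·O`). -/
noncomputable def vfStructure {K : Type*} [Field K] (O : ValuationSubring K) :
    vfLang.Structure K :=
  letI : Language.ring.Structure K := (compatibleRingOfRing K).toStructure
  letI : Language.Structure ⟨fun _ => Empty, DivRel⟩ K :=
    ⟨fun {n} f _ => Empty.elim f, fun {n} r x =>
      match r with
      | DivRel.o => ∃ c ∈ O, x 0 = c * x 1⟩
  inferInstanceAs ((Language.ring.sum ⟨fun _ => Empty, DivRel⟩).Structure K)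

/-- A sentence is existential if it is an existential quantifier prefix applied to a
quantifier-free formula. -/
def IsExistentialSentence {L : FirstOrder.Language} (φ : L.Sentence) : Prop :=
  ∃ (n : ℕ) (ψ : L.BoundedFormula Empty n), ψ.IsQF ∧ φ = ψ.exs

/-- Truth of a valued-field sentence in a valued field `(K, O)`. -/
noncomputable def RealizeVF {K : Type*} [Field K] (O : ValuationSubring K)
    (φ : vfLang.Sentence) : Prop :=
  letI := vfStructure O
  Sentence.Realize K φ

/-- Truth of a ring-language sentence in a ring `R`. -/
def RealizeRing (R : Type*) [Add R] [Mul R] [Neg R] [One R] [Zero R]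
    (φ : Language.ring.Sentence) : Prop :=
  letI := compatibleRingOfRing R
  Sentence.Realize R φ

/-- `(K, O)` is an equicharacteristic valued field. -/
def IsEquicharacteristic {K : Type*} [Field K] (O : ValuationSubring K) : Prop :=
  ringChar K = ringChar (ResidueField ↥O)


set_option linter.unusedSectionVars false
set_option linter.unusedVariables false
set_option linter.style.haveILetI false

open Polynomial Filter


open FirstOrder Ring Language IsLocalRing

section SubfieldAlgebra
open Polynomial

variable {W : Type*} [Field W]

/-- relative algebraic closure of a subfield -/
noncomputable def acl (A : Subfield W) : Subfield W := (algebraicClosure A W).toSubfield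

/-- field generated over a subfield by a set -/
def adjF (A : Subfield W) (S : Set W) : Subfield W := Subfield.closure ((A : Set W) ∪ S)

/-- polynomial with coefficients in a subfield -/
def PolyIn (A : Subfield W) (g : W[X]) : Prop := ∀ i, g.coeff i ∈ A

theorem polyIn_iff_lifts {A : Subfield W} {g : W[X]} :
    PolyIn A g ↔ ∃ f : A[X], f.map (algebraMap A W) = g := by
  have : (∃ f : A[X], f.map (algebraMap A W) = g) ↔ g ∈ lifts (algebraMap A W) := by
    rw [mem_lifts]
  rw [this, lifts_iff_coeff_lifts]
  constructor
  · intro h i; exact ⟨⟨_, h i⟩, rfl⟩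
  · intro h i; obtain ⟨a, ha⟩ := h i; rw [← ha]; exact a.2

theorem PolyIn.map {A : Subfield W} (f : A[X]) : PolyIn A (f.map (algebraMap A W)) :=
  polyIn_iff_lifts.2 ⟨f, rfl⟩

theorem PolyIn.mono {A B : Subfield W} (h : A ≤ B) {g : W[X]} (hg : PolyIn A g) : PolyIn B g :=
  fun i => h (hg i)

theorem PolyIn.zero (A : Subfield W) : PolyIn A 0 := fun i => by simp [A.zero_mem]

theorem PolyIn.C {A : Subfield W} {a : W} (h : a ∈ A) : PolyIn A (C a) := by
  intro i; rw [coeff_C]; split_ifs; exacts [h, A.zero_mem]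

theorem PolyIn.X (A : Subfield W) : PolyIn A X := by
  intro i; rw [coeff_X]; split_ifs; exacts [A.one_mem, A.zero_mem]

theorem PolyIn.one (A : Subfield W) : PolyIn A 1 := by
  rw [← C_1]; exact PolyIn.C A.one_mem

theorem PolyIn.add {A : Subfield W} {f g : W[X]} (hf : PolyIn A f) (hg : PolyIn A g) :
    PolyIn A (f + g) := fun i => by rw [coeff_add]; exact A.add_mem (hf i) (hg i)

theorem PolyIn.neg {A : Subfield W} {f : W[X]} (hf : PolyIn A f) :
    PolyIn A (-f) := fun i => by rw [coeff_neg]; exact A.neg_mem (hf i)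

theorem PolyIn.sub {A : Subfield W} {f g : W[X]} (hf : PolyIn A f) (hg : PolyIn A g) :
    PolyIn A (f - g) := fun i => by rw [coeff_sub]; exact A.sub_mem (hf i) (hg i)

theorem PolyIn.mul {A : Subfield W} {f g : W[X]} (hf : PolyIn A f) (hg : PolyIn A g) :
    PolyIn A (f * g) := fun i => by
  rw [coeff_mul]; exact A.sum_mem fun j _ => A.mul_mem (hf _) (hg _)

theorem PolyIn.pow {A : Subfield W} {f : W[X]} (hf : PolyIn A f) (n : ℕ) : PolyIn A (f ^ n) := by
  induction n with
  | zero => rw [pow_zero]; exact PolyIn.one A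
  | succ n ih => rw [pow_succ]; exact ih.mul hf

theorem PolyIn.sum {A : Subfield W} {ι : Type*} {s : Finset ι} {f : ι → W[X]}
    (h : ∀ i ∈ s, PolyIn A (f i)) : PolyIn A (∑ i ∈ s, f i) := fun n => by
  rw [finsetSum_coeff]; exact A.sum_mem fun i hi => h i hi n

theorem PolyIn.comp {A : Subfield W} {f g : W[X]} (hf : PolyIn A f) (hg : PolyIn A g) :
    PolyIn A (f.comp g) := by
  rw [comp_eq_sum_left, Polynomial.sum_def]
  exact PolyIn.sum fun i _ => (PolyIn.C (hf i)).mul (hg.pow i)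

theorem PolyIn.hasseDeriv {A : Subfield W} {f : W[X]} (hf : PolyIn A f) (k : ℕ) :
    PolyIn A (hasseDeriv k f) := fun n => by
  rw [hasseDeriv_coeff]; exact A.mul_mem (natCast_mem A _) (hf _)

theorem PolyIn.derivative {A : Subfield W} {f : W[X]} (hf : PolyIn A f) :
    PolyIn A (derivative f) := by
  have := hf.hasseDeriv 1
  rwa [hasseDeriv_one] at this

theorem PolyIn.eval {A : Subfield W} {f : W[X]} (hf : PolyIn A f) {x : W} (hx : x ∈ A) :
    f.eval x ∈ A := by
  rw [eval_eq_sum, Polynomial.sum_def]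
  exact A.sum_mem fun i _ => A.mul_mem (hf i) (A.pow_mem hx i)

theorem PolyIn.taylor {A : Subfield W} {f : W[X]} (hf : PolyIn A f) {c : W} (hc : c ∈ A) :
    PolyIn A (taylor c f) := fun n => by
  rw [taylor_coeff]; exact (hf.hasseDeriv n).eval hc

theorem PolyIn.modByMonic {A : Subfield W} {f g : W[X]} (hf : PolyIn A f) (hg : PolyIn A g)
    (hm : g.Monic) : PolyIn A (f %ₘ g) := by
  obtain ⟨f', rfl⟩ := polyIn_iff_lifts.1 hf
  obtain ⟨g', rfl⟩ := polyIn_iff_lifts.1 hg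
  have hm' : g'.Monic := by
    rwa [monic_map_iff] at hm
  rw [← map_modByMonic _ hm']
  exact PolyIn.map _

theorem mem_acl_iff {A : Subfield W} {z : W} :
    z ∈ acl A ↔ ∃ g : W[X], g ≠ 0 ∧ PolyIn A g ∧ g.eval z = 0 := by
  have h1 : z ∈ acl A ↔ IsAlgebraic A z := mem_algebraicClosure_iff
  rw [h1]
  constructor
  · rintro ⟨f, hf, hz⟩
    refine ⟨f.map (algebraMap A W), ?_, PolyIn.map f, ?_⟩
    · rwa [Ne, Polynomial.map_eq_zero]
    · rwa [eval_map_algebraMap]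
  · rintro ⟨g, hg, hA, hz⟩
    obtain ⟨f, rfl⟩ := polyIn_iff_lifts.1 hA
    refine ⟨f, ?_, ?_⟩
    · rwa [Ne, Polynomial.map_eq_zero] at hg
    · rwa [eval_map_algebraMap] at hz

theorem mem_acl_iff_isAlgebraic {A : Subfield W} {z : W} : z ∈ acl A ↔ IsAlgebraic A z :=
  mem_algebraicClosure_iff

theorem le_acl (A : Subfield W) : A ≤ acl A := fun x hx =>
  mem_acl_iff_isAlgebraic.2 (isAlgebraic_algebraMap (⟨x, hx⟩ : A))

theorem acl_mono {A B : Subfield W} (h : A ≤ B) : acl A ≤ acl B := fun x hx => by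
  rw [mem_acl_iff] at hx ⊢
  obtain ⟨g, h0, h1, h2⟩ := hx
  exact ⟨g, h0, h1.mono h, h2⟩

theorem acl_acl (A : Subfield W) : acl (acl A) = acl A := by
  apply le_antisymm _ (le_acl _)
  intro x hx
  have h1 : IsAlgebraic (algebraicClosure A W) x := mem_acl_iff_isAlgebraic.1 hx
  rw [mem_acl_iff_isAlgebraic]
  exact IsAlgebraic.restrictScalars A h1

theorem acl_le_acl {A B : Subfield W} (h : A ≤ acl B) : acl A ≤ acl B := by
  rw [← acl_acl B]; exact acl_mono h

theorem root_mem_acl {A : Subfield W} {g : W[X]} {z : W} (h0 : g ≠ 0) (hg : PolyIn (acl A) g)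
    (hz : g.eval z = 0) : z ∈ acl A := by
  rw [← acl_acl]; exact mem_acl_iff.2 ⟨g, h0, hg, hz⟩

theorem pow_mem_acl {A : Subfield W} {z : W} {n : ℕ} (hn : n ≠ 0) (h : z ^ n ∈ acl A) :
    z ∈ acl A := by
  apply root_mem_acl (g := X ^ n - C (z ^ n)) (X_pow_sub_C_ne_zero (Nat.pos_of_ne_zero hn) _)
    (((PolyIn.X _).pow n).sub (PolyIn.C h))
  simp

theorem adjF_le_iff {A B : Subfield W} {S : Set W} : adjF A S ≤ B ↔ A ≤ B ∧ S ⊆ B := by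
  unfold adjF
  rw [Subfield.closure_le, Set.union_subset_iff]; rfl

theorem le_adjF (A : Subfield W) (S : Set W) : A ≤ adjF A S := (adjF_le_iff.1 le_rfl).1

theorem subset_adjF (A : Subfield W) (S : Set W) : S ⊆ adjF A S := (adjF_le_iff.1 le_rfl).2

theorem mem_adjF_self (A : Subfield W) (x : W) : x ∈ adjF A {x} := subset_adjF A {x} rfl

theorem adjF_mono {A B : Subfield W} {S T : Set W} (h : A ≤ B) (h' : S ⊆ T) :
    adjF A S ≤ adjF B T :=
  adjF_le_iff.2 ⟨h.trans (le_adjF _ _), h'.trans (subset_adjF _ _)⟩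

theorem adjF_eq_adjoin (A : Subfield W) (S : Set W) :
    adjF A S = (IntermediateField.adjoin A S).toSubfield := by
  apply le_antisymm
  · rw [adjF_le_iff]
    exact ⟨fun x hx => (IntermediateField.adjoin A S).algebraMap_mem ⟨x, hx⟩,
      IntermediateField.subset_adjoin A S⟩
  · let I : IntermediateField A W :=
      { adjF A S with algebraMap_mem' := fun r => le_adjF A S r.2 }
    have : IntermediateField.adjoin A S ≤ I := by
      rw [IntermediateField.adjoin_le_iff]; exact subset_adjF A S
    exact this

theorem mem_adjF_iff_adjoin {A : Subfield W} {S : Set W} {x : W} :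
    x ∈ adjF A S ↔ x ∈ IntermediateField.adjoin A S := by
  rw [adjF_eq_adjoin]; rfl

theorem mem_adjF_singleton {A : Subfield W} {x w : W} :
    w ∈ adjF A {x} ↔ ∃ g h : W[X], PolyIn A g ∧ PolyIn A h ∧ w = g.eval x / h.eval x := by
  rw [mem_adjF_iff_adjoin, IntermediateField.mem_adjoin_simple_iff]
  constructor
  · rintro ⟨r, s, h⟩
    refine ⟨r.map (algebraMap A W), s.map (algebraMap A W), PolyIn.map _, PolyIn.map _, ?_⟩
    rw [eval_map_algebraMap, eval_map_algebraMap, h]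
  · rintro ⟨g, h, hg, hh, e⟩
    obtain ⟨g', rfl⟩ := polyIn_iff_lifts.1 hg
    obtain ⟨h', rfl⟩ := polyIn_iff_lifts.1 hh
    refine ⟨g', h', ?_⟩
    rw [eval_map_algebraMap, eval_map_algebraMap] at e
    exact e

/-- minimal polynomial over a subfield as polynomial over the big field -/
noncomputable def mpW (A : Subfield W) (z : W) : W[X] := (minpoly A z).map (algebraMap A W)

theorem mpW_polyIn (A : Subfield W) (z : W) : PolyIn A (mpW A z) := PolyIn.map _

theorem mpW_monic {A : Subfield W} {z : W} (hz : z ∈ acl A) : (mpW A z).Monic :=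
  (minpoly.monic (mem_acl_iff_isAlgebraic.1 hz).isIntegral).map _

theorem mpW_eval (A : Subfield W) (z : W) : (mpW A z).eval z = 0 := by
  unfold mpW; rw [eval_map_algebraMap]; exact minpoly.aeval _ _

theorem mpW_natDegree (A : Subfield W) (z : W) : (mpW A z).natDegree = (minpoly A z).natDegree :=
  natDegree_map _

theorem mpW_dvd {A : Subfield W} {z : W} {g : W[X]} (hg : PolyIn A g) (hz : g.eval z = 0) :
    mpW A z ∣ g := by
  obtain ⟨f, rfl⟩ := polyIn_iff_lifts.1 hg
  rw [eval_map_algebraMap] at hz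
  exact Polynomial.map_dvd _ (minpoly.dvd A z hz)

theorem mpW_dvd_mpW {A B : Subfield W} (h : A ≤ B) (z : W) : mpW B z ∣ mpW A z :=
  mpW_dvd ((mpW_polyIn A z).mono h) (mpW_eval A z)

theorem mpW_natDegree_pos {A : Subfield W} {z : W} (hz : z ∈ acl A) : 0 < (mpW A z).natDegree := by
  rw [mpW_natDegree]; exact minpoly.natDegree_pos (mem_acl_iff_isAlgebraic.1 hz).isIntegral

theorem natDegree_mpW_le {A : Subfield W} {z : W} {g : W[X]} (h0 : g ≠ 0) (hg : PolyIn A g)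
    (hz : g.eval z = 0) : (mpW A z).natDegree ≤ g.natDegree :=
  natDegree_le_of_dvd (mpW_dvd hg hz) h0

theorem mem_of_mpW_natDegree_eq_one {A : Subfield W} {z : W} (hz : z ∈ acl A)
    (h : (mpW A z).natDegree = 1) : z ∈ A := by
  have h1 := (mpW_monic hz).eq_X_add_C h
  have h2 := mpW_eval A z
  rw [h1] at h2
  simp at h2
  rw [eq_neg_of_add_eq_zero_left h2]
  exact A.neg_mem (mpW_polyIn A z 0)

/-- elements of a simple algebraic extension as polynomials reduced modulo a monic polynomial -/
theorem mem_adjF_of_root {A : Subfield W} {x w : W} {m : W[X]} (hm : m.Monic) (hmA : PolyIn A m)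
    (hx : m.eval x = 0) (hw : w ∈ adjF A {x}) :
    ∃ g : W[X], PolyIn A g ∧ g.degree < m.degree ∧ w = g.eval x := by
  have hintg : IsIntegral A x := by
    obtain ⟨f, rfl⟩ := polyIn_iff_lifts.1 hmA
    refine ⟨f, ?_, ?_⟩
    · rwa [monic_map_iff] at hm
    · rwa [eval_map] at hx
  rw [mem_adjF_iff_adjoin, ← IntermediateField.mem_toSubalgebra,
    IntermediateField.adjoin_simple_toSubalgebra_of_isAlgebraic hintg.isAlgebraic,
    Algebra.adjoin_singleton_eq_range_aeval] at hw
  obtain ⟨f, hf⟩ := hw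
  refine ⟨(f.map (algebraMap A W)) %ₘ m, (PolyIn.map f).modByMonic hmA hm,
    degree_modByMonic_lt _ hm, ?_⟩
  rw [← hf]
  have := congrArg (Polynomial.eval x) (modByMonic_add_div (f.map (algebraMap A W)) m)
  rw [eval_add, eval_mul, hx, zero_mul, add_zero] at this
  rw [this, eval_map_algebraMap]; rfl

open IntermediateField.algebraAdjoinAdjoin in
theorem mem_acl_adjF_iff {A : Subfield W} {S : Set W} {w : W} :
    w ∈ acl (adjF A S) ↔ IsAlgebraic (Algebra.adjoin A S) w := by
  rw [mem_acl_iff_isAlgebraic, IsFractionRing.isAlgebraic_iff (Algebra.adjoin A S)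
    (IntermediateField.adjoin A S) W, adjF_eq_adjoin]
  rfl

theorem acl_exchange {A : Subfield W} {x w : W} (hw : w ∈ acl (adjF A {x})) (hw' : w ∉ acl A) :
    x ∈ acl (adjF A {w}) := by
  rw [mem_acl_adjF_iff] at hw ⊢
  by_cases hx : x ∈ acl A
  · rw [← mem_acl_adjF_iff]; exact acl_mono (le_adjF _ _) hx
  · exact IsAlgebraic.adjoin_singleton
      (fun h => hx (mem_acl_iff_isAlgebraic.2 h)) (fun h => hw' (mem_acl_iff_isAlgebraic.2 h)) hw

end SubfieldAlgebra

open FirstOrder Ring Language IsLocalRing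
set_option linter.unusedSectionVars false

section UltraBasics
open Polynomial

variable {W : Type*} [NormedField W] [IsUltrametricDist W]

theorem um_add_le {x y : W} {r : ℝ} (hx : ‖x‖ ≤ r) (hy : ‖y‖ ≤ r) : ‖x + y‖ ≤ r :=
  (IsUltrametricDist.norm_add_le_max x y).trans (max_le hx hy)

theorem um_add_lt {x y : W} {r : ℝ} (hx : ‖x‖ < r) (hy : ‖y‖ < r) : ‖x + y‖ < r :=
  (IsUltrametricDist.norm_add_le_max x y).trans_lt (max_lt hx hy)

theorem um_sub_le {x y : W} {r : ℝ} (hx : ‖x‖ ≤ r) (hy : ‖y‖ ≤ r) : ‖x - y‖ ≤ r := by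
  rw [sub_eq_add_neg]; exact um_add_le hx (by rwa [norm_neg])

theorem um_sub_lt {x y : W} {r : ℝ} (hx : ‖x‖ < r) (hy : ‖y‖ < r) : ‖x - y‖ < r := by
  rw [sub_eq_add_neg]; exact um_add_lt hx (by rwa [norm_neg])

theorem um_tri_le {x y z : W} {r : ℝ} (h1 : ‖x - y‖ ≤ r) (h2 : ‖y - z‖ ≤ r) : ‖x - z‖ ≤ r := by
  have := um_add_le h1 h2
  rwa [sub_add_sub_cancel] at this

theorem um_tri_lt {x y z : W} {r : ℝ} (h1 : ‖x - y‖ < r) (h2 : ‖y - z‖ < r) : ‖x - z‖ < r := by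
  have := um_add_lt h1 h2
  rwa [sub_add_sub_cancel] at this

theorem um_add_eq {x y : W} (h : ‖y‖ < ‖x‖) : ‖x + y‖ = ‖x‖ := by
  rw [IsUltrametricDist.norm_add_eq_max_of_norm_ne_norm h.ne', max_eq_left h.le]

theorem um_eq_of_sub_lt {x y : W} (h : ‖x - y‖ < ‖x‖) : ‖y‖ = ‖x‖ := by
  have := um_add_eq (x := x) (y := y - x) (by rwa [norm_sub_rev])
  rwa [add_sub_cancel] at this

theorem um_eq_of_sub_lt' {x y : W} (h : ‖x - y‖ < ‖y‖) : ‖x‖ = ‖y‖ :=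
  um_eq_of_sub_lt (by rwa [norm_sub_rev])

theorem um_sum_le {ι : Type*} {s : Finset ι} {f : ι → W} {C : ℝ} (hC : 0 ≤ C)
    (h : ∀ i ∈ s, ‖f i‖ ≤ C) : ‖∑ i ∈ s, f i‖ ≤ C :=
  IsUltrametricDist.norm_sum_le_of_forall_le_of_nonneg hC h

theorem um_sum_lt {ι : Type*} {s : Finset ι} {f : ι → W} {C : ℝ} (hC : 0 < C)
    (h : ∀ i ∈ s, ‖f i‖ < C) : ‖∑ i ∈ s, f i‖ < C := by
  classical
  induction s using Finset.induction_on with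
  | empty => simpa using hC
  | insert a s ha ih =>
    rw [Finset.sum_insert ha]
    exact um_add_lt (h a (Finset.mem_insert_self _ _))
      (ih fun i hi => h i (Finset.mem_insert_of_mem hi))

theorem um_sum_eq {ι : Type*} {s : Finset ι} {f : ι → W} {j : ι} (hj : j ∈ s)
    (h : ∀ i ∈ s, i ≠ j → ‖f i‖ < ‖f j‖) : ‖∑ i ∈ s, f i‖ = ‖f j‖ := by
  classical
  rw [← Finset.add_sum_erase _ _ hj]
  by_cases h0 : ‖f j‖ = 0
  · have : s.erase j = ∅ := by
      rw [Finset.eq_empty_iff_forall_notMem]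
      intro i hi
      rw [Finset.mem_erase] at hi
      have := h i hi.2 hi.1
      rw [h0] at this
      exact absurd this (not_lt.2 (norm_nonneg _))
    rw [this]; simp
  · apply um_add_eq
    apply um_sum_lt (lt_of_le_of_ne (norm_nonneg _) (Ne.symm h0))
    intro i hi
    rw [Finset.mem_erase] at hi
    exact h i hi.2 hi.1

/-- if norms of nonzero terms are pairwise distinct, the norm of the sum is the max -/
theorem um_le_sum_of_distinct {ι : Type*} {s : Finset ι} {f : ι → W}
    (h : ∀ i ∈ s, ∀ j ∈ s, i ≠ j → f i ≠ 0 → ‖f i‖ ≠ ‖f j‖) {k : ι} (hk : k ∈ s) :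
    ‖f k‖ ≤ ‖∑ i ∈ s, f i‖ := by
  obtain ⟨j, hj, hmax⟩ := Finset.exists_max_image s (fun i => ‖f i‖) ⟨k, hk⟩
  by_cases h0 : f j = 0
  · have := hmax k hk
    rw [h0, norm_zero] at this
    exact this.trans (norm_nonneg _)
  · rw [um_sum_eq hj]
    · exact hmax k hk
    · intro i hi hij
      exact lt_of_le_of_ne (hmax i hi) (h j hj i hi (Ne.symm hij) h0).symm

theorem um_multiset_prod_lt (m : Multiset W) {s c : W} (h : ∀ a ∈ m, ‖s - c‖ < ‖s - a‖) :
    ‖(m.map fun a => s - a).prod - (m.map fun a => c - a).prod‖ < ‖(m.map fun a => s - a).prod‖ := by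
  induction m using Multiset.induction_on with
  | empty => simp
  | cons a m ih =>
    have ih := ih fun b hb => h b (Multiset.mem_cons_of_mem hb)
    have ha := h a (Multiset.mem_cons_self _ _)
    rw [Multiset.map_cons, Multiset.prod_cons, Multiset.map_cons, Multiset.prod_cons]
    set P := (m.map fun a => s - a).prod
    set Q := (m.map fun a => c - a).prod
    have e : (s - a) * P - (c - a) * Q = (s - a) * (P - Q) + (s - c) * Q := by ring
    have hQ : ‖Q‖ = ‖P‖ := um_eq_of_sub_lt ih
    have hP : 0 < ‖P‖ := lt_of_le_of_lt (norm_nonneg _) ih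
    have hs : 0 < ‖s - a‖ := lt_of_le_of_lt (norm_nonneg _) ha
    rw [e, norm_mul (s - a) P]
    apply um_add_lt
    · rw [norm_mul]; exact mul_lt_mul_of_pos_left ih hs
    · rw [norm_mul, hQ]; exact mul_lt_mul_of_pos_right ha hP

theorem um_multiset_prod_le (m : Multiset W) {s c : W} {ρ : ℝ} (h0 : 0 ≤ ρ) (h1 : ρ ≤ 1)
    (h : ∀ a ∈ m, ‖s - c‖ ≤ ρ * ‖s - a‖) :
    ‖(m.map fun a => s - a).prod - (m.map fun a => c - a).prod‖ ≤
      ρ * ‖(m.map fun a => s - a).prod‖ := by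
  induction m using Multiset.induction_on with
  | empty => simpa using h0
  | cons a m ih =>
    have ih := ih fun b hb => h b (Multiset.mem_cons_of_mem hb)
    have ha := h a (Multiset.mem_cons_self _ _)
    rw [Multiset.map_cons, Multiset.prod_cons, Multiset.map_cons, Multiset.prod_cons]
    set P := (m.map fun a => s - a).prod
    set Q := (m.map fun a => c - a).prod
    have e : (s - a) * P - (c - a) * Q = (s - a) * (P - Q) + (s - c) * Q := by ring
    have hQ : ‖Q‖ ≤ ‖P‖ := by
      have : Q = P - (P - Q) := by ring
      rw [this]
      refine um_sub_le le_rfl (ih.trans ?_)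
      exact mul_le_of_le_one_left (norm_nonneg _) h1
    rw [e, norm_mul (s - a) P]
    apply um_add_le
    · rw [norm_mul]
      calc ‖s - a‖ * ‖P - Q‖ ≤ ‖s - a‖ * (ρ * ‖P‖) := by gcongr
        _ = _ := by ring
    · rw [norm_mul]
      calc ‖s - c‖ * ‖Q‖ ≤ (ρ * ‖s - a‖) * ‖P‖ := by gcongr
        _ = _ := by ring

theorem eval_eq_prod_roots_sub [IsAlgClosed W] (g : W[X]) (s : W) :
    g.eval s = g.leadingCoeff * (g.roots.map fun a => s - a).prod := by
  conv_lhs => rw [(IsAlgClosed.splits g).eq_prod_roots]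
  rw [eval_mul, eval_C, eval_multiset_prod, Multiset.map_map]
  simp

theorem eval_close_lt [IsAlgClosed W] {g : W[X]} (hg : g ≠ 0) {s c : W}
    (h : ∀ a ∈ g.roots, ‖s - c‖ < ‖s - a‖) : ‖g.eval s - g.eval c‖ < ‖g.eval s‖ := by
  rw [eval_eq_prod_roots_sub g s, eval_eq_prod_roots_sub g c, ← mul_sub, norm_mul, norm_mul]
  exact mul_lt_mul_of_pos_left (um_multiset_prod_lt _ h)
    (norm_pos_iff.2 (leadingCoeff_ne_zero.2 hg))

theorem eval_close_le [IsAlgClosed W] (g : W[X]) {s c : W} {ρ : ℝ} (h0 : 0 ≤ ρ) (h1 : ρ ≤ 1)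
    (h : ∀ a ∈ g.roots, ‖s - c‖ ≤ ρ * ‖s - a‖) :
    ‖g.eval s - g.eval c‖ ≤ ρ * ‖g.eval s‖ := by
  rw [eval_eq_prod_roots_sub g s, eval_eq_prod_roots_sub g c, ← mul_sub, norm_mul, norm_mul,
    mul_left_comm]
  exact mul_le_mul_of_nonneg_left (um_multiset_prod_le _ h0 h1 h) (norm_nonneg _)

/-- closeness of roots: if a monic polynomial is small at `z`, it has a root near `z` -/
theorem exists_root_near [IsAlgClosed W] {g : W[X]} (hm : g.Monic) {z : W} {ε : ℝ} (hε : 0 ≤ ε)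
    (hz : ‖g.eval z‖ < ε ^ g.natDegree) : ∃ a, g.eval a = 0 ∧ ‖z - a‖ < ε := by
  by_contra! hcon
  have h1 : ∀ a ∈ g.roots, ε ≤ ‖z - a‖ := fun a ha => hcon a (isRoot_of_mem_roots ha)
  have h2 : ∀ m : Multiset W, (∀ a ∈ m, ε ≤ ‖z - a‖) →
      ε ^ (Multiset.card m) ≤ ‖(m.map fun a => z - a).prod‖ := by
    intro m
    induction m using Multiset.induction_on with
    | empty => simp
    | cons a m ih =>
      intro hm
      have := ih fun b hb => hm b (Multiset.mem_cons_of_mem hb)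
      rw [Multiset.map_cons, Multiset.prod_cons, norm_mul, Multiset.card_cons, pow_succ']
      have h3 := hm a (Multiset.mem_cons_self _ _)
      gcongr
  have h3 := h2 _ h1
  rw [eval_eq_prod_roots_sub, hm.leadingCoeff, one_mul] at hz
  rw [(IsAlgClosed.splits g).natDegree_eq_card_roots] at hz
  exact absurd hz (not_lt.2 h3)

theorem um_div_close {a b a' b' : W} (ha : ‖a - a'‖ < ‖a‖) (hb : ‖b - b'‖ < ‖b‖) :
    ‖a / b - a' / b'‖ < ‖a / b‖ := by
  have hbb := um_eq_of_sub_lt hb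
  have ha0 : 0 < ‖a‖ := (norm_nonneg _).trans_lt ha
  have hb0 : 0 < ‖b‖ := (norm_nonneg _).trans_lt hb
  have hb1 : b ≠ 0 := norm_pos_iff.1 hb0
  have hb1' : b' ≠ 0 := norm_pos_iff.1 (hbb ▸ hb0)
  have e : a / b - a' / b' = ((a - a') * b - a * (b - b')) / (b * b') := by
    field_simp; ring
  rw [e, norm_div, norm_div, norm_mul b b', hbb, div_lt_div_iff₀ (by positivity) hb0]
  rw [← mul_assoc, mul_lt_mul_iff_left₀ hb0]
  apply um_sub_lt
  · rw [norm_mul]; exact mul_lt_mul_of_pos_right ha hb0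
  · rw [norm_mul]; exact mul_lt_mul_of_pos_left hb ha0

end UltraBasics

section GoodFields
open Polynomial

variable {W : Type*} [NormedField W] [IsUltrametricDist W]

/-- every integral element is congruent to an element of `κ` -/
def Good (κ M : Subfield W) : Prop := ∀ x ∈ M, ‖x‖ ≤ 1 → ∃ c ∈ κ, ‖x - c‖ < 1

/-- norm trivial on `κ` -/
def TrivN (κ : Subfield W) : Prop := ∀ c ∈ κ, c ≠ 0 → ‖c‖ = 1

theorem TrivN.le {κ : Subfield W} (h : TrivN κ) {c : W} (hc : c ∈ κ) : ‖c‖ ≤ 1 := by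
  by_cases h0 : c = 0
  · simp [h0]
  · exact (h c hc h0).le

theorem TrivN.eq_zero {κ : Subfield W} (h : TrivN κ) {c : W} (hc : c ∈ κ) (h1 : ‖c‖ < 1) :
    c = 0 := by
  by_contra h0
  exact h1.ne (h c hc h0)

/-- immediate approximations give goodness -/
theorem Good.of_imm {κ M N : Subfield W} (hg : Good κ M)
    (h : ∀ x ∈ N, x ≠ 0 → ∃ m ∈ M, ‖x - m‖ < ‖x‖) : Good κ N := by
  intro x hx h1
  by_cases h0 : x = 0
  · exact ⟨0, κ.zero_mem, by simp [h0]⟩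
  obtain ⟨m, hm, hxm⟩ := h x hx h0
  obtain ⟨c, hc, hmc⟩ := hg m hm ((um_eq_of_sub_lt hxm).le.trans h1)
  exact ⟨c, hc, um_tri_lt (hxm.trans_le h1) hmc⟩

structure MaxGood (p : ℕ) (κ M : Subfield W) : Prop where
  triv : TrivN κ
  perf : ∀ c ∈ κ, ∃ d ∈ κ, d ^ p = c
  le : κ ≤ M
  good : Good κ M
  max : ∀ N : Subfield W, M ≤ N → Good κ N → N ≤ M

theorem exists_maxGood {p : ℕ} {κ K : Subfield W} (ht : TrivN κ)
    (hp : ∀ c ∈ κ, ∃ d ∈ κ, d ^ p = c) (hle : κ ≤ K) (hg : Good κ K) :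
    ∃ M, K ≤ M ∧ MaxGood p κ M := by
  obtain ⟨M, hKM, hM⟩ := zorn_le_nonempty₀ {N : Subfield W | Good κ N} (by
    intro c hc hchain y hy
    refine ⟨sSup c, ?_, fun z hz => le_sSup hz⟩
    intro x hx h1
    rw [Subfield.mem_sSup_of_directedOn ⟨y, hy⟩ hchain.directedOn] at hx
    obtain ⟨N, hN, hxN⟩ := hx
    exact hc hN x hxN h1) K hg
  exact ⟨M, hKM, ht, hp, hle.trans hKM, hM.1, fun N hN hg => hM.2 hg hN⟩

theorem MaxGood.isClosed {p : ℕ} {κ M : Subfield W} (h : MaxGood p κ M) :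
    IsClosed (M : Set W) := by
  have : M.topologicalClosure ≤ M := by
    apply h.max _ M.le_topologicalClosure
    apply h.good.of_imm
    intro x hx h0
    have hx' : x ∈ closure (M : Set W) := hx
    obtain ⟨m, hm, hd⟩ := Metric.mem_closure_iff.1 hx' ‖x‖ (norm_pos_iff.2 h0)
    exact ⟨m, hm, by rwa [dist_eq_norm] at hd⟩
  have h2 : M.topologicalClosure = M := le_antisymm this M.le_topologicalClosure
  rw [← h2]; exact M.isClosed_topologicalClosure

theorem MaxGood.perfect {p : ℕ} [hp : ExpChar W p] {κ M : Subfield W} (h : MaxGood p κ M) {x : W}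
    (hx : x ^ p ∈ M) : x ∈ M := by
  have hp0 : p ≠ 0 := (expChar_pos W p).ne'
  have : M.comap (frobenius W p) ≤ M := by
    apply h.max
    · intro y hy
      rw [Subfield.mem_comap, frobenius_def]; exact M.pow_mem hy p
    · intro y hy h1
      rw [Subfield.mem_comap, frobenius_def] at hy
      obtain ⟨c, hc, hcy⟩ := h.good _ hy (by rw [norm_pow]; exact pow_le_one₀ (norm_nonneg _) h1)
      obtain ⟨d, hd, rfl⟩ := h.perf c hc
      refine ⟨d, hd, ?_⟩
      rw [← sub_pow_expChar, norm_pow] at hcy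
      exact (pow_lt_one_iff_of_nonneg (norm_nonneg _) hp0).1 hcy
  exact this (by rw [Subfield.mem_comap, frobenius_def]; exact hx)

theorem MaxGood.exists_best_approx {p : ℕ} [IsAlgClosed W] {κ M : Subfield W}
    (h : MaxGood p κ M) (w : W) : ∃ m ∈ M, ∀ m' ∈ M, ‖w - m‖ ≤ ‖w - m'‖ := by
  classical
  let BA : W → Prop := fun w => ∃ m ∈ M, ∀ m' ∈ M, ‖w - m‖ ≤ ‖w - m'‖
  -- key claim
  have key : ∀ s : W, ¬ BA s → ∀ g : W[X], g ≠ 0 → (∀ a ∈ g.roots, BA a) →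
      ∃ c ∈ M, ∀ a ∈ g.roots, ‖s - c‖ < ‖s - a‖ := by
    intro s hs g hg hr
    have h1 : ∀ a ∈ g.roots.toFinset, ∃ c ∈ M, ‖s - c‖ < ‖s - a‖ := by
      intro a ha
      by_contra! hcon
      obtain ⟨m, hm, hma⟩ := hr a (Multiset.mem_toFinset.1 ha)
      apply hs
      refine ⟨m, hm, fun m' hm' => ?_⟩
      have h2 := hcon m' hm'
      refine um_tri_le h2 ((hma m' hm').trans ?_)
      exact um_tri_le (by rwa [norm_sub_rev]) le_rfl
    have h2 : ∀ t : Finset W, (∀ a ∈ t, ∃ c ∈ M, ‖s - c‖ < ‖s - a‖) →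
        ∃ c ∈ M, ∀ a ∈ t, ‖s - c‖ < ‖s - a‖ := by
      intro t
      induction t using Finset.induction_on with
      | empty => exact fun _ => ⟨0, M.zero_mem, by simp⟩
      | insert a t _ ih =>
        intro ht
        obtain ⟨c, hc, hct⟩ := ih fun b hb => ht b (Finset.mem_insert_of_mem hb)
        obtain ⟨d, hd, hda⟩ := ht a (Finset.mem_insert_self _ _)
        rcases le_total ‖s - c‖ ‖s - d‖ with hcd | hcd
        · refine ⟨c, hc, fun b hb => ?_⟩
          rcases Finset.mem_insert.1 hb with rfl | hb
          · exact hcd.trans_lt hda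
          · exact hct b hb
        · refine ⟨d, hd, fun b hb => ?_⟩
          rcases Finset.mem_insert.1 hb with rfl | hb
          · exact hda
          · exact hcd.trans_lt (hct b hb)
    obtain ⟨c, hc, hct⟩ := h2 _ h1
    exact ⟨c, hc, fun a ha => hct a (Multiset.mem_toFinset.2 ha)⟩
  have inM : ∀ s ∈ M, BA s := fun s hs => ⟨s, hs, by simp⟩
  have fin : ∀ s : W, Good κ (adjF M {s}) → s ∈ M := fun s hs =>
    h.max _ (le_adjF _ _) hs (mem_adjF_self M s)
  -- algebraic case
  have alg : ∀ n : ℕ, ∀ s ∈ acl M, (mpW M s).natDegree = n → BA s := by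
    intro n
    induction n using Nat.strong_induction_on with
    | _ n ih =>
      intro s hs hn
      by_contra hcon
      apply hcon
      apply inM
      apply fin
      apply h.good.of_imm
      intro x hx h0
      obtain ⟨g, hgM, hgd, rfl⟩ := mem_adjF_of_root (mpW_monic hs) (mpW_polyIn M s) (mpW_eval M s) hx
      have hg0 : g ≠ 0 := by rintro rfl; simp at h0
      obtain ⟨c, hc, hc'⟩ := key s hcon g hg0 (by
        intro a ha
        have hag : g.eval a = 0 := isRoot_of_mem_roots ha
        have h1 : (mpW M a).natDegree ≤ g.natDegree := natDegree_mpW_le hg0 hgM hag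
        have h2 : g.natDegree < (mpW M s).natDegree := natDegree_lt_natDegree hg0 hgd
        exact ih _ (by omega) a (mem_acl_iff.2 ⟨g, hg0, hgM, hag⟩) rfl)
      exact ⟨_, hgM.eval hc, eval_close_lt hg0 hc'⟩
  by_contra hcon
  by_cases hw : w ∈ acl M
  · exact hcon (alg _ w hw rfl)
  apply hcon
  apply inM
  apply fin
  apply h.good.of_imm
  intro x hx h0
  obtain ⟨g, f, hg, hf, rfl⟩ := mem_adjF_singleton.1 hx
  have hg0 : g ≠ 0 := by rintro rfl; simp at h0
  have hf0 : f ≠ 0 := by rintro rfl; simp at h0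
  obtain ⟨c, hc, hc'⟩ := key w hcon (g * f) (mul_ne_zero hg0 hf0) (by
    intro a ha
    exact alg _ a (mem_acl_iff.2 ⟨g * f, mul_ne_zero hg0 hf0, hg.mul hf, isRoot_of_mem_roots ha⟩) rfl)
  refine ⟨_, M.div_mem (hg.eval hc) (hf.eval hc), um_div_close ?_ ?_⟩
  · exact eval_close_lt hg0 fun a ha => hc' a (by
      rw [roots_mul (mul_ne_zero hg0 hf0)]; exact Multiset.mem_add.2 (Or.inl ha))
  · exact eval_close_lt hf0 fun a ha => hc' a (by
      rw [roots_mul (mul_ne_zero hg0 hf0)]; exact Multiset.mem_add.2 (Or.inr ha))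

/-- the set of norms of nonzero elements of a maximal good field is divisible -/
theorem MaxGood.norm_divisible {p : ℕ} [IsAlgClosed W] {κ M : Subfield W}
    (h : MaxGood p κ M) {b : W} (hb : b ∈ M) {n : ℕ} (hn : n ≠ 0) :
    ∃ m ∈ M, ‖m‖ ^ n = ‖b‖ := by
  classical
  by_cases hb0 : b = 0
  · exact ⟨0, M.zero_mem, by simp [hb0, hn]⟩
  obtain ⟨u, hu⟩ := IsAlgClosed.exists_pow_nat_eq b (Nat.pos_of_ne_zero hn)
  have hex : ∃ d : ℕ, d ≠ 0 ∧ ∃ m ∈ M, ‖m‖ = ‖u‖ ^ d := ⟨n, hn, b, hb, by rw [← hu, norm_pow]⟩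
  set d := Nat.find hex with hd
  obtain ⟨hd0, m, hm, hmu⟩ := Nat.find_spec hex
  rw [← hd] at hd0 hmu
  have hu0 : u ≠ 0 := by rintro rfl; rw [zero_pow hn] at hu; exact hb0 hu.symm
  have hupos : 0 < ‖u‖ := norm_pos_iff.2 hu0
  obtain ⟨u', hu'⟩ := IsAlgClosed.exists_pow_nat_eq m (Nat.pos_of_ne_zero hd0)
  have hnu : ‖u'‖ = ‖u‖ := by
    have : ‖u'‖ ^ d = ‖u‖ ^ d := by rw [← norm_pow, hu', hmu]
    exact (pow_left_inj₀ (norm_nonneg _) (norm_nonneg _) hd0).1 this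
  suffices hu'M : u' ∈ M by
    exact ⟨u', hu'M, by rw [hnu, ← norm_pow, hu]⟩
  have hdist : ∀ i j : ℕ, i < j → j < d → ∀ a ∈ M, ∀ c ∈ M, a ≠ 0 →
      ‖a * u' ^ i‖ ≠ ‖c * u' ^ j‖ := by
    intro i j hij hjd a ha c hc ha0 heq
    rw [norm_mul, norm_mul, norm_pow, norm_pow, hnu] at heq
    have hc0 : c ≠ 0 := by
      rintro rfl
      rw [norm_zero, zero_mul] at heq
      exact (mul_pos (norm_pos_iff.2 ha0) (pow_pos hupos i)).ne' heq
    have h1 : ‖a / c‖ = ‖u‖ ^ (j - i) := by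
      rw [norm_div, div_eq_iff (norm_pos_iff.2 hc0).ne']
      have : ‖u‖ ^ j = ‖u‖ ^ (j - i) * ‖u‖ ^ i := by rw [← pow_add]; congr 1; omega
      rw [this] at heq
      have hi := (pow_pos hupos i).ne'
      apply mul_right_cancel₀ hi
      rw [heq]; ring
    exact Nat.find_min hex (m := j - i) (by omega) ⟨by omega, a / c, M.div_mem ha hc, h1⟩
  apply h.max _ (le_adjF M {u'}) _ (mem_adjF_self M u')
  intro x hx h1
  obtain ⟨g, hgM, hgd, rfl⟩ := mem_adjF_of_root (monic_X_pow_sub_C m hd0)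
    (((PolyIn.X M).pow d).sub (PolyIn.C hm)) (x := u') (by simp [hu']) hx
  rw [degree_X_pow_sub_C (Nat.pos_of_ne_zero hd0)] at hgd
  have hgd' : g.natDegree < d := by
    by_cases hg : g = 0
    · rw [hg, natDegree_zero]; exact Nat.pos_of_ne_zero hd0
    · rwa [natDegree_lt_iff_degree_lt hg]
  have hsum := eval_eq_sum_range' hgd' u'
  rw [hsum] at h1 ⊢
  have hne : ∀ i ∈ Finset.range d, ∀ j ∈ Finset.range d, i ≠ j →
      g.coeff i * u' ^ i ≠ 0 → ‖g.coeff i * u' ^ i‖ ≠ ‖g.coeff j * u' ^ j‖ := by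
    intro i hi j hj hij h0
    rw [Finset.mem_range] at hi hj
    rcases lt_or_gt_of_ne hij with hlt | hlt
    · exact hdist i j hlt hj _ (hgM i) _ (hgM j) (left_ne_zero_of_mul h0)
    · by_cases hj0 : g.coeff j = 0
      · rw [hj0, zero_mul, norm_zero]; exact norm_ne_zero_iff.2 h0
      · exact (hdist j i hlt hi _ (hgM j) _ (hgM i) hj0).symm
  have hle : ∀ i ∈ Finset.range d, ‖g.coeff i * u' ^ i‖ ≤ 1 := fun i hi =>
    (um_le_sum_of_distinct hne hi).trans h1
  have h0mem : 0 ∈ Finset.range d := Finset.mem_range.2 (Nat.pos_of_ne_zero hd0)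
  obtain ⟨c, hc, hcc⟩ := h.good (g.coeff 0) (hgM 0) (by simpa using hle 0 h0mem)
  refine ⟨c, hc, ?_⟩
  rw [← Finset.add_sum_erase _ _ h0mem, pow_zero, mul_one, add_sub_right_comm]
  apply um_add_lt hcc
  apply um_sum_lt one_pos
  intro i hi
  rw [Finset.mem_erase, Finset.mem_range] at hi
  refine lt_of_le_of_ne (hle i (Finset.mem_range.2 hi.2)) ?_
  have := hdist 0 i (Nat.pos_of_ne_zero hi.1) hi.2 1 M.one_mem _ (hgM i) one_ne_zero
  simpa using this.symm

end GoodFields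

open FirstOrder Ring Language IsLocalRing
set_option linter.unusedSectionVars false
set_option linter.unusedVariables false
set_option linter.style.haveILetI false

section Iso
open Polynomial
variable {W : Type*} [NormedField W] [IsUltrametricDist W]

/-- conjugates over `R` have the same norm -/
def IsoN (R : Subfield W) : Prop := ∀ z ∈ acl R, ∀ w, (mpW R z).eval w = 0 → ‖w‖ = ‖z‖

theorem mpW_eq_of_root {R : Subfield W} {z w : W} (hz : z ∈ acl R) (hw : (mpW R z).eval w = 0) :
    mpW R w = mpW R z := by
  unfold mpW
  congr 1
  apply Eq.symm
  apply minpoly.eq_of_irreducible_of_monic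
  · exact minpoly.irreducible (mem_acl_iff_isAlgebraic.1 hz).isIntegral
  · unfold mpW at hw; rwa [eval_map_algebraMap] at hw
  · exact minpoly.monic (mem_acl_iff_isAlgebraic.1 hz).isIntegral

theorem root_mpW_mem_acl {R : Subfield W} {z w : W} (hz : z ∈ acl R)
    (hw : (mpW R z).eval w = 0) : w ∈ acl R :=
  mem_acl_iff.2 ⟨mpW R z, (mpW_monic hz).ne_zero, mpW_polyIn R z, hw⟩

theorem isoN_of_isClosed [CompleteSpace W] {R : Subfield W} (hc : IsClosed (R : Set W))
    (hn : ∃ x ∈ R, 1 < ‖x‖) : IsoN R := by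
  letI iN : NontriviallyNormedField R :=
    { (inferInstance : NormedField R) with
      non_trivial := by obtain ⟨x, hx, h1⟩ := hn; exact ⟨⟨x, hx⟩, h1⟩ }
  haveI : CompleteSpace R := hc.completeSpace_coe
  haveI : IsUltrametricDist R := ⟨fun x y z => IsUltrametricDist.dist_triangle_max (x : W) y z⟩
  let L := algebraicClosure R W
  haveI : IsUltrametricDist L := ⟨fun x y z => IsUltrametricDist.dist_triangle_max (x : W) y z⟩
  letI : NormedAlgebra R L :=
    { (inferInstance : Algebra R L) with
      norm_smul_le := fun r x => by
        rw [Algebra.smul_def]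
        exact (norm_mul (r : W) (x : W)).le }
  have key : ∀ z (hz : z ∈ acl R), ‖z‖ = spectralValue (minpoly R z) := by
    intro z hz
    have h1 := NormedAlgebra.norm_eq_spectralNorm (K := R) (L := L) ⟨z, hz⟩
    have h2 : minpoly R (⟨z, hz⟩ : L) = minpoly R z := by
      rw [← minpoly.algebraMap_eq (B := L) (B' := W) (algebraMap L W).injective]; rfl
    unfold spectralNorm at h1
    rw [h2] at h1
    exact h1
  intro z hz w hw
  rw [key z hz, key w (root_mpW_mem_acl hz hw)]
  congr 1
  have := mpW_eq_of_root hz hw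
  unfold mpW at this
  exact map_injective _ (algebraMap R W).injective this

theorem IsoN.of_le {R R' : Subfield W} (h : IsoN R) (h1 : R ≤ R') (h2 : R' ≤ acl R) : IsoN R' := by
  intro z hz w hw
  have hz' : z ∈ acl R := acl_le_acl h2 hz
  apply h z hz' w
  obtain ⟨q, hq⟩ := mpW_dvd_mpW h1 z
  rw [hq, eval_mul, hw, zero_mul]



/-- polynomial expressions respect conjugacy -/
theorem mpW_eval_conj {R : Subfield W} {z w : W} {g : W[X]} (hg : PolyIn R g)
    (hw : (mpW R z).eval w = 0) : (mpW R (g.eval z)).eval (g.eval w) = 0 := by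
  obtain ⟨q, hq⟩ := mpW_dvd (A := R) (z := z) ((mpW_polyIn R (g.eval z)).comp hg)
    (by rw [eval_comp, mpW_eval])
  rw [← eval_comp, hq, eval_mul, hw, zero_mul]

theorem IsoN.eval {R : Subfield W} (h : IsoN R) {z w : W} (hz : z ∈ acl R) {g : W[X]}
    (hg : PolyIn R g) (hw : (mpW R z).eval w = 0) : ‖g.eval w‖ = ‖g.eval z‖ :=
  h _ ((hg.mono (le_acl R)).eval hz) _ (mpW_eval_conj hg hw)

theorem IsoN.sub {R : Subfield W} (h : IsoN R) {z w a : W} (hz : z ∈ acl R)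
    (ha : a ∈ R) (hw : (mpW R z).eval w = 0) : ‖w - a‖ = ‖z - a‖ := by
  have := h.eval hz ((PolyIn.X R).sub (PolyIn.C ha)) hw
  simpa using this

theorem um_multiset_sum_lt (m : Multiset W) (f : W → W) {r : ℝ} (hr : 0 < r)
    (h : ∀ a ∈ m, ‖f a‖ < r) : ‖(m.map f).sum‖ < r := by
  induction m using Multiset.induction_on with
  | empty => simpa
  | cons a m ih =>
    rw [Multiset.map_cons, Multiset.sum_cons]
    exact um_add_lt (h a (Multiset.mem_cons_self _ _))
      (ih fun b hb => h b (Multiset.mem_cons_of_mem hb))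

theorem coeff_prod_le (m : Multiset W) (h : ∀ a ∈ m, ‖a‖ ≤ 1) (k : ℕ) :
    ‖((m.map fun a => X - C a).prod).coeff k‖ ≤ 1 := by
  induction m using Multiset.induction_on generalizing k with
  | empty =>
    simp only [Multiset.map_zero, Multiset.prod_zero, coeff_one]
    split_ifs <;> simp
  | cons a m ih =>
    have ih' := ih fun b hb => h b (Multiset.mem_cons_of_mem hb)
    have ha := h a (Multiset.mem_cons_self _ _)
    rw [Multiset.map_cons, Multiset.prod_cons, sub_mul, coeff_sub, coeff_C_mul]
    apply um_sub_le
    · cases k with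
      | zero => simp
      | succ k => rw [coeff_X_mul]; exact ih' k
    · rw [norm_mul]; exact mul_le_one₀ ha (norm_nonneg _) (ih' k)

theorem mpW_roots_iff {R : Subfield W} {z w : W} (hz : z ∈ acl R) :
    w ∈ (mpW R z).roots ↔ (mpW R z).eval w = 0 := by
  rw [mem_roots (mpW_monic hz).ne_zero]; rfl

theorem mpW_eq_prod [IsAlgClosed W] {R : Subfield W} {z : W} (hz : z ∈ acl R) :
    mpW R z = ((mpW R z).roots.map fun a => X - C a).prod :=
  (IsAlgClosed.splits _).eq_prod_roots_of_monic (mpW_monic hz)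

/-- goodness passes to algebraic extensions over an algebraically closed constant field -/
theorem Good.acl [IsAlgClosed W] {κ R : Subfield W} (hκ : TrivN κ) (hκa : acl κ = κ)
    (hg : Good κ R) (hi : IsoN R) : Good κ (acl R) := by
  classical
  intro x hx h1
  have hc : ∀ k, ‖(mpW R x).coeff k‖ ≤ 1 := by
    intro k
    rw [mpW_eq_prod hx]
    apply coeff_prod_le
    intro a ha
    rw [hi x hx a ((mpW_roots_iff hx).1 ha)]; exact h1
  choose c hcκ hcl using fun k => hg _ (mpW_polyIn R x k) (hc k)
  set n := (mpW R x).natDegree with hn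
  let f : W[X] := X ^ n + ∑ i ∈ Finset.range n, C (c i) * X ^ i
  have hdeg : (∑ i ∈ Finset.range n, C (c i) * X ^ i : W[X]).degree < n := by
    apply (degree_sum_le _ _).trans_lt
    rw [Finset.sup_lt_iff (WithBot.bot_lt_coe _)]
    intro i hi
    exact (degree_C_mul_X_pow_le _ _).trans_lt (by exact_mod_cast Finset.mem_range.1 hi)
  have hfm : f.Monic := monic_X_pow_add hdeg
  have hfd : f.natDegree = n := by
    apply natDegree_eq_of_degree_eq_some
    rw [degree_add_eq_left_of_degree_lt (by rwa [degree_X_pow]), degree_X_pow]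
  have hfκ : PolyIn κ f := ((PolyIn.X κ).pow n).add
    (PolyIn.sum fun i _ => (PolyIn.C (hcκ i)).mul ((PolyIn.X κ).pow i))
  have hfx : ‖f.eval x‖ < 1 := by
    have e1 : (mpW R x).eval x = x ^ n + ∑ i ∈ Finset.range n, (mpW R x).coeff i * x ^ i := by
      conv_lhs => rw [(mpW_monic hx).as_sum]
      simp [eval_finsetSum, ← hn]
    have e2 : f.eval x = -∑ i ∈ Finset.range n, ((mpW R x).coeff i - c i) * x ^ i := by
      have : f.eval x = f.eval x - (mpW R x).eval x := by rw [mpW_eval, sub_zero]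
      rw [this, e1]
      simp [f, eval_finsetSum, sub_mul]
    rw [e2, norm_neg]
    apply um_sum_lt one_pos
    intro i _
    rw [norm_mul, norm_pow]
    exact mul_lt_one_of_nonneg_of_lt_one_left (norm_nonneg _) (hcl i)
      (pow_le_one₀ (norm_nonneg _) h1)
  obtain ⟨a, ha, hxa⟩ := exists_root_near hfm zero_le_one (z := x) (by simpa using hfx)
  exact ⟨a, hκa ▸ mem_acl_iff.2 ⟨f, hfm.ne_zero, hfκ, ha⟩, hxa⟩

/-- sum of roots lies in the base field -/
theorem sum_roots_mem [IsAlgClosed W] {R : Subfield W} {z : W} (hz : z ∈ acl R) :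
    (mpW R z).roots.sum ∈ R := by
  have h := (IsAlgClosed.splits (mpW R z)).nextCoeff_eq_neg_sum_roots_of_monic (mpW_monic hz)
  have : (mpW R z).roots.sum = - (mpW R z).nextCoeff := by rw [h, neg_neg]
  rw [this]
  apply R.neg_mem
  rw [nextCoeff]
  split_ifs
  · exact R.zero_mem
  · exact mpW_polyIn R z _

/-- Ostrowski type lemma -/
theorem ostrowski [IsAlgClosed W] {κ R : Subfield W} (hκ : TrivN κ) (hκa : acl κ = κ)
    (hle : κ ≤ R) (hg : Good κ R) (hi : IsoN R) {z : W} (hz : z ∈ acl R)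
    (hn : ((mpW R z).natDegree : W) ≠ 0)
    (hdiv : ∀ b ∈ R, ∃ m ∈ R, ‖m‖ ^ (mpW R z).natDegree = ‖b‖) : z ∈ R := by
  set n := (mpW R z).natDegree with hn'
  have hn0 : n ≠ 0 := by rintro h; simp [h] at hn
  have hnκ : ‖(n : W)‖ = 1 := hκ _ (natCast_mem κ n) hn
  set Sr := (mpW R z).roots.sum with hSr
  set a := Sr / n with ha
  have haR : a ∈ R := R.div_mem (sum_roots_mem hz) (natCast_mem R n)
  by_contra hzR
  have hza : z - a ≠ 0 := fun h => hzR (by rw [sub_eq_zero.1 h]; exact haR)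
  have hcard : (mpW R z).roots.card = n := IsAlgClosed.card_roots_eq_natDegree
  have hb : ‖(mpW R z).eval a‖ = ‖z - a‖ ^ n := by
    rw [eval_eq_prod_roots_sub, (mpW_monic hz).leadingCoeff, one_mul, ← hcard]
    have : ∀ m : Multiset W, (∀ w ∈ m, ‖w - a‖ = ‖z - a‖) →
        ‖(m.map fun w => a - w).prod‖ = ‖z - a‖ ^ m.card := by
      intro m
      induction m using Multiset.induction_on with
      | empty => simp
      | cons w m ih =>
        intro h
        rw [Multiset.map_cons, Multiset.prod_cons, norm_mul, Multiset.card_cons, pow_succ',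
          ih fun b hb => h b (Multiset.mem_cons_of_mem hb), norm_sub_rev,
          h w (Multiset.mem_cons_self _ _)]
    exact this _ fun w hw => hi.sub hz haR ((mpW_roots_iff hz).1 hw)
  obtain ⟨m, hmR, hm⟩ := hdiv _ ((mpW_polyIn R z).eval haR)
  rw [hb] at hm
  have hm' : ‖m‖ = ‖z - a‖ := (pow_left_inj₀ (norm_nonneg _) (norm_nonneg _) hn0).1 hm
  have hρ : 0 < ‖z - a‖ := norm_pos_iff.2 hza
  have hm0 : m ≠ 0 := by intro h; rw [h, norm_zero] at hm'; exact hρ.ne hm'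
  have hR := le_acl R
  obtain ⟨c, hc, hzc⟩ := Good.acl hκ hκa hg hi ((z - a) / m)
    ((_root_.acl R).div_mem ((_root_.acl R).sub_mem hz (hR haR)) (hR hmR))
    (by rw [norm_div, hm', div_self hρ.ne'])
  have h1 : ‖z - (a + m * c)‖ < ‖z - a‖ := by
    have : z - (a + m * c) = m * ((z - a) / m - c) := by field_simp; ring
    rw [this, norm_mul, hm']
    exact mul_lt_of_lt_one_right hρ hzc
  have h2 : ‖m * c‖ = ‖z - a‖ := by
    apply um_eq_of_sub_lt
    rwa [sub_sub]
  have h3 := um_multiset_sum_lt (mpW R z).roots (fun w => w - (a + m * c)) hρ (by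
    intro w hw
    rw [hi.sub hz (R.add_mem haR (R.mul_mem hmR (hle hc))) ((mpW_roots_iff hz).1 hw)]
    exact h1)
  rw [Multiset.sum_map_sub, Multiset.map_id', Multiset.map_const', Multiset.sum_replicate, hcard,
    ← hSr] at h3
  have h4 : Sr - n • (a + m * c) = - (n * (m * c)) := by
    rw [nsmul_eq_mul, mul_add, ha]; field_simp; ring
  rw [h4, norm_neg, norm_mul, hnκ, one_mul, h2] at h3
  exact lt_irrefl _ h3

end Iso

open FirstOrder Ring Language IsLocalRing
set_option linter.unusedSectionVars false
set_option linter.unusedVariables false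
set_option linter.style.haveILetI false

section Step
open Polynomial

theorem as_generator_pgroup {F E : Type*} [Field F] [Field E] [Algebra F E] [FiniteDimensional F E]
    [IsGalois F E] (p : ℕ) [Fact p.Prime] [CharP E p] (hG : IsPGroup p Gal(E/F)) {z : E}
    (hz : z ∉ (⊥ : IntermediateField F E)) :
    ∃ θ ∈ IntermediateField.adjoin F {z}, θ ∉ (⊥ : IntermediateField F E) ∧
      θ ^ p - θ ∈ (⊥ : IntermediateField F E) := by
  classical
  set Z := IntermediateField.adjoin F {z} with hZ
  have hzZ : z ∈ Z := IntermediateField.mem_adjoin_simple_self F z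
  have hH : Z.fixingSubgroup ≠ ⊤ := by
    intro h
    apply hz
    rw [IsGalois.mem_bot_iff_fixed] 
    intro σ
    have : σ ∈ Z.fixingSubgroup := h ▸ Subgroup.mem_top σ
    exact (IntermediateField.mem_fixingSubgroup_iff _ _).1 this z hzZ
  obtain ⟨N, hN, hHN⟩ := (eq_top_or_exists_le_coatom Z.fixingSubgroup).resolve_left hH
  haveI : Group.IsNilpotent Gal(E/F) := hG.isNilpotent
  haveI hNn : N.Normal := Subgroup.NormalizerCondition.normal_of_coatom N
    Group.normalizerCondition_of_isNilpotent hN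
  obtain ⟨σ, hσ⟩ : ∃ σ, σ ∉ N := by
    by_contra! h
    exact hN.1 (top_unique fun x _ => h x)
  -- fixed by N and σ implies in F
  have hfix : ∀ x : E, (∀ τ ∈ N, τ x = x) → σ x = x → x ∈ (⊥ : IntermediateField F E) := by
    intro x h1 h2
    rw [IsGalois.mem_bot_iff_fixed]
    let S : Subgroup Gal(E/F) := MulAction.stabilizer Gal(E/F) x
    have hNS : N < S := by
      refine lt_of_le_of_ne (fun τ hτ => h1 τ hτ) ?_
      rintro rfl
      exact hσ h2
    have := hN.2 S hNS
    intro τ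
    have h3 : τ ∈ S := this ▸ Subgroup.mem_top τ
    exact h3
  let D : E →ₗ[F] E := σ.toLinearMap - LinearMap.id
  have hD : ∀ x, D x = σ x - x := fun x => rfl
  obtain ⟨x, hxN, hx1⟩ : ∃ x : E, (∀ τ ∈ N, τ x = x) ∧ D x ≠ 0 := by
    by_contra! h
    have h1 : IntermediateField.fixedField N = ⊥ := by
      rw [eq_bot_iff]
      intro x hx
      have hx' : ∀ τ ∈ N, τ x = x := fun τ hτ => hx ⟨τ, hτ⟩
      exact hfix x hx' (sub_eq_zero.1 (h x hx'))
    have h2 := IntermediateField.fixingSubgroup_fixedField N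
    rw [h1, IntermediateField.fixingSubgroup_bot] at h2
    exact hN.1 h2.symm
  obtain ⟨m, hm⟩ := hG σ
  have hpow : (D ^ p ^ m) = 0 := by
    haveI : CharP (Module.End F E) p := by
      haveI : CharP F p := (algebraMap F E).charP (algebraMap F E).injective p
      exact charP_of_injective_algebraMap (FaithfulSMul.algebraMap_injective F (Module.End F E)) p
    have h1 : D = σ.toLinearMap - (1 : Module.End F E) := rfl
    rw [h1, sub_pow_char_pow_of_commute p _ (Commute.one_right _), one_pow, sub_eq_zero]
    have h2 : ∀ n : ℕ, (σ.toLinearMap : Module.End F E) ^ n = (σ ^ n).toLinearMap := by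
      intro n
      induction n with
      | zero => rfl
      | succ n ih => rw [pow_succ, ih, pow_succ]; rfl
    rw [h2, hm]; rfl
  have hinv : ∀ k, ∀ τ ∈ N, τ ((D ^ k) x) = (D ^ k) x := by
    intro k
    induction k with
    | zero => exact hxN
    | succ k ih =>
      intro τ hτ
      rw [pow_succ', Module.End.mul_apply, hD, map_sub, ih τ hτ]
      congr 1
      have h1 : σ⁻¹ * τ * σ ∈ N := by
        have := hNn.conj_mem τ hτ σ⁻¹
        rwa [inv_inv] at this
      have h2 := ih _ h1
      have h3 : τ (σ ((D ^ k) x)) = σ ((σ⁻¹ * τ * σ) ((D ^ k) x)) := by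
        rw [← AlgEquiv.mul_apply, ← AlgEquiv.mul_apply]; congr 1; group
      rw [h3, h2]
  have hex : ∃ k, (D ^ k) x = 0 := ⟨p ^ m, by rw [hpow]; rfl⟩
  set k := Nat.find hex with hk
  have hk0 : (D ^ k) x = 0 := Nat.find_spec hex
  have hk2 : 2 ≤ k := by
    by_contra! h
    interval_cases h' : k
    · have : x = 0 := hk0
      rw [this, map_zero] at hx1; exact hx1 rfl
    · rw [pow_one] at hk0; exact hx1 hk0
  obtain ⟨j, hj⟩ : ∃ j, k = j + 2 := ⟨k - 2, by omega⟩
  set b := (D ^ (j + 1)) x with hb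
  set y := (D ^ j) x with hy
  have hb0 : b ≠ 0 := Nat.find_min hex (by omega)
  have hσb : σ b = b := by
    rw [hj, pow_succ', Module.End.mul_apply, hD, sub_eq_zero] at hk0; exact hk0
  have hσy : σ y = y + b := by
    rw [hb, pow_succ', Module.End.mul_apply, hD]; simp [hy]
  have hθ : σ (y / b) = y / b + 1 := by
    rw [map_div₀, hσb, hσy, add_div, div_self hb0]
  have hθN : ∀ τ ∈ N, τ (y / b) = y / b := by
    intro τ hτ; rw [map_div₀, hinv j τ hτ, hinv (j + 1) τ hτ]
  refine ⟨y / b, ?_, ?_, ?_⟩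
  · rw [← IsGalois.fixedField_fixingSubgroup Z]
    rintro ⟨τ, hτ⟩
    exact hθN τ (hHN hτ)
  · intro h
    rw [IsGalois.mem_bot_iff_fixed] at h
    have := h σ
    rw [hθ] at this
    simp at this
  · apply hfix
    · intro τ hτ
      rw [map_sub, map_pow, hθN τ hτ]
    · rw [map_sub, map_pow, hθ, add_pow_char, one_pow]; ring


theorem step_lemma {W : Type*} [Field W] [IsAlgClosed W] {p : ℕ} [hp : ExpChar W p]
    {R : Subfield W}
    (hO : ∀ w ∈ acl R, ((mpW R w).natDegree : W) ≠ 0 → w ∈ R) {z : W} (hz : z ∈ acl R)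
    (hs : (minpoly R z).Separable) (hzR : z ∉ R) :
    p.Prime ∧ ∃ θ ∈ adjF R {z}, θ ∉ R ∧ θ ^ p - θ ∈ R := by
  classical
  rcases hp with _ | hprime
  · exact absurd (hO z hz (by exact_mod_cast (mpW_natDegree_pos hz).ne')) hzR
  refine ⟨hprime, ?_⟩
  haveI : Fact p.Prime := ⟨hprime⟩
  let f := minpoly R z
  have hintg : IsIntegral R z := (mem_acl_iff_isAlgebraic.1 hz).isIntegral
  have hf0 : f ≠ 0 := minpoly.ne_zero hintg
  let E := IntermediateField.adjoin R (f.rootSet W)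
  haveI : f.IsSplittingField R E :=
    IntermediateField.adjoin_rootSet_isSplittingField (IsAlgClosed.splits _)
  haveI : IsGalois R E := IsGalois.of_separable_splitting_field hs
  haveI : FiniteDimensional R E := Polynomial.IsSplittingField.finiteDimensional E f
  haveI : CharP E p := (algebraMap E W).charP (algebraMap E W).injective p
  have hzE : z ∈ E := IntermediateField.subset_adjoin _ _
    ((mem_rootSet_of_ne hf0).2 (minpoly.aeval _ _))
  have hG : IsPGroup p Gal(E/R) := by
    obtain ⟨P⟩ : Nonempty (Sylow p Gal(E/R)) := inferInstance
    let FF := IntermediateField.fixedField (P : Subgroup Gal(E/R))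
    obtain ⟨α, hα⟩ := Field.exists_primitive_element R FF
    rw [Field.primitive_element_iff_minpoly_natDegree_eq] at hα
    have h1 : Module.finrank R FF = FF.fixingSubgroup.index :=
      IntermediateField.finrank_eq_fixingSubgroup_index (F := R) (E' := E) FF
    rw [IntermediateField.fixingSubgroup_fixedField] at h1
    let w : W := ((α : E) : W)
    have hw : minpoly R w = minpoly R α := by
      have e1 : minpoly R w = minpoly R (α : E) :=
        minpoly.algebraMap_eq (B := E) (B' := W) (algebraMap E W).injective (α : E)
      rw [e1]
      exact minpoly.algebraMap_eq (A := R) (B := FF) (B' := E) (algebraMap FF E).injective α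
    have hwi : IsAlgebraic R w := by
      have : IsAlgebraic R (α : E) := Algebra.IsAlgebraic.isAlgebraic _
      exact this.algebraMap
    have hwR : w ∈ R := by
      apply hO w (mem_acl_iff_isAlgebraic.2 hwi)
      rw [mpW_natDegree, hw, hα, h1, Ne, CharP.cast_eq_zero_iff W p]
      exact P.not_dvd_index
    have h2 : (minpoly R w).natDegree = 1 := by
      have : minpoly R w = X - C ⟨w, hwR⟩ := minpoly.eq_X_sub_C W (⟨w, hwR⟩ : R)
      rw [this, natDegree_X_sub_C]
    rw [hw, hα, h1, Subgroup.index_eq_one] at h2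
    have h3 := P.isPGroup'
    rw [h2] at h3
    exact h3.of_equiv Subgroup.topEquiv
  have hbot : ∀ x : E, x ∈ (⊥ : IntermediateField R E) ↔ (x : W) ∈ R := by
    intro x
    rw [IntermediateField.mem_bot]
    constructor
    · rintro ⟨y, rfl⟩; exact y.2
    · intro h; exact ⟨⟨x, h⟩, Subtype.ext rfl⟩
  obtain ⟨θ, h1, h2, h3⟩ := as_generator_pgroup (F := R) (E := E) p hG (z := ⟨z, hzE⟩)
    (by rw [hbot]; exact hzR)
  refine ⟨θ, ?_, fun h => h2 ((hbot _).2 h), (hbot _).1 h3⟩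
  rw [mem_adjF_iff_adjoin]
  have h4 : (IntermediateField.adjoin R {(⟨z, hzE⟩ : E)}).map E.val =
      IntermediateField.adjoin R {z} := by
    rw [IntermediateField.adjoin_map]; simp
  rw [← h4]
  exact ⟨θ, h1, rfl⟩

end Step

open FirstOrder Ring Language IsLocalRing
set_option linter.unusedSectionVars false
set_option linter.unusedVariables false
set_option linter.style.haveILetI false

section Orth
open Polynomial
variable {W : Type*} [NormedField W] [IsUltrametricDist W]

theorem TrivN.acl {κ : Subfield W} (h : TrivN κ) : TrivN (acl κ) := by
  have key : ∀ z ∈ _root_.acl κ, ‖z‖ ≤ 1 := by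
    intro z hz
    by_contra! h1
    set f := mpW κ z with hf
    have hm : f.Monic := mpW_monic hz
    have h0 : f.eval z = 0 := mpW_eval κ z
    rw [eval_eq_sum_range] at h0
    have h2 := um_sum_eq (s := Finset.range (f.natDegree + 1)) (f := fun i => f.coeff i * z ^ i)
      (j := f.natDegree) (by simp) (by
        intro i hi hne
        have hi' : i < f.natDegree := lt_of_le_of_ne (by simpa [Nat.lt_succ_iff] using hi) hne
        rw [hm.coeff_natDegree, one_mul, norm_mul, norm_pow, norm_pow]
        calc ‖f.coeff i‖ * ‖z‖ ^ i ≤ 1 * ‖z‖ ^ i := by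
              gcongr; exact h.le (mpW_polyIn κ z i)
          _ < _ := by rw [one_mul]; exact pow_lt_pow_right₀ h1 hi')
    rw [h0, hm.coeff_natDegree, one_mul, norm_zero, norm_pow] at h2
    have : 0 < ‖z‖ ^ f.natDegree := by positivity
    exact absurd h2 this.ne
  intro c hc h0
  apply le_antisymm (key c hc)
  have h3 := key c⁻¹ ((_root_.acl κ).inv_mem hc)
  rw [norm_inv] at h3
  exact (inv_le_one₀ (norm_pos_iff.2 h0)).1 h3

theorem Good.inf_acl {κ M : Subfield W} (h : TrivN κ) (hle : κ ≤ M) (hg : Good κ M) {c : W}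
    (hc : c ∈ M) (hc' : c ∈ _root_.acl κ) : c ∈ κ := by
  obtain ⟨d, hd, h1⟩ := hg c hc (h.acl.le hc')
  have := h.acl.eq_zero ((_root_.acl κ).sub_mem hc' (le_acl κ hd)) h1
  rw [sub_eq_zero] at this
  rwa [this]

theorem um_eval_le (P : W[X]) {a : W} {r : ℝ} (hr : 0 ≤ r) (ha : ‖a‖ ≤ 1)
    (h : ∀ j, ‖P.coeff j‖ ≤ r) : ‖P.eval a‖ ≤ r := by
  rw [eval_eq_sum_range]
  apply um_sum_le hr
  intro i _
  rw [norm_mul, norm_pow]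
  calc _ ≤ r * 1 := by gcongr; exacts [h i, pow_le_one₀ (norm_nonneg _) ha]
    _ = r := mul_one r

theorem mpW_perfect_separable {p : ℕ} [hp : ExpChar W p] {κ : Subfield W}
    (hperf : ∀ c ∈ κ, ∃ d ∈ κ, d ^ p = c) {z : W} (hz : z ∈ acl κ) :
    (minpoly κ z).Separable := by
  haveI : ExpChar κ p := (algebraMap κ W).expChar (algebraMap κ W).injective p
  haveI : PerfectRing κ p := PerfectRing.ofSurjective κ p (by
    rintro ⟨c, hc⟩
    obtain ⟨d, hd, h⟩ := hperf c hc
    exact ⟨⟨d, hd⟩, Subtype.ext h⟩)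
  haveI : PerfectField κ := PerfectRing.toPerfectField κ p
  exact PerfectField.separable_of_irreducible
    (minpoly.irreducible (mem_acl_iff_isAlgebraic.1 hz).isIntegral)

theorem mpW_nodup_roots {κ : Subfield W} {z : W} (hs : (minpoly κ z).Separable) :
    (mpW κ z).roots.Nodup := nodup_roots (hs.map)

theorem mpW_card_roots [IsAlgClosed W] [DecidableEq W] {κ : Subfield W} {z : W}
    (hs : (minpoly κ z).Separable) :
    (mpW κ z).roots.toFinset.card = (mpW κ z).natDegree := by
  rw [Multiset.toFinset_card_of_nodup (mpW_nodup_roots hs), IsAlgClosed.card_roots_eq_natDegree]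

/-- Lagrange interpolation over the constant field -/
theorem lag_coeff [IsAlgClosed W] [DecidableEq W] {κ : Subfield W} {z : W} (hz : z ∈ acl κ)
    (hs : (minpoly κ z).Separable) :
    ∃ b : W → ℕ → W, (∀ a ∈ (mpW κ z).roots, ∀ j, b a j ∈ acl κ) ∧
      ∀ P : W[X], P.degree < (mpW κ z).natDegree → ∀ j,
        P.coeff j = ∑ a ∈ (mpW κ z).roots.toFinset, P.eval a * b a j := by
  set s := (mpW κ z).roots.toFinset with hsdef
  have hmem : ∀ a ∈ s, a ∈ acl κ := fun a ha =>
    root_mpW_mem_acl hz ((mpW_roots_iff hz).1 (Multiset.mem_toFinset.1 ha))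
  refine ⟨fun a j => (Lagrange.basis s id a).coeff j, ?_, ?_⟩
  · intro a ha j
    have ha' : a ∈ s := Multiset.mem_toFinset.2 ha
    have : PolyIn (acl κ) (Lagrange.basis s id a) := by
      unfold Lagrange.basis
      have gen : ∀ t : Finset W, (∀ x ∈ t, x ∈ acl κ) →
          PolyIn (acl κ) (∏ j ∈ t, Lagrange.basisDivisor (id a) (id j)) := by
        intro t
        induction t using Finset.induction_on with
        | empty => intro _; rw [Finset.prod_empty]; exact PolyIn.one _
        | insert x t hx ih =>
          intro ht
          rw [Finset.prod_insert hx]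
          apply PolyIn.mul _ (ih fun y hy => ht y (Finset.mem_insert_of_mem hy))
          unfold Lagrange.basisDivisor
          have hxa := ht x (Finset.mem_insert_self _ _)
          exact (PolyIn.C ((acl κ).inv_mem ((acl κ).sub_mem (hmem a ha') hxa))).mul
            ((PolyIn.X _).sub (PolyIn.C hxa))
      exact gen _ fun x hx => hmem x (Finset.mem_of_mem_erase hx)
    exact this j
  · intro P hP j
    have h1 : P = Lagrange.interpolate s id fun a => P.eval (id a) :=
      Lagrange.eq_interpolate (Set.injOn_id _) (by rw [mpW_card_roots hs]; exact hP)
    conv_lhs => rw [h1]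
    rw [Lagrange.interpolate_apply, finsetSum_coeff]
    simp [coeff_C_mul]

theorem exists_interp [IsAlgClosed W] [DecidableEq W] {κ : Subfield W} {z : W}
    (hs : (minpoly κ z).Separable) (θ : W → W) :
    ∃ P : W[X], P.degree < (mpW κ z).natDegree ∧ ∀ a ∈ (mpW κ z).roots, P.eval a = θ a := by
  refine ⟨Lagrange.interpolate (mpW κ z).roots.toFinset id θ, ?_, ?_⟩
  · rw [← mpW_card_roots hs]
    exact Lagrange.degree_interpolate_lt _ (Set.injOn_id _)
  · intro a ha
    exact Lagrange.eval_interpolate_at_node (v := id) θ (Set.injOn_id _) (Multiset.mem_toFinset.2 ha)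

theorem lag_le [IsAlgClosed W] {κ : Subfield W} (hκ : TrivN κ) {z : W} (hz : z ∈ acl κ)
    (hs : (minpoly κ z).Separable) {P : W[X]} (hP : P.degree < (mpW κ z).natDegree) {r : ℝ}
    (hr : 0 ≤ r)
    (h : ∀ a ∈ (mpW κ z).roots, ‖P.eval a‖ ≤ r) (j : ℕ) : ‖P.coeff j‖ ≤ r := by
  classical
  obtain ⟨b, hb, hb'⟩ := lag_coeff hz hs
  rw [hb' P hP j]
  apply um_sum_le hr
  intro a ha
  have ha' := Multiset.mem_toFinset.1 ha
  rw [norm_mul]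
  calc _ ≤ r * 1 := by gcongr; exacts [h a ha', hκ.acl.le (hb a ha' j)]
    _ = r := mul_one r

theorem lag_lt [IsAlgClosed W] {κ : Subfield W} (hκ : TrivN κ) {z : W} (hz : z ∈ acl κ)
    (hs : (minpoly κ z).Separable) {P : W[X]} (hP : P.degree < (mpW κ z).natDegree) {r : ℝ}
    (hr : 0 < r)
    (h : ∀ a ∈ (mpW κ z).roots, ‖P.eval a‖ < r) (j : ℕ) : ‖P.coeff j‖ < r := by
  classical
  obtain ⟨b, hb, hb'⟩ := lag_coeff hz hs
  rw [hb' P hP j]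
  apply um_sum_lt hr
  intro a ha
  have ha' := Multiset.mem_toFinset.1 ha
  rw [norm_mul]
  calc _ ≤ ‖P.eval a‖ * 1 := by gcongr; exacts [hκ.acl.le (hb a ha' j)]
    _ < r := by rw [mul_one]; exact h a ha'

/-- powers of an algebraic constant are orthonormal over a good field -/
theorem orth {κ N : Subfield W} (hκ : TrivN κ) (hg : Good κ N) {α : W}
    (hα : α ∈ acl κ) {H : W[X]} (hH : PolyIn N H) (hd : H.degree < (mpW κ α).natDegree) (j : ℕ) :
    ‖H.coeff j‖ ≤ ‖H.eval α‖ := by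
  by_cases h0 : H = 0
  · simp [h0]
  obtain ⟨i, hi, hmax⟩ := Finset.exists_max_image H.support (fun i => ‖H.coeff i‖)
    (nonempty_support_iff.2 h0)
  set m := H.coeff i with hm
  have hm0 : m ≠ 0 := mem_support_iff.1 hi
  have hmax' : ∀ k, ‖H.coeff k‖ ≤ ‖m‖ := by
    intro k
    by_cases hk : k ∈ H.support
    · exact hmax k hk
    · rw [notMem_support_iff.1 hk, norm_zero]; positivity
  refine (hmax' j).trans ?_
  have hc : ∀ k, ∃ c ∈ κ, ‖H.coeff k / m - c‖ < 1 := by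
    intro k
    apply hg _ (N.div_mem (hH k) (hH i))
    rw [norm_div]
    exact div_le_one_of_le₀ (hmax' k) (norm_nonneg _)
  choose c hcκ hc using hc
  let G : W[X] := ∑ k ∈ Finset.range (H.natDegree + 1), C (c k) * X ^ k
  have hGc : ∀ k, k ≤ H.natDegree → G.coeff k = c k := by
    intro k hk
    simp only [G, finsetSum_coeff, coeff_C_mul, coeff_X_pow]
    rw [Finset.sum_eq_single k]
    · simp
    · intro b _ hb; simp [hb.symm]
    · intro h; simp at h; omega
  have hGκ : PolyIn κ G := PolyIn.sum fun k _ => (PolyIn.C (hcκ k)).mul ((PolyIn.X _).pow k)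
  have hiN : i ≤ H.natDegree := le_natDegree_of_mem_supp i hi
  have hci : c i ≠ 0 := by
    intro h
    have := hc i
    rw [h, sub_zero, ← hm, div_self hm0, norm_one] at this
    exact lt_irrefl _ this
  have hG0 : G ≠ 0 := by
    intro h
    have := hGc i hiN
    rw [h, coeff_zero] at this
    exact hci this.symm
  have hGe : G.eval α ≠ 0 := by
    intro h
    have h1 := natDegree_mpW_le hG0 hGκ h
    have h2 : G.natDegree ≤ H.natDegree := by
      apply natDegree_sum_le_of_forall_le
      intro k hk
      exact (natDegree_C_mul_X_pow_le _ _).trans (Nat.lt_succ_iff.1 (Finset.mem_range.1 hk))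
    rw [degree_eq_natDegree h0] at hd
    have : H.natDegree < (mpW κ α).natDegree := by exact_mod_cast hd
    omega
  have hG1 : ‖G.eval α‖ = 1 :=
    hκ.acl _ ((hGκ.mono (le_acl κ)).eval hα) hGe
  have hα1 : ‖α‖ ≤ 1 := hκ.acl.le hα
  have hdiff : ‖H.eval α / m - G.eval α‖ < 1 := by
    have e1 : H.eval α / m - G.eval α
        = ∑ k ∈ Finset.range (H.natDegree + 1), (H.coeff k / m - c k) * α ^ k := by
      rw [eval_eq_sum_range]
      simp only [G, eval_finsetSum, eval_mul, eval_C, eval_pow, eval_X]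
      rw [Finset.sum_div, ← Finset.sum_sub_distrib]
      apply Finset.sum_congr rfl; intro k _; ring
    rw [e1]
    apply um_sum_lt one_pos
    intro k _
    rw [norm_mul, norm_pow]
    calc _ ≤ ‖H.coeff k / m - c k‖ * 1 := by gcongr; exact pow_le_one₀ (norm_nonneg _) hα1
      _ < 1 := by rw [mul_one]; exact hc k
  have h2 : ‖H.eval α / m‖ = 1 := by
    rw [← hG1]; apply um_eq_of_sub_lt'; rw [hG1]; exact hdiff
  rw [norm_div, div_eq_one_iff_eq (norm_ne_zero_iff.2 hm0)] at h2
  exact h2.ge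

theorem mpW_good_eq [IsAlgClosed W] {κ M : Subfield W} (hκ : TrivN κ) (hle : κ ≤ M) (hg : Good κ M)
    {α : W} (hα : α ∈ acl κ) : mpW M α = mpW κ α := by
  have hαM : α ∈ acl M := acl_mono hle hα
  have h1 := mpW_dvd_mpW hle α
  have hroots : ∀ a ∈ (mpW M α).roots, a ∈ acl κ := by
    intro a ha
    have h2 := (mpW_roots_iff hαM).1 ha
    obtain ⟨q, hq⟩ := h1
    apply root_mpW_mem_acl hα
    rw [hq, eval_mul, h2, zero_mul]
  have hPa : PolyIn (acl κ) (mpW M α) := by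
    rw [mpW_eq_prod hαM]
    generalize (mpW M α).roots = m at hroots
    induction m using Multiset.induction_on with
    | empty => simp only [Multiset.map_zero, Multiset.prod_zero]; exact PolyIn.one _
    | cons a m ih =>
      rw [Multiset.map_cons, Multiset.prod_cons]
      exact ((PolyIn.X _).sub (PolyIn.C (hroots a (Multiset.mem_cons_self _ _)))).mul
        (ih fun b hb => hroots b (Multiset.mem_cons_of_mem hb))
  have hPκ : PolyIn κ (mpW M α) := fun i => hg.inf_acl hκ hle (mpW_polyIn M α i) (hPa i)
  exact eq_of_monic_of_associated (mpW_monic hαM) (mpW_monic hα)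
    (associated_of_dvd_dvd h1 (mpW_dvd hPκ (mpW_eval M α)))

end Orth

open FirstOrder Ring Language IsLocalRing
set_option linter.unusedSectionVars false
set_option linter.unusedVariables false
set_option linter.style.haveILetI false

section Tame
open Polynomial
variable {W : Type*} [NormedField W] [IsUltrametricDist W]

theorem exists_primitive_acl {p : ℕ} [hp : ExpChar W p] {κ : Subfield W}
    (hperf : ∀ c ∈ κ, ∃ d ∈ κ, d ^ p = c) (T : Finset W) (hT : ∀ x ∈ T, x ∈ acl κ) :
    ∃ α ∈ acl κ, ∀ x ∈ T, x ∈ adjF κ {α} := by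
  haveI : ExpChar κ p := (algebraMap κ W).expChar (algebraMap κ W).injective p
  haveI : PerfectRing κ p := PerfectRing.ofSurjective κ p (by
    rintro ⟨c, hc⟩
    obtain ⟨d, hd, h⟩ := hperf c hc
    exact ⟨⟨d, hd⟩, Subtype.ext h⟩)
  haveI : PerfectField κ := PerfectRing.toPerfectField κ p
  let E := IntermediateField.adjoin κ (T : Set W)
  haveI : FiniteDimensional κ E := IntermediateField.finiteDimensional_adjoin
    (fun x hx => (mem_acl_iff_isAlgebraic.1 (hT x hx)).isIntegral)
  obtain ⟨α, hα⟩ := Field.exists_primitive_element κ E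
  refine ⟨α, ?_, ?_⟩
  · rw [mem_acl_iff_isAlgebraic]
    have : IsAlgebraic κ α := Algebra.IsAlgebraic.isAlgebraic _
    exact this.algebraMap
  · intro x hx
    rw [mem_adjF_iff_adjoin]
    have hxE : x ∈ E := IntermediateField.subset_adjoin _ _ hx
    have h1 : (⟨x, hxE⟩ : E) ∈ IntermediateField.adjoin κ {α} := hα ▸ IntermediateField.mem_top
    have h2 : x ∈ (IntermediateField.adjoin κ {α}).map E.val := ⟨⟨x, hxE⟩, h1, rfl⟩
    rw [IntermediateField.adjoin_map] at h2
    simpa using h2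

theorem mem_comp {p : ℕ} [hp : ExpChar W p] {κ N : Subfield W}
    (hperf : ∀ c ∈ κ, ∃ d ∈ κ, d ^ p = c) (hle : κ ≤ N) {w : W}
    (hw : w ∈ adjF N (acl κ : Set W)) :
    ∃ α ∈ acl κ, ∃ q : W[X], PolyIn N q ∧ q.degree < (mpW κ α).natDegree ∧ w = q.eval α := by
  rw [mem_adjF_iff_adjoin] at hw
  obtain ⟨T, hT, hw⟩ := IntermediateField.exists_finset_of_mem_adjoin hw
  obtain ⟨α, hα, h⟩ := exists_primitive_acl hperf T (fun x hx => hT hx)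
  refine ⟨α, hα, ?_⟩
  have hw' : w ∈ adjF N {α} := by
    have h1 : adjF N (T : Set W) ≤ adjF N {α} :=
      adjF_le_iff.2 ⟨le_adjF _ _, fun x hx => adjF_mono hle subset_rfl (h x hx)⟩
    exact h1 (mem_adjF_iff_adjoin.2 hw)
  obtain ⟨g, hg, hd, he⟩ := mem_adjF_of_root (mpW_monic hα) ((mpW_polyIn κ α).mono hle)
    (mpW_eval κ α) hw'
  exact ⟨g, hg, by rwa [degree_eq_natDegree (mpW_monic hα).ne_zero] at hd, he⟩

theorem comp_norm {p : ℕ} [hp : ExpChar W p] {κ N : Subfield W} (hκ : TrivN κ)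
    (hperf : ∀ c ∈ κ, ∃ d ∈ κ, d ^ p = c) (hle : κ ≤ N) (hg : Good κ N) {w : W}
    (hw : w ∈ adjF N (acl κ : Set W)) : ∃ m ∈ N, ‖m‖ = ‖w‖ := by
  obtain ⟨α, hα, q, hq, hd, rfl⟩ := mem_comp hperf hle hw
  by_contra! hne
  have hlt : ∀ j, ‖q.coeff j‖ < ‖q.eval α‖ := fun j =>
    lt_of_le_of_ne (orth hκ hg hα hq hd j) (hne _ (hq j))
  have h0 : 0 < ‖q.eval α‖ := (norm_nonneg _).trans_lt (hlt 0)
  have : ‖q.eval α‖ < ‖q.eval α‖ := by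
    conv_lhs => rw [eval_eq_sum_range]
    apply um_sum_lt h0
    intro i _
    rw [norm_mul, norm_pow]
    calc _ ≤ ‖q.coeff i‖ * 1 := by
          gcongr; exact pow_le_one₀ (norm_nonneg _) (hκ.acl.le hα)
      _ < _ := by rw [mul_one]; exact hlt i
  exact lt_irrefl _ this

theorem comp_good {p : ℕ} [hp : ExpChar W p] {κ N : Subfield W} (hκ : TrivN κ)
    (hperf : ∀ c ∈ κ, ∃ d ∈ κ, d ^ p = c) (hle : κ ≤ N) (hg : Good κ N) :
    Good (acl κ) (adjF N (acl κ : Set W)) := by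
  intro w hw h1
  obtain ⟨α, hα, q, hq, hd, rfl⟩ := mem_comp hperf hle hw
  have hc : ∀ k, ∃ c ∈ κ, ‖q.coeff k - c‖ < 1 := fun k =>
    hg _ (hq k) ((orth hκ hg hα hq hd k).trans h1)
  choose c hcκ hc using hc
  refine ⟨∑ i ∈ Finset.range (q.natDegree + 1), c i * α ^ i,
    (acl κ).sum_mem fun i _ => (acl κ).mul_mem (le_acl κ (hcκ i)) ((acl κ).pow_mem hα i), ?_⟩
  rw [eval_eq_sum_range, ← Finset.sum_sub_distrib]
  apply um_sum_lt one_pos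
  intro i _
  rw [← sub_mul, norm_mul, norm_pow]
  calc _ ≤ ‖q.coeff i - c i‖ * 1 := by
        gcongr; exact pow_le_one₀ (norm_nonneg _) (hκ.acl.le hα)
    _ < _ := by rw [mul_one]; exact hc i

theorem comp_le_acl {κ N : Subfield W} (hle : κ ≤ N) : adjF N (acl κ : Set W) ≤ acl N :=
  adjF_le_iff.2 ⟨le_acl N, acl_mono hle⟩

/-- best approximation from `N ⊔ acl κ` is attained in `N` (for elements of a good field) -/
theorem comp_approx {p : ℕ} [hp : ExpChar W p] {κ N M : Subfield W} (hκ : TrivN κ)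
    (hperf : ∀ c ∈ κ, ∃ d ∈ κ, d ^ p = c) (hle : κ ≤ N) (hNM : N ≤ M) (hg : Good κ M) {w c : W}
    (hw : w ∈ M) (hc : c ∈ adjF N (acl κ : Set W)) : ∃ a ∈ N, ‖w - a‖ ≤ ‖w - c‖ := by
  obtain ⟨α, hα, q, hq, hd, rfl⟩ := mem_comp hperf hle hc
  refine ⟨q.coeff 0, hq 0, ?_⟩
  have hH : PolyIn M (C w - q) := (PolyIn.C hw).sub (hq.mono hNM)
  have hdeg : (C w - q).degree < (mpW κ α).natDegree := by
    apply (degree_sub_le _ _).trans_lt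
    apply max_lt _ hd
    apply degree_C_le.trans_lt
    exact_mod_cast mpW_natDegree_pos hα
  have := orth hκ hg hα hH hdeg 0
  simpa using this

/-- Artin–Schreier roots of norm `< 1` are rational -/
theorem as_small [IsAlgClosed W] {p : ℕ} [Fact p.Prime] [CharP W p] {R : Subfield W} (hi : IsoN R)
    {θ : W} (hθ : θ ^ p - θ ∈ R) (h1 : ‖θ‖ < 1) : θ ∈ R := by
  classical
  have hp1 : 1 < p := (Fact.out : p.Prime).one_lt
  set f : W[X] := X ^ p - X - C (θ ^ p - θ) with hf
  have hfR : PolyIn R f := (((PolyIn.X R).pow p).sub (PolyIn.X R)).sub (PolyIn.C hθ)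
  have hfder : derivative f = -1 := by
    rw [hf, derivative_sub, derivative_sub, derivative_X_pow, derivative_C, derivative_X,
      CharP.cast_eq_zero]
    simp
  have hf0 : f ≠ 0 := by
    intro h; rw [h] at hfder; simp at hfder
  have hfe : f.eval θ = 0 := by simp [hf]
  have hacl : θ ∈ acl R := mem_acl_iff.2 ⟨f, hf0, hfR, hfe⟩
  have hsep : f.Separable := by
    rw [separable_def, hfder]
    exact isCoprime_one_right.neg_right
  have hdvd := mpW_dvd hfR hfe
  have hnod : (mpW R θ).roots.Nodup := nodup_roots (hsep.of_dvd hdvd)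
  have hall : ∀ w ∈ (mpW R θ).roots, w = θ := by
    intro w hw
    have hw0 := (mpW_roots_iff hacl).1 hw
    have hn := hi θ hacl w hw0
    have hfw : f.eval w = 0 := by
      obtain ⟨q, hq⟩ := hdvd
      rw [hq, eval_mul, hw0, zero_mul]
    have h2 : (w - θ) ^ p = w - θ := by
      rw [sub_pow_char]
      simp only [hf, eval_sub, eval_pow, eval_X, eval_C] at hfw
      linear_combination hfw
    have h3 : ‖w - θ‖ < 1 := um_sub_lt (by rwa [hn]) h1
    by_contra hne
    have h4 : 0 < ‖w - θ‖ := norm_pos_iff.2 (sub_ne_zero.2 hne)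
    have h5 : ‖w - θ‖ ^ p = ‖w - θ‖ := by rw [← norm_pow, h2]
    have h6 : ‖w - θ‖ ^ p < ‖w - θ‖ := pow_lt_self_of_lt_one₀ h4 h3 hp1
    exact absurd h5 h6.ne
  apply mem_of_mpW_natDegree_eq_one hacl
  rw [← IsAlgClosed.card_roots_eq_natDegree]
  have h7 : (mpW R θ).roots = {θ} ∨ (mpW R θ).roots = 0 := by
    rcases Multiset.empty_or_exists_mem (mpW R θ).roots with h | ⟨a, ha⟩
    · exact Or.inr h
    · left
      have := Multiset.eq_replicate_card.2 hall
      have hc : Multiset.card (mpW R θ).roots ≤ 1 := by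
        rw [this] at hnod
        by_contra! h
        exact (Multiset.nodup_iff_count_le_one.1 hnod θ).not_gt (by
          rw [Multiset.count_replicate_self]; exact h)
      have hc' : 0 < Multiset.card (mpW R θ).roots := Multiset.card_pos_iff_exists_mem.2 ⟨a, ha⟩
      rw [this, show Multiset.card (mpW R θ).roots = 1 by omega]; simp
  rcases h7 with h | h
  · rw [h]; simp
  · have : θ ∈ (mpW R θ).roots := (mpW_roots_iff hacl).2 (mpW_eval R θ)
    rw [h] at this; simp at this

theorem MaxGood.acl_le [IsAlgClosed W] [CompleteSpace W] {p : ℕ} [hp : ExpChar W p]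
    {κ M : Subfield W} (h : MaxGood p κ M) (hn : ∃ x ∈ M, 1 < ‖x‖) :
    acl M ≤ adjF M (acl κ : Set W) := by
  classical
  set Cc := adjF M (acl κ : Set W) with hCc
  have hκ := h.triv
  have hMC : M ≤ Cc := le_adjF _ _
  have hκC : acl κ ≤ Cc := subset_adjF M _
  have hCM : Cc ≤ acl M := comp_le_acl h.le
  have hiM : IsoN M := isoN_of_isClosed h.isClosed hn
  have hiC : IsoN Cc := hiM.of_le hMC hCM
  have hgC : Good (acl κ) Cc := comp_good hκ h.perf h.le h.good
  have hO : ∀ w ∈ acl Cc, ((mpW Cc w).natDegree : W) ≠ 0 → w ∈ Cc := by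
    intro w hw hne
    apply ostrowski hκ.acl (acl_acl κ) hκC hgC hiC hw hne
    intro b hb
    obtain ⟨m, hm, hmb⟩ := comp_norm hκ h.perf h.le h.good hb
    obtain ⟨m', hm', hmb'⟩ := h.norm_divisible hm (n := (mpW Cc w).natDegree) (by
      intro h0; rw [h0] at hne; simp at hne)
    exact ⟨m', hMC hm', hmb'.trans hmb⟩
  intro z hz
  by_contra hzC
  have hMperf : ∀ c ∈ M, ∃ d ∈ M, d ^ p = c := by
    intro c hc
    obtain ⟨d, hd⟩ := IsAlgClosed.exists_pow_nat_eq c (expChar_pos W p)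
    exact ⟨d, h.perfect (by rwa [hd]), hd⟩
  have hsepM := mpW_perfect_separable hMperf hz
  have hsep : (minpoly Cc z).Separable := by
    have h1 : (mpW M z).Separable := hsepM.map
    have h2 : (mpW Cc z).Separable := h1.of_dvd (mpW_dvd_mpW hMC z)
    exact (separable_map _).1 h2
  obtain ⟨hprime, θ, hθz, hθC, hθ⟩ := step_lemma (p := p) hO (acl_mono hMC hz) hsep hzC
  haveI : Fact p.Prime := ⟨hprime⟩
  haveI : CharP W p := by
    rcases hp with _ | _
    · exact absurd hprime Nat.not_prime_one
    · assumption
  obtain ⟨α, hα, H, hH, hHd, hHe⟩ := mem_comp h.perf h.le hθ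
  have hαs := mpW_perfect_separable h.perf hα
  set μ := mpW κ α with hμ
  have hμm : μ.Monic := mpW_monic hα
  have hμM : PolyIn M μ := (mpW_polyIn κ α).mono h.le
  have hroot : ∀ a ∈ μ.roots, μ.eval a = 0 := fun a ha => (mpW_roots_iff hα).1 ha
  have hracl : ∀ a ∈ μ.roots, a ∈ acl κ := fun a ha => root_mpW_mem_acl hα (hroot a ha)
  -- choose Artin-Schreier roots
  have hex : ∀ a : W, ∃ t : W, t ^ p - t = H.eval a ∧ (a = α → t = θ) := by
    intro a
    by_cases ha : a = α
    · exact ⟨θ, by rw [ha, hHe], fun _ => rfl⟩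
    · have hd : (X ^ p - X - C (H.eval a) : W[X]).degree ≠ 0 := by
        have : (X ^ p - X - C (H.eval a) : W[X]).natDegree = p := by
          rw [sub_sub]
          have hlt : (X + C (H.eval a) : W[X]).degree < (X ^ p : W[X]).degree := by
            rw [degree_X_add_C, degree_X_pow]
            exact_mod_cast hprime.one_lt
          rw [natDegree_sub_eq_left_of_natDegree_lt, natDegree_X_pow]
          rw [natDegree_X_add_C, natDegree_X_pow]; exact hprime.one_lt
        intro h0
        have h1 : (X ^ p - X - C (H.eval a) : W[X]).natDegree = 0 :=
          natDegree_eq_zero_iff_degree_le_zero.2 h0.le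
        exact hprime.ne_zero (this.symm.trans h1)
      obtain ⟨t, ht⟩ := IsAlgClosed.exists_root _ hd
      refine ⟨t, ?_, fun h => absurd h ha⟩
      have : t ^ p - t - H.eval a = 0 := by simpa using ht
      linear_combination this
  choose Θ hΘ hΘα using hex
  obtain ⟨P, hPd, hPe⟩ := exists_interp hαs Θ
  have hba : ∀ j, ∃ m ∈ M, ∀ m' ∈ M, ‖P.coeff j - m‖ ≤ ‖P.coeff j - m'‖ :=
    fun j => h.exists_best_approx _
  choose m hmM hmb using hba
  set n := μ.natDegree with hn'
  have hn0 : 0 < n := mpW_natDegree_pos hα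
  let B : W[X] := ∑ k ∈ Finset.range n, C (m k) * X ^ k
  have hBM : PolyIn M B := PolyIn.sum fun k _ => (PolyIn.C (hmM k)).mul ((PolyIn.X _).pow k)
  have hBd : B.degree < n := by
    refine (degree_sum_le _ _).trans_lt ?_
    rw [Finset.sup_lt_iff (by exact_mod_cast WithBot.bot_lt_coe n)]
    intro k hk
    refine (degree_C_mul_X_pow_le _ _).trans_lt ?_
    exact_mod_cast Finset.mem_range.1 hk
  have hBc : ∀ k, k < n → B.coeff k = m k := by
    intro k hk
    simp only [B, finsetSum_coeff, coeff_C_mul, coeff_X_pow]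
    rw [Finset.sum_eq_single k]
    · simp
    · intro b _ hb; simp [hb.symm]
    · intro h; simp at h; omega
  set D := P - B with hD
  have hDd : D.degree < n := (degree_sub_le _ _).trans_lt (max_lt hPd hBd)
  have hDbest : ∀ G : W[X], PolyIn M G → ∀ j, ‖D.coeff j‖ ≤ ‖(D - G).coeff j‖ := by
    intro G hG j
    by_cases hj : j < n
    · have h1 := hmb j (m j + G.coeff j) (M.add_mem (hmM j) (hG j))
      rw [hD, coeff_sub, coeff_sub, coeff_sub, hBc j hj, sub_sub]
      exact h1
    · rw [coeff_eq_zero_of_degree_lt (hDd.trans_le (by exact_mod_cast not_lt.1 hj)), norm_zero]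
      exact norm_nonneg _
  -- p-th roots of conjugates
  obtain ⟨g, hgκ, hg⟩ : ∃ g : W[X], PolyIn κ g ∧ ∀ a ∈ μ.roots, g.eval a ^ p = a := by
    obtain ⟨β, hβ⟩ := IsAlgClosed.exists_pow_nat_eq α (expChar_pos W p)
    have hβa : β ∈ acl κ := pow_mem_acl (expChar_pos W p).ne' (by rwa [hβ])
    have hβ' : β ∈ adjF κ {α} := by
      obtain ⟨γ, hγ, hγ'⟩ := exists_primitive_acl h.perf {α, β} (by
        intro x hx
        simp only [Finset.mem_insert, Finset.mem_singleton] at hx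
        rcases hx with rfl | rfl <;> assumption)
      -- β is purely inseparable and separable over κ(α)
      have hsepβ : (minpoly (adjF κ {α}) β).Separable := by
        have h1 : (mpW κ β).Separable := (mpW_perfect_separable h.perf hβa).map
        exact (separable_map _).1 (h1.of_dvd (mpW_dvd_mpW (le_adjF κ {α}) β))
      have hβacl : β ∈ acl (adjF κ {α}) := acl_mono (le_adjF _ _) hβa
      apply mem_of_mpW_natDegree_eq_one hβacl
      have hnd := mpW_nodup_roots hsepβ
      rw [← IsAlgClosed.card_roots_eq_natDegree]
      have hall : ∀ b ∈ (mpW (adjF κ {α}) β).roots, b = β := by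
        intro b hb
        have h2 : PolyIn (adjF κ {α}) (X ^ p - C α) :=
          ((PolyIn.X _).pow p).sub (PolyIn.C (mem_adjF_self κ α))
        obtain ⟨q, hq⟩ := mpW_dvd (z := β) h2 (by simp [hβ])
        have h3 : (X ^ p - C α : W[X]).eval b = 0 := by
          rw [hq, eval_mul, (mpW_roots_iff hβacl).1 hb, zero_mul]
        have h4 : (b - β) ^ p = 0 := by
          rw [sub_pow_char, hβ]; simpa using h3
        exact sub_eq_zero.1 (pow_eq_zero_iff hprime.ne_zero |>.1 h4)
      have h5 := Multiset.eq_replicate_card.2 hall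
      have h6 : Multiset.card (mpW (adjF κ {α}) β).roots ≤ 1 := by
        rw [h5] at hnd
        by_contra! h
        exact (Multiset.nodup_iff_count_le_one.1 hnd β).not_gt (by
          rw [Multiset.count_replicate_self]; exact h)
      have h7 : 0 < Multiset.card (mpW (adjF κ {α}) β).roots :=
        Multiset.card_pos_iff_exists_mem.2 ⟨β, (mpW_roots_iff hβacl).2 (mpW_eval _ β)⟩
      omega
    obtain ⟨g, hg1, hg2, hg3⟩ := mem_adjF_of_root hμm (mpW_polyIn κ α) (mpW_eval κ α) hβ'
    refine ⟨g, hg1, fun a ha => ?_⟩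
    have h1 : PolyIn κ (g ^ p - X) := (hg1.pow p).sub (PolyIn.X κ)
    obtain ⟨q, hq⟩ := mpW_dvd (z := α) h1 (by simp [← hg3, hβ])
    have h2 : (g ^ p - X).eval a = 0 := by rw [hq, eval_mul, hroot a ha, zero_mul]
    rw [eval_sub, eval_pow, eval_X] at h2
    exact sub_eq_zero.1 h2
  have hmod : ∀ (G : W[X]) a, a ∈ μ.roots → (G %ₘ μ).eval a = G.eval a := by
    intro G a ha
    conv_rhs => rw [← modByMonic_add_div G μ]
    rw [eval_add, eval_mul, hroot a ha, zero_mul, add_zero]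
  -- p-th root of a polynomial in M[X] modulo μ
  have hpth : ∀ E : W[X], PolyIn M E → ∃ G : W[X], PolyIn M G ∧ G.degree < n ∧
      ∀ a ∈ μ.roots, G.eval a ^ p = E.eval a := by
    intro E hE
    have : ∀ k, ∃ d ∈ M, d ^ p = E.coeff k := fun k => hMperf _ (hE k)
    choose d hdM hd using this
    let G : W[X] := ∑ k ∈ Finset.range (E.natDegree + 1), C (d k) * g ^ k
    have hGM : PolyIn M G := PolyIn.sum fun k _ => (PolyIn.C (hdM k)).mul ((hgκ.mono h.le).pow k)
    refine ⟨G %ₘ μ, hGM.modByMonic hμM hμm, ?_, ?_⟩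
    · have := degree_modByMonic_lt G hμm
      rwa [degree_eq_natDegree hμm.ne_zero] at this
    · intro a ha
      rw [hmod G a ha, eval_eq_sum_range (p := E)]
      simp only [G, eval_finsetSum, eval_mul, eval_C, eval_pow]
      rw [sum_pow_char]
      apply Finset.sum_congr rfl
      intro k _
      rw [mul_pow, hd, ← pow_mul, mul_comm k p, pow_mul, hg a ha]
  have hDe : ∀ a ∈ μ.roots, D.eval a ^ p - D.eval a = (H - B ^ p + B).eval a := by
    intro a ha
    rw [hD, eval_sub, hPe a ha, sub_pow_char, eval_add, eval_sub, eval_pow]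
    linear_combination hΘ a
  -- the distance is at most one
  have hle1 : ∀ a ∈ μ.roots, ‖D.eval a‖ ≤ 1 := by
    by_contra! hcon
    obtain ⟨a0, ha0, ha01⟩ := hcon
    obtain ⟨a1, ha1, hmax⟩ := Finset.exists_max_image μ.roots.toFinset (fun a => ‖D.eval a‖)
      ⟨a0, Multiset.mem_toFinset.2 ha0⟩
    set r := ‖D.eval a1‖ with hr
    have hr1 : 1 < r := ha01.trans_le (hmax a0 (Multiset.mem_toFinset.2 ha0))
    obtain ⟨G, hGM, hGd, hGe⟩ := hpth (H - B ^ p + B) ((hH.sub (hBM.pow p)).add hBM)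
    have hcl : ∀ a ∈ μ.roots, ‖(D - G).eval a‖ < r := by
      intro a ha
      have h1 : ((D - G).eval a) ^ p = D.eval a := by
        rw [eval_sub, sub_pow_char, hGe a ha, ← hDe a ha]; ring
      have h2 : ‖(D - G).eval a‖ ^ p ≤ r := by
        rw [← norm_pow, h1]; exact hmax a (Multiset.mem_toFinset.2 ha)
      by_contra! h3
      have h4 : r ^ p ≤ ‖(D - G).eval a‖ ^ p := by gcongr
      have h5 : r < r ^ p := lt_self_pow₀ hr1 hprime.one_lt
      linarith
    have h6 := lag_lt hκ hα hαs (P := D - G)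
      ((degree_sub_le _ _).trans_lt (max_lt hDd hGd)) (by linarith) hcl
    have h7 : ‖D.eval a1‖ < r := by
      rw [eval_eq_sum_range]
      apply um_sum_lt (by linarith)
      intro i _
      rw [norm_mul, norm_pow]
      calc _ ≤ ‖D.coeff i‖ * 1 := by
            gcongr
            exact pow_le_one₀ (norm_nonneg _) (hκ.acl.le (hracl a1 (Multiset.mem_toFinset.1 ha1)))
        _ < _ := by rw [mul_one]; exact (hDbest G hGM i).trans_lt (h6 i)
    exact lt_irrefl _ h7
  have hαr : α ∈ μ.roots := (mpW_roots_iff hα).2 (mpW_eval κ α)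
  have hDα : D.eval α = θ - B.eval α := by
    rw [hD, eval_sub, hPe α hαr, hΘα α rfl]
  have hBα : B.eval α ∈ Cc := (hBM.mono hMC).eval (hκC hα)
  have hθa : θ ∈ acl Cc := by
    apply root_mem_acl (g := X ^ p - X - C (θ ^ p - θ))
    · intro h0
      have : derivative (X ^ p - X - C (θ ^ p - θ) : W[X]) = -1 := by
        rw [derivative_sub, derivative_sub, derivative_X_pow, derivative_C, derivative_X,
          CharP.cast_eq_zero]
        simp
      rw [h0] at this; simp at this
    · exact ((((PolyIn.X _).pow p).sub (PolyIn.X _)).sub (PolyIn.C (le_acl Cc hθ)))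
    · simp
  have hgood2 : Good (acl κ) (acl Cc) := hgC.acl hκ.acl (acl_acl κ) hiC
  obtain ⟨c, hcκ, hc⟩ := hgood2 (θ - B.eval α) ((acl Cc).sub_mem hθa (le_acl Cc hBα))
    (by rw [← hDα]; exact hle1 α hαr)
  have hb : B.eval α + c ∈ Cc := Cc.add_mem hBα (hκC hcκ)
  have hfin : θ - (B.eval α + c) ∈ Cc := by
    apply as_small hiC _ (by rwa [← sub_sub])
    rw [sub_pow_char]
    have : θ ^ p - (B.eval α + c) ^ p - (θ - (B.eval α + c))
      = (θ ^ p - θ) - ((B.eval α + c) ^ p - (B.eval α + c)) := by ring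
    rw [this]
    exact Cc.sub_mem hθ (Cc.sub_mem (Cc.pow_mem hb p) hb)
  apply hθC
  have := Cc.add_mem hfin hb
  rwa [sub_add_cancel] at this

/-- Fact L -/
theorem MaxGood.acl_sub [IsAlgClosed W] [CompleteSpace W] {p : ℕ} [hp : ExpChar W p]
    {κ M A : Subfield W} (h : MaxGood p κ M) (hn : ∃ x ∈ M, 1 < ‖x‖) (hκA : κ ≤ A) (hAM : A ≤ M)
    (hA : ∀ x ∈ acl A, x ∈ M → x ∈ A) : acl A = adjF A (acl κ : Set W) := by
  classical
  apply le_antisymm _ (comp_le_acl hκA)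
  intro w hw
  obtain ⟨α, hα, q, hq, hd, rfl⟩ := mem_comp h.perf h.le (h.acl_le hn (acl_mono hAM hw))
  have hαs := mpW_perfect_separable h.perf hα
  obtain ⟨b, hb, hb'⟩ := lag_coeff hα hαs
  have hmp := mpW_good_eq h.triv h.le h.good hα
  have hqa : ∀ a ∈ (mpW κ α).roots, q.eval a ∈ acl A := by
    intro a ha
    set G := mpW A (q.eval α) with hG
    have h1 : PolyIn M (G.comp q) := ((mpW_polyIn A _).mono hAM).comp hq
    obtain ⟨t, ht⟩ := mpW_dvd (z := α) h1 (by rw [eval_comp]; exact mpW_eval A _)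
    rw [hmp] at ht
    have h2 : (G.comp q).eval a = 0 := by
      rw [ht, eval_mul, (mpW_roots_iff hα).1 ha, zero_mul]
    rw [eval_comp] at h2
    exact root_mpW_mem_acl hw h2
  have hqA : PolyIn A q := by
    intro j
    apply hA _ _ (hq j)
    rw [hb' q hd j]
    apply (acl A).sum_mem
    intro a ha
    have ha' := Multiset.mem_toFinset.1 ha
    exact (acl A).mul_mem (hqa a ha') (acl_mono hκA (hb a ha' j))
  exact (hqA.mono (le_adjF _ _)).eval (subset_adjF A _ hα)

end Tame

open FirstOrder Ring Language IsLocalRing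
set_option linter.unusedSectionVars false
set_option linter.unusedVariables false
set_option linter.style.haveILetI false

section RtSec
open Polynomial
variable {W : Type*} [NormedField W] [IsUltrametricDist W]

theorem mem_of_unique_conj [IsAlgClosed W] {R : Subfield W} {v : W} (hv : v ∈ acl R)
    (hs : (mpW R v).Separable) (hall : ∀ w, (mpW R v).eval w = 0 → w = v) : v ∈ R := by
  classical
  apply mem_of_mpW_natDegree_eq_one hv
  have hnd := nodup_roots hs
  rw [← IsAlgClosed.card_roots_eq_natDegree]
  have h5 := Multiset.eq_replicate_card.2 (fun b hb => hall b ((mpW_roots_iff hv).1 hb))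
  have h6 : Multiset.card (mpW R v).roots ≤ 1 := by
    rw [h5] at hnd
    by_contra! h
    exact (Multiset.nodup_iff_count_le_one.1 hnd v).not_gt (by
      rw [Multiset.count_replicate_self]; exact h)
  have h7 : 0 < Multiset.card (mpW R v).roots :=
    Multiset.card_pos_iff_exists_mem.2 ⟨v, (mpW_roots_iff hv).2 (mpW_eval _ v)⟩
  omega

/-- norm of nonzero natural numbers is one -/
def NatTriv (W : Type*) [NormedField W] : Prop := ∀ n : ℕ, (n : W) ≠ 0 → ‖(n : W)‖ = 1

theorem TrivN.natTriv {κ : Subfield W} (h : TrivN κ) : NatTriv W :=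
  fun n hn => h n (natCast_mem κ n) hn

theorem unit_pow_sub (hN : NatTriv W) {v : W} (hv : ‖v - 1‖ < 1) {n : ℕ} (hn : (n : W) ≠ 0) :
    ‖v ^ n - 1‖ = ‖v - 1‖ := by
  have h1 : v ^ n - 1 = (∑ i ∈ Finset.range n, v ^ i) * (v - 1) := (geom_sum_mul v n).symm
  have hpow : ∀ i : ℕ, ‖v ^ i - 1‖ < 1 := by
    intro i
    induction i with
    | zero => simp
    | succ i ih =>
      have : v ^ (i + 1) - 1 = (v ^ i - 1) * (v - 1) + (v ^ i - 1) + (v - 1) := by ring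
      rw [this]
      refine um_add_lt (um_add_lt ?_ ih) hv
      rw [norm_mul]
      calc _ ≤ ‖v ^ i - 1‖ * 1 := by gcongr
        _ < 1 := by rw [mul_one]; exact ih
  have h2 : ‖(∑ i ∈ Finset.range n, v ^ i) - n‖ < 1 := by
    have : (∑ i ∈ Finset.range n, v ^ i) - n = ∑ i ∈ Finset.range n, (v ^ i - 1) := by simp
    rw [this]
    exact um_sum_lt one_pos fun i _ => hpow i
  have h3 : ‖∑ i ∈ Finset.range n, v ^ i‖ = 1 := by
    rw [← hN n hn]; apply um_eq_of_sub_lt'; rw [hN n hn]; exact h2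
  rw [h1, norm_mul, h3, one_mul]

theorem unit_root_exists [IsAlgClosed W] (hN : NatTriv W) {w : W} (hw : ‖w - 1‖ < 1) {n : ℕ}
    (hn : (n : W) ≠ 0) : ∃ v, v ^ n = w ∧ ‖v - 1‖ < 1 ∧ ‖v - 1‖ = ‖w - 1‖ := by
  have hn0 : n ≠ 0 := by rintro rfl; simp at hn
  obtain ⟨a, ha, ha'⟩ := exists_root_near (g := X ^ n - C w) (monic_X_pow_sub_C w hn0) (z := 1)
    (ε := 1) zero_le_one (by
      rw [one_pow]
      simp only [eval_sub, eval_pow, eval_X, one_pow, eval_C]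
      rwa [norm_sub_rev])
  have h1 : a ^ n = w := by
    simp only [eval_sub, eval_pow, eval_X, eval_C] at ha
    exact sub_eq_zero.1 ha
  rw [norm_sub_rev] at ha'
  exact ⟨a, h1, ha', by rw [← h1, unit_pow_sub hN ha' hn]⟩

theorem unit_root_unique (hN : NatTriv W) {v v' : W} (hv : ‖v - 1‖ < 1)
    (hv' : ‖v' - 1‖ < 1) {n : ℕ} (hn : (n : W) ≠ 0) (h : v ^ n = v' ^ n) : v = v' := by
  have h1 : ‖v'‖ = 1 := by
    have := um_eq_of_sub_lt' (x := v') (y := 1) (by simpa using hv'); simpa using this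
  have h0 : v' ≠ 0 := by intro h; rw [h] at h1; simp at h1
  have h2 : ‖v / v' - 1‖ < 1 := by
    have : v / v' - 1 = (v - v') / v' := by field_simp
    rw [this, norm_div, h1, div_one]
    have : v - v' = (v - 1) - (v' - 1) := by ring
    rw [this]; exact um_sub_lt hv hv'
  have h3 := unit_pow_sub hN h2 hn
  rw [div_pow, h, div_self (pow_ne_zero n h0), sub_self, norm_zero] at h3
  have := sub_eq_zero.1 (norm_eq_zero.1 h3.symm)
  rwa [div_eq_one_iff_eq h0] at this

/-- closed subfields are closed under prime-to-p roots of 1-units -/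
theorem unit_root_mem [IsAlgClosed W] [CompleteSpace W] (hN : NatTriv W) {E : Subfield W}
    (hc : IsClosed (E : Set W)) {v : W} (hv : ‖v - 1‖ < 1) {n : ℕ} (hn : (n : W) ≠ 0)
    (hvE : v ^ n ∈ E) : v ∈ E := by
  have hn0 : n ≠ 0 := by rintro rfl; simp at hn
  by_cases hnt : ∃ x ∈ E, 1 < ‖x‖
  · have hi := isoN_of_isClosed hc hnt
    have hfE : PolyIn E (X ^ n - C (v ^ n)) := ((PolyIn.X E).pow n).sub (PolyIn.C hvE)
    have hv0 : v ≠ 0 := by rintro rfl; simp at hv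
    have hva : v ∈ acl E := mem_acl_iff.2 ⟨_, X_pow_sub_C_ne_zero (Nat.pos_of_ne_zero hn0) _, hfE,
      by simp⟩
    have hd := mpW_dvd hfE (z := v) (by simp)
    apply mem_of_unique_conj hva
    · exact (separable_X_pow_sub_C (v ^ n) hn (pow_ne_zero n hv0)).of_dvd hd
    · intro w hw
      have h1 : w ^ n = v ^ n := by
        obtain ⟨q, hq⟩ := hd
        have : (X ^ n - C (v ^ n)).eval w = 0 := by rw [hq, eval_mul, hw, zero_mul]
        simp only [eval_sub, eval_pow, eval_X, eval_C] at this
        exact sub_eq_zero.1 this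
      apply unit_root_unique hN _ hv hn h1
      rwa [hi.sub hva E.one_mem hw]
  · push Not at hnt
    have h1 := unit_pow_sub hN hv hn
    have h2 : v ^ n - 1 = 0 := by
      by_contra h0
      have h3 := hnt (v ^ n - 1)⁻¹ (E.inv_mem (E.sub_mem hvE E.one_mem))
      rw [norm_inv, h1] at h3
      have h4 : 0 < ‖v - 1‖ := by rw [← h1]; exact norm_pos_iff.2 h0
      have := (inv_le_one₀ h4).1 h3
      linarith
    rw [h2, norm_zero] at h1
    rw [sub_eq_zero.1 (norm_eq_zero.1 h1.symm)]
    exact E.one_mem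

/-- closed under prime-to-p roots -/
def PC (E : Subfield W) : Prop := ∀ (w : W) (n : ℕ), (n : W) ≠ 0 → w ^ n ∈ E → w ∈ E

theorem PC.acl (A : Subfield W) : PC (acl A) := fun w n hn h =>
  pow_mem_acl (by rintro rfl; simp at hn) h

/-- criterion: closed field, with enough approximate roots -/
theorem PC.of_approx [IsAlgClosed W] [CompleteSpace W] (hN : NatTriv W) {E : Subfield W}
    (hc : IsClosed (E : Set W)) (Mon : Set W) (hMon : ∀ w (n : ℕ), (n : W) ≠ 0 → w ^ n ∈ Mon → w ∈ Mon)
    (h1 : (1 : W) ∈ Mon) (hME : Mon ⊆ E)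
    (h : ∀ e ∈ E, e ≠ 0 → ∃ m ∈ Mon, ‖e - m‖ < ‖e‖) : PC E := by
  intro w n hn hw
  by_cases hw0 : w = 0
  · rw [hw0]; exact E.zero_mem
  have hn0 : n ≠ 0 := by rintro rfl; simp at hn
  obtain ⟨m, hm, hwm⟩ := h _ hw (pow_ne_zero n hw0)
  obtain ⟨d, hd⟩ := IsAlgClosed.exists_pow_nat_eq m (Nat.pos_of_ne_zero hn0)
  have hdM : d ∈ Mon := hMon d n hn (by rwa [hd])
  have hm0 : m ≠ 0 := by
    rintro rfl; simp at hwm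
  have hd0 : d ≠ 0 := by rintro rfl; rw [zero_pow hn0] at hd; exact hm0 hd.symm
  have hu : ‖(w / d) ^ n - 1‖ < 1 := by
    rw [div_pow, hd]
    have : w ^ n / m - 1 = (w ^ n - m) / m := by field_simp
    rw [this, norm_div, um_eq_of_sub_lt hwm]
    exact (div_lt_one (norm_pos_iff.2 (pow_ne_zero n hw0))).2 hwm
  obtain ⟨v, hv, hv1, _⟩ := unit_root_exists hN hu hn
  have hvE : v ∈ E := by
    apply unit_root_mem hN hc hv1 hn
    rw [hv, div_pow]
    exact E.div_mem hw (E.pow_mem (hME hdM) n)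
  have hv0 : v ≠ 0 := by rintro rfl; simp at hv1
  have hz : w / d / v ∈ Mon := by
    apply hMon _ n hn
    rw [div_pow, hv, div_self]
    · exact h1
    · exact pow_ne_zero n (div_ne_zero hw0 hd0)
  have : w = w / d / v * v * d := by field_simp
  rw [this]
  exact E.mul_mem (E.mul_mem (hME hz) hvE) (hME hdM)

theorem closure_approx {s : Set W} {e : W} (he : e ∈ closure s) {ε : ℝ} (hε : 0 < ε) :
    ∃ v ∈ s, ‖e - v‖ < ε := by
  obtain ⟨v, hv, h⟩ := Metric.mem_closure_iff.1 he ε hε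
  exact ⟨v, hv, by rwa [← dist_eq_norm]⟩

theorem mem_closure_of_approx {s : Set W} {e : W} (h : ∀ ε : ℝ, 0 < ε → ∃ v ∈ s, ‖e - v‖ < ε) :
    e ∈ closure s := Metric.mem_closure_iff.2 fun ε hε => by
  obtain ⟨v, hv, h⟩ := h ε hε
  exact ⟨v, hv, by rwa [dist_eq_norm]⟩

theorem PC.topologicalClosure [IsAlgClosed W] [CompleteSpace W] (hN : NatTriv W) {E : Subfield W}
    (h : PC E) : PC E.topologicalClosure := by
  apply PC.of_approx hN (Subfield.isClosed_topologicalClosure E) (E : Set W) h E.one_mem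
    E.le_topologicalClosure
  intro e he h0
  exact closure_approx (s := (E : Set W)) he (norm_pos_iff.2 h0)

/-- smallest closed subfield containing `B`, closed under prime-to-`p` roots -/
def Rt (B : Set W) : Subfield W := sInf {E | IsClosed (E : Set W) ∧ PC E ∧ B ⊆ E}

theorem subset_Rt (B : Set W) : B ⊆ Rt B := by
  intro x hx
  show x ∈ Rt B
  unfold Rt
  rw [Subfield.mem_sInf]
  exact fun E hE => hE.2.2 hx

theorem Rt_le {B : Set W} {E : Subfield W} (h1 : IsClosed (E : Set W)) (h2 : PC E) (h3 : B ⊆ E) :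
    Rt B ≤ E := sInf_le ⟨h1, h2, h3⟩

theorem Rt_isClosed (B : Set W) : IsClosed (Rt B : Set W) := by
  unfold Rt
  rw [Subfield.coe_sInf]
  exact isClosed_biInter fun E hE => hE.1

theorem Rt_PC (B : Set W) : PC (Rt B) := by
  intro w n hn hw
  unfold Rt at hw ⊢
  rw [Subfield.mem_sInf] at hw ⊢
  exact fun E hE => hE.2.1 w n hn (hw E hE)

theorem Rt_le_Rt {B B' : Set W} (h : B ⊆ Rt B') : Rt B ≤ Rt B' := Rt_le (Rt_isClosed _) (Rt_PC _) h

/-- contraction lemma -/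
theorem lin_contract {E B : Subfield W} (hB : IsClosed (B : Set W)) (V : Set W)
    (hV : ∀ e ∈ E, ∀ ε : ℝ, 0 < ε → ∃ v ∈ V, ‖e - v‖ < ε) {ρ : ℝ} (hρ0 : 0 < ρ) (hρ : ρ < 1)
    (h : ∀ v ∈ V, ∃ b ∈ B, b ∈ E ∧ ‖v - b‖ ≤ ρ * ‖v‖) : E ≤ B := by
  intro e he
  have step : ∀ k : ℕ, ∃ b ∈ B, b ∈ E ∧ ‖e - b‖ ≤ ρ ^ k * ‖e‖ := by
    intro k
    induction k with
    | zero => exact ⟨0, B.zero_mem, E.zero_mem, by simp⟩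
    | succ k ih =>
      obtain ⟨b, hbB, hbE, hb⟩ := ih
      by_cases h0 : e - b = 0
      · exact ⟨b, hbB, hbE, by rw [h0, norm_zero]; positivity⟩
      have hpos : 0 < ‖e - b‖ := norm_pos_iff.2 h0
      obtain ⟨v, hv, hev⟩ := hV (e - b) (E.sub_mem he hbE) (ρ * ‖e - b‖) (by positivity)
      have hvn : ‖v‖ = ‖e - b‖ := um_eq_of_sub_lt (hev.trans (by nlinarith))
      obtain ⟨b', hb'B, hb'E, hb'⟩ := h v hv
      refine ⟨b + b', B.add_mem hbB hb'B, E.add_mem hbE hb'E, ?_⟩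
      have h1 : ‖e - b - b'‖ ≤ ρ * ‖e - b‖ := um_tri_le hev.le (by rwa [← hvn])
      rw [← sub_sub]
      calc _ ≤ ρ * ‖e - b‖ := h1
        _ ≤ ρ * (ρ ^ k * ‖e‖) := by gcongr
        _ = _ := by ring
  have : e ∈ closure (B : Set W) := by
    apply mem_closure_of_approx
    intro ε hε
    obtain ⟨k, hk⟩ := exists_pow_lt_of_lt_one (show 0 < ε / (‖e‖ + 1) by positivity) hρ
    obtain ⟨b, hbB, _, hb⟩ := step k
    refine ⟨b, hbB, hb.trans_lt ?_⟩
    rw [lt_div_iff₀ (by positivity)] at hk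
    refine lt_of_le_of_lt ?_ hk
    gcongr; linarith
  rwa [hB.closure_eq] at this

/-- closure of a subring with enough invertible approximations is a field -/
theorem exists_field_closure [CompleteSpace W] (V : Subring W) (Mon : Set W)
    (hMV : Mon ⊆ V) (hinv : ∀ m ∈ Mon, m⁻¹ ∈ Mon)
    (h : ∀ v ∈ V, v ≠ 0 → ∃ m ∈ Mon, ‖v - m‖ < ‖v‖) :
    ∃ E : Subfield W, (E : Set W) = closure (V : Set W) ∧
      ∀ e ∈ E, e ≠ 0 → ∃ m ∈ Mon, ‖e - m‖ < ‖e‖ := by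
  have happ : ∀ e ∈ V.topologicalClosure, e ≠ 0 → ∃ m ∈ Mon, ‖e - m‖ < ‖e‖ := by
    intro e he h0
    have he' : e ∈ closure (V : Set W) := he
    obtain ⟨v, hv, hev⟩ := closure_approx he' (norm_pos_iff.2 h0)
    have hvn := um_eq_of_sub_lt hev
    obtain ⟨m, hm, hvm⟩ := h v hv (by rintro rfl; simp at hev)
    exact ⟨m, hm, um_tri_lt hev (by rwa [hvn] at hvm)⟩
  refine ⟨{ V.topologicalClosure with inv_mem' := ?_ }, rfl, happ⟩
  intro e he
  have he : e ∈ V.topologicalClosure := he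
  show e⁻¹ ∈ V.topologicalClosure
  by_cases h0 : e = 0
  · rw [h0, inv_zero]; exact V.topologicalClosure.zero_mem
  obtain ⟨m, hm, hem⟩ := happ e he h0
  have hm0 : m ≠ 0 := by rintro rfl; simp at hem
  have hmi : m⁻¹ ∈ V.topologicalClosure := V.le_topologicalClosure (hMV (hinv m hm))
  set t := 1 - e * m⁻¹ with ht
  have htV : t ∈ V.topologicalClosure :=
    V.topologicalClosure.sub_mem V.topologicalClosure.one_mem (V.topologicalClosure.mul_mem he hmi)
  have ht1 : ‖t‖ < 1 := by
    have : t = -((e - m) / m) := by rw [ht]; field_simp; ring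
    rw [this, norm_neg, norm_div, um_eq_of_sub_lt hem]
    exact (div_lt_one (norm_pos_iff.2 h0)).2 hem
  have hone : ‖1 - t‖ = 1 := by
    have := um_eq_of_sub_lt (x := (1 : W)) (y := 1 - t) (by simpa using ht1)
    simpa using this
  have h1t : 1 - t ≠ 0 := by intro h; rw [h] at hone; simp at hone
  have hmem : (1 - t)⁻¹ ∈ V.topologicalClosure := by
    have : (1 - t)⁻¹ ∈ closure (V.topologicalClosure : Set W) := by
      apply mem_closure_of_approx
      intro ε hε
      obtain ⟨k, hk⟩ := exists_pow_lt_of_lt_one hε ht1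
      refine ⟨∑ i ∈ Finset.range k, t ^ i,
        V.topologicalClosure.sum_mem fun i _ => V.topologicalClosure.pow_mem htV i, ?_⟩
      have e1 : (1 - t)⁻¹ - ∑ i ∈ Finset.range k, t ^ i = t ^ k / (1 - t) := by
        rw [eq_div_iff h1t, sub_mul, inv_mul_cancel₀ h1t, geom_sum_mul_neg]; ring
      rw [e1, norm_div, hone, div_one, norm_pow]
      exact hk
    rwa [V.isClosed_topologicalClosure.closure_eq] at this
  have e2 : e⁻¹ = (1 - t)⁻¹ * m⁻¹ := by
    have : 1 - t = e * m⁻¹ := by rw [ht]; ring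
    rw [this, mul_inv, inv_inv]; field_simp
  rw [e2]
  exact V.topologicalClosure.mul_mem hmem hmi

end RtSec

open FirstOrder Ring Language IsLocalRing
set_option linter.unusedSectionVars false
set_option linter.unusedVariables false
set_option linter.style.haveILetI false

open Polynomial

section P7a
variable {W : Type*} [NormedField W] [IsUltrametricDist W]

/-- the rank-one-step context -/
structure Ctx (κ Ab Om : Subfield W) : Prop where
  triv : TrivN κ
  kacl : acl κ = κ
  le : κ ≤ Ab
  aacl : acl Ab = Ab
  lo : Ab ≤ Om
  oacl : acl Om = Om
  good : Good κ Om
  nt : ∃ x ∈ Om, 1 < ‖x‖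
  rk : ∀ x ∈ Om, x ∉ Ab → Om ≤ acl (adjF Ab {x})

/-- coordinate field -/
def Ry (Ab : Subfield W) (y : W) : Subfield W := Rt (insert y (Ab : Set W))

theorem le_Ry (Ab : Subfield W) (y : W) : Ab ≤ Ry Ab y := fun x hx =>
  subset_Rt _ (Set.mem_insert_of_mem _ hx)

theorem mem_Ry (Ab : Subfield W) (y : W) : y ∈ Ry Ab y := subset_Rt _ (Set.mem_insert _ _)

theorem Ry_le {Ab : Subfield W} {y : W} {B : Set W} (h : (Ab : Set W) ⊆ Rt B) (hy : y ∈ Rt B) :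
    Ry Ab y ≤ Rt B := Rt_le_Rt (Set.insert_subset hy h)

theorem Ry_le_Ry {Ab : Subfield W} {y z : W} (h : y ∈ Ry Ab z) : Ry Ab y ≤ Ry Ab z :=
  Ry_le (le_Ry Ab z) h

theorem adjF_le_Ry (Ab : Subfield W) (y : W) : adjF Ab {y} ≤ Ry Ab y :=
  adjF_le_iff.2 ⟨le_Ry Ab y, by simpa using mem_Ry Ab y⟩

/-- separable over -/
def SepOver (R : Subfield W) (z : W) : Prop := z ∈ acl R ∧ (mpW R z).Separable

theorem SepOver.mono {R R' : Subfield W} (h : R ≤ R') {z : W} (hz : SepOver R z) : SepOver R' z :=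
  ⟨acl_mono h hz.1, hz.2.of_dvd (mpW_dvd_mpW h z)⟩

theorem SepOver.minpoly {R : Subfield W} {z : W} (h : SepOver R z) : (minpoly R z).Separable := by
  have := h.2
  unfold mpW at this
  exact (separable_map _).1 this

theorem degree_drop {R R' : Subfield W} (hR : R ≤ R') {s θ : W} (hs : s ∈ acl R)
    (hθ : θ ∈ adjF R {s}) (hθR : θ ∉ R) (hθ' : θ ∈ R') :
    (mpW R' s).natDegree < (mpW R s).natDegree := by
  have hd := mpW_dvd_mpW hR s
  by_contra! hge
  have hm := mpW_monic hs
  have hm' := mpW_monic (acl_mono hR hs)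
  have heq : mpW R' s = mpW R s :=
    (eq_of_monic_of_dvd_of_natDegree_le hm' hm hd hge).symm
  obtain ⟨g, hg, hgd, hgs⟩ := mem_adjF_of_root hm (mpW_polyIn R s) (mpW_eval R s) hθ
  have hPin : PolyIn R' (g - C θ) := (hg.mono hR).sub (PolyIn.C hθ')
  have hdv := mpW_dvd (A := R') (z := s) hPin (by simp [hgs])
  have h0 : g - C θ = 0 := by
    apply eq_zero_of_dvd_of_degree_lt hdv
    rw [heq]
    apply (degree_sub_le _ _).trans_lt
    apply max_lt hgd
    apply degree_C_le.trans_lt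
    rw [degree_eq_natDegree hm.ne_zero]
    exact_mod_cast mpW_natDegree_pos hs
  apply hθR
  have : θ = g.coeff 0 := by rw [sub_eq_zero.1 h0]; simp
  rw [this]; exact hg 0

namespace Ctx
variable {κ Ab Om : Subfield W} (h : Ctx κ Ab Om)
include h

theorem pcOm : PC Om := by rw [← h.oacl]; exact PC.acl Om

theorem natTriv : NatTriv W := h.triv.natTriv

theorem good_cl : Good κ Om.topologicalClosure := by
  apply h.good.of_imm
  intro x hx h0
  exact closure_approx (s := (Om : Set W)) hx (norm_pos_iff.2 h0)

theorem good_mono {N : Subfield W} (hN : N ≤ Om.topologicalClosure) : Good κ N :=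
  fun x hx => h.good_cl x (hN hx)

variable [IsAlgClosed W] [CompleteSpace W]

theorem Rt_le_cl {B : Set W} (hB : B ⊆ Om) : Rt B ≤ Om.topologicalClosure :=
  Rt_le (Subfield.isClosed_topologicalClosure Om) (h.pcOm.topologicalClosure h.natTriv)
    (hB.trans Om.le_topologicalClosure)

theorem Ry_le_cl {y : W} (hy : y ∈ Om) : Ry Ab y ≤ Om.topologicalClosure :=
  h.Rt_le_cl (Set.insert_subset hy h.lo)

theorem Om_le_acl {y : W} (hy : y ∈ Om) (hyA : y ∉ Ab) : Om ≤ acl (Ry Ab y) :=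
  (h.rk y hy hyA).trans (acl_mono (adjF_le_Ry Ab y))

theorem Ry_nt {y : W} (hy : y ∈ Om) (hyA : y ∉ Ab) : ∃ x ∈ Ry Ab y, 1 < ‖x‖ := by
  by_contra! hc
  have ht : TrivN (Ry Ab y) := by
    intro c hc' h0
    apply le_antisymm (hc c hc')
    have := hc _ ((Ry Ab y).inv_mem hc')
    rw [norm_inv] at this
    exact (inv_le_one₀ (norm_pos_iff.2 h0)).1 this
  obtain ⟨x, hx, h1⟩ := h.nt
  have := ht.acl.le (h.Om_le_acl hy hyA hx)
  linarith

theorem Ry_iso {y : W} (hy : y ∈ Om) (hyA : y ∉ Ab) : IsoN (Ry Ab y) :=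
  isoN_of_isClosed (Rt_isClosed _) (h.Ry_nt hy hyA)

theorem Ry_ost {y : W} (hy : y ∈ Om) (hyA : y ∉ Ab) :
    ∀ w ∈ acl (Ry Ab y), ((mpW (Ry Ab y) w).natDegree : W) ≠ 0 → w ∈ Ry Ab y := by
  intro w hw hn
  apply ostrowski h.triv h.kacl (h.le.trans (le_Ry Ab y)) (h.good_mono (h.Ry_le_cl hy))
    (h.Ry_iso hy hyA) hw hn
  intro b hb
  obtain ⟨m, hm⟩ := IsAlgClosed.exists_pow_nat_eq b (n := (mpW (Ry Ab y) w).natDegree)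
    (mpW_natDegree_pos hw)
  exact ⟨m, Rt_PC _ m _ hn (by rw [hm]; exact hb), by rw [← norm_pow, hm]⟩

/-- the Artin-Schreier step property -/
def _root_.ASProp (p : ℕ) (Ab : Subfield W) (Co : W → Prop) : Prop :=
  ∀ y, Co y → ∀ θ, θ ∉ Ry Ab y → θ ^ p - θ ∈ Ry Ab y →
    ∃ θ', Co θ' ∧ θ' - θ ∈ Ry Ab y ∧ Ry Ab y ≤ Ry Ab θ'

theorem induct1 {p : ℕ} [hp : ExpChar W p] {Co : W → Prop} (hCo : ∀ y, Co y → y ∈ Om ∧ y ∉ Ab)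
    (hAS : p.Prime → ASProp p Ab Co) (n : ℕ) {y s : W} (hy : Co y) (hs : SepOver (Ry Ab y) s)
    (hn : (mpW (Ry Ab y) s).natDegree ≤ n) :
    ∃ y', Co y' ∧ Ry Ab y ≤ Ry Ab y' ∧ s ∈ Ry Ab y' ∧ y' ∈ Rt (insert s (insert y (Ab : Set W))) := by
  induction n generalizing y with
  | zero => have := mpW_natDegree_pos hs.1; omega
  | succ n ih =>
    set B := insert s (insert y (Ab : Set W)) with hB
    have hyB : Ry Ab y ≤ Rt B := Rt_le_Rt ((Set.subset_insert _ _).trans (subset_Rt _))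
    have hsB : s ∈ Rt B := subset_Rt _ (Set.mem_insert _ _)
    by_cases hsy : s ∈ Ry Ab y
    · exact ⟨y, hy, le_rfl, hsy, subset_Rt _ (Set.mem_insert_of_mem _ (Set.mem_insert _ _))⟩
    obtain ⟨hyO, hyA⟩ := hCo y hy
    obtain ⟨hpr, θ, hθ, hθR, hθp⟩ := step_lemma (p := p) (h.Ry_ost hyO hyA) hs.1 hs.minpoly hsy
    obtain ⟨θ', hco, hsub, hle⟩ := hAS hpr y hy θ hθR hθp
    have hθ' : θ ∈ Ry Ab θ' := by
      have := (Ry Ab θ').sub_mem (mem_Ry Ab θ') (hle hsub)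
      simpa using this
    have hdrop := degree_drop hle hs.1 hθ hθR hθ'
    have hθB : θ ∈ Rt B := (adjF_le_iff.2 ⟨hyB, by simpa using hsB⟩ : adjF (Ry Ab y) {s} ≤ Rt B) hθ
    have hθ'B : θ' ∈ Rt B := by
      have := (Rt B).add_mem (hyB hsub) hθB
      simpa using this
    obtain ⟨y', h1, h2, h3, h4⟩ := ih hco (hs.mono hle) (by omega)
    refine ⟨y', h1, hle.trans h2, h3, ?_⟩
    refine Rt_le_Rt (B := insert s (insert θ' (Ab : Set W))) ?_ h4
    exact Set.insert_subset hsB (Set.insert_subset hθ'B ((le_Ry Ab y).trans hyB))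

theorem inductS {p : ℕ} [hp : ExpChar W p] {Co : W → Prop} (hCo : ∀ y, Co y → y ∈ Om ∧ y ∉ Ab)
    (hAS : p.Prime → ASProp p Ab Co) (S : Finset W) {y : W} (hy : Co y)
    (hS : ∀ s ∈ S, SepOver (Ry Ab y) s) :
    ∃ y', Co y' ∧ Ry Ab y ≤ Ry Ab y' ∧ (∀ s ∈ S, s ∈ Ry Ab y') ∧
      y' ∈ Rt (insert y (Ab ∪ S : Set W)) := by
  classical
  induction S using Finset.induction_on with
  | empty => exact ⟨y, hy, le_rfl, by simp, subset_Rt _ (Set.mem_insert _ _)⟩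
  | insert s S hsS ih =>
    obtain ⟨y1, h1, h2, h3, h4⟩ := ih fun t ht => hS t (Finset.mem_insert_of_mem ht)
    obtain ⟨y', k1, k2, k3, k4⟩ := h.induct1 hCo hAS _ h1
      ((hS s (Finset.mem_insert_self _ _)).mono h2) le_rfl
    refine ⟨y', k1, h2.trans k2, ?_, ?_⟩
    · intro t ht
      rcases Finset.mem_insert.1 ht with rfl | ht
      · exact k3
      · exact k2 (h3 t ht)
    · refine Rt_le_Rt (B := insert s (insert y1 (Ab : Set W))) ?_ k4
      have hsub : insert y (Ab ∪ S : Set W) ⊆ insert y (Ab ∪ (insert s S : Finset W) : Set W) := by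
        apply Set.insert_subset_insert
        apply Set.union_subset_union_right
        simp
      refine Set.insert_subset (subset_Rt _ (by simp)) (Set.insert_subset
        (Rt_le_Rt (hsub.trans (subset_Rt _)) h4) fun a ha => subset_Rt _ (by simp [show a ∈ Ab from ha]))

end Ctx
end P7a

section P7b
variable {W : Type*} [NormedField W] [IsUltrametricDist W]

/-- Artin-Schreier equivalence -/
def AE (p : ℕ) (R : Subfield W) (a b : W) : Prop := ∃ z ∈ R, a - b = z ^ p - z

section AE
variable {p : ℕ} [Fact p.Prime] [CharP W p] {R : Subfield W}

theorem AE.refl (a : W) : AE p R a a :=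
  ⟨0, R.zero_mem, by rw [zero_pow (Fact.out : p.Prime).ne_zero]; ring⟩

theorem AE.symm {a b : W} (h : AE p R a b) : AE p R b a := by
  obtain ⟨z, hz, h⟩ := h
  have := sub_pow_char (0 : W) z (p := p)
  rw [zero_pow (Fact.out : p.Prime).ne_zero] at this
  exact ⟨-z, R.neg_mem hz, by rw [← zero_sub z, this]; linear_combination -h⟩

theorem AE.add {a b a' b' : W} (h : AE p R a b) (h' : AE p R a' b') :
    AE p R (a + a') (b + b') := by
  obtain ⟨z, hz, h⟩ := h
  obtain ⟨z', hz', h'⟩ := h'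
  exact ⟨z + z', R.add_mem hz hz', by rw [add_pow_char]; linear_combination h + h'⟩

theorem AE.trans {a b c : W} (h : AE p R a b) (h' : AE p R b c) : AE p R a c := by
  obtain ⟨z, hz, h⟩ := h
  obtain ⟨z', hz', h'⟩ := h'
  exact ⟨z + z', R.add_mem hz hz', by rw [add_pow_char]; linear_combination h + h'⟩

theorem AE.sum {ι : Type*} (s : Finset ι) {f g : ι → W} (h : ∀ i ∈ s, AE p R (f i) (g i)) :
    AE p R (∑ i ∈ s, f i) (∑ i ∈ s, g i) := by
  classical
  induction s using Finset.induction_on with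
  | empty => simpa using AE.refl (p := p) (R := R) (0 : W)
  | insert a s ha ih =>
    rw [Finset.sum_insert ha, Finset.sum_insert ha]
    exact (h a (Finset.mem_insert_self _ _)).add (ih fun i hi => h i (Finset.mem_insert_of_mem hi))

theorem AE.frob {x : W} (hx : x ∈ R) (m : ℕ) : AE p R (x ^ p ^ m) x := by
  induction m with
  | zero => simpa using AE.refl (p := p) (R := R) x
  | succ m ih =>
    refine AE.trans ⟨x ^ p ^ m, R.pow_mem hx _, ?_⟩ ih
    rw [pow_succ, pow_mul]

theorem exists_as_root [IsAlgClosed W] (a : W) : ∃ θ : W, θ ^ p - θ = a := by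
  have hp1 : 1 < p := (Fact.out : p.Prime).one_lt
  have hd : (X ^ p - X - C a : W[X]).degree ≠ 0 := by
    have : (X ^ p - (X + C a) : W[X]).degree = p := by
      rw [degree_sub_eq_left_of_degree_lt] <;> rw [degree_X_pow]
      rw [degree_X_add_C]
      exact_mod_cast hp1
    rw [sub_sub, this]
    exact_mod_cast (by omega : p ≠ 0)
  obtain ⟨θ, hθ⟩ := IsAlgClosed.exists_root _ hd
  refine ⟨θ, ?_⟩
  simp only [IsRoot.def, eval_sub, eval_pow, eval_X, eval_C] at hθ
  linear_combination hθ

theorem as_root_mem_acl {θ a : W} (ha : a ∈ R) (h : θ ^ p - θ = a) : θ ∈ acl R := by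
  have hp1 : 1 < p := (Fact.out : p.Prime).one_lt
  refine root_mem_acl (g := X ^ p - X - C a) ?_ ?_ ?_
  · intro h0
    have := congrArg derivative h0
    rw [derivative_sub, derivative_sub, derivative_X_pow, derivative_C, derivative_X,
      CharP.cast_eq_zero] at this
    simp at this
  · exact ((((PolyIn.X R).pow p).sub (PolyIn.X R)).sub (PolyIn.C ha)).mono (le_acl R)
  · simp [h]

theorem AE.of_closed [IsAlgClosed W] {A : Subfield W} (hA : acl A = A) (hle : A ≤ R) {a : W} (ha : a ∈ A) :
    AE p R a 0 := by
  obtain ⟨θ, hθ⟩ := exists_as_root (p := p) a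
  exact ⟨θ, hle (by rw [← hA]; exact as_root_mem_acl ha hθ), by rw [hθ, sub_zero]⟩

theorem as_mem [IsAlgClosed W] {κ : Subfield W} (hκ : acl κ = κ) (hle : κ ≤ R) (hi : IsoN R) {δ : W}
    (hδ : δ ^ p - δ ∈ R) (h1 : ‖δ ^ p - δ‖ < 1) : δ ∈ R := by
  have hp1 : 1 < p := (Fact.out : p.Prime).one_lt
  have hdeg : (X + C (δ ^ p - δ) : W[X]).degree < (p : WithBot ℕ) := by
    rw [degree_X_add_C]; exact_mod_cast hp1
  obtain ⟨d, hd, hd1⟩ := exists_root_near (g := X ^ p - (X + C (δ ^ p - δ))) (monic_X_pow_sub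
    (by
      rw [degree_X_add_C]
      exact_mod_cast hp1)) (z := 0) (ε := 1) zero_le_one (by
      rw [one_pow]
      rw [norm_sub_rev] at h1
      simpa [zero_pow (Fact.out : p.Prime).ne_zero] using h1)
  simp only [eval_sub, eval_pow, eval_X, eval_C, eval_add] at hd
  have hd1 : ‖d‖ < 1 := by simpa using hd1
  have hdR : d ∈ R := as_small (p := p) hi (by
    have : d ^ p - d = δ ^ p - δ := by linear_combination hd
    rw [this]; exact hδ) hd1
  have hk : δ - d ∈ κ := by
    rw [← hκ]
    apply as_root_mem_acl (p := p) κ.zero_mem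
    rw [sub_pow_char]
    linear_combination -hd
  have := R.add_mem hdR (hle hk)
  simpa using this

end AE

/-- unique dominance just above `r` -/
theorem real_dom (s : Finset ℕ) (β : ℕ → ℝ) (hβ : ∀ k ∈ s, 0 ≤ β k) (hpos : ∃ k ∈ s, 0 < β k) {r : ℝ}
    (hr : 0 < r) :
    ∃ J ∈ s, 0 < β J ∧ ∃ δ > 0, ∀ t, r < t → t < r + δ → ∀ k ∈ s, k ≠ J →
      β k * t ^ k < β J * t ^ J := by
  classical
  obtain ⟨k0, hk0, hk0'⟩ := hpos
  obtain ⟨J0, hJ0, hmax0⟩ := Finset.exists_max_image s (fun k => β k * r ^ k) ⟨k0, hk0⟩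
  set s' := s.filter fun k => β k * r ^ k = β J0 * r ^ J0 with hs'
  obtain ⟨J, hJ, hmax⟩ := Finset.exists_max_image s' id ⟨J0, by simp [hs', hJ0]⟩
  obtain ⟨hJs, hJe⟩ := Finset.mem_filter.1 hJ
  have hJpos : 0 < β J := by
    have h1 : 0 < β J * r ^ J := by
      rw [hJe]
      exact (by positivity : 0 < β k0 * r ^ k0).trans_le (hmax0 k0 hk0)
    exact pos_of_mul_pos_left h1 (by positivity)
  have hev : ∀ k ∈ s, ∃ δ > 0, ∀ t, r < t → t < r + δ → k ≠ J → β k * t ^ k < β J * t ^ J := by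
    intro k hk
    rcases (hmax0 k hk).lt_or_eq with hlt | heq
    · have hlt : β k * r ^ k < β J * r ^ J := by rw [hJe]; exact hlt
      have hc : ContinuousAt (fun t : ℝ => β J * t ^ J - β k * t ^ k) r := by fun_prop
      have := hc.eventually (lt_mem_nhds (show (0:ℝ) < β J * r ^ J - β k * r ^ k by linarith))
      obtain ⟨δ, hδ, hball⟩ := Metric.eventually_nhds_iff.1 this
      refine ⟨δ, hδ, fun t h1 h2 _ => ?_⟩
      have := hball (y := t) (by rw [Real.dist_eq, abs_of_pos (by linarith)]; linarith)
      linarith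
    · refine ⟨1, one_pos, fun t h1 h2 hne => ?_⟩
      have hks : k ∈ s' := Finset.mem_filter.2 ⟨hk, heq⟩
      have hkJ : k < J := lt_of_le_of_ne (hmax k hks) hne
      have hbk : β k * r ^ k = β J * r ^ J := heq.trans hJe.symm
      obtain ⟨m, rfl⟩ := Nat.exists_eq_add_of_lt hkJ
      have hb : β k = β (k + m + 1) * r ^ (m + 1) := by
        have hrk : r ^ k ≠ 0 := by positivity
        apply mul_right_cancel₀ hrk
        rw [hbk]; ring
      rw [hb, add_assoc, pow_add t, ← mul_assoc, mul_right_comm _ (t ^ k)]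
      have : r ^ (m + 1) < t ^ (m + 1) := pow_lt_pow_left₀ h1 hr.le (by omega)
      have ht : 0 < t := hr.trans h1
      gcongr
  choose! δ hδ hδ' using hev
  obtain ⟨k1, hk1, hmin⟩ := Finset.exists_min_image s δ ⟨k0, hk0⟩
  exact ⟨J, hJs, hJpos, δ k1, hδ k1 hk1, fun t h1 h2 k hk hne =>
    hδ' k hk t h1 (by linarith [hmin k hk]) hne⟩

theorem eval_taylor_sum (F : W[X]) (c y : W) :
    F.eval y = F.eval c + ∑ i ∈ Finset.Icc 1 F.natDegree, (hasseDeriv i F).eval c * (y - c) ^ i := by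
  have h := taylor_eval_sub c F y
  rw [← h, eval_eq_sum_range, natDegree_taylor, Finset.sum_range_succ', add_comm]
  congr 1
  · simp
  · simp only [taylor_coeff]
    rw [← Finset.sum_image (g := fun i => i + 1) (f := fun i => (hasseDeriv i F).eval c * (y - c) ^ i)]
    · apply Finset.sum_congr _ fun _ _ => rfl
      ext i; simp only [Finset.mem_image, Finset.mem_range, Finset.mem_Icc]
      constructor
      · rintro ⟨a, ha, rfl⟩; omega
      · intro hi; exact ⟨i - 1, by omega, by omega⟩
    · intro a _ b _ h; simpa using h

/-- filter of approximations of `y` from `Ab` -/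
def L4 (Ab : Subfield W) (y : W) : Filter W :=
  ⨅ c0 : Ab, 𝓟 {c | c ∈ Ab ∧ ‖y - c‖ ≤ ‖y - c0‖}

theorem L4_eventually {Ab : Subfield W} {y : W} {P : W → Prop} :
    (∀ᶠ c in L4 Ab y, P c) ↔ ∃ c0 ∈ Ab, ∀ c ∈ Ab, ‖y - c‖ ≤ ‖y - c0‖ → P c := by
  have hb := Filter.hasBasis_iInf_principal (s := fun c0 : Ab => {c | c ∈ Ab ∧ ‖y - c‖ ≤ ‖y - c0‖})
    (by
      intro a b
      rcases le_total ‖y - a‖ ‖y - b‖ with h | h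
      · exact ⟨a, fun x hx => hx, fun x hx => ⟨hx.1, hx.2.trans h⟩⟩
      · exact ⟨b, fun x hx => ⟨hx.1, hx.2.trans h⟩, fun x hx => hx⟩)
  unfold L4
  rw [hb.eventually_iff]
  constructor
  · rintro ⟨⟨c0, hc0⟩, _, h⟩
    exact ⟨c0, hc0, fun c hc hcc => h ⟨hc, hcc⟩⟩
  · rintro ⟨c0, hc0, h⟩
    exact ⟨⟨c0, hc0⟩, trivial, fun c hc => h c hc.1 hc.2⟩

theorem L4_neBot (Ab : Subfield W) (y : W) : (L4 Ab y).NeBot := by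
  rw [← Filter.frequently_true_iff_neBot, Filter.Frequently, L4_eventually]
  rintro ⟨c0, hc0, h⟩
  exact h c0 hc0 le_rfl trivial

theorem L4_mem (Ab : Subfield W) (y : W) : ∀ᶠ c in L4 Ab y, c ∈ Ab :=
  L4_eventually.2 ⟨0, Ab.zero_mem, fun c hc _ => hc⟩

theorem L4_le {Ab : Subfield W} (y : W) {c1 : W} (h : c1 ∈ Ab) : ∀ᶠ c in L4 Ab y, ‖y - c‖ ≤ ‖y - c1‖ :=
  L4_eventually.2 ⟨c1, h, fun c _ hcc => hcc⟩

/-- the immediate transcendental case -/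
structure Imm (κ Ab Om : Subfield W) : Prop extends Ctx κ Ab Om where
  imm : ∀ w ∈ Om, w ≠ 0 → ∃ c ∈ Ab, ‖w - c‖ < ‖w‖
  far : ∀ w ∈ Om, w ∉ Ab → ∃ r : ℝ, 0 < r ∧ ∀ c ∈ Ab, r ≤ ‖w - c‖

namespace Imm
variable {κ Ab Om : Subfield W} (h : Imm κ Ab Om) {y : W} (hy : y ∈ Om) (hyA : y ∉ Ab)
include h hy hyA

theorem lt {c1 : W} (hc : c1 ∈ Ab) : ∀ᶠ c in L4 Ab y, ‖y - c‖ < ‖y - c1‖ := by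
  obtain ⟨c, hc', hlt⟩ := h.imm (y - c1) (Om.sub_mem hy (h.lo hc)) (by
    intro h0; rw [sub_eq_zero] at h0; exact hyA (h0 ▸ hc))
  filter_upwards [L4_le y (Ab.add_mem hc hc')] with c2 h2
  exact h2.trans_lt (by rwa [← sub_sub])

theorem pos {c : W} (hc : c ∈ Ab) : 0 < ‖y - c‖ := by
  rw [norm_pos_iff, sub_ne_zero]; rintro rfl; exact hyA hc

/-- the distance -/
theorem exists_r : ∃ r : ℝ, 0 < r ∧ (∀ c ∈ Ab, r < ‖y - c‖) ∧
    ∀ ε > 0, ∀ᶠ c in L4 Ab y, ‖y - c‖ < r + ε := by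
  obtain ⟨r0, hr0, hr0'⟩ := h.far y hy hyA
  set T : Set ℝ := (fun c => ‖y - c‖) '' (Ab : Set W) with hT
  have hbdd : BddBelow T := ⟨r0, by rintro _ ⟨c, hc, rfl⟩; exact hr0' c hc⟩
  have hne : T.Nonempty := ⟨_, 0, Ab.zero_mem, rfl⟩
  have hle : ∀ c ∈ Ab, sInf T ≤ ‖y - c‖ := fun c hc => csInf_le hbdd ⟨c, hc, rfl⟩
  refine ⟨sInf T, hr0.trans_le (le_csInf hne (by rintro _ ⟨c, hc, rfl⟩; exact hr0' c hc)), ?_, ?_⟩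
  · intro c hc
    haveI := L4_neBot Ab y
    obtain ⟨c', h1, h2⟩ := ((h.lt hy hyA hc).and (L4_mem Ab y)).exists
    exact (hle c' h2).trans_lt h1
  · intro ε hε
    obtain ⟨_, ⟨c, hc, rfl⟩, hlt⟩ := exists_lt_of_csInf_lt hne (show sInf T < sInf T + ε by linarith)
    filter_upwards [L4_le y hc] with c' h'
    exact h'.trans_lt hlt

variable [IsAlgClosed W]

theorem roots_lt {G : W[X]} (hG : PolyIn Ab G) :
    ∀ᶠ c in L4 Ab y, ∀ a ∈ G.roots, ‖y - c‖ < ‖y - a‖ := by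
  classical
  by_cases hG0 : G = 0
  · simp [hG0]
  have : ∀ᶠ c in L4 Ab y, ∀ a ∈ G.roots.toFinset, ‖y - c‖ < ‖y - a‖ := by
    rw [Filter.eventually_all_finset]
    intro a ha
    apply h.lt hy hyA
    rw [← h.aacl]
    exact mem_acl_iff.2 ⟨G, hG0, hG, isRoot_of_mem_roots (Multiset.mem_toFinset.1 ha)⟩
  filter_upwards [this] with c hc a ha
  exact hc a (Multiset.mem_toFinset.2 ha)

theorem eval_ne {G : W[X]} (hG : PolyIn Ab G) (hG0 : G ≠ 0) : G.eval y ≠ 0 := by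
  intro h0
  apply hyA
  rw [← h.aacl]
  exact mem_acl_iff.2 ⟨G, hG0, hG, h0⟩

theorem eval_lt {G : W[X]} (hG : PolyIn Ab G) (hG0 : G ≠ 0) :
    ∀ᶠ c in L4 Ab y, ‖G.eval y - G.eval c‖ < ‖G.eval y‖ := by
  filter_upwards [h.roots_lt hy hyA hG] with c hc
  exact eval_close_lt hG0 hc

theorem eval_norm {G : W[X]} (hG : PolyIn Ab G) :
    ∀ᶠ c in L4 Ab y, ‖G.eval c‖ = ‖G.eval y‖ := by
  by_cases hG0 : G = 0
  · simp [hG0]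
  filter_upwards [h.eval_lt hy hyA hG hG0] with c hc
  exact um_eq_of_sub_lt hc

/-- unique dominance in the Taylor expansion -/
theorem dom {F : W[X]} (hF : PolyIn Ab F) (hd : F.natDegree ≠ 0) :
    ∃ J, 1 ≤ J ∧ J ≤ F.natDegree ∧ ∀ᶠ c in L4 Ab y, (hasseDeriv J F).eval c ≠ 0 ∧
      (∀ k, 1 ≤ k → k ≠ J → ‖(hasseDeriv k F).eval c‖ * ‖y - c‖ ^ k <
        ‖(hasseDeriv J F).eval c‖ * ‖y - c‖ ^ J) ∧
      ‖F.eval y - F.eval c‖ = ‖(hasseDeriv J F).eval c‖ * ‖y - c‖ ^ J := by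
  classical
  obtain ⟨r, hr0, hr, hrε⟩ := h.exists_r hy hyA
  set d := F.natDegree with hdd
  have htop : hasseDeriv d F = C F.leadingCoeff := by
    ext i
    rw [hasseDeriv_coeff, coeff_C]
    split_ifs with hi
    · subst hi; simp [hdd]
    · rw [coeff_eq_zero_of_natDegree_lt (by omega), mul_zero]
  have hlc : F.leadingCoeff ≠ 0 := by
    rw [leadingCoeff_ne_zero]; rintro rfl; simp [hdd] at hd
  obtain ⟨J, hJ, hJpos, δ, hδ, hdom⟩ := real_dom (Finset.Icc 1 d) (fun k => ‖(hasseDeriv k F).eval y‖)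
    (fun _ _ => norm_nonneg _) ⟨d, by simp; omega, by simp [htop, hlc]⟩ hr0
  rw [Finset.mem_Icc] at hJ
  refine ⟨J, hJ.1, hJ.2, ?_⟩
  have hnorm : ∀ᶠ c in L4 Ab y, ∀ k ∈ Finset.Icc 1 d,
      ‖(hasseDeriv k F).eval c‖ = ‖(hasseDeriv k F).eval y‖ := by
    rw [Filter.eventually_all_finset]
    intro k _
    exact h.eval_norm hy hyA (hF.hasseDeriv k)
  filter_upwards [hnorm, hrε δ hδ, L4_mem Ab y] with c hc hcδ hcA
  have hJn := hc J (by simp [hJ])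
  have hJ0 : 0 < ‖(hasseDeriv J F).eval c‖ := by rw [hJn]; exact hJpos
  have ht := h.pos hy hyA hcA
  have hk : ∀ k, 1 ≤ k → k ≠ J → ‖(hasseDeriv k F).eval c‖ * ‖y - c‖ ^ k <
        ‖(hasseDeriv J F).eval c‖ * ‖y - c‖ ^ J := by
    intro k hk1 hkJ
    by_cases hkd : k ≤ d
    · rw [hc k (by simp [hk1, hkd]), hJn]
      exact hdom _ (hr c hcA) hcδ k (by simp [hk1, hkd]) hkJ
    · rw [hasseDeriv_eq_zero_of_lt_natDegree _ _ (by omega)]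
      simp only [eval_zero, norm_zero, zero_mul]
      positivity
  refine ⟨norm_pos_iff.1 hJ0, hk, ?_⟩
  rw [eval_taylor_sum F c y, add_sub_cancel_left]
  rw [um_sum_eq (j := J) (by simp; omega), norm_mul, norm_pow]
  intro k hk1 hkJ
  rw [Finset.mem_Icc] at hk1
  rw [norm_mul, norm_pow, norm_mul, norm_pow]
  exact hk k hk1.1 hkJ

variable [CompleteSpace W]

theorem approx {e : W} (he : e ∈ Ry Ab y) {ε : ℝ} (hε : 0 < ε) :
    ∃ G, PolyIn Ab G ∧ ‖e - G.eval y‖ < ε := by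
  let V : Subring W :=
    { carrier := {v | ∃ G, PolyIn Ab G ∧ v = G.eval y}
      mul_mem' := by
        rintro _ _ ⟨G, hG, rfl⟩ ⟨G', hG', rfl⟩; exact ⟨G * G', hG.mul hG', by simp⟩
      one_mem' := ⟨1, PolyIn.one Ab, by simp⟩
      add_mem' := by
        rintro _ _ ⟨G, hG, rfl⟩ ⟨G', hG', rfl⟩; exact ⟨G + G', hG.add hG', by simp⟩
      zero_mem' := ⟨0, PolyIn.zero Ab, by simp⟩
      neg_mem' := by
        rintro _ ⟨G, hG, rfl⟩; exact ⟨-G, hG.neg, by simp⟩ }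
  have hAV : (Ab : Set W) ⊆ V := fun a ha => ⟨C a, PolyIn.C ha, by simp⟩
  obtain ⟨E, hE, hE'⟩ := exists_field_closure V (Ab : Set W) hAV (fun m hm => Ab.inv_mem hm) (by
    rintro _ ⟨G, hG, rfl⟩ h0
    haveI := L4_neBot Ab y
    obtain ⟨c, h1, h2⟩ := ((h.eval_lt hy hyA hG (by rintro rfl; simp at h0)).and (L4_mem Ab y)).exists
    exact ⟨_, hG.eval h2, h1⟩)
  have hVE : (V : Set W) ⊆ E := by rw [hE]; exact subset_closure
  have hEc : IsClosed (E : Set W) := by rw [hE]; exact isClosed_closure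
  have hPC : PC E := PC.of_approx h.natTriv hEc (Ab : Set W)
    (by have := PC.acl Ab; rw [h.aacl] at this; exact this) Ab.one_mem (hAV.trans hVE) hE'
  have hle : Ry Ab y ≤ E := Rt_le hEc hPC
    (Set.insert_subset (hVE ⟨X, PolyIn.X Ab, by simp⟩) (hAV.trans hVE))
  have : e ∈ closure (V : Set W) := by rw [← hE]; exact hle he
  obtain ⟨v, ⟨G, hG, rfl⟩, hv⟩ := closure_approx this hε
  exact ⟨G, hG, hv⟩

theorem lin4 {B : Subfield W} (hB : IsClosed (B : Set W)) (hAB : Ab ≤ B) {ρ : ℝ} (hρ0 : 0 < ρ)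
    (hρ : ρ < 1)
    (hT : ∀ᶠ c in L4 Ab y, ∃ T ∈ B, T ∈ Ry Ab y ∧ ‖T - (y - c)‖ ≤ ρ * ‖y - c‖) : Ry Ab y ≤ B := by
  apply lin_contract hB {v | ∃ G, PolyIn Ab G ∧ v = G.eval y} _ hρ0 hρ
  · rintro _ ⟨G, hG, rfl⟩
    haveI := L4_neBot Ab y
    obtain ⟨c, ⟨T, hTB, hTy, hT'⟩, h2, h3⟩ :=
      (hT.and ((h.roots_lt hy hyA hG).and (L4_mem Ab y))).exists
    refine ⟨G.eval (c + T), (hG.mono hAB).eval (B.add_mem (hAB h3) hTB),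
      (hG.mono (le_Ry Ab y)).eval ((Ry Ab y).add_mem (le_Ry Ab y h3) hTy), ?_⟩
    apply eval_close_le G hρ0.le hρ.le
    intro a ha
    have : y - (c + T) = -(T - (y - c)) := by ring
    rw [this, norm_neg]
    exact hT'.trans (mul_le_mul_of_nonneg_left (h2 a ha).le hρ0.le)
  · intro e he ε hε
    obtain ⟨G, hG, hG'⟩ := h.approx hy hyA he hε
    exact ⟨_, ⟨G, hG, rfl⟩, hG'⟩

end Imm
end P7b

section P7c
variable {W : Type*} [NormedField W] [IsUltrametricDist W]

theorem um_pow_taylor {b h : W} (hh : ‖h‖ ≤ ‖b‖) (j : ℕ) :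
    ‖(b + h) ^ j - b ^ j - j * b ^ (j - 1) * h‖ * ‖b‖ ^ 2 ≤ ‖b‖ ^ j * ‖h‖ ^ 2 := by
  induction j with
  | zero => simp
  | succ j ih =>
    have e : (b + h) ^ (j + 1) - b ^ (j + 1) - (j + 1 : ℕ) * b ^ (j + 1 - 1) * h
        = (b + h) * ((b + h) ^ j - b ^ j - j * b ^ (j - 1) * h) + h * (j * b ^ (j - 1)) * h := by
      rcases j with _ | j
      · simp
      · push_cast
        ring
    rw [e, ← norm_pow, ← norm_mul, add_mul]
    apply um_add_le
    · rw [mul_assoc, norm_mul, norm_mul, norm_pow, pow_succ' _ j, mul_assoc ‖b‖]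
      exact mul_le_mul (um_add_le le_rfl hh) ih (by positivity) (by positivity)
    · rcases j with _ | j
      · simp; positivity
      · simp only [Nat.add_sub_cancel, norm_mul, norm_pow]
        have : ‖((j + 1 : ℕ) : W)‖ ≤ 1 := IsUltrametricDist.norm_natCast_le_one W _
        calc ‖h‖ * (‖((j + 1 : ℕ) : W)‖ * ‖b‖ ^ j) * ‖h‖ * ‖b‖ ^ 2
            ≤ ‖h‖ * (1 * ‖b‖ ^ j) * ‖h‖ * ‖b‖ ^ 2 := by gcongr
          _ = _ := by ring

theorem as_nf {p : ℕ} [Fact p.Prime] [CharP W p] {Ab R : Subfield W} [IsAlgClosed W]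
    (hA : acl Ab = Ab) (hle : Ab ≤ R) {y : W} (hy : y ∈ R) {F : W[X]} (hF : PolyIn Ab F) :
    ∃ (I0 : Finset ℕ) (G : ℕ → W[X]), (∀ j ∈ I0, (j : W) ≠ 0) ∧ (∀ j, PolyIn Ab (G j)) ∧
      ∀ c ∈ Ab, ∀ g : ℕ → W, (∀ j ∈ I0, g j ∈ Ab ∧ g j ^ p ^ F.natDegree = (G j).eval c) →
        AE p R (F.eval y) (∑ j ∈ I0, g j * (y - c) ^ j) := by
  classical
  have hpp : p.Prime := Fact.out
  set d := F.natDegree with hd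
  let e : ℕ → ℕ := fun i => i.factorization p
  let o : ℕ → ℕ := fun i => i / p ^ e i
  have hio : ∀ i, p ^ e i * o i = i := fun i => Nat.ordProj_mul_ordCompl_eq_self i p
  refine ⟨(Finset.Icc 1 d).image o,
    fun j => ∑ i ∈ (Finset.Icc 1 d).filter (fun i => o i = j), (hasseDeriv i F) ^ (p ^ (d - e i)),
    ?_, ?_, ?_⟩
  · intro j hj
    obtain ⟨i, hi, rfl⟩ := Finset.mem_image.1 hj
    rw [Finset.mem_Icc] at hi
    rw [Ne, CharP.cast_eq_zero_iff W p]
    exact Nat.not_dvd_ordCompl hpp (by omega)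
  · intro j
    exact PolyIn.sum fun i _ => (hF.hasseDeriv i).pow _
  · intro c hc g hg
    have hu : y - c ∈ R := R.sub_mem hy (hle hc)
    rw [eval_taylor_sum F c y]
    rw [show (∑ j ∈ (Finset.Icc 1 d).image o, g j * (y - c) ^ j) =
      0 + ∑ j ∈ (Finset.Icc 1 d).image o, g j * (y - c) ^ j by rw [zero_add] ]
    apply AE.add (AE.of_closed hA hle (hF.eval hc))
    refine AE.trans (AE.sum _ (g := fun i => ((hasseDeriv i F).eval c * (y - c) ^ i) ^ p ^ (d - e i))
      fun i hi => (AE.frob (R.mul_mem (hle ((hF.hasseDeriv i).eval hc)) (R.pow_mem hu i)) _).symm) ?_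
    have e1 : ∑ i ∈ Finset.Icc 1 d, ((hasseDeriv i F).eval c * (y - c) ^ i) ^ p ^ (d - e i) =
        ∑ j ∈ (Finset.Icc 1 d).image o, (g j * (y - c) ^ j) ^ p ^ d := by
      rw [← Finset.sum_fiberwise_of_maps_to (g := o) (t := (Finset.Icc 1 d).image o)
        fun i hi => Finset.mem_image_of_mem _ hi]
      apply Finset.sum_congr rfl
      intro j hj
      rw [mul_pow, (hg j hj).2, eval_finsetSum, Finset.sum_mul]
      apply Finset.sum_congr rfl
      intro i hi
      obtain ⟨hi, hij⟩ := Finset.mem_filter.1 hi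
      rw [Finset.mem_Icc] at hi
      rw [mul_pow, eval_pow, ← pow_mul, ← pow_mul]
      congr 2
      have hle : e i ≤ d := (Nat.factorization_lt p (by omega)).le.trans hi.2
      rw [← hij]
      calc i * p ^ (d - e i) = (p ^ e i * o i) * p ^ (d - e i) := by rw [hio]
        _ = o i * (p ^ e i * p ^ (d - e i)) := by ring
        _ = _ := by rw [← pow_add, Nat.add_sub_cancel' hle]
    rw [e1]
    exact AE.sum _ fun j hj => AE.frob (R.mul_mem (hle (hg j hj).1) (R.pow_mem hu j)) _

theorem Imm.as4 [IsAlgClosed W] [CompleteSpace W] {p : ℕ} [Fact p.Prime] [CharP W p]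
    {κ Ab Om : Subfield W} (h : Imm κ Ab Om) : ASProp p Ab (fun y => y ∈ Om ∧ y ∉ Ab) := by
  classical
  rintro y ⟨hy, hyA⟩ θ hθ hθp
  have hpp : p.Prime := Fact.out
  set R := Ry Ab y with hR
  have hiso : IsoN R := h.Ry_iso hy hyA
  have hAR : Ab ≤ R := le_Ry Ab y
  have hyR : y ∈ R := mem_Ry Ab y
  have hκR := h.le.trans hAR
  obtain ⟨F, hF, hFlt⟩ := h.approx hy hyA hθp one_pos
  have hFR : F.eval y ∈ R := (hF.mono hAR).eval hyR
  obtain ⟨I0, G, hI0, hG, hnf⟩ := as_nf (p := p) h.aacl hAR hyR hF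
  have key : ∀ θ' q, θ' ^ p - θ' = q → AE p R (F.eval y) q → θ' - θ ∈ R := by
    rintro θ' q hq ⟨z, hz, hzq⟩
    have e : (θ' - θ + z) ^ p - (θ' - θ + z) = -((θ ^ p - θ) - F.eval y) := by
      rw [add_pow_char, sub_pow_char]
      linear_combination hq - hzq
    have : θ' - θ + z ∈ R := as_mem (p := p) h.kacl hκR hiso
      (by rw [e]; exact R.neg_mem (R.sub_mem hθp hFR)) (by rw [e, norm_neg]; exact hFlt)
    simpa using R.sub_mem this hz
  have hroot : ∀ c, ∃ g : W, g ^ p ^ F.natDegree = c := fun c =>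
    IsAlgClosed.exists_pow_nat_eq c (pow_pos hpp.pos _)
  choose rt hrt using hroot
  have hrtA : ∀ c ∈ Ab, rt c ∈ Ab := by
    intro c hc
    have : rt c ∈ acl Ab := pow_mem_acl (pow_pos hpp.pos F.natDegree).ne' (by rw [hrt]; exact le_acl Ab hc)
    rwa [h.aacl] at this
  have hpow : ∀ a b : W, ‖a‖ = ‖b‖ → ‖rt a‖ = ‖rt b‖ := by
    intro a b hab
    refine (pow_left_inj₀ (norm_nonneg _) (norm_nonneg _) (pow_pos hpp.pos F.natDegree).ne').1 ?_
    rw [← norm_pow, ← norm_pow, hrt, hrt, hab]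
  have hnorm : ∀ᶠ c in L4 Ab y, ∀ j ∈ I0, ‖(G j).eval c‖ = ‖(G j).eval y‖ := by
    rw [Filter.eventually_all_finset]
    intro j _
    exact h.eval_norm hy hyA (hG j)
  haveI := L4_neBot Ab y
  by_cases hpos : ∃ j ∈ I0, 0 < ‖rt ((G j).eval y)‖
  swap
  · exfalso
    push Not at hpos
    obtain ⟨c, hc1, hcA⟩ := (hnorm.and (L4_mem Ab y)).exists
    have := hnf c hcA (fun j => rt ((G j).eval c)) fun j hj => ⟨hrtA _ ((hG j).eval hcA), hrt _⟩
    rw [Finset.sum_eq_zero] at this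
    · have h2 := key 0 0 (by rw [zero_pow hpp.ne_zero, sub_zero]) this
      apply hθ
      simpa using R.neg_mem h2
    · intro j hj
      have h3 := hpow _ _ (hc1 j hj)
      have h4 : rt ((G j).eval c) = 0 := norm_le_zero_iff.1 (h3.trans_le (hpos j hj))
      rw [h4, zero_mul]
  obtain ⟨r, hr0, hr, hrε⟩ := h.exists_r hy hyA
  obtain ⟨J, hJ, hJpos, δ, hδ, hdom⟩ := real_dom I0 (fun j => ‖rt ((G j).eval y)‖)
    (fun _ _ => norm_nonneg _) hpos hr0
  obtain ⟨c0, hc0n, hc0δ, hc0A⟩ := (hnorm.and ((hrε δ hδ).and (L4_mem Ab y))).exists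
  obtain ⟨c1, hc1, hc1A⟩ := ((h.lt hy hyA hc0A).and (L4_mem Ab y)).exists
  set g : ℕ → W := fun j => rt ((G j).eval c0) with hg
  have hgA : ∀ j, g j ∈ Ab := fun j => hrtA _ ((hG j).eval hc0A)
  have hgn : ∀ j ∈ I0, ‖g j‖ = ‖rt ((G j).eval y)‖ := fun j hj => hpow _ _ (hc0n j hj)
  set t0 := ‖y - c0‖ with ht0
  have ht0pos : 0 < t0 := h.pos hy hyA hc0A
  have hdom0 : ∀ k ∈ I0, k ≠ J → ‖g k‖ * t0 ^ k < ‖g J‖ * t0 ^ J := by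
    intro k hk hkJ
    rw [hgn k hk, hgn J hJ]
    exact hdom t0 (hr c0 hc0A) hc0δ k hk hkJ
  have hgJ : 0 < ‖g J‖ := by rw [hgn J hJ]; exact hJpos
  have hdom1 : ∀ k ∈ I0, ‖g k‖ * t0 ^ k ≤ ‖g J‖ * t0 ^ J := by
    intro k hk
    by_cases hkJ : k = J
    · rw [hkJ]
    · exact (hdom0 k hk hkJ).le
  have hae := hnf c0 hc0A g fun j hj => ⟨hgA j, hrt _⟩
  set Q : W → W := fun s => ∑ j ∈ I0, g j * (s - c0) ^ j with hQ
  obtain ⟨θ', hθ'⟩ := exists_as_root (p := p) (Q y)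
  have hsub := key θ' _ hθ' hae
  have hQOm : Q y ∈ Om := Om.sum_mem fun j _ =>
    Om.mul_mem (h.lo (hgA j)) (Om.pow_mem (Om.sub_mem hy (h.lo hc0A)) _)
  have hθ'Om : θ' ∈ Om := by rw [← h.oacl]; exact as_root_mem_acl hQOm hθ'
  refine ⟨θ', ⟨hθ'Om, fun hA' => hθ ?_⟩, hsub, ?_⟩
  · have := R.sub_mem (hAR hA') hsub
    simpa using this
  have hQB : Q y ∈ Ry Ab θ' := by
    rw [← hθ']; exact (Ry Ab θ').sub_mem ((Ry Ab θ').pow_mem (mem_Ry Ab θ') _) (mem_Ry Ab θ')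
  have hQR : Q y ∈ R := R.sum_mem fun j _ =>
    R.mul_mem (hAR (hgA j)) (R.pow_mem (R.sub_mem hyR (hAR hc0A)) _)
  have ht1pos : 0 < ‖y - c1‖ := h.pos hy hyA hc1A
  apply h.lin4 hy hyA (Rt_isClosed _) (le_Ry Ab θ') (ρ := ‖y - c1‖ / t0) (by positivity)
    ((div_lt_one ht0pos).2 hc1)
  filter_upwards [L4_le y hc1A, L4_mem Ab y] with c hcc hcA
  have hcpos : 0 < ‖y - c‖ := h.pos hy hyA hcA
  set b := c - c0 with hb
  have hbn : ‖b‖ = t0 := by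
    have : ‖(y - c0) - (c - c0)‖ < ‖y - c0‖ := by
      rw [sub_sub_sub_cancel_right]; exact hcc.trans_lt hc1
    exact um_eq_of_sub_lt this
  have hb0 : b ≠ 0 := by rw [← norm_pos_iff, hbn]; exact ht0pos
  set Q1 := ∑ j ∈ I0, g j * (j * b ^ (j - 1)) with hQ1
  have hQ1A : Q1 ∈ Ab := Ab.sum_mem fun j _ => Ab.mul_mem (hgA j)
    (Ab.mul_mem (natCast_mem Ab j) (Ab.pow_mem (Ab.sub_mem hcA hc0A) _))
  have hQ1b : ‖Q1‖ * t0 = ‖g J‖ * t0 ^ J := by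
    have e1 : Q1 * b = ∑ j ∈ I0, g j * (j * b ^ j) := by
      rw [hQ1, Finset.sum_mul]
      apply Finset.sum_congr rfl
      intro j hj
      have : j ≠ 0 := by rintro rfl; exact hI0 0 hj (by simp)
      obtain ⟨m, rfl⟩ := Nat.exists_eq_succ_of_ne_zero this
      simp only [Nat.succ_eq_add_one, Nat.add_sub_cancel]; ring
    have hn : ∀ j ∈ I0, ‖g j * (j * b ^ j)‖ = ‖g j‖ * t0 ^ j := by
      intro j hj
      rw [norm_mul, norm_mul, norm_pow, hbn, h.natTriv j (hI0 j hj), one_mul]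
    rw [← hbn, ← norm_mul, e1, um_sum_eq hJ, hn J hJ, hbn]
    intro i hi hiJ
    rw [hn i hi, hn J hJ]; exact hdom0 i hi hiJ
  have hQ1pos : 0 < ‖Q1‖ := by
    have : 0 < ‖Q1‖ * t0 := by rw [hQ1b]; positivity
    exact pos_of_mul_pos_left this ht0pos.le
  have hQ10 : Q1 ≠ 0 := norm_pos_iff.1 hQ1pos
  have hQcA : Q c ∈ Ab := Ab.sum_mem fun j _ =>
    Ab.mul_mem (hgA j) (Ab.pow_mem (Ab.sub_mem hcA hc0A) _)
  refine ⟨(Q y - Q c) / Q1, ?_, ?_, ?_⟩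
  · exact (Ry Ab θ').div_mem ((Ry Ab θ').sub_mem hQB (le_Ry Ab θ' hQcA)) (le_Ry Ab θ' hQ1A)
  · exact R.div_mem (R.sub_mem hQR (hAR hQcA)) (hAR hQ1A)
  · have e2 : (Q y - Q c) / Q1 - (y - c) =
        (∑ j ∈ I0, g j * ((b + (y - c)) ^ j - b ^ j - j * b ^ (j - 1) * (y - c))) / Q1 := by
      rw [div_sub' hQ10]
      congr 1
      rw [hQ, hQ1, Finset.sum_mul, ← Finset.sum_sub_distrib, ← Finset.sum_sub_distrib]
      apply Finset.sum_congr rfl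
      intro j _
      rw [show b + (y - c) = y - c0 by rw [hb]; ring]
      ring
    rw [e2, norm_div, div_le_iff₀ hQ1pos]
    apply um_sum_le (by positivity)
    intro j hj
    rw [norm_mul]
    have h5 := um_pow_taylor (b := b) (h := y - c) (by rw [hbn]; exact (hcc.trans_lt hc1).le) j
    rw [hbn] at h5
    have h6 : ‖g j‖ * ‖(b + (y - c)) ^ j - b ^ j - j * b ^ (j - 1) * (y - c)‖ * t0 ^ 2 ≤
        (‖Q1‖ * t0) * ‖y - c‖ ^ 2 := by
      rw [hQ1b]
      calc _ = ‖g j‖ * (‖(b + (y - c)) ^ j - b ^ j - j * b ^ (j - 1) * (y - c)‖ * t0 ^ 2) := by ring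
        _ ≤ ‖g j‖ * (t0 ^ j * ‖y - c‖ ^ 2) := by gcongr
        _ = (‖g j‖ * t0 ^ j) * ‖y - c‖ ^ 2 := by ring
        _ ≤ _ := mul_le_mul_of_nonneg_right (hdom1 j hj) (by positivity)
    have h7 : ‖g j‖ * ‖(b + (y - c)) ^ j - b ^ j - j * b ^ (j - 1) * (y - c)‖ ≤
        (‖Q1‖ * t0) * ‖y - c‖ ^ 2 / t0 ^ 2 := by
      rw [le_div_iff₀ (by positivity)]; exact h6
    refine h7.trans ?_
    rw [div_le_iff₀ (by positivity)]
    have e3 : ‖y - c1‖ / t0 * ‖y - c‖ * ‖Q1‖ * t0 ^ 2 = (‖Q1‖ * t0) * (‖y - c1‖ * ‖y - c‖) := by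
      field_simp
    rw [e3, pow_two]
    gcongr

end P7c

section P7d
variable {W : Type*} [NormedField W] [IsUltrametricDist W]

theorem exists_sigma [IsAlgClosed W] {M : Subfield W} {α a : W} (hα : α ∈ acl M)
    (ha : (mpW M α).eval a = 0) :
    ∃ σ : acl M →+* W, (∀ m : W, ∀ hm : m ∈ M, σ ⟨m, le_acl M hm⟩ = m) ∧ σ ⟨α, hα⟩ = a := by
  have ha' : a ∈ acl M := root_mpW_mem_acl hα ha
  have heq := mpW_eq_of_root hα ha
  have heq' : minpoly M a = minpoly M α := by
    unfold mpW at heq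
    exact map_injective _ (algebraMap M W).injective heq
  let L := algebraicClosure M W
  let x : L := ⟨α, hα⟩
  let y : L := ⟨a, ha'⟩
  have hc : IsConjRoot M y x := by
    unfold IsConjRoot
    rw [← minpoly.algebraMap_eq (algebraMap L W).injective x,
      ← minpoly.algebraMap_eq (algebraMap L W).injective y]
    exact heq'
  haveI : Normal M L := IsAlgClosure.normal M L
  obtain ⟨σ, hσ⟩ := isConjRoot_iff_exists_algEquiv.1 hc
  refine ⟨(algebraMap L W).comp (σ : L →+* L), ?_, ?_⟩
  · intro m hm
    have := σ.commutes (⟨m, hm⟩ : M)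
    exact congrArg (algebraMap L W) this
  · exact congrArg (algebraMap L W) hσ

section sigma
variable {M : Subfield W} (σ : acl M →+* W) (hσ : ∀ m : W, ∀ hm : m ∈ M, σ ⟨m, le_acl M hm⟩ = m)
include hσ

theorem sigma_eval {g : W[X]} (hg : PolyIn M g) (z : acl M) : σ ⟨g.eval (z : W),
    (hg.mono (le_acl M)).eval z.2⟩ = g.eval (σ z) := by
  have h1 : (⟨g.eval (z : W), (hg.mono (le_acl M)).eval z.2⟩ : acl M) =
      ∑ i ∈ Finset.range (g.natDegree + 1), ⟨g.coeff i, le_acl M (hg i)⟩ * z ^ i := by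
    apply Subtype.ext
    simp [eval_eq_sum_range]
  rw [h1, map_sum, eval_eq_sum_range]
  apply Finset.sum_congr rfl
  intro i _
  rw [map_mul, map_pow, hσ _ (hg i)]

theorem sigma_root (z : acl M) : (mpW M (z : W)).eval (σ z) = 0 := by
  rw [← sigma_eval σ hσ (mpW_polyIn M _) z]
  have : (⟨(mpW M (z : W)).eval (z : W), ((mpW_polyIn M (z : W)).mono (le_acl M)).eval z.2⟩ : acl M) = 0 :=
    Subtype.ext (mpW_eval M _)
  rw [this, map_zero]

theorem sigma_norm (hi : IsoN M) (z : acl M) : ‖σ z‖ = ‖(z : W)‖ :=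
  hi z z.2 _ (sigma_root σ hσ z)

theorem sigma_acl {A : Subfield W} (hAM : A ≤ M) (z : acl M) (hz : (z : W) ∈ acl A) : σ z ∈ acl A := by
  obtain ⟨g, h0, hg, he⟩ := mem_acl_iff.1 hz
  refine mem_acl_iff.2 ⟨g, h0, hg, ?_⟩
  rw [← sigma_eval σ hσ (hg.mono hAM) z]
  have : (⟨g.eval (z : W), ((hg.mono hAM).mono (le_acl M)).eval z.2⟩ : acl M) = 0 := Subtype.ext he
  rw [this, map_zero]

theorem sigma_Rt [IsAlgClosed W] [CompleteSpace W] (hN : NatTriv W) (hi : IsoN M) {B B' : Set W}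
    (hB : ∀ b ∈ B, ∃ hb : b ∈ acl M, σ ⟨b, hb⟩ ∈ Rt B') (z : acl M) (hz : (z : W) ∈ Rt B) :
    σ z ∈ Rt B' := by
  let E0 : Subfield W := ((Rt B').comap σ).map (acl M).subtype
  have hE0 : ∀ e, e ∈ E0 ↔ ∃ he : e ∈ acl M, σ ⟨e, he⟩ ∈ Rt B' := by
    intro e
    simp only [E0, Subfield.mem_map, Subfield.mem_comap]
    constructor
    · rintro ⟨x, hx, rfl⟩; exact ⟨x.2, hx⟩
    · rintro ⟨he, h⟩; exact ⟨⟨e, he⟩, h, rfl⟩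
  have hPC : PC E0 := by
    intro w n hn hw
    obtain ⟨hw1, hw2⟩ := (hE0 _).1 hw
    have hwM := PC.acl M w n hn hw1
    refine (hE0 _).2 ⟨hwM, Rt_PC _ _ n hn ?_⟩
    rw [← map_pow]; exact hw2
  have hle : Rt B ≤ E0.topologicalClosure := Rt_le (Subfield.isClosed_topologicalClosure _)
    (hPC.topologicalClosure hN) fun b hb => E0.le_topologicalClosure ((hE0 b).2 (hB b hb))
  have hcl : σ z ∈ closure (Rt B' : Set W) := by
    apply mem_closure_of_approx
    intro ε hε
    obtain ⟨v, hv, hv'⟩ := closure_approx (s := (E0 : Set W)) (hle hz) hε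
    obtain ⟨hvM, hvR⟩ := (hE0 v).1 hv
    refine ⟨_, hvR, ?_⟩
    rw [← map_sub, sigma_norm σ hσ hi]
    exact hv'
  rwa [(Rt_isClosed B').closure_eq] at hcl

end sigma

/-- conjugates of the coordinate generate the same field -/
theorem conj_stable [IsAlgClosed W] [CompleteSpace W] {M A : Subfield W} (hN : NatTriv W) (hi : IsoN M)
    (hAM : A ≤ M) {T : Set W} (hT : T ⊆ M) {y α a : W} (hα : α ∈ acl M) (ha : (mpW M α).eval a = 0)
    {q : W[X]} (hq : PolyIn M q) (hy : y = q.eval α)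
    (hyT : y ∈ Rt (acl A ∪ T : Set W)) (hTy : T ⊆ Ry (acl A) y) :
    q.eval a ∈ Ry (acl A) y ∧ y ∈ Ry (acl A) (q.eval a) := by
  obtain ⟨σ, hσ, hσα⟩ := exists_sigma hα ha
  have hyM : y ∈ acl M := by rw [hy]; exact (hq.mono (le_acl M)).eval hα
  have hσy : σ ⟨y, hyM⟩ = q.eval a := by
    have := sigma_eval σ hσ hq ⟨α, hα⟩
    rw [hσα] at this
    rw [← this]
    congr 1
    exact Subtype.ext hy
  have hAA : ∀ b ∈ acl A, ∃ hb : b ∈ acl M, σ ⟨b, hb⟩ ∈ acl A := fun b hb =>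
    ⟨acl_mono hAM hb, sigma_acl σ hσ hAM _ hb⟩
  constructor
  · rw [← hσy]
    refine sigma_Rt σ hσ hN hi (B := (acl A ∪ T : Set W)) ?_ ⟨y, hyM⟩ hyT
    rintro b (hb | hb)
    · obtain ⟨h1, h2⟩ := hAA b hb
      exact ⟨h1, le_Ry _ _ h2⟩
    · refine ⟨le_acl M (hT hb), ?_⟩
      rw [hσ b (hT hb)]; exact hTy hb
  · have key : T ⊆ Ry (acl A) (q.eval a) := by
      intro t ht
      have := sigma_Rt σ hσ hN hi (B := insert y (acl A : Set W))
        (B' := insert (q.eval a) (acl A : Set W)) (by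
        rintro b (rfl | hb)
        · exact ⟨hyM, by rw [hσy]; exact mem_Ry _ _⟩
        · obtain ⟨h1, h2⟩ := hAA b hb
          exact ⟨h1, le_Ry _ _ h2⟩) ⟨t, le_acl M (hT ht)⟩ (hTy ht)
      rw [hσ t (hT ht)] at this
      exact this
    exact Rt_le_Rt (Set.union_subset (le_Ry (acl A) (q.eval a)) key) hyT

end P7d

section P7e
variable {W : Type*} [NormedField W] [IsUltrametricDist W]

theorem eval_mem_of_natDegree_zero {Ab : Subfield W} {F : W[X]} (hF : PolyIn Ab F)
    (hd : F.natDegree = 0) (y : W) : F.eval y ∈ Ab := by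
  rw [eq_C_of_natDegree_eq_zero hd, eval_C]; exact hF 0

theorem taylor2_le (F : W[X]) (c y : W) {B : ℝ} (hB : 0 ≤ B)
    (hk : ∀ k, 1 ≤ k → k ≠ 1 → ‖(hasseDeriv k F).eval c‖ * ‖y - c‖ ^ k ≤ B) :
    ‖F.eval y - F.eval c - (hasseDeriv 1 F).eval c * (y - c)‖ ≤ B := by
  classical
  by_cases hd : F.natDegree = 0
  · rw [eq_C_of_natDegree_eq_zero hd, hasseDeriv_C _ _ one_pos]; simpa using hB
  rw [eval_taylor_sum F c y, add_sub_cancel_left,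
    ← Finset.add_sum_erase _ _ (show 1 ∈ Finset.Icc 1 F.natDegree by simp; omega), pow_one,
    add_sub_cancel_left]
  apply um_sum_le hB
  intro k hk'
  rw [Finset.mem_erase, Finset.mem_Icc] at hk'
  rw [norm_mul, norm_pow]
  exact hk k hk'.2.1 hk'.1

namespace Imm
variable {κ Ab Om : Subfield W} (h : Imm κ Ab Om) {y : W} (hy : y ∈ Om) (hyA : y ∉ Ab)
include h hy hyA
variable [IsAlgClosed W] [CompleteSpace W]

theorem notMem_of {z : W} (hz : y ∈ Ry Ab z) : z ∉ Ab := by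
  intro hzA
  have hPC : PC Ab := by have := PC.acl Ab; rwa [h.aacl] at this
  have hle : Ry Ab z ≤ Ab.topologicalClosure := Rt_le (Subfield.isClosed_topologicalClosure _)
    (hPC.topologicalClosure h.natTriv)
    ((Set.insert_subset hzA subset_rfl).trans Ab.le_topologicalClosure)
  obtain ⟨r, hr, hr'⟩ := h.far y hy hyA
  obtain ⟨c, hc, hlt⟩ := closure_approx (s := (Ab : Set W)) (hle hz) hr
  exact absurd (hr' c hc) (not_le.2 hlt)

theorem tendsto_poly {F : W[X]} (hF : PolyIn Ab F) (hFy : F.eval y ∉ Ab) {c' : W} (hc' : c' ∈ Ab) :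
    ∀ᶠ c in L4 Ab y, ‖F.eval y - F.eval c‖ ≤ ‖F.eval y - c'‖ := by
  have hd : F.natDegree ≠ 0 := fun h0 => hFy (eval_mem_of_natDegree_zero hF h0 y)
  obtain ⟨J, hJ1, hJd, hJ⟩ := h.dom hy hyA hF hd
  have hev : ∀ᶠ c in L4 Ab y, ‖F.eval y - F.eval c‖ = ‖(hasseDeriv J F).eval y‖ * ‖y - c‖ ^ J := by
    filter_upwards [hJ, h.eval_norm hy hyA (hF.hasseDeriv J)] with c h1 h2
    rw [h1.2.2, h2]
  obtain ⟨c0, hc0, hc0'⟩ := L4_eventually.1 hev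
  have hne : F - C c' ≠ 0 := by
    intro h0
    apply hd
    rw [sub_eq_zero.1 h0]; simp
  by_cases hroot : ∃ a ∈ (F - C c').roots, ‖y - a‖ ≤ ‖y - c0‖
  · obtain ⟨a, ha, hac⟩ := hroot
    have haA : a ∈ Ab := by
      rw [← h.aacl]
      exact mem_acl_iff.2 ⟨_, hne, hF.sub (PolyIn.C hc'), isRoot_of_mem_roots ha⟩
    have hFa : F.eval a = c' := by
      have := isRoot_of_mem_roots ha
      simpa [IsRoot, sub_eq_zero] using this
    filter_upwards [L4_le y haA, L4_le y hc0, L4_mem Ab y] with c h1 h2 h3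
    rw [hc0' c h3 h2, ← hFa, hc0' a haA hac]
    gcongr
  · push Not at hroot
    filter_upwards [L4_le y hc0] with c h1
    have := eval_close_lt hne (s := y) (c := c) fun a ha => h1.trans_lt (hroot a ha)
    simp only [eval_sub, eval_C] at this
    rw [sub_sub_sub_cancel_right] at this
    exact this.le

theorem deg_one {F G : W[X]} (hF : PolyIn Ab F) (hG : PolyIn Ab G) (hFy : F.eval y ∈ Om)
    (hFyA : F.eval y ∉ Ab)
    (hGF : ∀ c ∈ Ab, ‖y - G.eval (F.eval y)‖ < ‖y - c‖) :
    ∀ᶠ c in L4 Ab y, (hasseDeriv 1 F).eval c ≠ 0 ∧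
      (∀ k, 1 ≤ k → k ≠ 1 → ‖(hasseDeriv k F).eval c‖ * ‖y - c‖ ^ k <
        ‖(hasseDeriv 1 F).eval c‖ * ‖y - c‖ ^ 1) ∧
      ‖F.eval y - F.eval c‖ = ‖(hasseDeriv 1 F).eval c‖ * ‖y - c‖ ^ 1 := by
  have hd : F.natDegree ≠ 0 := fun h0 => hFyA (eval_mem_of_natDegree_zero hF h0 y)
  have hdG : G.natDegree ≠ 0 := fun h0 =>
    lt_irrefl _ (hGF _ (eval_mem_of_natDegree_zero hG h0 (F.eval y)))
  obtain ⟨J, hJ1, hJd, hJ⟩ := h.dom hy hyA hF hd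
  suffices J = 1 by rw [this] at hJ; exact hJ
  obtain ⟨J', hJ1', hJd', hJ'⟩ := h.dom hFy hFyA hG hdG
  have hJ'' : ∀ᶠ c' in L4 Ab (F.eval y), ‖G.eval (F.eval y) - G.eval c'‖ =
      ‖(hasseDeriv J' G).eval (F.eval y)‖ * ‖F.eval y - c'‖ ^ J' := by
    filter_upwards [hJ', h.eval_norm hFy hFyA (hG.hasseDeriv J')] with c h1 h2
    rw [h1.2.2, h2]
  obtain ⟨c0, hc0, hc0'⟩ := L4_eventually.1 hJ''
  set μ := ‖(hasseDeriv J' G).eval (F.eval y)‖ * ‖(hasseDeriv J F).eval y‖ ^ J' with hμ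
  have hE : PolyIn Ab (G.comp F - X) := (hG.comp hF).sub (PolyIn.X Ab)
  have key : ∀ᶠ c in L4 Ab y, μ * ‖y - c‖ ^ (J * J') = ‖y - c‖ := by
    filter_upwards [hJ, h.eval_norm hy hyA (hF.hasseDeriv J), h.tendsto_poly hy hyA hF hFyA hc0,
      L4_mem Ab y, h.eval_norm hy hyA hE] with c h1 h2 h3 h4 h5
    have e1 := hc0' _ (hF.eval h4) h3
    rw [h1.2.2, h2] at e1
    have e2 : μ * ‖y - c‖ ^ (J * J') = ‖G.eval (F.eval y) - G.eval (F.eval c)‖ := by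
      rw [e1, hμ, mul_pow, pow_mul]; ring
    rw [e2]
    simp only [eval_sub, eval_comp, eval_X] at h5
    have h6 := hGF c h4
    rw [norm_sub_rev] at h6
    have h7 : ‖(G.eval (F.eval y) - y) - (G.eval (F.eval c) - c)‖ < ‖y - c‖ :=
      um_sub_lt h6 (by rw [h5]; exact h6)
    have : G.eval (F.eval y) - G.eval (F.eval c) =
      (y - c) + ((G.eval (F.eval y) - y) - (G.eval (F.eval c) - c)) := by ring
    rw [this, um_add_eq h7]
  haveI := L4_neBot Ab y
  obtain ⟨c1, k1, m1⟩ := (key.and (L4_mem Ab y)).exists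
  obtain ⟨c2, k2, m2, l2⟩ := (key.and ((L4_mem Ab y).and (h.lt hy hyA m1))).exists
  have p1 := h.pos hy hyA m1
  have p2 := h.pos hy hyA m2
  obtain ⟨m, hm⟩ : ∃ m, J * J' = m + 1 := ⟨J * J' - 1, by
    have : 0 < J * J' := by positivity
    omega⟩
  rw [hm] at k1 k2
  have q1 : μ * ‖y - c1‖ ^ m = 1 := by
    apply mul_right_cancel₀ p1.ne'
    rw [one_mul]; rw [pow_succ, ← mul_assoc] at k1; exact k1
  have q2 : μ * ‖y - c2‖ ^ m = 1 := by
    apply mul_right_cancel₀ p2.ne'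
    rw [one_mul]; rw [pow_succ, ← mul_assoc] at k2; exact k2
  have hμ0 : μ ≠ 0 := by intro h0; rw [h0] at q1; simp at q1
  have q3 : ‖y - c1‖ ^ m = ‖y - c2‖ ^ m := mul_left_cancel₀ hμ0 (q1.trans q2.symm)
  have hm0 : m = 0 := by
    by_contra hm0
    exact (pow_lt_pow_left₀ l2 p2.le hm0).ne q3.symm
  rw [hm0] at hm
  exact Nat.eq_one_of_mul_eq_one_right hm

theorem desc {I : Finset W} (hI : I.Nonempty) {ys : W → W} (hys : ∀ i ∈ I, ys i ∈ Om)
    (h1 : ∀ i ∈ I, ys i ∈ Ry Ab y) (h2 : ∀ i ∈ I, y ∈ Ry Ab (ys i)) {n : ℕ} {b v : W → ℕ → W}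
    (hb : ∀ i ∈ I, ∀ j, b i j ∈ κ) (hv : ∀ i ∈ I, ∀ j, ‖v i j‖ ≤ 1)
    (hinv : ∀ f : W → W, ∀ i ∈ I, f i = ∑ j ∈ Finset.range n, v i j * ∑ i' ∈ I, f i' * b i' j) :
    ∃ j, (∑ i ∈ I, ys i * b i j) ∉ Ab ∧ Ry Ab y ≤ Ry Ab (∑ i ∈ I, ys i * b i j) := by
  classical
  have hb1 : ∀ i ∈ I, ∀ j, ‖b i j‖ ≤ 1 := fun i hi j => h.triv.le (hb i hi j)
  have hbA : ∀ i ∈ I, ∀ j, b i j ∈ Ab := fun i hi j => h.le (hb i hi j)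
  have hysA : ∀ i ∈ I, ys i ∉ Ab := fun i hi => h.notMem_of hy hyA (h2 i hi)
  obtain ⟨r, hr0, hr, -⟩ := h.exists_r hy hyA
  have hF : ∀ i ∈ I, ∃ F, PolyIn Ab F ∧ ∀ᶠ c in L4 Ab y,
      (hasseDeriv 1 F).eval c ≠ 0 ∧
      (∀ k, 1 ≤ k → k ≠ 1 → ‖(hasseDeriv k F).eval c‖ * ‖y - c‖ ^ k <
        ‖(hasseDeriv 1 F).eval c‖ * ‖y - c‖) ∧
      ‖ys i - F.eval y‖ ≤ 1 / 2 * (‖(hasseDeriv 1 F).eval c‖ * ‖y - c‖) := by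
    intro i hi
    obtain ⟨ri, hri0, hri, -⟩ := h.exists_r (hys i hi) (hysA i hi)
    obtain ⟨G, hG, hGy⟩ := h.approx (hys i hi) (hysA i hi) (h2 i hi) hr0
    obtain ⟨δ, hδ, hδ'⟩ := Metric.continuousAt_iff.1 (G.continuous.continuousAt (x := ys i)) r hr0
    obtain ⟨F, hF, hFy⟩ := h.approx hy hyA (h1 i hi) (lt_min hδ (half_pos hri0))
    have hFy1 : ‖ys i - F.eval y‖ < δ := hFy.trans_le (min_le_left _ _)
    have hFy2 : ‖ys i - F.eval y‖ < ri / 2 := hFy.trans_le (min_le_right _ _)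
    have hFA : F.eval y ∉ Ab := fun hc => by linarith [hri _ hc]
    have hG' : ‖y - G.eval (F.eval y)‖ < r := by
      apply um_tri_lt hGy
      rw [← dist_eq_norm, dist_comm]
      apply hδ'
      rw [dist_comm, dist_eq_norm]; exact hFy1
    refine ⟨F, hF, ?_⟩
    filter_upwards [h.deg_one hy hyA hF hG ((hF.mono h.lo).eval hy) hFA
      (fun c hc => hG'.trans (hr c hc)), L4_mem Ab y] with c hc hcA
    simp only [pow_one] at hc
    refine ⟨hc.1, hc.2.1, ?_⟩
    rw [← hc.2.2]
    have e1 := hri _ (hF.eval hcA)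
    have e2 : ‖F.eval y - F.eval c‖ = ‖ys i - F.eval c‖ := by
      apply um_eq_of_sub_lt
      rw [sub_sub_sub_cancel_right]
      linarith
    rw [e2]; linarith
  choose! F hFA hFev using hF
  set f : W → W := fun i => (hasseDeriv 1 (F i)).eval y with hf
  have hDev : ∀ᶠ c in L4 Ab y, ∀ i ∈ I, ∀ k, ‖(hasseDeriv k (F i)).eval c‖ =
      ‖(hasseDeriv k (F i)).eval y‖ := by
    rw [Filter.eventually_all_finset]
    intro i hi
    have : ∀ᶠ c in L4 Ab y, ∀ k ∈ Finset.range ((F i).natDegree + 1),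
      ‖(hasseDeriv k (F i)).eval c‖ = ‖(hasseDeriv k (F i)).eval y‖ := by
      rw [Filter.eventually_all_finset]
      exact fun k _ => h.eval_norm hy hyA ((hFA i hi).hasseDeriv k)
    filter_upwards [this] with c hc k
    by_cases hk : k ≤ (F i).natDegree
    · exact hc k (by simp; omega)
    · rw [hasseDeriv_eq_zero_of_lt_natDegree _ _ (by omega)]; simp
  have hFev' : ∀ᶠ c in L4 Ab y, ∀ i ∈ I, f i ≠ 0 ∧
      (∀ k, 1 ≤ k → k ≠ 1 → ‖(hasseDeriv k (F i)).eval y‖ * ‖y - c‖ ^ k < ‖f i‖ * ‖y - c‖) ∧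
      ‖ys i - (F i).eval y‖ ≤ 1 / 2 * (‖f i‖ * ‖y - c‖) := by
    have : ∀ᶠ c in L4 Ab y, ∀ i ∈ I, _ := (Filter.eventually_all_finset I).2 hFev
    filter_upwards [this, hDev] with c hc hc' i hi
    obtain ⟨a1, a2, a3⟩ := hc i hi
    have hn := hc' i hi
    rw [hn 1] at a2 a3
    refine ⟨?_, ?_, a3⟩
    · rw [← norm_ne_zero_iff, hf]; simp only; rw [← hn 1, norm_ne_zero_iff]; exact a1
    · intro k k1 k2
      rw [← hn k]; exact a2 k k1 k2
  obtain ⟨i0, hi0, hmax⟩ := Finset.exists_max_image I (fun i => ‖f i‖) hI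
  set Λ := ‖f i0‖ with hΛ
  haveI := L4_neBot Ab y
  obtain ⟨c1, hc1, hc1A⟩ := (hFev'.and (L4_mem Ab y)).exists
  have hΛ0 : 0 < Λ := norm_pos_iff.2 (hc1 i0 hi0).1
  have ht1 := h.pos hy hyA hc1A
  obtain ⟨c2, hc2, hc2A⟩ := ((h.lt hy hyA hc1A).and (L4_mem Ab y)).exists
  have ht2 := h.pos hy hyA hc2A
  obtain ⟨j, hj⟩ : ∃ j, Λ ≤ ‖∑ i ∈ I, f i * b i j‖ := by
    by_contra! hc
    have := hinv f i0 hi0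
    have hlt : ‖f i0‖ < Λ := by
      rw [this]
      apply um_sum_lt hΛ0
      intro j _
      rw [norm_mul]
      calc _ ≤ 1 * ‖∑ i' ∈ I, f i' * b i' j‖ := by gcongr; exact hv i0 hi0 j
        _ < Λ := by rw [one_mul]; exact hc j
    exact lt_irrefl _ hlt
  set z := ∑ i ∈ I, ys i * b i j with hz
  set P : W[X] := ∑ i ∈ I, C (b i j) * F i with hP
  have hPA : PolyIn Ab P := PolyIn.sum fun i hi => (PolyIn.C (hbA i hi j)).mul (hFA i hi)
  have hPe : ∀ w, P.eval w = ∑ i ∈ I, b i j * (F i).eval w := by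
    intro w; rw [hP, eval_finsetSum]; simp
  have hPd : ∀ w, (hasseDeriv 1 P).eval w = ∑ i ∈ I, b i j * (hasseDeriv 1 (F i)).eval w := by
    intro w; rw [hP, map_sum, eval_finsetSum]
    apply Finset.sum_congr rfl
    intro i _
    rw [← smul_eq_C_mul, map_smul, eval_smul, smul_eq_mul]
  have hzR : z ∈ Ry Ab y := (Ry Ab y).sum_mem fun i hi =>
    (Ry Ab y).mul_mem (h1 i hi) (le_Ry Ab y (hbA i hi j))
  have hΛ' : Λ ≤ ‖(hasseDeriv 1 P).eval y‖ := by
    rw [hPd]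
    convert hj using 3
    ring
  set ρ : ℝ := max (1 / 2) (‖y - c2‖ / ‖y - c1‖) with hρ
  have hρ0 : 0 < ρ := lt_of_lt_of_le (by norm_num) (le_max_left _ _)
  have hρ1 : ρ < 1 := max_lt (by norm_num) ((div_lt_one ht1).2 hc2)
  have hle : Ry Ab y ≤ Ry Ab z := by
    apply h.lin4 hy hyA (Rt_isClosed _) (le_Ry Ab z) hρ0 hρ1
    filter_upwards [hDev, hFev', L4_mem Ab y, L4_le y hc2A, h.eval_norm hy hyA (hPA.hasseDeriv 1)]
      with c a1 a2 a3 a4 a5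
    have ht := h.pos hy hyA a3
    have hQ0 : 0 < ‖(hasseDeriv 1 P).eval c‖ := by rw [a5]; exact hΛ0.trans_le hΛ'
    have hQ1 : (hasseDeriv 1 P).eval c ≠ 0 := norm_pos_iff.1 hQ0
    refine ⟨(z - P.eval c) / (hasseDeriv 1 P).eval c, ?_, ?_, ?_⟩
    · exact (Ry Ab z).div_mem ((Ry Ab z).sub_mem (mem_Ry Ab z) (le_Ry Ab z (hPA.eval a3)))
        (le_Ry Ab z ((hPA.hasseDeriv 1).eval a3))
    · exact (Ry Ab y).div_mem ((Ry Ab y).sub_mem hzR (le_Ry Ab y (hPA.eval a3)))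
        (le_Ry Ab y ((hPA.hasseDeriv 1).eval a3))
    have e1 : (z - P.eval c) / (hasseDeriv 1 P).eval c - (y - c) =
        (z - P.eval c - (hasseDeriv 1 P).eval c * (y - c)) / (hasseDeriv 1 P).eval c := by
      field_simp
    rw [e1, norm_div, div_le_iff₀ hQ0]
    have e2 : z - P.eval c - (hasseDeriv 1 P).eval c * (y - c) = ∑ i ∈ I, b i j *
        ((ys i - (F i).eval y) +
          ((F i).eval y - (F i).eval c - (hasseDeriv 1 (F i)).eval c * (y - c))) := by
      rw [hPe, hPd, hz, Finset.sum_mul, ← Finset.sum_sub_distrib, ← Finset.sum_sub_distrib]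
      apply Finset.sum_congr rfl; intro i _; ring
    have e3 : ρ * ‖y - c‖ * Λ ≤ ρ * ‖y - c‖ * ‖(hasseDeriv 1 P).eval c‖ := by
      rw [a5]; gcongr
    refine le_trans ?_ e3
    rw [e2]
    have hB0 : 0 ≤ ρ * ‖y - c‖ * Λ := by positivity
    apply um_sum_le hB0
    intro i hi
    rw [norm_mul]
    refine (mul_le_of_le_one_left (norm_nonneg _) (hb1 i hi j)).trans ?_
    apply um_add_le
    · refine (a2 i hi).2.2.trans ?_
      have := hmax i hi
      have h12 : 1 / 2 ≤ ρ := le_max_left _ _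
      calc 1 / 2 * (‖f i‖ * ‖y - c‖) ≤ ρ * (Λ * ‖y - c‖) := by gcongr
        _ = _ := by ring
    · apply taylor2_le _ _ _ hB0
      intro k k1 k2
      rw [a1 i hi k]
      have b1 := ((hc1 i hi).2.1 k k1 k2).le
      have hs1 : ‖y - c‖ / ‖y - c1‖ ≤ ‖y - c2‖ / ‖y - c1‖ := by gcongr
      have hs2 : ‖y - c2‖ / ‖y - c1‖ ≤ ρ := le_max_right _ _
      set s := ‖y - c‖ / ‖y - c1‖ with hs
      have hs0 : 0 ≤ s := by positivity
      have hss : ‖y - c‖ = s * ‖y - c1‖ := by rw [hs]; field_simp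
      have hs3 : s ^ k ≤ ρ * s := by
        obtain ⟨m, rfl⟩ : ∃ m, k = m + 2 := ⟨k - 2, by omega⟩
        calc s ^ (m + 2) = s ^ m * (s * s) := by ring
          _ ≤ 1 * (ρ * s) := by
            gcongr
            · exact pow_le_one₀ hs0 (by linarith)
            · linarith
          _ = _ := one_mul _
      calc ‖(hasseDeriv k (F i)).eval y‖ * ‖y - c‖ ^ k
          = s ^ k * (‖(hasseDeriv k (F i)).eval y‖ * ‖y - c1‖ ^ k) := by rw [hss, mul_pow]; ring
        _ ≤ (ρ * s) * (Λ * ‖y - c1‖) := by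
            refine mul_le_mul hs3 (b1.trans ?_) (by positivity) (by positivity)
            gcongr
            exact hmax i hi
        _ = _ := by rw [hss]; ring
  exact ⟨j, h.notMem_of hy hyA (hle (mem_Ry Ab y)), hle⟩

end Imm
end P7e

section P7f
variable {W : Type*} [NormedField W] [IsUltrametricDist W]

/-- sums of elements with distinct norms -/
theorem exists_rep (Mo : Set W) (hcol : ∀ w ∈ Mo, ∀ w' ∈ Mo, w ≠ 0 → w' ≠ 0 → ‖w‖ = ‖w'‖ → w + w' ∈ Mo)
    {v : W} (hv : v ∈ AddSubmonoid.closure Mo) :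
    ∃ s : Finset W, (∀ w ∈ s, w ∈ Mo ∧ w ≠ 0) ∧ Set.InjOn (fun w : W => ‖w‖) (s : Set W) ∧ v = ∑ w ∈ s, w := by
  classical
  have step : ∀ n : ℕ, ∀ s : Finset W, s.card = n → (∀ w ∈ s, w ∈ Mo ∧ w ≠ 0) →
      Set.InjOn (fun w : W => ‖w‖) (s : Set W) → ∀ w ∈ Mo, ∃ s' : Finset W, (∀ w ∈ s', w ∈ Mo ∧ w ≠ 0) ∧
      Set.InjOn (fun w : W => ‖w‖) (s' : Set W) ∧ w + ∑ w ∈ s, w = ∑ w ∈ s', w := by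
    intro n
    induction n with
    | zero =>
      intro s hs h1 h2 w hw
      rw [Finset.card_eq_zero.1 hs]
      by_cases h0 : w = 0
      · exact ⟨∅, by simp, by simp, by simp [h0]⟩
      · exact ⟨{w}, by simp [hw, h0], by simp, by simp⟩
    | succ n ih =>
      intro s hs h1 h2 w hw
      by_cases h0 : w = 0
      · exact ⟨s, h1, h2, by simp [h0]⟩
      by_cases hex : ∃ w' ∈ s, ‖w'‖ = ‖w‖
      · obtain ⟨w', hw', hn⟩ := hex
        obtain ⟨s', k1, k2, k3⟩ := ih (s.erase w') (by rw [Finset.card_erase_of_mem hw', hs]; rfl)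
          (fun x hx => h1 x (Finset.mem_of_mem_erase hx))
          (h2.mono (by simp)) (w + w') (hcol w hw w' (h1 w' hw').1 h0 (h1 w' hw').2 hn.symm)
        refine ⟨s', k1, k2, ?_⟩
        rw [← k3, ← Finset.add_sum_erase s _ hw', add_assoc]
      · push Not at hex
        refine ⟨insert w s, ?_, ?_, ?_⟩
        · intro x hx
          rcases Finset.mem_insert.1 hx with rfl | hx
          exacts [⟨hw, h0⟩, h1 x hx]
        · intro a ha b hb hab
          simp only [Finset.coe_insert, Set.mem_insert_iff, Finset.mem_coe] at ha hb
          simp only at hab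
          rcases ha with rfl | ha <;> rcases hb with rfl | hb
          · rfl
          · exact absurd hab.symm (hex b hb)
          · exact absurd hab (hex a ha)
          · exact h2 ha hb hab
        · rw [Finset.sum_insert]
          intro hc; exact hex w hc rfl
  induction hv using AddSubmonoid.closure_induction_left with
  | zero => exact ⟨∅, by simp, by simp, by simp⟩
  | add_left x hx y _ ih =>
    obtain ⟨s, h1, h2, rfl⟩ := ih
    exact step _ s rfl h1 h2 x hx

theorem rep_le {s : Finset W} (h : Set.InjOn (fun w : W => ‖w‖) (s : Set W)) {w : W} (hw : w ∈ s) :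
    ‖w‖ ≤ ‖∑ x ∈ s, x‖ :=
  um_le_sum_of_distinct (f := fun x => x) (fun i hi j hj hij _ hn => hij (h hi hj hn)) hw

theorem rep_dom {s : Finset W} (h : Set.InjOn (fun w : W => ‖w‖) (s : Set W)) (hne : s.Nonempty)
    (h0 : ∀ w ∈ s, w ≠ 0) : ∃ w ∈ s, ‖(∑ x ∈ s, x) - w‖ < ‖w‖ := by
  classical
  obtain ⟨w, hw, hmax⟩ := Finset.exists_max_image s (fun w => ‖w‖) hne
  refine ⟨w, hw, ?_⟩
  rw [← Finset.add_sum_erase s _ hw, add_sub_cancel_left]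
  apply um_sum_lt (norm_pos_iff.2 (h0 w hw))
  intro x hx
  rw [Finset.mem_erase] at hx
  exact lt_of_le_of_ne (hmax x hx.2) fun hn => hx.1 (h hx.2 hw hn)

/-- monomials -/
def Mon (Ab : Subfield W) (y : W) : Set W :=
  {w | ∃ n : ℕ, (n : W) ≠ 0 ∧ ∃ i : ℤ, ∃ a ∈ Ab, w ^ n = a * y ^ i}

theorem Mon.of_mem {Ab : Subfield W} {y a : W} (ha : a ∈ Ab) : a ∈ Mon Ab y :=
  ⟨1, by simp, 0, a, ha, by simp⟩

theorem Mon.self (Ab : Subfield W) (y : W) : y ∈ Mon Ab y :=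
  ⟨1, by simp, 1, 1, Ab.one_mem, by simp⟩

theorem Mon.mul {Ab : Subfield W} {y : W} (hy : y ≠ 0) {w w' : W} (h : w ∈ Mon Ab y) (h' : w' ∈ Mon Ab y) :
    w * w' ∈ Mon Ab y := by
  obtain ⟨n, hn, i, a, ha, e⟩ := h
  obtain ⟨m, hm, j, b, hb, e'⟩ := h'
  refine ⟨n * m, by push_cast; exact mul_ne_zero hn hm, i * m + j * n, a ^ m * b ^ n,
    Ab.mul_mem (Ab.pow_mem ha _) (Ab.pow_mem hb _), ?_⟩
  rw [mul_pow, pow_mul, e, mul_comm n m, pow_mul, e', zpow_add₀ hy, zpow_mul, zpow_mul]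
  simp only [zpow_natCast]
  ring

theorem Mon.inv {Ab : Subfield W} {y : W} {w : W} (h : w ∈ Mon Ab y) : w⁻¹ ∈ Mon Ab y := by
  obtain ⟨n, hn, i, a, ha, e⟩ := h
  exact ⟨n, hn, -i, a⁻¹, Ab.inv_mem ha, by rw [inv_pow, e, mul_inv, zpow_neg]⟩

theorem Mon.root {Ab : Subfield W} {y : W} {w : W} {k : ℕ} (hk : (k : W) ≠ 0) (h : w ^ k ∈ Mon Ab y) :
    w ∈ Mon Ab y := by
  obtain ⟨n, hn, i, a, ha, e⟩ := h
  exact ⟨k * n, by push_cast; exact mul_ne_zero hk hn, i, a, ha, by rw [pow_mul, e]⟩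

/-- bad norm -/
def Bad (Ab : Subfield W) (y : W) : Prop := ∀ c ∈ Ab, ‖c‖ ≠ ‖y‖

theorem Bad.ne {Ab : Subfield W} {y : W} (h : Bad Ab y) : y ≠ 0 := by
  rintro rfl; exact h 0 Ab.zero_mem rfl

theorem Bad.notMem {Ab : Subfield W} {y : W} (h : Bad Ab y) : y ∉ Ab := fun hc => h y hc rfl

section
variable [IsAlgClosed W] {Ab : Subfield W} (hA : acl Ab = Ab) {y : W} (hB : Bad Ab y)
include hA

theorem Bad.of_pow {w : W} {n : ℕ} (hn : n ≠ 0) (h : Bad Ab w) : Bad Ab (w ^ n) := by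
  intro c hc he
  obtain ⟨b, hb⟩ := IsAlgClosed.exists_pow_nat_eq c (Nat.pos_of_ne_zero hn)
  apply h b (by rw [← hA]; exact pow_mem_acl hn (by rw [hb]; exact (le_acl Ab hc)))
  rw [← hb, norm_pow, norm_pow] at he
  exact (pow_left_inj₀ (norm_nonneg _) (norm_nonneg _) hn).1 he

theorem Bad.zpow {w : W} {n : ℤ} (hn : n ≠ 0) (h : Bad Ab w) : Bad Ab (w ^ n) := by
  rcases Int.eq_nat_or_neg n with ⟨m, rfl | rfl⟩
  · rw [zpow_natCast]; exact Bad.of_pow hA (by simpa using hn) h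
  · intro c hc he
    rw [zpow_neg, zpow_natCast, norm_inv] at he
    apply Bad.of_pow hA (n := m) (by simpa using hn) h c⁻¹ (Ab.inv_mem hc)
    rw [norm_inv, he, inv_inv]

include hB

theorem Bad.mon {w : W} (hw0 : w ≠ 0) {n : ℕ} (hn : n ≠ 0) {i : ℤ} {a : W} (ha : a ∈ Ab)
    (hw : w ^ n = a * y ^ i) (hi : i ≠ 0) : Bad Ab w := by
  intro c hc he
  have ha0 : a ≠ 0 := by
    rintro rfl; rw [zero_mul] at hw; exact hw0 (pow_eq_zero_iff hn |>.1 hw)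
  apply hB.zpow hA hi (c ^ n / a) (Ab.div_mem (Ab.pow_mem hc n) ha)
  rw [norm_div, norm_pow, he, ← norm_pow, hw, norm_mul, mul_div_cancel_left₀]
  exact norm_ne_zero_iff.2 ha0

theorem Bad.mon_mem {w : W} (hw : w ∈ Mon Ab y) (hw0 : w ≠ 0) {c : W} (hc : c ∈ Ab) (hn : ‖w‖ = ‖c‖) :
    w ∈ Ab := by
  obtain ⟨n, hn0, i, a, ha, e⟩ := hw
  have hn' : n ≠ 0 := by rintro rfl; simp at hn0
  by_cases hi : i = 0
  · subst hi
    rw [← hA]; exact pow_mem_acl hn' (by rw [e]; simpa using le_acl Ab ha)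
  · exact absurd hn.symm (hB.mon hA hw0 hn' ha e hi c hc)

theorem Bad.ratio {w w' : W} (hw : w ∈ Mon Ab y) (hw' : w' ∈ Mon Ab y) (h0 : w ≠ 0) (h0' : w' ≠ 0)
    (hn : ‖w‖ = ‖w'‖) : w / w' ∈ Ab := by
  rw [div_eq_mul_inv]
  apply hB.mon_mem hA (Mon.mul hB.ne hw (Mon.inv hw')) (mul_ne_zero h0 (inv_ne_zero h0')) Ab.one_mem
  rw [norm_mul, norm_inv, hn, norm_one, mul_inv_cancel₀ (norm_ne_zero_iff.2 h0')]

theorem Bad.collect : ∀ w ∈ Mon Ab y, ∀ w' ∈ Mon Ab y, w ≠ 0 → w' ≠ 0 → ‖w‖ = ‖w'‖ → w + w' ∈ Mon Ab y := by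
  intro w hw w' hw' h0 h0' hn
  have := hB.ratio hA hw hw' h0 h0' hn
  have e : w + w' = (w / w' + 1) * w' := by field_simp
  rw [e]
  exact Mon.mul hB.ne (Mon.of_mem (Ab.add_mem this Ab.one_mem)) hw'

theorem Bad.collect1 {p : ℕ} : ∀ w, (∃ n : ℕ, (n : W) ≠ 0 ∧ ∃ i : ℤ, ¬ (p : ℤ) ∣ i ∧ ∃ a ∈ Ab, w ^ n = a * y ^ i) →
    ∀ w', (∃ n : ℕ, (n : W) ≠ 0 ∧ ∃ i : ℤ, ¬ (p : ℤ) ∣ i ∧ ∃ a ∈ Ab, w' ^ n = a * y ^ i) →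
    w ≠ 0 → w' ≠ 0 → ‖w‖ = ‖w'‖ →
    ∃ n : ℕ, (n : W) ≠ 0 ∧ ∃ i : ℤ, ¬ (p : ℤ) ∣ i ∧ ∃ a ∈ Ab, (w + w') ^ n = a * y ^ i := by
  rintro w ⟨m, hm, j, -, b, hb, e'⟩ w' ⟨n, hn, i, hi, a, ha, e⟩ h0 h0' hnn
  have := hB.ratio hA ⟨m, hm, j, b, hb, e'⟩ ⟨n, hn, i, a, ha, e⟩ h0 h0' hnn
  have e2 : w + w' = (w / w' + 1) * w' := by field_simp
  refine ⟨n, hn, i, hi, (w / w' + 1) ^ n * a, Ab.mul_mem (Ab.pow_mem (Ab.add_mem this Ab.one_mem) n) ha, ?_⟩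
  rw [e2, mul_pow, e]; ring

end

/-- ring spanned by the monomials -/
noncomputable def MonV (Ab : Subfield W) {y : W} (hy : y ≠ 0) : Subring W :=
  let N : Submonoid W :=
    { carrier := Mon Ab y
      mul_mem' := fun h h' => Mon.mul hy h h'
      one_mem' := Mon.of_mem Ab.one_mem }
  { N.subsemiringClosure with
    neg_mem' := by
      intro x hx
      have h1 : (-1 : W) ∈ N.subsemiringClosure :=
        AddSubmonoid.subset_closure (Mon.of_mem (Ab.neg_mem Ab.one_mem))
      have := N.subsemiringClosure.mul_mem h1 hx
      rwa [neg_one_mul] at this }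

theorem mem_MonV {Ab : Subfield W} {y : W} (hy : y ≠ 0) {v : W} :
    v ∈ MonV Ab hy ↔ v ∈ AddSubmonoid.closure (Mon Ab y) := Iff.rfl

theorem Mon_le {Ab B : Subfield W} {y : W} (hPC : PC B) (hAB : Ab ≤ B) (hy : y ∈ B) : Mon Ab y ⊆ B := by
  rintro w ⟨n, hn, i, a, ha, e⟩
  exact hPC w n hn (by rw [e]; exact B.mul_mem (hAB ha) (B.zpow_mem hy i))

theorem MonV_le {Ab B : Subfield W} {y : W} (hPC : PC B) (hAB : Ab ≤ B) (hy : y ∈ B) {v : W}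
    (hv : v ∈ AddSubmonoid.closure (Mon Ab y)) : v ∈ B :=
  (AddSubmonoid.closure_le (S := B.toAddSubgroup.toAddSubmonoid)).2 (Mon_le hPC hAB hy) hv

section
variable [IsAlgClosed W] [CompleteSpace W] (hN : NatTriv W) {Ab : Subfield W} (hA : acl Ab = Ab) {y : W}
  (hB : Bad Ab y)
include hN hA hB

theorem Bad.approx {e : W} (he : e ∈ Ry Ab y) {ε : ℝ} (hε : 0 < ε) :
    ∃ v ∈ AddSubmonoid.closure (Mon Ab y), ‖e - v‖ < ε := by
  obtain ⟨E, hE, hE'⟩ := exists_field_closure (MonV Ab hB.ne) (Mon Ab y)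
    (fun m hm => (mem_MonV hB.ne).2 (AddSubmonoid.subset_closure hm)) (fun m hm => Mon.inv hm) (by
    intro v hv h0
    obtain ⟨s, h1, h2, rfl⟩ := exists_rep _ (hB.collect hA) ((mem_MonV hB.ne).1 hv)
    have hne : s.Nonempty := by
      rw [Finset.nonempty_iff_ne_empty]; rintro rfl; simp at h0
    obtain ⟨w, hw, hlt⟩ := rep_dom h2 hne fun w hw => (h1 w hw).2
    exact ⟨w, (h1 w hw).1, hlt.trans_le (rep_le h2 hw)⟩)
  have hVE : (MonV Ab hB.ne : Set W) ⊆ E := by rw [hE]; exact subset_closure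
  have hMV : Mon Ab y ⊆ (MonV Ab hB.ne : Set W) := fun m hm =>
    (mem_MonV hB.ne).2 (AddSubmonoid.subset_closure hm)
  have hEc : IsClosed (E : Set W) := by rw [hE]; exact isClosed_closure
  have hPC : PC E := PC.of_approx hN hEc (Mon Ab y) (fun w n hn h => Mon.root hn h)
    (Mon.of_mem Ab.one_mem) (hMV.trans hVE) hE'
  have hle : Ry Ab y ≤ E := Rt_le hEc hPC
    (Set.insert_subset (hVE (hMV (Mon.self Ab y))) fun a ha => hVE (hMV (Mon.of_mem ha)))
  have : e ∈ closure (MonV Ab hB.ne : Set W) := by rw [← hE]; exact hle he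
  obtain ⟨v, hv, hv'⟩ := closure_approx this hε
  exact ⟨v, (mem_MonV hB.ne).1 hv, hv'⟩

theorem Bad.lin3 {B : Subfield W} (hBc : IsClosed (B : Set W)) (hPC : PC B) (hAB : Ab ≤ B) {T : W}
    (hTB : T ∈ B) (hTy : T ∈ Ry Ab y) (hT : ‖T - y‖ < ‖y‖) : Ry Ab y ≤ B := by
  have hy0 := hB.ne
  have hyp : 0 < ‖y‖ := norm_pos_iff.2 hy0
  set ξ := T / y with hξ
  have hξT : T = y * ξ := by rw [hξ]; field_simp
  have hξ1 : ‖ξ - 1‖ < 1 := by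
    have : ξ - 1 = (T - y) / y := by rw [hξ]; field_simp
    rw [this, norm_div, div_lt_one hyp]; exact hT
  have hξn : ‖ξ‖ = 1 := by
    have := um_eq_of_sub_lt' (x := ξ) (y := 1) (by simpa using hξ1); simpa using this
  have hξ0 : ξ ≠ 0 := by intro h; rw [h] at hξn; simp at hξn
  have hpow : ∀ k : ℕ, ‖ξ ^ k - 1‖ ≤ ‖ξ - 1‖ := by
    intro k
    rw [← geom_sum_mul, norm_mul]
    apply mul_le_of_le_one_left (norm_nonneg _)
    apply um_sum_le zero_le_one
    intro i _
    rw [norm_pow, hξn, one_pow]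
  have hzpow : ∀ i : ℤ, ‖ξ ^ i - 1‖ ≤ ‖ξ - 1‖ := by
    intro i
    rcases Int.eq_nat_or_neg i with ⟨m, rfl | rfl⟩
    · rw [zpow_natCast]; exact hpow m
    · rw [zpow_neg, zpow_natCast]
      have : (ξ ^ m)⁻¹ - 1 = -((ξ ^ m - 1) * (ξ ^ m)⁻¹) := by field_simp; ring
      rw [this, norm_neg, norm_mul, norm_inv, norm_pow, hξn, one_pow, inv_one, mul_one]
      exact hpow m
  set ρ : ℝ := max (1 / 2) ‖ξ - 1‖ with hρ
  have hρ0 : 0 < ρ := lt_of_lt_of_le (by norm_num) (le_max_left _ _)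
  have hmono : ∀ w ∈ Mon Ab y, ∃ b ∈ B, b ∈ Ry Ab y ∧ ‖w - b‖ ≤ ρ * ‖w‖ := by
    rintro w ⟨n, hn, i, a, ha, e⟩
    obtain ⟨ζ, hζ, hζ1, hζ2⟩ := unit_root_exists hN ((hzpow i).trans_lt hξ1) hn
    have hpw : (w * ζ) ^ n = a * T ^ i := by
      rw [mul_pow, hζ, e, hξT, mul_zpow, mul_assoc]
    refine ⟨w * ζ, hPC _ n hn ?_, Rt_PC _ _ n hn ?_, ?_⟩
    · rw [hpw]; exact B.mul_mem (hAB ha) (B.zpow_mem hTB i)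
    · rw [hpw]; exact (Ry Ab y).mul_mem (le_Ry Ab y ha) ((Ry Ab y).zpow_mem hTy i)
    · have : w - w * ζ = -((ζ - 1) * w) := by ring
      rw [this, norm_neg, norm_mul, hζ2]
      gcongr
      exact (hzpow i).trans (le_max_right _ _)
  apply lin_contract hBc (AddSubmonoid.closure (Mon Ab y) : Set W)
    (fun e he ε hε => hB.approx hN hA he hε) hρ0 (max_lt (by norm_num) hξ1)
  intro v hv
  obtain ⟨s, h1, h2, rfl⟩ := exists_rep _ (hB.collect hA) hv
  choose! b hb1 hb2 hb3 using hmono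
  refine ⟨∑ w ∈ s, b w, B.sum_mem fun w hw => hb1 w (h1 w hw).1,
    (Ry Ab y).sum_mem fun w hw => hb2 w (h1 w hw).1, ?_⟩
  rw [← Finset.sum_sub_distrib]
  apply um_sum_le (by positivity)
  intro w hw
  exact (hb3 w (h1 w hw).1).trans (by gcongr; exact rep_le h2 hw)

end
end P7f

section P7f2
variable {W : Type*} [NormedField W] [IsUltrametricDist W]

/-- monomials with exponent prime to p -/
def Mon1 (p : ℕ) (Ab : Subfield W) (y : W) : Set W :=
  {w | ∃ n : ℕ, (n : W) ≠ 0 ∧ ∃ i : ℤ, ¬ (p : ℤ) ∣ i ∧ ∃ a ∈ Ab, w ^ n = a * y ^ i}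

theorem Mon1_sub {p : ℕ} {Ab : Subfield W} {y : W} : Mon1 p Ab y ⊆ Mon Ab y := by
  rintro w ⟨n, hn, i, -, a, ha, e⟩
  exact ⟨n, hn, i, a, ha, e⟩

theorem mon_nf [IsAlgClosed W] {p : ℕ} [Fact p.Prime] [CharP W p] {Ab R : Subfield W} (hA : acl Ab = Ab)
    (hAR : Ab ≤ R) (hPC : PC R) {y : W} (hyR : y ∈ R) (k : ℕ) {w : W} {n : ℕ} (hn : (n : W) ≠ 0)
    {i : ℤ} (hik : i.natAbs ≤ k) {a : W} (ha : a ∈ Ab) (e : w ^ n = a * y ^ i) :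
    ∃ v ∈ AddSubmonoid.closure (Mon1 p Ab y), AE p R w v := by
  have hpp : p.Prime := Fact.out
  have hn' : n ≠ 0 := by rintro rfl; simp at hn
  induction k generalizing w i a with
  | zero =>
    have hi : i = 0 := by omega
    subst hi
    refine ⟨0, zero_mem _, AE.of_closed (p := p) hA hAR ?_⟩
    have : w ∈ acl Ab := pow_mem_acl hn' (by rw [e]; simpa using le_acl Ab ha)
    rwa [hA] at this
  | succ k ih =>
    by_cases hp : (p : ℤ) ∣ i
    · obtain ⟨j, rfl⟩ := hp
      by_cases hj : j = 0
      · subst hj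
        refine ih (i := 0) (by simp) ha (by simpa using e)
      obtain ⟨m, hm⟩ := IsAlgClosed.exists_pow_nat_eq w hpp.pos
      obtain ⟨b, hb⟩ := IsAlgClosed.exists_pow_nat_eq a hpp.pos
      have hbA : b ∈ Ab := by
        have : b ∈ acl Ab := pow_mem_acl hpp.ne_zero (by rw [hb]; exact le_acl Ab ha)
        rwa [hA] at this
      have em : m ^ n = b * y ^ j := by
        apply frobenius_inj W p
        rw [frobenius_def, frobenius_def, ← pow_mul, mul_comm n p, pow_mul, hm, e, mul_pow, hb,
          mul_comm (p : ℤ) j, zpow_mul, zpow_natCast]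
      have hmR : m ∈ R := hPC m n hn (by rw [em]; exact R.mul_mem (hAR hbA) (R.zpow_mem hyR j))
      obtain ⟨v, hv, hv'⟩ := ih (i := j) (by
        rw [Int.natAbs_mul, Int.natAbs_natCast] at hik
        have h2 := hpp.two_le
        have h3 : 0 < j.natAbs := Int.natAbs_pos.2 hj
        nlinarith) hbA em
      refine ⟨v, hv, AE.trans (b := m) ?_ hv'⟩
      have := AE.frob (p := p) hmR 1
      rwa [pow_one, hm] at this
    · exact ⟨w, AddSubmonoid.subset_closure ⟨n, hn, i, hp, a, ha, e⟩, AE.refl w⟩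

theorem closure_nf [IsAlgClosed W] {p : ℕ} [Fact p.Prime] [CharP W p] {Ab R : Subfield W} (hA : acl Ab = Ab)
    (hAR : Ab ≤ R) (hPC : PC R) {y : W} (hyR : y ∈ R) {v : W} (hv : v ∈ AddSubmonoid.closure (Mon Ab y)) :
    ∃ q ∈ AddSubmonoid.closure (Mon1 p Ab y), AE p R v q := by
  induction hv using AddSubmonoid.closure_induction with
  | mem w hw =>
    obtain ⟨n, hn, i, a, ha, e⟩ := hw
    exact mon_nf hA hAR hPC hyR i.natAbs hn le_rfl ha e
  | zero => exact ⟨0, zero_mem _, AE.refl 0⟩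
  | add x y _ _ hx hy =>
    obtain ⟨q, hq, e⟩ := hx
    obtain ⟨q', hq', e'⟩ := hy
    exact ⟨q + q', add_mem hq hq', e.add e'⟩

theorem Bad.as3 [IsAlgClosed W] [CompleteSpace W] {p : ℕ} [Fact p.Prime] [CharP W p]
    {κ Ab Om : Subfield W} (h : Ctx κ Ab Om) : ASProp p Ab (fun y => y ∈ Om ∧ Bad Ab y) := by
  classical
  rintro y ⟨hy, hB⟩ θ hθ hθp
  have hyA := hB.notMem
  have hN := h.natTriv
  have hA := h.aacl
  have hpp : p.Prime := Fact.out
  set R := Ry Ab y with hR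
  have hiso : IsoN R := h.Ry_iso hy hyA
  have hAR : Ab ≤ R := le_Ry Ab y
  have hyR : y ∈ R := mem_Ry Ab y
  have hκR := h.le.trans hAR
  have hPCR : PC R := Rt_PC _
  obtain ⟨v, hv, hvlt⟩ := hB.approx hN hA hθp one_pos
  have hvR : v ∈ R := MonV_le hPCR hAR hyR hv
  obtain ⟨Q, hQ, hvQ⟩ := closure_nf (p := p) hA hAR hPCR hyR hv
  have hQR : Q ∈ R := MonV_le hPCR hAR hyR (AddSubmonoid.closure_mono Mon1_sub hQ)
  have hQO : Q ∈ Om := MonV_le h.pcOm h.lo hy (AddSubmonoid.closure_mono Mon1_sub hQ)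
  have key : ∀ θ', θ' ^ p - θ' = Q → θ' - θ ∈ R := by
    intro θ' hq
    obtain ⟨z, hz, hzq⟩ := hvQ
    have e : (θ' - θ + z) ^ p - (θ' - θ + z) = -((θ ^ p - θ) - v) := by
      rw [add_pow_char, sub_pow_char]
      linear_combination hq - hzq
    have : θ' - θ + z ∈ R := as_mem (p := p) h.kacl hκR hiso
      (by rw [e]; exact R.neg_mem (R.sub_mem hθp hvR)) (by rw [e, norm_neg]; exact hvlt)
    simpa using R.sub_mem this hz
  obtain ⟨θ', hθ'⟩ := exists_as_root (p := p) Q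
  have hkey := key θ' hθ'
  have hθ'R : θ' ∉ R := fun hc => hθ (by simpa using R.sub_mem hc hkey)
  have hQ1 : ¬ ‖Q‖ < 1 := fun hc => hθ'R
    (as_mem (p := p) h.kacl hκR hiso (by rw [hθ']; exact hQR) (by rw [hθ']; exact hc))
  have hθ'O : θ' ∈ Om := by
    have := as_root_mem_acl hQO hθ'
    rwa [h.oacl] at this
  obtain ⟨s, h1, h2, h3⟩ := exists_rep (Mon1 p Ab y) (hB.collect1 hA) hQ
  have hne : s.Nonempty := by
    rw [Finset.nonempty_iff_ne_empty]; rintro rfl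
    apply hQ1; rw [h3]; simp
  obtain ⟨w, hw, hlt⟩ := rep_dom h2 hne fun w hw => (h1 w hw).2
  rw [← h3] at hlt
  obtain ⟨⟨n, hn, i, hi, a, ha, e⟩, hw0⟩ := h1 w hw
  have hn' : n ≠ 0 := by rintro rfl; simp at hn
  have hi0 : i ≠ 0 := by rintro rfl; simp at hi
  have hBw : Bad Ab w := hB.mon hA hw0 hn' ha e hi0
  have hQw : ‖Q‖ = ‖w‖ := um_eq_of_sub_lt' hlt
  have hQ1' : 1 < ‖Q‖ := by
    refine lt_of_le_of_ne (not_lt.1 hQ1) fun hc => hBw 1 Ab.one_mem ?_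
    rw [norm_one, hc, hQw]
  have hθ'1 : 1 < ‖θ'‖ := by
    by_contra! hc
    have : ‖Q‖ ≤ 1 := by
      rw [← hθ']
      exact um_sub_le (by rw [norm_pow]; exact pow_le_one₀ (norm_nonneg _) hc) hc
    linarith
  have hθ'Q : ‖θ' ^ p‖ = ‖Q‖ := by
    refine (um_eq_of_sub_lt (x := θ' ^ p) (y := Q) ?_).symm
    rw [← hθ', sub_sub_cancel, norm_pow]
    exact lt_self_pow₀ hθ'1 hpp.one_lt
  have hBθ' : Bad Ab θ' := by
    intro c hc hcn
    apply hBw (c ^ p) (Ab.pow_mem hc p)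
    rw [norm_pow, hcn, ← norm_pow, hθ'Q, hQw]
  refine ⟨θ', ⟨hθ'O, hBθ'⟩, hkey, ?_⟩
  -- linearisation
  have ha0 : a ≠ 0 := by
    rintro rfl; rw [zero_mul] at e; exact hw0 (pow_eq_zero_iff hn' |>.1 e)
  have hQ0 : Q ≠ 0 := by rw [← norm_pos_iff]; linarith
  have hQB : Q ∈ Ry Ab θ' := by
    rw [← hθ']
    exact (Ry Ab θ').sub_mem ((Ry Ab θ').pow_mem (mem_Ry _ _) p) (mem_Ry _ _)
  have hy0 := hB.ne
  set g := (Q / w) ^ n with hg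
  have hg1 : ‖g - 1‖ < 1 := by
    have h5 : ‖Q / w - 1‖ < 1 := by
      rw [div_sub_one hw0, norm_div, div_lt_one (norm_pos_iff.2 hw0)]; exact hlt
    rw [hg, unit_pow_sub hN h5 hn]; exact h5
  have hgn : ‖g‖ = 1 := by
    have := um_eq_of_sub_lt' (x := g) (y := 1) (by simpa using hg1); simpa using this
  have hg0 : g ≠ 0 := by intro hc; rw [hc] at hgn; simp at hgn
  have hgQ : g * y ^ i = Q ^ n / a := by
    rw [hg, div_pow, e]; field_simp
  have hmW : (i.natAbs : W) ≠ 0 := by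
    rw [Ne, CharP.cast_eq_zero_iff W p, ← Int.natCast_dvd]; exact hi
  have hex : ∃ g' q, ‖g' - 1‖ < 1 ∧ q ∈ R ∧ q ∈ Ry Ab θ' ∧ g' * y ^ i.natAbs = q := by
    have hqR : Q ^ n / a ∈ R := R.div_mem (R.pow_mem hQR n) (hAR ha)
    have hqB : Q ^ n / a ∈ Ry Ab θ' := (Ry Ab θ').div_mem ((Ry Ab θ').pow_mem hQB n) (le_Ry _ _ ha)
    rcases Int.natAbs_eq i with hii | hii
    · refine ⟨g, _, hg1, hqR, hqB, ?_⟩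
      rw [← hgQ]; conv_rhs => rw [hii, zpow_natCast]
    · refine ⟨g⁻¹, (Q ^ n / a)⁻¹, ?_, R.inv_mem hqR, (Ry Ab θ').inv_mem hqB, ?_⟩
      · have : g⁻¹ - 1 = -((g - 1) * g⁻¹) := by field_simp; ring
        rw [this, norm_neg, norm_mul, norm_inv, hgn, inv_one, mul_one]; exact hg1
      · rw [← hgQ, mul_inv]; conv_rhs => rw [hii, zpow_neg, zpow_natCast, inv_inv]
  obtain ⟨g', q, hg'1, hqR, hqB, hq⟩ := hex
  obtain ⟨ξ, hξ, hξ1, -⟩ := unit_root_exists hN hg'1 hmW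
  have hT : (y * ξ) ^ i.natAbs = q := by rw [mul_pow, hξ, ← hq, mul_comm]
  apply hB.lin3 hN hA (Rt_isClosed _) (Rt_PC _) (le_Ry _ _) (T := y * ξ)
  · exact Rt_PC _ _ _ hmW (by rw [hT]; exact hqB)
  · exact Rt_PC _ _ _ hmW (by rw [hT]; exact hqR)
  · rw [← mul_sub_one, norm_mul]
    exact mul_lt_of_lt_one_right (norm_pos_iff.2 hy0) hξ1

end P7f2

section P7g
variable {W : Type*} [NormedField W] [IsUltrametricDist W]

/-- one transcendental step inside the maximal good field -/
structure Stp (p : ℕ) (κ M A : Subfield W) (x : W) : Prop where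
  mg : MaxGood p κ M
  nt : ∃ x ∈ M, 1 < ‖x‖
  kA : κ ≤ A
  AM : A ≤ M
  rac : ∀ z ∈ acl A, z ∈ M → z ∈ A
  xM : x ∈ M
  xA : x ∉ A

/-- the enlarged relatively algebraically closed field -/
noncomputable def nx (M A : Subfield W) (x : W) : Subfield W := acl (adjF A {x}) ⊓ M

theorem A_le_nx {M A : Subfield W} (h : A ≤ M) (x : W) : A ≤ nx M A x :=
  le_inf ((le_adjF A _).trans (le_acl _)) h

theorem mem_nx_self {M : Subfield W} (A : Subfield W) {x : W} (h : x ∈ M) : x ∈ nx M A x :=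
  ⟨le_acl _ (mem_adjF_self A x), h⟩

theorem nx_rac {M A : Subfield W} {x z : W} (hz : z ∈ acl (nx M A x)) (hM : z ∈ M) : z ∈ nx M A x :=
  ⟨acl_le_acl inf_le_left hz, hM⟩

namespace Stp
variable {p : ℕ} [hp : ExpChar W p] [IsAlgClosed W] [CompleteSpace W] {κ M A : Subfield W} {x : W}
  (h : Stp p κ M A x)
include h

theorem acl_nx : acl (nx M A x) = acl (adjF A {x}) :=
  le_antisymm (acl_le_acl inf_le_left)
    (acl_mono (adjF_le_iff.2 ⟨A_le_nx h.AM x, by simpa using mem_nx_self A h.xM⟩))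

theorem acl_nx' : acl (adjF A {x}) = adjF (nx M A x) (acl κ : Set W) := by
  rw [← h.acl_nx]
  exact h.mg.acl_sub h.nt (h.kA.trans (A_le_nx h.AM x)) inf_le_right fun z hz hz' => nx_rac hz hz'

theorem acl_A : acl A = adjF A (acl κ : Set W) := h.mg.acl_sub h.nt h.kA h.AM h.rac

theorem notMem {z : W} (hz : z ∈ M) (hA : z ∉ A) : z ∉ acl A := fun hc => hA (h.rac z hc hz)

theorem exch {z : W} (hz : z ∈ acl (adjF A {x})) (hzA : z ∉ acl A) : x ∈ acl (adjF A {z}) :=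
  acl_exchange hz hzA

theorem ctx : Ctx (acl κ) (acl A) (acl (adjF A {x})) where
  triv := h.mg.triv.acl
  kacl := acl_acl κ
  le := acl_mono h.kA
  aacl := acl_acl A
  lo := acl_mono (le_adjF A _)
  oacl := acl_acl _
  good := by
    rw [h.acl_nx']
    exact comp_good h.mg.triv h.mg.perf (h.kA.trans (A_le_nx h.AM x)) fun z hz => h.mg.good z hz.2
  nt := by
    by_contra! hc
    have ht : TrivN (acl (adjF A {x})) := by
      intro c hc' h0
      apply le_antisymm (hc c hc')
      have := hc _ (Subfield.inv_mem _ hc')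
      rw [norm_inv] at this
      exact (inv_le_one₀ (norm_pos_iff.2 h0)).1 this
    have hx : x ∈ acl (adjF A {x}) := le_acl _ (mem_adjF_self A x)
    obtain ⟨c, hcκ, hlt⟩ := h.mg.good x h.xM (ht.le hx)
    have := ht.eq_zero (Subfield.sub_mem _ hx (le_acl _ (le_adjF A _ (h.kA hcκ)))) hlt
    rw [sub_eq_zero] at this
    exact h.xA (this ▸ h.kA hcκ)
  rk := by
    intro z hz hzA
    apply acl_le_acl
    apply adjF_le_iff.2 ⟨?_, ?_⟩
    · exact (le_acl A).trans ((le_adjF _ _).trans (le_acl _))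
    · rw [Set.singleton_subset_iff]
      exact acl_mono (adjF_mono (le_acl A) le_rfl) (h.exch hz hzA)

theorem perfA {a : W} (ha : a ∈ A) : ∃ b ∈ A, b ^ p = a := by
  have hp0 : p ≠ 0 := expChar_ne_zero W p
  obtain ⟨b, hb⟩ := IsAlgClosed.exists_pow_nat_eq a (Nat.pos_of_ne_zero hp0)
  refine ⟨b, h.rac b (pow_mem_acl hp0 (by rw [hb]; exact le_acl A ha)) ?_, hb⟩
  exact h.mg.perfect (by rw [hb]; exact h.AM ha)

theorem perfA_iter (k : ℕ) {a b : W} (ha : a ∈ A) (hb : b ^ p ^ k = a) : b ∈ A := by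
  have hp0 : p ≠ 0 := expChar_ne_zero W p
  induction k generalizing a b with
  | zero => rw [pow_zero, pow_one] at hb; rwa [hb]
  | succ k ih =>
    rw [pow_succ, pow_mul] at hb
    apply ih (a := b ^ p ^ k) _ rfl
    refine h.rac _ (pow_mem_acl hp0 (by rw [hb]; exact le_acl A ha)) ?_
    exact h.mg.perfect (by rw [hb]; exact h.AM ha)

/-- separability after extracting p-power roots of the coordinate -/
theorem sep1 {y s : W} (hs : s ∈ acl (adjF A {y})) : ∃ k, ∀ k', k ≤ k' → ∀ ξ : W, ξ ^ p ^ k' = y →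
    SepOver (adjF A {ξ}) s := by
  classical
  have hirr : Irreducible (minpoly (adjF A {y}) s) :=
    minpoly.irreducible (isAlgebraic_iff_isIntegral.1 (mem_acl_iff_isAlgebraic.1 hs))
  haveI : ExpChar (adjF A {y}) p := (algebraMap (adjF A {y}) W).expChar (algebraMap (adjF A {y}) W).injective p
  obtain ⟨g, hg, k, hexp⟩ := hirr.hasSeparableContraction p
  have main : ∀ ξ : W, ξ ^ p ^ k = y → SepOver (adjF A {ξ}) s := by
    intro ξ hξ
    let φ : W ≃+* W := iterateFrobeniusEquiv W p k
    have hφ : ∀ w, φ w = w ^ p ^ k := fun w => iterateFrobeniusEquiv_def W p k w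
    have hle : adjF A {y} ≤ (adjF A {ξ}).comap (φ.symm : W →+* W) := by
      apply adjF_le_iff.2 ⟨?_, ?_⟩
      · intro a ha
        change φ.symm a ∈ adjF A {ξ}
        apply le_adjF A _
        apply h.perfA_iter k ha
        rw [← hφ, RingEquiv.apply_symm_apply]
      · rw [Set.singleton_subset_iff]
        change φ.symm y ∈ adjF A {ξ}
        have : φ.symm y = ξ := by rw [RingEquiv.symm_apply_eq, hφ, hξ]
        rw [this]; exact mem_adjF_self A ξ
    set g1 : W[X] := (g.map (algebraMap (adjF A {y}) W)).map (φ.symm : W →+* W) with hg1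
    have hg1s : g1.Separable := (hg.map).map
    have hin : PolyIn (adjF A {ξ}) g1 := by
      intro i
      rw [hg1, coeff_map, coeff_map]
      exact hle (g.coeff i).2
    have hev : g1.eval s = 0 := by
      apply φ.injective
      rw [map_zero]
      have e1 : (φ : W →+* W) (g1.eval s) = (g1.map (φ : W →+* W)).eval (φ s) := (eval_map_apply _ _).symm
      change (φ : W →+* W) (g1.eval s) = 0
      rw [e1, hg1, Polynomial.map_map (f := (φ.symm : W →+* W))]
      have : (φ : W →+* W).comp (φ.symm : W →+* W) = RingHom.id W := by
        ext w; simp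
      rw [this, Polynomial.map_id, hφ, eval_map_algebraMap, ← expand_aeval, hexp, minpoly.aeval]
    refine ⟨mem_acl_iff.2 ⟨g1, hg1s.ne_zero, hin, hev⟩, hg1s.of_dvd (mpW_dvd hin hev)⟩
  refine ⟨k, fun k' hk ξ hξ => ?_⟩
  obtain ⟨m, rfl⟩ := Nat.exists_eq_add_of_le' hk
  rw [pow_add, pow_mul] at hξ
  refine (main _ hξ).mono (adjF_le_iff.2 ⟨le_adjF _ _, ?_⟩)
  rw [Set.singleton_subset_iff]
  exact (adjF A {ξ}).pow_mem (mem_adjF_self A ξ) _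

theorem sepS {y : W} (S : Finset W) (hS : ∀ s ∈ S, s ∈ acl (adjF A {y})) : ∃ k, ∀ ξ : W, ξ ^ p ^ k = y →
    ∀ s ∈ S, SepOver (adjF A {ξ}) s := by
  have h1 : ∀ s, ∃ k, s ∈ S → ∀ k', k ≤ k' → ∀ ξ : W, ξ ^ p ^ k' = y → SepOver (adjF A {ξ}) s := by
    intro s
    by_cases hs : s ∈ S
    · obtain ⟨k, hk⟩ := h.sep1 (hS s hs)
      exact ⟨k, fun _ => hk⟩
    · exact ⟨0, fun hc => absurd hc hs⟩
  choose k hk using h1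
  exact ⟨S.sup k, fun ξ hξ s hs => hk s hs _ (Finset.le_sup hs) ξ hξ⟩

/-- root of the coordinate inside the next field -/
theorem root_nx {y : W} (hy : y ∈ nx M A x) (hyA : y ∉ A) (k : ℕ) :
    ∃ ξ ∈ nx M A x, ξ ∉ A ∧ ξ ^ p ^ k = y := by
  have hp0 : p ≠ 0 := expChar_ne_zero W p
  obtain ⟨ξ, hξ⟩ := IsAlgClosed.exists_pow_nat_eq y (Nat.pos_of_ne_zero (pow_ne_zero k hp0))
  have hM : ∀ k : ℕ, ∀ z : W, z ^ p ^ k ∈ M → z ∈ M := by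
    intro k
    induction k with
    | zero => intro z hz; simpa using hz
    | succ k ih =>
      intro z hz
      rw [pow_succ, pow_mul] at hz
      exact ih z (h.mg.perfect hz)
  refine ⟨ξ, ⟨?_, hM k ξ (hξ ▸ hy.2)⟩, ?_, hξ⟩
  · have := pow_mem_acl (A := acl (adjF A {x})) (pow_ne_zero k hp0) (z := ξ) (by rw [hξ]; exact le_acl _ hy.1)
    rwa [acl_acl] at this
  · intro hc; exact hyA (hξ ▸ A.pow_mem hc _)

/-- the target of the analysis of one step -/
def _root_.Nice (A A' : Subfield W) (S : Finset W) : Prop :=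
  ∃ y0 ∈ A', y0 ∉ A ∧ (∀ s ∈ S, SepOver (adjF A {y0}) s) ∧
    ∀ z ∈ adjF A (insert y0 (S : Set W)), ∀ ε : ℝ, 0 < ε → ∃ u ∈ A', u ∉ A ∧ y0 ∈ adjF A {u} ∧
      ∃ a ∈ adjF A {u}, ‖z - a‖ < ε

theorem Om_le {y : W} (hy : y ∈ nx M A x) (hyA : y ∉ A) : acl (adjF A {x}) ≤ acl (adjF A {y}) :=
  acl_le_acl (adjF_le_iff.2 ⟨(le_adjF _ _).trans (le_acl _), by
    rw [Set.singleton_subset_iff]; exact h.exch hy.1 (h.notMem hy.2 hyA)⟩)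

theorem nice_of {Co : W → Prop} (hCo : ∀ y, Co y → y ∈ acl (adjF A {x}) ∧ y ∉ acl A)
    (hAS : p.Prime → ASProp p (acl A) Co)
    (hroot : ∀ y ξ : W, ∀ k : ℕ, Co y → ξ ∈ acl (adjF A {x}) → ξ ^ p ^ k = y → Co ξ)
    (hdesc : ∀ (T : Set W) (y : W), T ⊆ nx M A x → Co y → y ∈ Rt (acl A ∪ T : Set W) → T ⊆ Ry (acl A) y →
      ∃ Y ∈ nx M A x, Co Y ∧ Ry (acl A) y ≤ Ry (acl A) Y)
    (hfin : ∀ y0 ∈ nx M A x, Co y0 → ∀ z ∈ Ry (acl A) y0, z ∈ M → ∀ ε : ℝ, 0 < ε →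
      ∃ u ∈ nx M A x, u ∉ A ∧ y0 ∈ adjF A {u} ∧ ∃ a ∈ adjF A {u}, ‖z - a‖ < ε)
    {x0 : W} (hx0 : x0 ∈ nx M A x) (hx0C : Co x0) (S : Finset W) (hS : ∀ s ∈ S, s ∈ nx M A x) :
    Nice A (nx M A x) S := by
  have hCA : ∀ y, Co y → y ∉ A := fun y hy hc => (hCo y hy).2 (le_acl A hc)
  have hadj : ∀ y : W, adjF A {y} ≤ Ry (acl A) y := fun y =>
    (adjF_mono (le_acl A) le_rfl).trans (adjF_le_Ry _ _)
  obtain ⟨k, hk⟩ := h.sepS (y := x0) S fun s hs => h.Om_le hx0 (hCA _ hx0C) (hS s hs).1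
  obtain ⟨x1, hx1, hx1A, hx1k⟩ := h.root_nx hx0 (hCA _ hx0C) k
  have hx1C := hroot x0 x1 k hx0C hx1.1 hx1k
  obtain ⟨y, hyC, hy1, hy2, hy3⟩ := h.ctx.inductS (p := p) hCo hAS S hx1C
    fun s hs => (hk x1 hx1k s hs).mono (hadj x1)
  obtain ⟨Y, hYn, hYC, hYle⟩ := hdesc (insert x1 (S : Set W)) y
    (Set.insert_subset hx1 fun s hs => hS s hs) hyC (by rwa [Set.union_insert])
    (Set.insert_subset (hy1 (mem_Ry _ _)) fun s hs => hy2 s hs)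
  obtain ⟨k2, hk2⟩ := h.sepS (y := Y) S fun s hs => h.Om_le hYn (hCA _ hYC) (hS s hs).1
  obtain ⟨y0, hy0, hy0A, hy0k⟩ := h.root_nx hYn (hCA _ hYC) k2
  have hy0C := hroot Y y0 k2 hYC hy0.1 hy0k
  have hYy0 : Ry (acl A) Y ≤ Ry (acl A) y0 := Ry_le_Ry (hy0k ▸ Subfield.pow_mem _ (mem_Ry _ _) _)
  refine ⟨y0, hy0, hy0A, hk2 y0 hy0k, fun z hz ε hε => ?_⟩
  refine hfin y0 hy0 hy0C z ?_ ?_ ε hε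
  · have : adjF A (insert y0 (S : Set W)) ≤ Ry (acl A) y0 := adjF_le_iff.2
      ⟨(le_acl A).trans (le_Ry _ _), Set.insert_subset (mem_Ry _ _) fun s hs => hYy0 (hYle (hy2 s hs))⟩
    exact this hz
  · have : adjF A (insert y0 (S : Set W)) ≤ M := adjF_le_iff.2
      ⟨h.AM, Set.insert_subset hy0.2 fun s hs => (hS s hs).2⟩
    exact this hz

/-- Lagrange data for an element of the algebraic closure -/
theorem lag {y : W} (hy : y ∈ acl (adjF A {x})) {T : Set W} (hT : T ⊆ M) (hyT : y ∈ Rt (acl A ∪ T : Set W))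
    (hTy : T ⊆ Ry (acl A) y) :
    ∃ (I : Finset W) (n : ℕ) (q : W[X]) (b : W → ℕ → W) (α : W), α ∈ acl κ ∧ I.Nonempty ∧
      PolyIn (nx M A x) q ∧ (∀ a ∈ I, a ∈ acl κ) ∧
      (∀ a ∈ I, ∀ j, b a j ∈ acl κ) ∧ (∀ a ∈ I, q.eval a ∈ Ry (acl A) y ∧ y ∈ Ry (acl A) (q.eval a)) ∧
      (∀ j, q.coeff j = ∑ a ∈ I, q.eval a * b a j) ∧ y = q.eval α ∧ (∀ j, ‖q.coeff j‖ ≤ ‖y‖) ∧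
      (∀ f : W → W, ∀ i ∈ I, f i = ∑ j ∈ Finset.range n, i ^ j * ∑ i' ∈ I, f i' * b i' j) := by
  classical
  have hκn : κ ≤ nx M A x := h.kA.trans (A_le_nx h.AM x)
  rw [h.acl_nx'] at hy
  obtain ⟨α, hα, q, hq, hd, hyq⟩ := mem_comp h.mg.perf hκn hy
  have hs := mpW_perfect_separable h.mg.perf hα
  obtain ⟨b, hb, hb2⟩ := lag_coeff hα hs
  have hM := mpW_good_eq h.mg.triv h.mg.le h.mg.good hα
  have hroot : ∀ a ∈ (mpW κ α).roots.toFinset, (mpW κ α).eval a = 0 := fun a ha =>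
    (mpW_roots_iff hα).1 (Multiset.mem_toFinset.1 ha)
  refine ⟨(mpW κ α).roots.toFinset, (mpW κ α).natDegree, q, b, α, hα,
    ⟨α, Multiset.mem_toFinset.2 ((mpW_roots_iff hα).2 (mpW_eval κ α))⟩, hq,
    fun a ha => root_mpW_mem_acl hα (hroot a ha), fun a ha => hb a (Multiset.mem_toFinset.1 ha), ?_,
    hb2 q hd, hyq, ?_, ?_⟩
  · intro a ha
    exact conj_stable h.mg.triv.natTriv (isoN_of_isClosed h.mg.isClosed h.nt) h.AM hT
      (acl_mono h.mg.le hα) (by rw [hM]; exact hroot a ha) (hq.mono inf_le_right) hyq hyT hTy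
  · intro j
    rw [hyq]
    exact orth h.mg.triv h.mg.good hα (hq.mono inf_le_right) hd j
  · intro f i hi
    obtain ⟨P, hP, hPf⟩ := exists_interp hs f
    rw [← hPf i (Multiset.mem_toFinset.1 hi)]
    rcases eq_or_ne (mpW κ α).natDegree 0 with h0 | h0
    · exact absurd h0 (mpW_natDegree_pos hα).ne'
    have hP' : P.natDegree < (mpW κ α).natDegree := by
      by_cases hP0 : P = 0
      · rw [hP0, natDegree_zero]; exact mpW_natDegree_pos hα
      · exact (natDegree_lt_iff_degree_lt hP0).2 hP
    rw [eval_eq_sum_range' hP']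
    apply Finset.sum_congr rfl
    intro j _
    rw [hb2 P hP j, mul_comm]
    congr 1
    apply Finset.sum_congr rfl
    intro a ha
    rw [hPf a (Multiset.mem_toFinset.1 ha)]

end Stp
end P7g

section P7h
variable {W : Type*} [NormedField W] [IsUltrametricDist W]

/-- the closure of an algebraically closed subfield is algebraically closed -/
theorem acl_topologicalClosure [IsAlgClosed W] {E : Subfield W} (hE : acl E = E) {w : W}
    (hw : w ∈ acl E.topologicalClosure) : w ∈ E.topologicalClosure := by
  classical
  set f := mpW E.topologicalClosure w with hf
  have hm : f.Monic := mpW_monic hw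
  have hd : 0 < f.natDegree := mpW_natDegree_pos hw
  have h0 : f.eval w = 0 := mpW_eval _ w
  have : w ∈ closure (E : Set W) := by
    apply mem_closure_of_approx
    intro ε hε
    -- approximate coefficients
    set B : ℝ := max 1 ‖w‖ with hB
    have hB1 : 1 ≤ B := le_max_left _ _
    set δ : ℝ := ε ^ f.natDegree / B ^ f.natDegree with hδ
    have hδ0 : 0 < δ := by positivity
    have happ : ∀ i, ∃ c ∈ E, ‖f.coeff i - c‖ < δ := fun i =>
      closure_approx (s := (E : Set W)) (mpW_polyIn E.topologicalClosure w i) hδ0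
    choose c hcE hc using happ
    set g : W[X] := X ^ f.natDegree + ∑ i ∈ Finset.range f.natDegree, C (c i) * X ^ i with hg
    have hdeg : (∑ i ∈ Finset.range f.natDegree, C (c i) * X ^ i : W[X]).degree < f.natDegree := by
      rw [degree_lt_iff_coeff_zero]
      intro k hk
      rw [finsetSum_coeff]
      apply Finset.sum_eq_zero
      intro i hi
      rw [coeff_C_mul, coeff_X_pow, if_neg, mul_zero]
      rintro rfl
      exact absurd (Finset.mem_range.1 hi) (not_lt.2 hk)
    have hgm : g.Monic := monic_X_pow_add hdeg
    have hgd : g.natDegree = f.natDegree := by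
      apply natDegree_eq_of_degree_eq_some
      rw [hg, degree_add_eq_left_of_degree_lt] <;> rw [degree_X_pow]
      exact hdeg
    have hgE : PolyIn E g := ((PolyIn.X E).pow _).add (PolyIn.sum fun i _ => (PolyIn.C (hcE i)).mul ((PolyIn.X E).pow i))
    have hval : ‖g.eval w‖ < ε ^ g.natDegree := by
      have e : g.eval w = ∑ i ∈ Finset.range f.natDegree, (c i - f.coeff i) * w ^ i := by
        have h1 : g.eval w = g.eval w - f.eval w := by rw [h0, sub_zero]
        rw [h1, eval_eq_sum_range (p := f), Finset.sum_range_succ, hm.coeff_natDegree, hg]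
        simp only [eval_add, eval_pow, eval_X, eval_finsetSum, eval_mul, eval_C]
        simp only [sub_mul, Finset.sum_sub_distrib]
        ring
      rw [e, hgd]
      apply um_sum_lt (by positivity)
      intro i hi
      rw [norm_mul, norm_pow, norm_sub_rev]
      have h2 : ‖w‖ ^ i ≤ B ^ f.natDegree :=
        (pow_le_pow_left₀ (norm_nonneg _) (le_max_right _ _) i).trans
          (pow_le_pow_right₀ hB1 (Finset.mem_range.1 hi).le)
      calc ‖f.coeff i - c i‖ * ‖w‖ ^ i ≤ ‖f.coeff i - c i‖ * B ^ f.natDegree := by gcongr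
        _ < δ * B ^ f.natDegree := by
          apply mul_lt_mul_of_pos_right (hc i); positivity
        _ = _ := by rw [hδ]; field_simp
    obtain ⟨a, ha, ha'⟩ := exists_root_near hgm hε.le hval
    refine ⟨a, ?_, ha'⟩
    have := mem_acl_iff.2 ⟨g, hgm.ne_zero, hgE, ha⟩
    rwa [hE] at this
  exact this

namespace Stp
variable {p : ℕ} [hp : ExpChar W p] [IsAlgClosed W] [CompleteSpace W] {κ M A : Subfield W} {x : W}
  (h : Stp p κ M A x)
include h

theorem case1 {w : W} (hw : w ∈ acl (adjF A {x})) (hwA : w ∉ acl A)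
    (hcl : w ∈ (acl A).topologicalClosure) (S : Finset W) (hS : ∀ s ∈ S, s ∈ nx M A x) :
    Nice A (nx M A x) S := by
  have hle : acl (adjF A {x}) ≤ (acl A).topologicalClosure := by
    intro z hz
    apply acl_topologicalClosure (acl_acl A)
    refine acl_mono ?_ (h.ctx.rk w hw hwA hz)
    exact adjF_le_iff.2 ⟨(acl A).le_topologicalClosure, by simpa using hcl⟩
  have hxn := mem_nx_self A h.xM
  obtain ⟨k, hk⟩ := h.sepS (y := x) S fun s hs => (hS s hs).1
  obtain ⟨y0, hy0, hy0A, hy0k⟩ := h.root_nx hxn h.xA k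
  refine ⟨y0, hy0, hy0A, hk y0 hy0k, fun z hz ε hε => ⟨y0, hy0, hy0A, mem_adjF_self A y0, ?_⟩⟩
  have hzn : z ∈ nx M A x := by
    have : adjF A (insert y0 (S : Set W)) ≤ nx M A x := adjF_le_iff.2
      ⟨A_le_nx h.AM x, Set.insert_subset hy0 fun s hs => hS s hs⟩
    exact this hz
  obtain ⟨c, hc, hlt⟩ := closure_approx (s := (acl A : Set W)) (hle hzn.1) hε
  obtain ⟨a, ha, hle'⟩ := comp_approx h.mg.triv h.mg.perf h.kA h.AM h.mg.good hzn.2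
    (c := c) (by rw [← h.acl_A]; exact hc)
  exact ⟨a, le_adjF A _ ha, hle'.trans_lt hlt⟩

theorem case4 (hI : Imm (acl κ) (acl A) (acl (adjF A {x}))) (S : Finset W) (hS : ∀ s ∈ S, s ∈ nx M A x) :
    Nice A (nx M A x) S := by
  have hp0 : p ≠ 0 := expChar_ne_zero W p
  refine h.nice_of (Co := fun y => y ∈ acl (adjF A {x}) ∧ y ∉ acl A) (fun y hy => hy) ?_ ?_ ?_ ?_
    (mem_nx_self A h.xM) ⟨(mem_nx_self A h.xM).1, h.notMem h.xM h.xA⟩ S hS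
  · intro hpp
    haveI : Fact p.Prime := ⟨hpp⟩
    haveI : CharP W p := by
      cases hp with
      | zero => exact absurd hpp Nat.not_prime_one
      | prime _ => assumption
    exact hI.as4
  · rintro y ξ k ⟨hy, hyA⟩ hξ e
    exact ⟨hξ, fun hc => hyA (e ▸ Subfield.pow_mem _ hc _)⟩
  · rintro T y hT ⟨hy, hyA⟩ hyT hTy
    obtain ⟨I, n, q, b, α, hα, hIne, hq, hIκ, hb, hst, hco, -, -, hinv⟩ :=
      h.lag hy (fun t ht => (hT ht).2) hyT hTy
    obtain ⟨j, hj1, hj2⟩ := hI.desc hy hyA hIne (ys := fun a => q.eval a) (n := n) (b := b)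
      (v := fun a j => a ^ j)
      (fun a ha => (hq.mono inf_le_left).eval (acl_mono (h.kA.trans (le_adjF A _)) (hIκ a ha)))
      (fun a ha => (hst a ha).1) (fun a ha => (hst a ha).2) hb
      (fun a ha j => by rw [norm_pow]; exact pow_le_one₀ (norm_nonneg _) (h.mg.triv.acl.le (hIκ a ha))) hinv
    rw [← hco j] at hj1 hj2
    exact ⟨q.coeff j, hq j, ⟨(hq j).1, hj1⟩, hj2⟩
  · rintro y0 hy0 ⟨hy0O, hy0A⟩ z hz hzM ε hε
    obtain ⟨G, hG, hlt⟩ := hI.approx hy0O hy0A hz hε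
    have hκ' : κ ≤ adjF A {y0} := h.kA.trans (le_adjF A _)
    have hGm : G.eval y0 ∈ adjF (adjF A {y0}) (acl κ : Set W) := by
      apply PolyIn.eval (hG.mono ?_) (le_adjF _ _ (mem_adjF_self A y0))
      rw [h.acl_A]
      exact adjF_mono (le_adjF A _) le_rfl
    obtain ⟨a, ha, hle⟩ := comp_approx h.mg.triv h.mg.perf hκ'
      (adjF_le_iff.2 ⟨h.AM, by simpa using hy0.2⟩) h.mg.good hzM hGm
    exact ⟨y0, hy0, fun hc => hy0A (le_acl A hc), mem_adjF_self A y0, a, ha, hle.trans_lt hlt⟩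

theorem fin3 {y0 : W} (hy0 : y0 ∈ nx M A x) (hB : Bad (acl A) y0) {z : W} (hz : z ∈ Ry (acl A) y0)
    (hzM : z ∈ M) {ε : ℝ} (hε : 0 < ε) :
    ∃ u ∈ nx M A x, u ∉ A ∧ y0 ∈ adjF A {u} ∧ ∃ a ∈ adjF A {u}, ‖z - a‖ < ε := by
  have hN := h.mg.triv.natTriv
  obtain ⟨v, hv, hlt⟩ := hB.approx hN (acl_acl A) hz hε
  have key : ∃ N : ℕ, (N : W) ≠ 0 ∧ ∀ u c : W, ∀ m : ℕ, (m : W) ≠ 0 → c ∈ A → y0 = c * u ^ (N * m) →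
      v ∈ adjF (adjF A {u}) (acl κ : Set W) := by
    clear hlt
    induction hv using AddSubmonoid.closure_induction with
    | mem w hw =>
      obtain ⟨n, hn, i, a, ha, e⟩ := hw
      have hn' : n ≠ 0 := by rintro rfl; simp at hn
      refine ⟨n, hn, fun u c m hm hc hy => ?_⟩
      have hu0 : u ≠ 0 := by
        rintro rfl
        have hm' : m ≠ 0 := by rintro rfl; simp at hm
        rw [zero_pow (mul_ne_zero hn' hm'), mul_zero] at hy
        exact hB.ne hy
      have hAle : acl A ≤ adjF (adjF A {u}) (acl κ : Set W) := by
        rw [h.acl_A]; exact adjF_mono (le_adjF A _) le_rfl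
      have h1 : w / u ^ ((m : ℤ) * i) ∈ acl (acl A) := by
        apply pow_mem_acl hn'
        have : (w / u ^ ((m : ℤ) * i)) ^ n = a * c ^ i := by
          rw [div_pow, e, hy, mul_zpow, ← zpow_natCast, ← zpow_natCast, ← zpow_mul, ← zpow_mul]
          have h3 : ((n * m : ℕ) : ℤ) * i = (m : ℤ) * i * n := by push_cast; ring
          rw [h3, ← mul_assoc]
          rw [mul_div_assoc, div_self (zpow_ne_zero _ hu0), mul_one]
        rw [this]
        exact le_acl _ (Subfield.mul_mem _ ha (Subfield.zpow_mem _ (le_acl A hc) i))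
      rw [acl_acl] at h1
      have h2 : w = w / u ^ ((m : ℤ) * i) * u ^ ((m : ℤ) * i) := by
        rw [div_mul_cancel₀ _ (zpow_ne_zero _ hu0)]
      rw [h2]
      exact Subfield.mul_mem _ (hAle h1) (Subfield.zpow_mem _ (le_adjF _ _ (mem_adjF_self A u)) _)
    | zero => exact ⟨1, by simp, fun _ _ _ _ _ _ => Subfield.zero_mem _⟩
    | add a b _ _ ha hb =>
      obtain ⟨n, hn, h1⟩ := ha
      obtain ⟨m, hm, h2⟩ := hb
      refine ⟨n * m, by push_cast; exact mul_ne_zero hn hm, fun u c k hk hc hy => Subfield.add_mem _ ?_ ?_⟩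
      · exact h1 u c (m * k) (by push_cast; exact mul_ne_zero hm hk) hc (by rw [hy, mul_assoc])
      · exact h2 u c (n * k) (by push_cast; exact mul_ne_zero hn hk) hc
          (by rw [hy]; congr 2; ring)
  obtain ⟨N, hN0, hkey⟩ := key
  have hN0' : N ≠ 0 := by rintro rfl; simp at hN0
  obtain ⟨m, hmM, hm⟩ := h.mg.norm_divisible hy0.2 hN0'
  have hy00 := hB.ne
  have hm0 : m ≠ 0 := by
    rintro rfl; rw [norm_zero, zero_pow hN0'] at hm
    exact hy00 (norm_eq_zero.1 hm.symm)
  have hq1 : ‖y0 / m ^ N‖ = 1 := by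
    rw [norm_div, norm_pow, hm, div_self (norm_ne_zero_iff.2 hy00)]
  obtain ⟨c, hc, hclt⟩ := h.mg.good _ (M.div_mem hy0.2 (M.pow_mem hmM N)) hq1.le
  have hc1 : ‖c‖ = 1 := by
    rw [← hq1]; apply um_eq_of_sub_lt; rw [hq1]; exact hclt
  have hc0 : c ≠ 0 := by intro h0; rw [h0] at hc1; simp at hc1
  have hunit : ‖y0 / m ^ N / c - 1‖ < 1 := by
    rw [div_sub_one hc0, norm_div, hc1, div_one]; exact hclt
  obtain ⟨t, ht, ht1, -⟩ := unit_root_exists hN hunit hN0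
  have htM : t ∈ M := unit_root_mem hN h.mg.isClosed ht1 hN0
    (by rw [ht]; exact M.div_mem (M.div_mem hy0.2 (M.pow_mem hmM N)) (h.mg.le hc))
  have hu : y0 = c * (m * t) ^ N := by
    rw [mul_pow, ht]; field_simp
  have hcA := h.kA hc
  have huM : m * t ∈ M := M.mul_mem hmM htM
  have hun : m * t ∈ nx M A x := by
    refine ⟨?_, huM⟩
    have h1 : m * t ∈ acl (acl (adjF A {x})) := by
      apply pow_mem_acl hN0'
      have : (m * t) ^ N = y0 / c := by rw [eq_div_iff hc0, mul_comm, ← hu]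
      rw [this]
      exact le_acl _ (Subfield.div_mem _ hy0.1 (le_acl _ (le_adjF A _ hcA)))
    rwa [acl_acl] at h1
  have hy0u : y0 ∈ adjF A {m * t} := by
    have : c * (m * t) ^ N ∈ adjF A {m * t} :=
      Subfield.mul_mem _ (le_adjF A _ hcA) (Subfield.pow_mem _ (mem_adjF_self A _) N)
    rwa [← hu] at this
  refine ⟨m * t, hun, ?_, hy0u, ?_⟩
  · intro hc'
    apply hB.notMem
    apply le_acl A
    rw [hu]; exact A.mul_mem hcA (A.pow_mem hc' N)
  · obtain ⟨a, ha, hle⟩ := comp_approx h.mg.triv h.mg.perf (h.kA.trans (le_adjF A _))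
      (adjF_le_iff.2 ⟨h.AM, by simpa using huM⟩) h.mg.good hzM
      (hkey (m * t) c 1 (by simp) hcA (by rw [mul_one]; exact hu))
    exact ⟨a, ha, hle.trans_lt hlt⟩

theorem case3 {w : W} (hw : w ∈ acl (adjF A {x})) (hwB : Bad (acl A) w)
    (S : Finset W) (hS : ∀ s ∈ S, s ∈ nx M A x) : Nice A (nx M A x) S := by
  have hp0 : p ≠ 0 := expChar_ne_zero W p
  have hκn : κ ≤ nx M A x := h.kA.trans (A_le_nx h.AM x)
  have hN := h.mg.triv.natTriv
  obtain ⟨x0, hx0, hx0n⟩ := comp_norm h.mg.triv h.mg.perf hκn (fun z hz => h.mg.good z hz.2)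
    (w := w) (by rw [← h.acl_nx']; exact hw)
  have hx0B : Bad (acl A) x0 := fun c hc hcn => hwB c hc (hcn.trans hx0n)
  refine h.nice_of (Co := fun y => y ∈ acl (adjF A {x}) ∧ Bad (acl A) y)
    (fun y hy => ⟨hy.1, hy.2.notMem⟩) ?_ ?_ ?_ ?_ hx0 ⟨hx0.1, hx0B⟩ S hS
  · intro hpp
    haveI : Fact p.Prime := ⟨hpp⟩
    haveI : CharP W p := by
      cases hp with
      | zero => exact absurd hpp Nat.not_prime_one
      | prime _ => assumption
    exact Bad.as3 h.ctx
  · rintro y ξ k ⟨hy, hyA⟩ hξ e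
    refine ⟨hξ, fun c hc hcn => hyA (c ^ p ^ k) (Subfield.pow_mem _ hc _) ?_⟩
    rw [← e, norm_pow, norm_pow, hcn]
  · rintro T y hT ⟨hy, hyB⟩ hyT hTy
    obtain ⟨I, n, q, b, α, hα, hIne, hq, hIκ, hb, hst, hco, hyq, hqle, -⟩ :=
      h.lag hy (fun t ht => (hT ht).2) hyT hTy
    have hypos : 0 < ‖y‖ := norm_pos_iff.2 hyB.ne
    obtain ⟨j, hj⟩ : ∃ j, ‖q.coeff j‖ = ‖y‖ := by
      by_contra! hc
      have : ‖y‖ < ‖y‖ := by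
        conv_lhs => rw [hyq, eval_eq_sum_range]
        apply um_sum_lt hypos
        intro i _
        rw [norm_mul, norm_pow]
        exact (mul_le_of_le_one_right (norm_nonneg _)
          (pow_le_one₀ (norm_nonneg _) (h.mg.triv.acl.le hα))).trans_lt (lt_of_le_of_ne (hqle i) (hc i))
      exact lt_irrefl _ this
    have hqR : q.coeff j ∈ Ry (acl A) y := by
      rw [hco j]
      exact Subfield.sum_mem _ fun a ha => Subfield.mul_mem _ (hst a ha).1
        (le_Ry _ _ (acl_mono h.kA (hb a ha j)))
    have hr1 : ‖q.coeff j / y‖ = 1 := by rw [norm_div, hj, div_self hypos.ne']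
    obtain ⟨c, hc, hclt⟩ := h.ctx.good_mono (h.ctx.Ry_le_cl hy) _
      (Subfield.div_mem _ hqR (mem_Ry _ _)) hr1.le
    have hc1 : ‖c‖ = 1 := by
      rw [← hr1]; apply um_eq_of_sub_lt; rw [hr1]; exact hclt
    have hc0 : c ≠ 0 := by intro h0; rw [h0] at hc1; simp at hc1
    have hcA : c ∈ acl A := acl_mono h.kA hc
    refine ⟨q.coeff j, hq j, ⟨(hq j).1, fun d hd hdn => hyB d hd (hdn.trans hj)⟩, ?_⟩
    apply hyB.lin3 hN (acl_acl A) (Rt_isClosed _) (Rt_PC _) (le_Ry _ _) (T := q.coeff j / c)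
    · exact Subfield.div_mem _ (mem_Ry _ _) (le_Ry _ _ hcA)
    · exact Subfield.div_mem _ hqR (le_Ry _ _ hcA)
    · have e : q.coeff j / c - y = (q.coeff j / y - c) * (y / c) := by
        have := hyB.ne
        field_simp
      rw [e, norm_mul, norm_div, hc1, div_one]
      exact mul_lt_of_lt_one_left hypos hclt
  · rintro y0 hy0 ⟨hy0O, hy0B⟩ z hz hzM ε hε
    exact h.fin3 hy0 hy0B hz hzM hε

theorem nice (S : Finset W) (hS : ∀ s ∈ S, s ∈ nx M A x) : Nice A (nx M A x) S := by
  by_cases h3 : ∃ w ∈ acl (adjF A {x}), Bad (acl A) w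
  · obtain ⟨w, hw, hB⟩ := h3
    exact h.case3 hw hB S hS
  by_cases h1 : ∃ w ∈ acl (adjF A {x}), w ∉ acl A ∧ w ∈ (acl A).topologicalClosure
  · obtain ⟨w, hw, hwA, hcl⟩ := h1
    exact h.case1 hw hwA hcl S hS
  refine h.case4 { h.ctx with imm := ?_, far := ?_ } S hS
  · intro w hw hw0
    have : ¬ Bad (acl A) w := fun hc => h3 ⟨w, hw, hc⟩
    unfold Bad at this
    push Not at this
    obtain ⟨a, ha, han⟩ := this
    have ha0 : a ≠ 0 := by rw [← norm_pos_iff, han]; exact norm_pos_iff.2 hw0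
    have hr1 : ‖w / a‖ = 1 := by rw [norm_div, han, div_self (norm_ne_zero_iff.2 hw0)]
    obtain ⟨c, hc, hclt⟩ := h.ctx.good _ (Subfield.div_mem _ hw (h.ctx.lo ha)) hr1.le
    refine ⟨c * a, Subfield.mul_mem _ (h.ctx.le hc) ha, ?_⟩
    have e : w - c * a = (w / a - c) * a := by field_simp
    rw [e, norm_mul, ← han]
    exact mul_lt_of_lt_one_left (norm_pos_iff.2 ha0) hclt
  · intro w hw hwA
    by_contra! hc
    apply h1
    refine ⟨w, hw, hwA, ?_⟩
    exact mem_closure_of_approx (s := (acl A : Set W)) fun ε hε => hc ε hε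

end Stp
end P7h

section P8a

/-- the henselian property used in the proof -/
def Hens {F : Type*} [Field F] (O : ValuationSubring F) : Prop :=
  ∀ q : F[X], (∀ k, O.valuation (q.coeff k) < 1) →
    ∃ V, O.valuation V ≤ 1 ∧ 1 + V + V ^ 2 * q.eval V = 0

theorem Hens.newton {F : Type*} [Field F] {O : ValuationSubring F} (hO : Hens O) (f : F[X]) (t : F)
    (h1 : (taylor t f).coeff 1 ≠ 0)
    (h2 : ∀ k, 2 ≤ k → O.valuation ((taylor t f).coeff k * (taylor t f).coeff 0 ^ (k - 1) /
      (taylor t f).coeff 1 ^ k) < 1) :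
    ∃ ζ, f.eval ζ = 0 ∧ O.valuation (ζ - t) ≤ O.valuation ((taylor t f).coeff 0 / (taylor t f).coeff 1) := by
  set g := taylor t f with hg
  set a := g.coeff 0
  set b := g.coeff 1
  let q : F[X] := ∑ k ∈ Finset.range g.natDegree, C (g.coeff (k + 2) * a ^ (k + 1) / b ^ (k + 2)) * X ^ k
  have hq : ∀ k, O.valuation (q.coeff k) < 1 := by
    intro k
    have : q.coeff k = if k < g.natDegree then g.coeff (k + 2) * a ^ (k + 1) / b ^ (k + 2) else 0 := by
      simp [q, finsetSum_coeff, coeff_X_pow]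
    rw [this]
    split_ifs
    · exact h2 (k + 2) (by omega)
    · simp
  obtain ⟨V, hV, hV0⟩ := hO q hq
  refine ⟨t + a / b * V, ?_, ?_⟩
  · have e : f.eval (t + a / b * V) = g.eval (a / b * V) := by
      rw [hg, taylor_eval, add_comm]
    have e2 : g.eval (a / b * V) = a * (1 + V + V ^ 2 * q.eval V) := by
      rw [eval_eq_sum_range' (n := g.natDegree + 2) (by omega), Finset.sum_range_succ',
        Finset.sum_range_succ']
      have : ∀ k, g.coeff (k + 1 + 1) * (a / b * V) ^ (k + 1 + 1) =
          a * (V ^ 2 * (g.coeff (k + 2) * a ^ (k + 1) / b ^ (k + 2) * V ^ k)) := by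
        intro k
        rw [mul_pow, div_pow]
        ring
      simp only [this, ← Finset.mul_sum]
      simp only [q, eval_finsetSum, eval_mul, eval_C, eval_pow, eval_X]
      have hb : g.coeff (0 + 1) * (a / b * V) ^ (0 + 1) = a * V := by
        change b * (a / b * V) ^ (0 + 1) = a * V
        rw [zero_add, pow_one]
        field_simp
      rw [hb]
      generalize (∑ k ∈ Finset.range g.natDegree, (_ : F)) = Z
      change _ + a * V + a * _ = _
      ring
    rw [e, e2, hV0, mul_zero]
  · rw [add_sub_cancel_left, map_mul]
    exact mul_le_of_le_one_right' hV

/-- homs defined on the image of a ring hom -/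
theorem exists_lift_range {R W F : Type*} [CommRing R] [Field W] [Field F] (φ : R →+* W) (θ : R →+* F)
    (h : ∀ r, φ r = 0 → θ r = 0) : ∃ (B : Subring W) (hB : ∀ r, φ r ∈ B) (ψ : B →+* F),
      ∀ r, ψ ⟨φ r, hB r⟩ = θ r := by
  let f := φ.rangeRestrict
  have hf : Function.Surjective f := φ.rangeRestrict_surjective
  refine ⟨φ.range, fun r => ⟨r, rfl⟩, (f.liftOfRightInverse _ (Function.rightInverse_surjInv hf)) ⟨θ, ?_⟩, ?_⟩
  · intro r hr
    apply h
    exact congrArg Subtype.val hr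
  · intro r
    exact f.liftOfRightInverse_comp_apply _ (Function.rightInverse_surjInv hf) ⟨θ, _⟩ r

theorem exists_lift_inv {W F : Type*} [Field W] [Field F] (B : Subring W) (ψ : B →+* F) :
    ∃ (B' : Subring W) (h : B ≤ B') (ψ' : B' →+* F), (∀ b : B, ψ' (Subring.inclusion h b) = ψ b) ∧
      ∀ b : B, ψ b ≠ 0 → (b : W)⁻¹ ∈ B' := by
  haveI : (RingHom.ker ψ).IsPrime := RingHom.ker_isPrime ψ
  refine ⟨_, LocalSubring.le_ofPrime B (RingHom.ker ψ), IsLocalization.lift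
    (M := (RingHom.ker ψ).primeCompl) (S := (LocalSubring.ofPrime B (RingHom.ker ψ)).toSubring) (g := ψ) ?_, ?_, ?_⟩
  · rintro ⟨y, hy⟩
    exact IsUnit.mk0 _ hy
  · intro b
    exact IsLocalization.lift_eq _ b
  · intro b hb
    have hu := IsLocalization.map_units (LocalSubring.ofPrime B (RingHom.ker ψ)).toSubring
      (⟨b, hb⟩ : (RingHom.ker ψ).primeCompl)
    obtain ⟨c, hc⟩ := hu.exists_right_inv
    have h2 : (b : W) * (c : W) = 1 := congrArg Subtype.val hc
    have : (b : W)⁻¹ = c := inv_eq_of_mul_eq_one_right h2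
    rw [this]
    exact c.2

universe u w
/-- transfer of the finite set `S` over the field `A`; `m` is the set of small elements -/
def TrS {W : Type u} [Field W] (m : Set W) (A : Subfield W) (S : Finset W) : Prop :=
  ∃ T : Finset W, (∀ t ∈ T, t ∈ A) ∧ ∀ A0 : Subring W, A0 ≤ A.toSubring → (∀ t ∈ T, t ∈ A0) →
    ∀ (F : Type w) [Field F] (O : ValuationSubring F), Hens O → O ≠ ⊤ → ∀ i : A0 →+* F,
      (∀ t : A0, (t : W) ∈ T → (t : W) ∈ m → O.valuation (i t) < 1) →
      ∃ (B : Subring W) (h : A0 ≤ B) (ψ : B →+* F), (∀ a : A0, ψ (Subring.inclusion h a) = i a) ∧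
        (∀ s ∈ S, s ∈ B) ∧ ∀ s : B, (s : W) ∈ S → (s : W) ∈ m → O.valuation (ψ s) < 1

theorem TrS.of_mem {W : Type u} [Field W] {m : Set W} {A : Subfield W} {S : Finset W}
    (h : ∀ s ∈ S, s ∈ A) : TrS.{u, w} m A S :=
  ⟨S, h, fun A0 _ hT F _ O _ _ i hi => ⟨A0, le_rfl, i, fun _ => rfl, hT, hi⟩⟩

theorem TrS.trans {W : Type u} [Field W] {m : Set W} {A A1 : Subfield W} (hA : A ≤ A1) {S : Finset W}
    (h : TrS.{u, w} m A1 S) (h' : ∀ T : Finset W, (∀ t ∈ T, t ∈ A1) → TrS.{u, w} m A T) :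
    TrS.{u, w} m A S := by
  obtain ⟨T1, hT1, h1⟩ := h
  obtain ⟨T, hT, h2⟩ := h' T1 hT1
  refine ⟨T, hT, fun A0 hA0 hTA F _ O hO hO' i hi => ?_⟩
  obtain ⟨B, hB, ψ, e1, e2, e3⟩ := h2 A0 hA0 hTA F O hO hO' i hi
  let B1 : Subring W := B ⊓ A1.toSubring
  have hB1 : B1 ≤ B := inf_le_left
  obtain ⟨D, hD, χ, c1, c2, c3⟩ := h1 B1 inf_le_right (fun t ht => ⟨e2 t ht, hT1 t ht⟩) F O hO hO'
    (ψ.comp (Subring.inclusion hB1)) (fun t ht htm => e3 ⟨t.1, t.2.1⟩ ht htm)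
  have hAB : A0 ≤ B1 := le_inf hB (hA0.trans hA)
  refine ⟨D, hAB.trans hD, χ, fun a => ?_, c2, c3⟩
  rw [← e1 a]
  exact c1 (Subring.inclusion hAB a)

theorem TrS.mono_set {W : Type u} [Field W] {m : Set W} {A : Subfield W} {S S' : Finset W}
    (h : TrS.{u, w} m A S) (hS : S' ⊆ S) : TrS.{u, w} m A S' := by
  obtain ⟨T, hT, h1⟩ := h
  refine ⟨T, hT, fun A0 hA0 hTA F _ O hO hO' i hi => ?_⟩
  obtain ⟨B, hB, ψ, e1, e2, e3⟩ := h1 A0 hA0 hTA F O hO hO' i hi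
  exact ⟨B, hB, ψ, e1, fun s hs => e2 s (hS hs), fun s hs => e3 s (hS hs)⟩

/-- lifting polynomials to subrings -/
theorem exists_lift_poly {W : Type*} [Field W] {A0 : Subring W} {f : W[X]} (h : ∀ i, f.coeff i ∈ A0) :
    ∃ f0 : A0[X], f0.map A0.subtype = f := by
  have := (lifts_iff_coeff_lifts (f := A0.subtype) f).2 (fun n => ⟨⟨_, h n⟩, rfl⟩)
  exact (mem_lifts _).1 this

theorem coeff_mem_of_coeffs {W : Type*} [Field W] {A0 : Subring W} {f : W[X]}
    (h : ∀ c ∈ f.coeffs, c ∈ A0) (i : ℕ) : f.coeff i ∈ A0 := by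
  by_cases h0 : f.coeff i = 0
  · rw [h0]; exact A0.zero_mem
  · exact h _ (coeff_mem_coeffs h0)

end P8a

section P8b
universe u w
variable {W : Type u} [NormedField W] [IsUltrametricDist W]

theorem prod_cmp (m : Multiset W) {s c : W} {l : ℝ} (h0 : 0 ≤ l) (h : ∀ b ∈ m, l * ‖s - b‖ ≤ ‖c - b‖) :
    l ^ m.card * ‖(m.map fun a => s - a).prod‖ ≤ ‖(m.map fun a => c - a).prod‖ := by
  induction m using Multiset.induction with
  | empty => simp
  | cons a m ih =>
    simp only [Multiset.map_cons, Multiset.prod_cons, Multiset.card_cons, norm_mul]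
    have h1 := ih fun b hb => h b (Multiset.mem_cons_of_mem hb)
    have h2 := h a (Multiset.mem_cons_self a m)
    calc l ^ (m.card + 1) * (‖s - a‖ * ‖(m.map fun a => s - a).prod‖)
        = (l * ‖s - a‖) * (l ^ m.card * ‖(m.map fun a => s - a).prod‖) := by ring
      _ ≤ _ := mul_le_mul h2 h1 (by positivity) (norm_nonneg _)

/-- specialisation property of a transcendental element -/
def Spec (A : Subfield W) (x : W) : Prop :=
  ∀ J : Finset (W[X] × W[X]), (∀ j ∈ J, PolyIn A j.1 ∧ PolyIn A j.2 ∧ ‖j.1.eval x‖ < ‖j.2.eval x‖) →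
    ∃ T : Finset W, (∀ t ∈ T, t ∈ A) ∧ ∀ A0 : Subring W, A0 ≤ A.toSubring → (∀ t ∈ T, t ∈ A0) →
      (∀ j ∈ J, ∀ i, j.1.coeff i ∈ A0 ∧ j.2.coeff i ∈ A0) →
      ∀ (F : Type w) [Field F] (O : ValuationSubring F), Hens O → O ≠ ⊤ → ∀ i : A0 →+* F,
      (∀ t : A0, (t : W) ∈ T → ‖(t : W)‖ < 1 → O.valuation (i t) < 1) →
      ∃ η : F, ∀ g h : A0[X], (g.map A0.subtype, h.map A0.subtype) ∈ J →
        O.valuation ((g.map i).eval η) < O.valuation ((h.map i).eval η)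

theorem Spec.trS {A : Subfield W} {x : W} (hx : x ∉ acl A) (h : Spec.{u, w} A x) (S : Finset W)
    (hS : ∀ s ∈ S, s ∈ adjF A {x}) : TrS.{u, w} {y | ‖y‖ < 1} A S := by
  classical
  have h1 : ∀ s : W, ∃ g h : W[X], s ∈ S → PolyIn A g ∧ PolyIn A h ∧ h.eval x ≠ 0 ∧ s = g.eval x / h.eval x := by
    intro s
    by_cases hs : s ∈ S
    · obtain ⟨g, h, hg, hh, e⟩ := mem_adjF_singleton.1 (hS s hs)
      by_cases h0 : h.eval x = 0
      · refine ⟨0, 1, fun _ => ⟨PolyIn.zero A, PolyIn.one A, by simp, ?_⟩⟩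
        rw [e, h0]; simp
      · exact ⟨g, h, fun _ => ⟨hg, hh, h0, e⟩⟩
    · exact ⟨0, 0, fun h => absurd h hs⟩
  choose g h' hgh using h1
  let J : Finset (W[X] × W[X]) := S.image (fun s => (0, h' s)) ∪ (S.filter fun s => ‖s‖ < 1).image fun s => (g s, h' s)
  have hJ : ∀ j ∈ J, PolyIn A j.1 ∧ PolyIn A j.2 ∧ ‖j.1.eval x‖ < ‖j.2.eval x‖ := by
    intro j hj
    rcases Finset.mem_union.1 hj with hj | hj
    · obtain ⟨s, hs, rfl⟩ := Finset.mem_image.1 hj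
      obtain ⟨a, b, c, d⟩ := hgh s hs
      refine ⟨PolyIn.zero A, b, ?_⟩
      simpa using c
    · obtain ⟨s, hs, rfl⟩ := Finset.mem_image.1 hj
      obtain ⟨hs, hs1⟩ := Finset.mem_filter.1 hs
      obtain ⟨a, b, c, d⟩ := hgh s hs
      refine ⟨a, b, ?_⟩
      rw [d, norm_div, div_lt_one (norm_pos_iff.2 c)] at hs1
      exact hs1
  obtain ⟨T, hT, hsp⟩ := h J hJ
  let T' : Finset W := T ∪ S.biUnion fun s => (g s).coeffs ∪ (h' s).coeffs
  have hco : ∀ {f : W[X]}, PolyIn A f → ∀ c ∈ f.coeffs, c ∈ A := by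
    intro f hf c hc
    obtain ⟨n, -, rfl⟩ := mem_coeffs_iff.1 hc
    exact hf n
  refine ⟨T', ?_, ?_⟩
  · intro t ht
    rcases Finset.mem_union.1 ht with ht | ht
    · exact hT t ht
    · obtain ⟨s, hs, ht⟩ := Finset.mem_biUnion.1 ht
      obtain ⟨a, b, c, d⟩ := hgh s hs
      rcases Finset.mem_union.1 ht with ht | ht
      · exact hco a t ht
      · exact hco b t ht
  intro A0 hA0 hTA F _ O hO hO' i hi
  have hg0 : ∀ s ∈ S, ∀ k, (g s).coeff k ∈ A0 := fun s hs => coeff_mem_of_coeffs fun c hc => hTA c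
    (Finset.mem_union_right _ (Finset.mem_biUnion.2 ⟨s, hs, Finset.mem_union_left _ hc⟩))
  have hh0 : ∀ s ∈ S, ∀ k, (h' s).coeff k ∈ A0 := fun s hs => coeff_mem_of_coeffs fun c hc => hTA c
    (Finset.mem_union_right _ (Finset.mem_biUnion.2 ⟨s, hs, Finset.mem_union_right _ hc⟩))
  obtain ⟨η, hη⟩ := hsp A0 hA0 (fun t ht => hTA t (Finset.mem_union_left _ ht)) (by
    intro j hj k
    rcases Finset.mem_union.1 hj with hj | hj
    · obtain ⟨s, hs, rfl⟩ := Finset.mem_image.1 hj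
      exact ⟨by simp, hh0 s hs k⟩
    · obtain ⟨s, hs, rfl⟩ := Finset.mem_image.1 hj
      exact ⟨hg0 s (Finset.mem_filter.1 hs).1 k, hh0 s (Finset.mem_filter.1 hs).1 k⟩) F O hO hO' i
    (fun t ht ht1 => hi t (Finset.mem_union_left _ ht) ht1)
  obtain ⟨B, hB, ψ, hψ⟩ := exists_lift_range (eval₂RingHom A0.subtype x) (eval₂RingHom i η) (by
    intro r hr
    have : r = 0 := by
      by_contra h0
      apply hx
      refine mem_acl_iff.2 ⟨r.map A0.subtype, ?_, fun k => ?_, ?_⟩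
      · exact (Polynomial.map_ne_zero_iff A0.subtype_injective).2 h0
      · rw [coeff_map]; exact hA0 (r.coeff k).2
      · rw [eval_map]; exact hr
    rw [this, map_zero])
  obtain ⟨B', hBB, ψ', hψ', hinv⟩ := exists_lift_inv B ψ
  have hAB : A0 ≤ B := fun a ha => by simpa using hB (C ⟨a, ha⟩)
  have key : ∀ s ∈ S, ∃ G H : B, ψ H ≠ 0 ∧ s = (G : W) / H ∧ (‖s‖ < 1 → O.valuation (ψ G) < O.valuation (ψ H)) := by
    intro s hs
    obtain ⟨a, b, c, d⟩ := hgh s hs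
    obtain ⟨g0, hg0⟩ := exists_lift_poly (hg0 s hs)
    obtain ⟨h0, hh0⟩ := exists_lift_poly (hh0 s hs)
    refine ⟨⟨_, hB g0⟩, ⟨_, hB h0⟩, ?_, ?_, ?_⟩
    · rw [hψ]
      have := hη 0 h0 (by
        rw [Polynomial.map_zero, hh0]
        exact Finset.mem_union_left _ (Finset.mem_image_of_mem _ hs))
      simp only [Polynomial.map_zero, eval_zero, map_zero] at this
      have h3 := (Valuation.ne_zero_iff _).1 this.ne'
      rwa [eval_map] at h3
    · change s = eval₂ A0.subtype x g0 / eval₂ A0.subtype x h0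
      rw [← eval_map, ← eval_map, hg0, hh0]; exact d
    · intro hs1
      rw [hψ, hψ]
      have := hη g0 h0 (by
        rw [hg0, hh0]
        exact Finset.mem_union_right _ (Finset.mem_image.2 ⟨s, Finset.mem_filter.2 ⟨hs, hs1⟩, rfl⟩))
      simpa only [eval_map, coe_eval₂RingHom] using this
  refine ⟨B', hAB.trans hBB, ψ', ?_, ?_, ?_⟩
  · intro a
    have e1 := hψ' (Subring.inclusion hAB a)
    have e2 := hψ (C a)
    have e3 : (⟨_, hB (C a)⟩ : B) = Subring.inclusion hAB a := Subtype.ext (by simp)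
    rw [e3] at e2
    simp only [coe_eval₂RingHom, eval₂_C] at e2
    rw [← e2, ← e1]; rfl
  · intro s hs
    obtain ⟨G, H, hH, e, -⟩ := key s hs
    rw [e, div_eq_mul_inv]
    exact B'.mul_mem (hBB G.2) (hinv H hH)
  · intro s hs hs1
    obtain ⟨G, H, hH, e, hlt⟩ := key s hs
    have hH0 : (H : W) ≠ 0 := by
      intro h0
      apply hH
      have : H = 0 := Subtype.ext h0
      rw [this, map_zero]
    have e1 : s * Subring.inclusion hBB H = Subring.inclusion hBB G := Subtype.ext (by
      change (s : W) * (H : W) = G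
      rw [e]; field_simp)
    have e2 := congrArg ψ' e1
    rw [map_mul, hψ', hψ'] at e2
    have := hlt hs1
    rw [← e2, map_mul] at this
    by_contra hc
    rw [not_lt] at hc
    exact absurd this (not_lt.2 (le_mul_of_one_le_left' hc))

theorem exists_small {F : Type*} [Field F] {O : ValuationSubring F} (hO : O ≠ ⊤) (Q : Finset (F × F)) :
    ∃ η : F, η ≠ 0 ∧ O.valuation η < 1 ∧ ∀ q ∈ Q, q.2 ≠ 0 → O.valuation (η * q.1) < O.valuation q.2 := by
  classical
  obtain ⟨e, he0, he1⟩ : ∃ e : F, e ≠ 0 ∧ O.valuation e < 1 := by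
    obtain ⟨y, hy⟩ : ∃ y, y ∉ O := by
      by_contra! hc
      exact hO (top_le_iff.1 fun y _ => hc y)
    rw [← O.valuation_le_one_iff, not_le] at hy
    have hy0 : y ≠ 0 := by rintro rfl; simp at hy
    refine ⟨y⁻¹, inv_ne_zero hy0, ?_⟩
    rw [map_inv₀]
    exact inv_lt_one_of_one_lt₀ hy
  induction Q using Finset.induction with
  | empty => exact ⟨e, he0, he1, by simp⟩
  | insert q Q hq ih =>
    obtain ⟨η, h0, h1, h2⟩ := ih
    by_cases hb : q.2 ≠ 0 → O.valuation (η * q.1) < O.valuation q.2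
    · refine ⟨η, h0, h1, ?_⟩
      intro r hr hr0
      rcases Finset.mem_insert.1 hr with rfl | hr
      · exact hb hr0
      · exact h2 r hr hr0
    push Not at hb
    obtain ⟨hc0, hb⟩ := hb
    have hb0 : η * q.1 ≠ 0 := by
      intro hz
      rw [hz, map_zero, le_zero_iff] at hb
      exact hc0 ((map_eq_zero _).1 hb)
    set X := e * (q.2 / (η * q.1)) with hX
    have hle : O.valuation (q.2 / (η * q.1)) ≤ 1 := by
      rw [map_div₀]
      exact div_le_one_of_le₀ hb zero_le
    have hX1 : O.valuation X < 1 := by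
      rw [hX, map_mul]; exact mul_lt_one_of_lt_of_le he1 hle
    refine ⟨X * η, mul_ne_zero (mul_ne_zero he0 (div_ne_zero hc0 hb0)) h0, ?_, ?_⟩
    · rw [map_mul]; exact mul_lt_one_of_lt_of_le hX1 h1.le
    · intro r hr hr0
      rcases Finset.mem_insert.1 hr with rfl | hr
      · have : X * η * r.1 = e * r.2 := by
          rw [hX, mul_assoc, mul_assoc, div_mul_cancel₀ _ hb0]
        rw [this, map_mul]
        exact mul_lt_of_lt_one_left (zero_lt_iff.2 ((Valuation.ne_zero_iff _).2 hr0)) he1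
      · rw [mul_assoc, map_mul]
        exact lt_of_le_of_lt (mul_le_of_le_one_left' hX1.le) (h2 r hr hr0)

end P8b

section P8c
universe u w
variable {W : Type u} [NormedField W] [IsUltrametricDist W]

theorem norm_eval_triv {A : Subfield W} (hA : TrivN A) {x : W} (hx0 : x ≠ 0) (hx : ‖x‖ < 1) {g : W[X]}
    (hg : PolyIn A g) (h0 : g ≠ 0) : ‖g.eval x‖ = ‖x‖ ^ g.natTrailingDegree := by
  have hxp := norm_pos_iff.2 hx0
  have hc : g.coeff g.natTrailingDegree ≠ 0 := by
    have := trailingCoeff_nonzero_iff_nonzero.2 h0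
    exact this
  rw [eval_eq_sum_range]
  rw [um_sum_eq (j := g.natTrailingDegree)]
  · rw [norm_mul, norm_pow, hA _ (hg _) hc, one_mul]
  · exact Finset.mem_range.2 (Nat.lt_succ_of_le (natTrailingDegree_le_natDegree g))
  · intro k hk hkn
    rw [norm_mul, norm_mul, norm_pow, norm_pow, hA _ (hg _) hc, one_mul]
    rcases lt_or_gt_of_ne hkn with h | h
    · rw [coeff_eq_zero_of_lt_natTrailingDegree h]
      simpa using pow_pos hxp _
    · calc ‖g.coeff k‖ * ‖x‖ ^ k ≤ 1 * ‖x‖ ^ k := by gcongr; exact hA.le (hg _)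
        _ < _ := by rw [one_mul]; exact pow_lt_pow_right_of_lt_one₀ hxp hx h

theorem spec_triv {A : Subfield W} (hA : TrivN A) {x : W} (hx0 : x ≠ 0) (hx : ‖x‖ < 1) : Spec.{u, w} A x := by
  classical
  intro J hJ
  refine ⟨J.image fun j => (j.2.coeff j.2.natTrailingDegree)⁻¹, ?_, ?_⟩
  · intro t ht
    obtain ⟨j, hj, rfl⟩ := Finset.mem_image.1 ht
    exact A.inv_mem ((hJ j hj).2.1 _)
  intro A0 hA0 hTA hJA F _ O hO hO' i hi
  let i' : W → F := fun y => if h : y ∈ A0 then i ⟨y, h⟩ else 0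
  let Q : Finset (F × F) := J.biUnion fun j => (Finset.range (j.1.natDegree + 1 + (j.2.natDegree + 1))).image
      (fun k => (i' (j.1.coeff k), i' (j.2.coeff j.2.natTrailingDegree))) ∪
      (Finset.range (j.1.natDegree + 1 + (j.2.natDegree + 1))).image
      (fun k => (i' (j.2.coeff k), i' (j.2.coeff j.2.natTrailingDegree)))
  obtain ⟨η, h0, h1, h2⟩ := exists_small hO' Q
  refine ⟨η, fun g h hgh => ?_⟩
  obtain ⟨hg, hh, hlt⟩ := hJ _ hgh
  dsimp only at hg hh hlt
  set G := g.map A0.subtype with hG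
  set H := h.map A0.subtype with hH
  have hH0 : H ≠ 0 := by
    rintro h0
    rw [h0, eval_zero, norm_zero] at hlt
    exact absurd hlt (not_lt.2 (norm_nonneg _))
  set n := H.natTrailingDegree with hn
  have hHc : H.coeff n ≠ 0 := trailingCoeff_nonzero_iff_nonzero.2 hH0
  have hlt' : ∀ k, k ≤ n → G.coeff k = 0 := by
    intro k hk
    by_cases hG0 : G = 0
    · rw [hG0, coeff_zero]
    rw [norm_eval_triv hA hx0 hx hg hG0, norm_eval_triv hA hx0 hx hh hH0] at hlt
    have : n < G.natTrailingDegree := by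
      by_contra hc
      rw [not_lt] at hc
      exact absurd hlt (not_lt.2 (pow_le_pow_of_le_one (norm_nonneg _) hx.le hc))
    exact coeff_eq_zero_of_lt_natTrailingDegree (hk.trans_lt this)
  have hiG : ∀ k, i' (G.coeff k) = i (g.coeff k) := by
    intro k
    have e : G.coeff k = (g.coeff k : W) := by rw [hG, coeff_map]; rfl
    have : G.coeff k ∈ A0 := by rw [e]; exact (g.coeff k).2
    simp only [i', this, dif_pos]
    congr 1
    exact Subtype.ext e
  have hiH : ∀ k, i' (H.coeff k) = i (h.coeff k) := by
    intro k
    have e : H.coeff k = (h.coeff k : W) := by rw [hH, coeff_map]; rfl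
    have : H.coeff k ∈ A0 := by rw [e]; exact (h.coeff k).2
    simp only [i', this, dif_pos]
    congr 1
    exact Subtype.ext e
  have hb0 : i (h.coeff n) ≠ 0 := by
    have hm : (H.coeff n)⁻¹ ∈ A0 := hTA _ (Finset.mem_image.2 ⟨_, hgh, rfl⟩)
    have e : h.coeff n * ⟨_, hm⟩ = 1 := Subtype.ext (by
      change (h.coeff n : W) * (H.coeff n)⁻¹ = 1
      have e : H.coeff n = (h.coeff n : W) := by rw [hH, coeff_map]; rfl
      rw [← e]; exact mul_inv_cancel₀ hHc)
    have := congrArg i e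
    rw [map_mul, map_one] at this
    exact left_ne_zero_of_mul_eq_one this
  set c := i (h.coeff n) with hc
  have hgd : g.natDegree = G.natDegree := (natDegree_map_eq_of_injective A0.subtype_injective g).symm
  have hhd : h.natDegree = H.natDegree := (natDegree_map_eq_of_injective A0.subtype_injective h).symm
  have hq1 : ∀ k, O.valuation (η * i (g.coeff k)) < O.valuation c := by
    intro k
    by_cases hk : k ≤ g.natDegree
    · have := h2 (i' (G.coeff k), i' (H.coeff n)) (Finset.mem_biUnion.2 ⟨_, hgh, Finset.mem_union_left _
        (Finset.mem_image.2 ⟨k, Finset.mem_range.2 (by dsimp only; omega), rfl⟩)⟩)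
      simp only [hiG, hiH] at this
      exact this hb0
    · rw [coeff_eq_zero_of_natDegree_lt (not_le.1 hk), map_zero, mul_zero, map_zero]
      exact zero_lt_iff.2 ((Valuation.ne_zero_iff _).2 hb0)
  have hq2 : ∀ k, O.valuation (η * i (h.coeff k)) < O.valuation c := by
    intro k
    by_cases hk : k ≤ h.natDegree
    · have := h2 (i' (H.coeff k), i' (H.coeff n)) (Finset.mem_biUnion.2 ⟨_, hgh, Finset.mem_union_right _
        (Finset.mem_image.2 ⟨k, Finset.mem_range.2 (by dsimp only; omega), rfl⟩)⟩)
      simp only [hiH] at this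
      exact this hb0
    · rw [coeff_eq_zero_of_natDegree_lt (not_le.1 hk), map_zero, mul_zero, map_zero]
      exact zero_lt_iff.2 ((Valuation.ne_zero_iff _).2 hb0)
  have hη : O.valuation η ≠ 0 := (Valuation.ne_zero_iff _).2 h0
  have hterm : ∀ b : F, O.valuation (η * b) < O.valuation c → ∀ k, n < k →
      O.valuation (b * η ^ k) < O.valuation (c * η ^ n) := by
    intro b hb k hk
    obtain ⟨l, rfl⟩ := Nat.exists_eq_add_of_lt hk
    have e : b * η ^ (n + l + 1) = (η * b) * η ^ n * η ^ l := by ring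
    rw [e, map_mul, map_mul O.valuation c, map_mul O.valuation (η * b)]
    calc _ ≤ O.valuation (η * b) * O.valuation (η ^ n) := by
          apply mul_le_of_le_one_right'
          rw [map_pow]; exact pow_le_one' h1.le _
      _ < _ := by
          apply mul_lt_mul_of_pos_right hb
          rw [map_pow]; exact pow_pos (zero_lt_iff.2 hη) _
  have hcn : O.valuation (c * η ^ n) ≠ 0 := (Valuation.ne_zero_iff _).2 (mul_ne_zero hb0 (pow_ne_zero _ h0))
  have hgc : ∀ k, k ≤ n → g.coeff k = 0 := by
    intro k hk
    have := hlt' k hk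
    rw [hG, coeff_map] at this
    exact A0.subtype_injective (this.trans (map_zero _).symm)
  have hhc : ∀ k, k < n → h.coeff k = 0 := by
    intro k hk
    have := coeff_eq_zero_of_lt_natTrailingDegree (p := H) hk
    rw [hH, coeff_map] at this
    exact A0.subtype_injective (this.trans (map_zero _).symm)
  have hL : O.valuation ((g.map i).eval η) < O.valuation (c * η ^ n) := by
    rw [eval_map, eval₂_eq_sum_range]
    apply Valuation.map_sum_lt _ hcn
    intro k _
    by_cases hk : k ≤ n
    · rw [hgc k hk]; simpa using zero_lt_iff.2 hcn
    · exact hterm _ (hq1 k) k (not_le.1 hk)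
  have hR : O.valuation ((h.map i).eval η) = O.valuation (c * η ^ n) := by
    rw [eval_map, eval₂_eq_sum_range, ← Finset.add_sum_erase _ _ (a := n)]
    · apply Valuation.map_add_eq_of_lt_left
      apply Valuation.map_sum_lt _ hcn
      intro k hk
      rcases lt_or_gt_of_ne (Finset.ne_of_mem_erase hk) with h' | h'
      · rw [hhc k h']; simpa using zero_lt_iff.2 hcn
      · exact hterm _ (hq2 k) k h'
    · rw [Finset.mem_range, hhd]
      exact Nat.lt_succ_of_le (natTrailingDegree_le_natDegree H)
  rw [hR]; exact hL

theorem spec_near [IsAlgClosed W] {A : Subfield W} {x : W}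
    (hn : ∀ Bs : Finset W, (∀ b ∈ Bs, b ∈ acl A) → ∀ l : ℝ, 0 < l → l < 1 → ∃ η ∈ A, ∀ b ∈ Bs,
      l * ‖x - b‖ ≤ ‖η - b‖ ∧ ‖η - b‖ ≤ ‖x - b‖) : Spec.{u, w} A x := by
  classical
  intro J hJ
  obtain ⟨l, hl0, hl1, hlJ⟩ : ∃ l : ℝ, 0 < l ∧ l < 1 ∧ ∀ j ∈ J,
      ‖j.1.eval x‖ < l ^ j.2.roots.card * ‖j.2.eval x‖ := by
    have h1 : ∀ᶠ l : ℝ in nhdsWithin 1 (Set.Iio 1), ∀ j ∈ J, ‖j.1.eval x‖ < l ^ j.2.roots.card * ‖j.2.eval x‖ := by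
      rw [Filter.eventually_all_finset]
      intro j hj
      apply Filter.Eventually.filter_mono nhdsWithin_le_nhds
      apply Tendsto.eventually_const_lt (hJ j hj).2.2
      have : Continuous fun l : ℝ => l ^ j.2.roots.card * ‖j.2.eval x‖ := by fun_prop
      have := this.tendsto 1
      simpa using this
    have h2 : ∀ᶠ l : ℝ in nhdsWithin 1 (Set.Iio 1), l < 1 := self_mem_nhdsWithin
    have h3 : ∀ᶠ l : ℝ in nhdsWithin 1 (Set.Iio 1), 0 < l :=
      Filter.Eventually.filter_mono nhdsWithin_le_nhds (lt_mem_nhds one_pos)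
    obtain ⟨l, ⟨a, b⟩, c⟩ := ((h1.and h2).and h3).exists
    exact ⟨l, c, b, a⟩
  obtain ⟨η, hη, hB⟩ := hn (J.biUnion fun j => j.1.roots.toFinset ∪ j.2.roots.toFinset) (by
    intro b hb
    obtain ⟨j, hj, hb⟩ := Finset.mem_biUnion.1 hb
    rcases Finset.mem_union.1 hb with hb | hb <;> rw [Multiset.mem_toFinset] at hb
    · exact mem_acl_iff.2 ⟨_, ne_zero_of_mem_roots hb, (hJ j hj).1, (mem_roots'.1 hb).2⟩
    · exact mem_acl_iff.2 ⟨_, ne_zero_of_mem_roots hb, (hJ j hj).2.1, (mem_roots'.1 hb).2⟩) l hl0 hl1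
  have hlt : ∀ j ∈ J, ‖j.1.eval η‖ < ‖j.2.eval η‖ := by
    intro j hj
    have e1 : ‖j.1.eval η‖ ≤ ‖j.1.eval x‖ := by
      rw [eval_eq_prod_roots_sub, eval_eq_prod_roots_sub j.1 x, norm_mul, norm_mul]
      have := prod_cmp j.1.roots (s := η) (c := x) zero_le_one (fun b hb => by
        rw [one_mul]
        exact (hB b (Finset.mem_biUnion.2 ⟨j, hj, Finset.mem_union_left _ (Multiset.mem_toFinset.2 hb)⟩)).2)
      rw [one_pow, one_mul] at this
      gcongr
    have e2 : l ^ j.2.roots.card * ‖j.2.eval x‖ ≤ ‖j.2.eval η‖ := by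
      rw [eval_eq_prod_roots_sub, eval_eq_prod_roots_sub j.2 η, norm_mul, norm_mul]
      have := prod_cmp j.2.roots (s := x) (c := η) hl0.le (fun b hb =>
        (hB b (Finset.mem_biUnion.2 ⟨j, hj, Finset.mem_union_right _ (Multiset.mem_toFinset.2 hb)⟩)).1)
      rw [mul_left_comm]
      gcongr
    exact e1.trans_lt ((hlJ j hj).trans_le e2)
  refine ⟨insert η (J.image (fun j => (j.2.eval η)⁻¹) ∪ J.image fun j => j.1.eval η / j.2.eval η), ?_, ?_⟩
  · intro t ht
    rcases Finset.mem_insert.1 ht with rfl | ht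
    · exact hη
    rcases Finset.mem_union.1 ht with ht | ht <;> obtain ⟨j, hj, rfl⟩ := Finset.mem_image.1 ht
    · exact A.inv_mem ((hJ j hj).2.1.eval hη)
    · exact A.div_mem ((hJ j hj).1.eval hη) ((hJ j hj).2.1.eval hη)
  intro A0 hA0 hTA hJA F _ O hO hO' i hi
  have hηA : η ∈ A0 := hTA _ (Finset.mem_insert_self _ _)
  refine ⟨i ⟨η, hηA⟩, fun g h hgh => ?_⟩
  have ev : ∀ g : A0[X], (g.map i).eval (i ⟨η, hηA⟩) = i (g.eval ⟨η, hηA⟩) := fun g => by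
    rw [eval_map, eval₂_at_apply]
  have ev2 : ∀ g : A0[X], (g.map A0.subtype).eval η = (g.eval ⟨η, hηA⟩ : A0) := fun g => by
    rw [eval_map]; exact eval₂_at_apply A0.subtype (⟨η, hηA⟩ : A0)
  have hlt' := hlt _ hgh
  dsimp only at hlt'
  have hm1 : ((h.map A0.subtype).eval η)⁻¹ ∈ A0 := hTA _ (Finset.mem_insert_of_mem (Finset.mem_union_left _
    (Finset.mem_image.2 ⟨_, hgh, rfl⟩)))
  have hm2' : (g.map A0.subtype).eval η / (h.map A0.subtype).eval η ∈ insert η (J.image (fun j => (j.2.eval η)⁻¹) ∪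
      J.image fun j => j.1.eval η / j.2.eval η) := Finset.mem_insert_of_mem (Finset.mem_union_right _
    (Finset.mem_image.2 ⟨_, hgh, rfl⟩))
  have hm2 := hTA _ hm2'
  have hne : (h.map A0.subtype).eval η ≠ 0 := by
    intro h0
    rw [h0, norm_zero] at hlt'
    exact absurd hlt' (not_lt.2 (norm_nonneg _))
  have hs := hi ⟨_, hm2⟩ hm2' (by
    change ‖_ / _‖ < 1
    rw [norm_div]; exact (div_lt_one (norm_pos_iff.2 hne)).2 hlt')
  have e1 : h.eval ⟨η, hηA⟩ * ⟨_, hm1⟩ = 1 := Subtype.ext (by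
    change ((h.eval ⟨η, hηA⟩ : A0) : W) * _ = 1
    rw [← ev2]; exact mul_inv_cancel₀ hne)
  have e2 : (⟨_, hm2⟩ : A0) * h.eval ⟨η, hηA⟩ = g.eval ⟨η, hηA⟩ := Subtype.ext (by
    change _ * ((h.eval ⟨η, hηA⟩ : A0) : W) = ((g.eval ⟨η, hηA⟩ : A0) : W)
    rw [← ev2, ← ev2]; exact div_mul_cancel₀ _ hne)
  have e1' := congrArg i e1
  rw [map_mul, map_one] at e1'
  rw [ev, ev, ← e2, map_mul, map_mul]
  exact mul_lt_of_lt_one_left (zero_lt_iff.2 ((Valuation.ne_zero_iff _).2 (left_ne_zero_of_mul_eq_one e1'))) hs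

end P8c

section P8d
universe u w
variable {W : Type u} [NormedField W] [IsUltrametricDist W]

theorem exists_primitive_sep {E : Subfield W} (S : Finset W) (hS : ∀ s ∈ S, SepOver E s) :
    ∃ z ∈ adjF E (S : Set W), SepOver E z ∧ ∀ s ∈ S, s ∈ adjF E {z} := by
  let L := IntermediateField.adjoin E (S : Set W)
  haveI : FiniteDimensional E L := IntermediateField.finiteDimensional_adjoin
    (fun x hx => (mem_acl_iff_isAlgebraic.1 (hS x hx).1).isIntegral)
  haveI : Algebra.IsSeparable E L := (IntermediateField.isSeparable_adjoin_iff_isSeparable E W).2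
    fun x hx => (hS x hx).minpoly
  obtain ⟨α, hα⟩ := Field.exists_primitive_element E L
  refine ⟨α, mem_adjF_iff_adjoin.2 α.2, ⟨?_, ?_⟩, ?_⟩
  · rw [mem_acl_iff_isAlgebraic]
    have : IsAlgebraic E α := Algebra.IsAlgebraic.isAlgebraic _
    exact this.algebraMap
  · have h1 : (minpoly E α).Separable := Algebra.IsSeparable.isSeparable E α
    have h2 : minpoly E (α : W) = minpoly E α := minpoly.algebraMap_eq (algebraMap L W).injective α
    unfold mpW
    rw [h2]
    exact Polynomial.Separable.map h1
  · intro x hx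
    rw [mem_adjF_iff_adjoin]
    have hxE : x ∈ L := IntermediateField.subset_adjoin _ _ hx
    have h1 : (⟨x, hxE⟩ : L) ∈ IntermediateField.adjoin E {α} := hα ▸ IntermediateField.mem_top
    have h2 : x ∈ (IntermediateField.adjoin E {α}).map L.val := ⟨⟨x, hxE⟩, h1, rfl⟩
    rw [IntermediateField.adjoin_map] at h2
    simpa using h2

/-- Newton conditions at an approximate root -/
def NC (q : W[X]) (h : W → W[X]) (S : Finset W) (t : W) : Prop :=
  (taylor t q).coeff 1 ≠ 0 ∧
  (∀ k, 2 ≤ k → ‖(taylor t q).coeff k * (taylor t q).coeff 0 ^ (k - 1) / (taylor t q).coeff 1 ^ k‖ < 1) ∧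
  ∀ s ∈ S, ‖s‖ < 1 → ∀ k, ‖(taylor t (h s)).coeff k * ((taylor t q).coeff 0 / (taylor t q).coeff 1) ^ k‖ < 1

theorem tay_tendsto (q : W[X]) (z : W) (k : ℕ) :
    Tendsto (fun t => (taylor t q).coeff k) (nhds z) (nhds ((taylor z q).coeff k)) := by
  simp only [taylor_coeff]
  exact (hasseDeriv k q).continuous.tendsto z

theorem NC_eventually {q : W[X]} {h : W → W[X]} {S : Finset W} {z : W} (h0 : q.eval z = 0)
    (h1 : q.derivative.eval z ≠ 0) (hh : ∀ s ∈ S, (h s).eval z = s) : ∀ᶠ t in nhds z, NC q h S t := by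
  have c0 : (taylor z q).coeff 0 = 0 := by rw [taylor_coeff_zero, h0]
  have c1 : (taylor z q).coeff 1 ≠ 0 := by rwa [taylor_coeff_one]
  refine Filter.Eventually.and ?_ (Filter.Eventually.and ?_ ?_)
  · exact (tay_tendsto q z 1).eventually_ne c1
  · have : ∀ᶠ t in nhds z, ∀ k ∈ Finset.range (q.natDegree + 1), 2 ≤ k →
        ‖(taylor t q).coeff k * (taylor t q).coeff 0 ^ (k - 1) / (taylor t q).coeff 1 ^ k‖ < 1 := by
      rw [Filter.eventually_all_finset]
      intro k _
      by_cases hk : 2 ≤ k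
      · simp only [hk, forall_true_left]
        have := (((tay_tendsto q z k).mul ((tay_tendsto q z 0).pow (k - 1))).div
          ((tay_tendsto q z 1).pow k) (pow_ne_zero _ c1)).norm
        rw [c0, zero_pow (by omega), mul_zero, zero_div, norm_zero] at this
        exact this.eventually_lt_const one_pos
      · simp [hk]
    filter_upwards [this] with t ht k hk
    by_cases hkn : k ∈ Finset.range (q.natDegree + 1)
    · exact ht k hkn hk
    · rw [coeff_eq_zero_of_natDegree_lt (n := k)]
      · simp
      · rw [natDegree_taylor]
        simpa using hkn
  · rw [Filter.eventually_all_finset]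
    intro s hs
    by_cases hs1 : ‖s‖ < 1
    · simp only [hs1, forall_true_left]
      have : ∀ᶠ t in nhds z, ∀ k ∈ Finset.range ((h s).natDegree + 1),
          ‖(taylor t (h s)).coeff k * ((taylor t q).coeff 0 / (taylor t q).coeff 1) ^ k‖ < 1 := by
        rw [Filter.eventually_all_finset]
        intro k _
        have := ((tay_tendsto (h s) z k).mul (((tay_tendsto q z 0).div (tay_tendsto q z 1) c1).pow k)).norm
        rw [c0, zero_div] at this
        refine this.eventually_lt_const ?_
        rcases Nat.eq_zero_or_pos k with rfl | hk
        · rw [taylor_coeff_zero, hh s hs, pow_zero, mul_one]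
          exact hs1
        · rw [zero_pow hk.ne', mul_zero, norm_zero]
          exact one_pos
      filter_upwards [this] with t ht k
      by_cases hkn : k ∈ Finset.range ((h s).natDegree + 1)
      · exact ht k hkn
      · rw [coeff_eq_zero_of_natDegree_lt (n := k)]
        · simp
        · rw [natDegree_taylor]
          simpa using hkn
    · simp [hs1]

theorem NC.trS {E : Subfield W} {S : Finset W} {z t : W} {h : W → W[X]} (hz : z ∈ acl E)
    (hh : ∀ s ∈ S, PolyIn E (h s) ∧ (h s).eval z = s) (ht : t ∈ E) (hN : NC (mpW E z) h S t) :
    TrS.{u, w} {y | ‖y‖ < 1} E S := by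
  classical
  set q := mpW E z with hq
  have hqE : PolyIn E q := mpW_polyIn E z
  obtain ⟨n1, n2, n3⟩ := hN
  let c : ℕ → W := fun k => (taylor t q).coeff k * (taylor t q).coeff 0 ^ (k - 1) / (taylor t q).coeff 1 ^ k
  let d : W → ℕ → W := fun s k => (taylor t (h s)).coeff k * ((taylor t q).coeff 0 / (taylor t q).coeff 1) ^ k
  let T : Finset W := {t, ((taylor t q).coeff 1)⁻¹} ∪ q.coeffs ∪ (S.biUnion fun s => (h s).coeffs) ∪
    (Finset.range (q.natDegree + 1)).image c ∪ S.biUnion fun s => (Finset.range ((h s).natDegree + 1)).image (d s)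
  have hqt : PolyIn E (taylor t q) := hqE.taylor ht
  have hco : ∀ {f : W[X]}, PolyIn E f → ∀ c ∈ f.coeffs, c ∈ E := by
    intro f hf c hc
    obtain ⟨n, -, rfl⟩ := mem_coeffs_iff.1 hc
    exact hf n
  refine ⟨T, ?_, ?_⟩
  · intro y hy
    simp only [T, Finset.mem_union, Finset.mem_insert, Finset.mem_singleton, Finset.mem_biUnion,
      Finset.mem_image] at hy
    rcases hy with (((((rfl | rfl) | hy) | ⟨s, hs, hy⟩) | ⟨k, -, rfl⟩) | ⟨s, hs, k, -, rfl⟩)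
    · exact ht
    · exact E.inv_mem (hqt 1)
    · exact hco hqE y hy
    · exact hco (hh s hs).1 y hy
    · exact E.div_mem (E.mul_mem (hqt k) (E.pow_mem (hqt 0) _)) (E.pow_mem (hqt 1) _)
    · exact E.mul_mem (((hh s hs).1.taylor ht) k) (E.pow_mem (E.div_mem (hqt 0) (hqt 1)) _)
  intro A0 hA0 hTA F _ O hO hO' i hi
  have hT1 : t ∈ A0 := hTA t (by simp [T])
  have hT2 : ((taylor t q).coeff 1)⁻¹ ∈ A0 := hTA _ (by simp [T])
  have hT3 : ∀ k, q.coeff k ∈ A0 := coeff_mem_of_coeffs fun c hc => hTA c (by simp [T, hc])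
  have hT4 : ∀ s ∈ S, ∀ k, (h s).coeff k ∈ A0 := fun s hs => coeff_mem_of_coeffs fun c hc => hTA c (by
    simp only [T, Finset.mem_union, Finset.mem_biUnion]
    exact Or.inl (Or.inl (Or.inr ⟨s, hs, hc⟩)))
  have hT5 : ∀ k, k ≤ q.natDegree → c k ∈ T := fun k hk => by
    simp only [T, Finset.mem_union, Finset.mem_image, Finset.mem_range]
    exact Or.inl (Or.inr ⟨k, by omega, rfl⟩)
  have hT6 : ∀ s ∈ S, ∀ k, k ≤ (h s).natDegree → d s k ∈ T := fun s hs k hk => by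
    simp only [T, Finset.mem_union, Finset.mem_image, Finset.mem_range, Finset.mem_biUnion]
    exact Or.inr ⟨s, hs, k, by omega, rfl⟩
  obtain ⟨q0, hq0⟩ := exists_lift_poly hT3
  set t0 : A0 := ⟨t, hT1⟩ with ht0
  have tay : ∀ f : A0[X], ∀ k, ((taylor t0 f).coeff k : W) = (taylor t (f.map A0.subtype)).coeff k := by
    intro f k
    have := map_taylor f t0 A0.subtype
    have h2 : A0.subtype t0 = t := rfl
    rw [← h2, ← this, coeff_map]; rfl
  have tayF : ∀ f : A0[X], ∀ k, (taylor (i t0) (f.map i)).coeff k = i ((taylor t0 f).coeff k) := by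
    intro f k
    rw [← map_taylor, coeff_map]
  set a : ℕ → A0 := fun k => (taylor t0 q0).coeff k with ha
  have haW : ∀ k, (a k : W) = (taylor t q).coeff k := fun k => by rw [ha]; dsimp only; rw [tay, hq0]
  have ha1 : i (a 1) ≠ 0 := by
    have e : a 1 * ⟨_, hT2⟩ = 1 := Subtype.ext (by
      change (a 1 : W) * _ = 1
      rw [haW]; exact mul_inv_cancel₀ n1)
    have := congrArg i e
    rw [map_mul, map_one] at this
    exact left_ne_zero_of_mul_eq_one this
  have hz0 : ∀ k, q.natDegree < k → a k = 0 := fun k hk => Subtype.ext (by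
    rw [haW]
    exact coeff_eq_zero_of_natDegree_lt (by rwa [natDegree_taylor]))
  obtain ⟨ζ, hζ, hζv⟩ := hO.newton (q0.map i) (i t0) (by rw [tayF]; exact ha1) (by
    intro k hk
    rw [tayF, tayF, tayF]
    change O.valuation (i (a k) * i (a 0) ^ (k - 1) / i (a 1) ^ k) < 1
    by_cases hkn : k ≤ q.natDegree
    · have hm := hT5 k hkn
      have hlt := hi ⟨_, hTA _ hm⟩ hm (n2 k hk)
      have e : (⟨_, hTA _ hm⟩ : A0) * a 1 ^ k = a k * a 0 ^ (k - 1) := Subtype.ext (by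
        change c k * (a 1 : W) ^ k = (a k : W) * (a 0 : W) ^ (k - 1)
        rw [haW, haW, haW]
        exact div_mul_cancel₀ _ (pow_ne_zero _ n1))
      have e' := congrArg i e
      simp only [map_mul, map_pow] at e'
      rw [← e', mul_div_cancel_right₀ _ (pow_ne_zero _ ha1)]
      exact hlt
    · rw [hz0 k (not_le.1 hkn)]; simp)
  rw [tayF, tayF] at hζv
  change O.valuation (ζ - i t0) ≤ O.valuation (i (a 0) / i (a 1)) at hζv
  have hqm : q.Monic := mpW_monic hz
  have hq0m : q0.Monic := by
    apply monic_of_injective A0.subtype_injective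
    rw [hq0]; exact hqm
  obtain ⟨B, hB, ψ, hψ⟩ := exists_lift_range (eval₂RingHom A0.subtype z) (eval₂RingHom i ζ) (by
    intro r hr
    have hr0 : r %ₘ q0 = 0 := by
      have e : (r.map A0.subtype) %ₘ q = (r %ₘ q0).map A0.subtype := by
        rw [map_modByMonic _ hq0m, hq0]
      have hP : PolyIn E ((r %ₘ q0).map A0.subtype) := fun k => by
        rw [coeff_map]; exact hA0 ((r %ₘ q0).coeff k).2
      have hev : ((r %ₘ q0).map A0.subtype).eval z = 0 := by
        rw [← e, modByMonic_eq_sub_mul_div, eval_sub, eval_mul, hq, mpW_eval, zero_mul, sub_zero, eval_map]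
        exact hr
      have hdvd := mpW_dvd hP hev
      have hz0 : (r %ₘ q0).map A0.subtype = 0 := by
        apply eq_zero_of_dvd_of_degree_lt hdvd
        rw [← e]
        exact degree_modByMonic_lt _ hqm
      exact (Polynomial.map_eq_zero_iff A0.subtype_injective).1 hz0
    have hr2 : r = q0 * (r /ₘ q0) := by
      have := modByMonic_add_div r q0
      rw [hr0, zero_add] at this
      exact this.symm
    rw [hr2, map_mul]
    have : eval₂RingHom i ζ q0 = 0 := by
      rw [coe_eval₂RingHom, ← eval_map]; exact hζ
    rw [this, zero_mul])
  have hAB : A0 ≤ B := fun a ha => by simpa using hB (C ⟨a, ha⟩)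
  have key : ∀ s ∈ S, ∃ h0 : A0[X], h0.map A0.subtype = h s ∧ eval₂RingHom A0.subtype z h0 = s := by
    intro s hs
    obtain ⟨h0, hh0⟩ := exists_lift_poly (hT4 s hs)
    refine ⟨h0, hh0, ?_⟩
    rw [coe_eval₂RingHom, ← eval_map, hh0]; exact (hh s hs).2
  refine ⟨B, hAB, ψ, ?_, ?_, ?_⟩
  · intro a
    have e2 := hψ (C a)
    have e3 : (⟨_, hB (C a)⟩ : B) = Subring.inclusion hAB a := Subtype.ext (by simp)
    rw [e3] at e2
    simpa only [coe_eval₂RingHom, eval₂_C] using e2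
  · intro s hs
    obtain ⟨h0, -, e⟩ := key s hs
    rw [← e]; exact hB h0
  · rintro ⟨s, hsB⟩ hs hs1
    dsimp only at hs hs1
    obtain ⟨h0, hh0, e⟩ := key s hs
    have e3 : (⟨_, hB h0⟩ : B) = ⟨s, hsB⟩ := Subtype.ext e
    rw [← e3, hψ, coe_eval₂RingHom, ← eval_map]
    have e4 : (h0.map i).eval ζ = (taylor (i t0) (h0.map i)).eval (ζ - i t0) := by
      rw [taylor_eval_sub]
    rw [e4, eval_eq_sum_range]
    apply Valuation.map_sum_lt _ one_ne_zero
    intro k _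
    rw [tayF]
    by_cases hkn : k ≤ (h s).natDegree
    · have hm := hT6 s hs k hkn
      have hlt := hi ⟨_, hTA _ hm⟩ hm (n3 s hs hs1 k)
      have e : (⟨_, hTA _ hm⟩ : A0) * a 1 ^ k = (taylor t0 h0).coeff k * a 0 ^ k := Subtype.ext (by
        change d s k * (a 1 : W) ^ k = ((taylor t0 h0).coeff k : W) * (a 0 : W) ^ k
        rw [haW, haW, tay, hh0]
        simp only [d]
        rw [div_pow, mul_assoc, div_mul_cancel₀ _ (pow_ne_zero _ n1)])
      have e' := congrArg i e
      simp only [map_mul, map_pow] at e'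
      refine lt_of_le_of_lt ?_ hlt
      have e5 : i ⟨d s k, hTA _ hm⟩ = i ((taylor t0 h0).coeff k) * (i (a 0) / i (a 1)) ^ k := by
        rw [div_pow, ← mul_div_assoc, eq_div_iff (pow_ne_zero _ ha1)]
        exact e'
      rw [e5, map_mul, map_mul, map_pow, map_pow]
      gcongr
    · have : (taylor t0 h0).coeff k = 0 := Subtype.ext (by
        rw [tay, hh0]
        exact coeff_eq_zero_of_natDegree_lt (by rw [natDegree_taylor]; exact not_le.1 hkn))
      rw [this]; simp

theorem exists_newton [IsAlgClosed W] {E : Subfield W} (S : Finset W) (hS : ∀ s ∈ S, SepOver E s) :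
    ∃ z ∈ adjF E (S : Set W), ∃ ε : ℝ, 0 < ε ∧ ∀ E' : Subfield W, E ≤ E' → ∀ t ∈ E', ‖z - t‖ < ε →
      TrS.{u, w} {y | ‖y‖ < 1} E' S := by
  classical
  obtain ⟨z, hz, hzs, hzS⟩ := exists_primitive_sep S hS
  set f := mpW E z with hf
  have hfm : f.Monic := mpW_monic hzs.1
  have hh : ∀ s : W, ∃ g : W[X], s ∈ S → PolyIn E g ∧ g.eval z = s := by
    intro s
    by_cases hs : s ∈ S
    · obtain ⟨g, hg, -, e⟩ := mem_adjF_of_root hfm (mpW_polyIn E z) (mpW_eval E z) (hzS s hs)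
      exact ⟨g, fun _ => ⟨hg, e.symm⟩⟩
    · exact ⟨0, fun h => absurd h hs⟩
  choose h hh using hh
  let Q : Finset W[X] := (f.roots.powerset.map fun m => (m.map fun a => X - C a).prod).toFinset
  have hev : ∀ᶠ t in nhds z, ∀ q ∈ Q, q.eval z = 0 → q.derivative.eval z ≠ 0 → NC q h S t := by
    rw [Filter.eventually_all_finset]
    intro q _
    by_cases h1 : q.eval z = 0 ∧ q.derivative.eval z ≠ 0
    · filter_upwards [NC_eventually h1.1 h1.2 (fun s hs => (hh s hs).2)] with t ht _ _ using ht
    · filter_upwards with t a b using absurd ⟨a, b⟩ h1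
  obtain ⟨ε, hε, hball⟩ := Metric.eventually_nhds_iff.1 hev
  refine ⟨z, hz, ε, hε, fun E' hE t ht hzt => ?_⟩
  have hz' : z ∈ acl E' := acl_mono hE hzs.1
  have hqm : (mpW E' z).Monic := mpW_monic hz'
  have hdvd : mpW E' z ∣ f := mpW_dvd_mpW hE z
  refine NC.trS hz' (fun s hs => ⟨(hh s hs).1.mono hE, (hh s hs).2⟩) ht
    (hball (by rwa [dist_comm, dist_eq_norm]) _ ?_ (mpW_eval E' z) ?_)
  · rw [Multiset.mem_toFinset, Multiset.mem_map]
    refine ⟨(mpW E' z).roots, Multiset.mem_powerset.2 (roots.le_of_dvd hfm.ne_zero hdvd), ?_⟩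
    have := (IsAlgClosed.splits (mpW E' z)).eq_prod_roots
    rw [hqm.leadingCoeff, C_1, one_mul] at this
    exact this.symm
  · have hsep : (mpW E' z).Separable := hzs.2.of_dvd hdvd
    have := hsep.eval₂_derivative_ne_zero (RingHom.id W) (x := z) (by rw [eval₂_id]; exact mpW_eval E' z)
    rwa [eval₂_id] at this

end P8d

section P8e
universe u w
variable {W : Type u} [NormedField W] [IsUltrametricDist W]

namespace Stp
variable {p : ℕ} [hp : ExpChar W p] [IsAlgClosed W] [CompleteSpace W] {κ M A : Subfield W} {x : W}
  (h : Stp p κ M A x)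
include h

theorem dense_norm (hg : ∃ g ∈ A, 1 < ‖g‖) {s r : ℝ} (hs : 0 < s) (hsr : s < r) :
    ∃ e ∈ A, s < ‖e‖ ∧ ‖e‖ < r := by
  obtain ⟨g, hgA, hg1⟩ := hg
  obtain ⟨n, hn⟩ := pow_unbounded_of_one_lt ‖g‖ ((one_lt_div hs).2 hsr)
  have hn0 : n ≠ 0 := by
    rintro rfl
    rw [pow_zero] at hn
    linarith
  obtain ⟨γ, hγ⟩ := IsAlgClosed.exists_pow_nat_eq g (Nat.pos_of_ne_zero hn0)
  have hγA : γ ∈ _root_.acl A := pow_mem_acl hn0 (by rw [hγ]; exact le_acl A hgA)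
  have h1 : ‖γ‖ < r / s := by
    apply lt_of_pow_lt_pow_left₀ n (div_pos (hs.trans hsr) hs).le
    rwa [← norm_pow, hγ]
  have h2 : 1 < ‖γ‖ := by
    apply lt_of_pow_lt_pow_left₀ n (norm_nonneg _)
    rwa [← norm_pow, hγ, one_pow]
  obtain ⟨k, hk1, hk2⟩ := exists_mem_Ico_zpow hs h2
  have hk3 : ‖γ‖ ^ (k + 1) < r := by
    rw [zpow_add_one₀ (by positivity)]
    calc ‖γ‖ ^ k * ‖γ‖ ≤ s * ‖γ‖ := by gcongr
      _ < s * (r / s) := by gcongr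
      _ = r := by field_simp
  have hz : γ ^ (k + 1) ∈ adjF A (_root_.acl κ : Set W) := by
    rw [← h.acl_A]
    exact zpow_mem hγA _
  obtain ⟨m, hm, e⟩ := comp_norm h.mg.triv h.mg.perf h.kA (fun z hz => h.mg.good z (h.AM hz)) hz
  exact ⟨m, hm, by rw [e, norm_zpow]; exact hk2, by rw [e, norm_zpow]; exact hk3⟩

theorem near (hg : ∃ g ∈ A, 1 < ‖g‖) : Spec.{u, w} A x := by
  classical
  apply spec_near
  intro Bs hBs l hl0 hl1
  have happ : ∀ b ∈ Bs, ∃ a ∈ A, ‖x - a‖ ≤ ‖x - b‖ := by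
    intro b hb
    have hb' := hBs b hb
    rw [h.acl_A] at hb'
    exact comp_approx h.mg.triv h.mg.perf h.kA h.AM h.mg.good h.xM hb'
  by_cases hatt : ∃ a ∈ A, ∀ a' ∈ A, ‖x - a‖ ≤ ‖x - a'‖
  · obtain ⟨a, ha, hmin⟩ := hatt
    set r := ‖x - a‖ with hr
    have hr0 : 0 < r := by
      rw [hr, norm_pos_iff, sub_ne_zero]
      rintro rfl
      exact h.xA ha
    obtain ⟨s, hsr, hls, hs⟩ : ∃ s, s < r ∧ l * r < s ∧ ∀ b ∈ Bs, ‖a - b‖ < r → ‖a - b‖ < s := by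
      have h1 : ∀ᶠ s : ℝ in nhdsWithin r (Set.Iio r), l * r < s ∧ ∀ b ∈ Bs, ‖a - b‖ < r → ‖a - b‖ < s := by
        apply Filter.Eventually.filter_mono nhdsWithin_le_nhds
        apply (lt_mem_nhds (by nlinarith)).and
        rw [Filter.eventually_all_finset]
        intro b hb
        by_cases hbr : ‖a - b‖ < r
        · filter_upwards [lt_mem_nhds hbr] with s hs _ using hs
        · exact Filter.Eventually.of_forall fun s hc => absurd hc hbr
      obtain ⟨s, hs⟩ := (h1.and self_mem_nhdsWithin).exists
      exact ⟨s, hs.2, hs.1⟩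
    obtain ⟨e, he, he1, he2⟩ := h.dense_norm hg ((mul_pos hl0 hr0).trans hls) hsr
    refine ⟨a + e, add_mem ha he, fun b hb => ?_⟩
    have hxb : r ≤ ‖x - b‖ := by
      obtain ⟨a', ha', hle⟩ := happ b hb
      exact (hmin a' ha').trans hle
    have e1 : x - b = (x - a) + (a - b) := by ring
    have e2 : a + e - b = e + (a - b) := by ring
    by_cases hbr : ‖a - b‖ < r
    · have h3 : ‖x - b‖ = r := by
        rw [e1, hr]; exact um_add_eq hbr
      have h4 : ‖a + e - b‖ = ‖e‖ := by
        rw [e2]; exact um_add_eq ((hs b hb hbr).trans he1)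
      rw [h3, h4]
      exact ⟨by linarith, he2.le⟩
    · push Not at hbr
      have h4 : ‖a + e - b‖ = ‖a - b‖ := by
        rw [e2, add_comm]; exact um_add_eq (he2.trans_le hbr)
      have h3 : ‖x - b‖ = ‖a - b‖ := by
        rcases hbr.lt_or_eq with hlt | heq
        · rw [e1, add_comm]; exact um_add_eq hlt
        · apply le_antisymm _ (heq ▸ hxb)
          rw [e1]
          exact (IsUltrametricDist.norm_add_le_max _ _).trans (max_le hbr le_rfl)
      rw [h3, h4]
      exact ⟨by nlinarith [norm_nonneg (a - b)], le_rfl⟩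
  · push Not at hatt
    obtain ⟨η, hη, hη'⟩ : ∃ η ∈ A, ∀ b ∈ Bs, ‖x - η‖ < ‖x - b‖ := by
      clear hBs
      induction Bs using Finset.induction_on with
      | empty => exact ⟨0, zero_mem _, by simp⟩
      | insert b Bs _ ih =>
        obtain ⟨η, hη, hη'⟩ := ih fun b hb => happ b (Finset.mem_insert_of_mem hb)
        obtain ⟨a, ha, hab⟩ := happ b (Finset.mem_insert_self _ _)
        obtain ⟨a', ha', hlt⟩ := hatt a ha
        rcases le_total ‖x - η‖ ‖x - a'‖ with hc | hc
        · refine ⟨η, hη, fun c hcB => ?_⟩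
          rcases Finset.mem_insert.1 hcB with rfl | hcB
          · exact hc.trans_lt (hlt.trans_le hab)
          · exact hη' c hcB
        · refine ⟨a', ha', fun c hcB => ?_⟩
          rcases Finset.mem_insert.1 hcB with rfl | hcB
          · exact (hlt.trans_le hab)
          · exact hc.trans_lt (hη' c hcB)
    refine ⟨η, hη, fun b hb => ?_⟩
    have : ‖η - b‖ = ‖x - b‖ := by
      apply um_eq_of_sub_lt
      rw [show x - b - (η - b) = x - η by ring]
      exact hη' b hb
    rw [this]
    exact ⟨by nlinarith [norm_nonneg (x - b)], le_rfl⟩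

theorem trS_gen (S : Finset W) (hS : ∀ s ∈ S, s ∈ adjF A {x}) : TrS.{u, w} {y | ‖y‖ < 1} A S := by
  by_cases hg : ∃ g ∈ A, 1 < ‖g‖
  · exact (h.near hg).trS (h.notMem h.xM h.xA) S hS
  push Not at hg
  have ht : TrivN A := by
    intro c hc' h0
    apply le_antisymm (hg c hc')
    have := hg _ (Subfield.inv_mem _ hc')
    rw [norm_inv] at this
    exact (inv_le_one₀ (norm_pos_iff.2 h0)).1 this
  have key : ∀ z : W, z ∈ M → z ∉ A → ‖z‖ ≤ 1 → x ∈ adjF A {z} → TrS.{u, w} {y | ‖y‖ < 1} A S := by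
    intro z hzM hzA hz1 hxz
    obtain ⟨c, hc, hlt⟩ := h.mg.good z hzM hz1
    have hcA := h.kA hc
    have hzc : z - c ∉ A := fun hh => hzA (by simpa using add_mem hh hcA)
    have hzcM : z - c ∈ M := sub_mem hzM (h.AM hcA)
    refine (spec_triv ht (x := z - c) (fun h0 => hzc (h0 ▸ zero_mem _)) hlt).trS (h.notMem hzcM hzc) S ?_
    have h1 : adjF A {z} ≤ adjF A {z - c} := by
      apply adjF_le_iff.2 ⟨le_adjF _ _, ?_⟩
      rw [Set.singleton_subset_iff]
      have := add_mem (mem_adjF_self A (z - c)) (le_adjF A {z - c} hcA)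
      simpa using this
    have h2 : adjF A {x} ≤ adjF A {z} := by
      apply adjF_le_iff.2 ⟨le_adjF _ _, ?_⟩
      rwa [Set.singleton_subset_iff]
    exact fun s hs => h1 (h2 (hS s hs))
  rcases le_total ‖x‖ 1 with hx | hx
  · exact key x h.xM h.xA hx (mem_adjF_self A x)
  · refine key x⁻¹ (inv_mem h.xM) (fun hh => h.xA (by simpa using inv_mem hh)) ?_ ?_
    · rw [norm_inv]; exact inv_le_one_of_one_le₀ hx
    · simpa using inv_mem (mem_adjF_self A x⁻¹)

theorem trS_nx (S : Finset W) (hS : ∀ s ∈ S, s ∈ nx M A x) : TrS.{u, w} {y | ‖y‖ < 1} A S := by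
  obtain ⟨y0, hy0, hy0A, hsep, hdense⟩ := h.nice S hS
  obtain ⟨z, hz, ε, hε, hnew⟩ := exists_newton (E := adjF A {y0}) S hsep
  have hz' : z ∈ adjF A (insert y0 (S : Set W)) := by
    have : adjF (adjF A {y0}) (S : Set W) ≤ adjF A (insert y0 (S : Set W)) := by
      apply adjF_le_iff.2 ⟨adjF_mono le_rfl (by simp), ?_⟩
      exact (Set.subset_insert _ _).trans (subset_adjF _ _)
    exact this hz
  obtain ⟨u', hu, huA, hyu, a, ha, hza⟩ := hdense z hz' ε hε
  have hE : adjF A {y0} ≤ adjF A {u'} := by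
    apply adjF_le_iff.2 ⟨le_adjF _ _, ?_⟩
    rwa [Set.singleton_subset_iff]
  have hu' : Stp p κ M A u' := ⟨h.mg, h.nt, h.kA, h.AM, h.rac, hu.2, huA⟩
  exact TrS.trans (le_adjF A _) (hnew _ hE a ha hza) fun T hT => hu'.trS_gen T hT

end Stp

/-- main rank one result -/
theorem MaxGood.trS {p : ℕ} [hp : ExpChar W p] [IsAlgClosed W] [CompleteSpace W] {κ M : Subfield W}
    (h : MaxGood p κ M) (nt : ∃ x ∈ M, 1 < ‖x‖) (S : Finset W) (hS : ∀ s ∈ S, s ∈ M) :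
    TrS.{u, w} {y | ‖y‖ < 1} κ S := by
  classical
  have main : ∃ A : Subfield W, κ ≤ A ∧ A ≤ M ∧ (∀ z ∈ _root_.acl A, z ∈ M → z ∈ A) ∧ (∀ s ∈ S, s ∈ A) ∧
      ∀ T : Finset W, (∀ t ∈ T, t ∈ A) → TrS.{u, w} {y | ‖y‖ < 1} κ T := by
    induction S using Finset.induction_on with
    | empty =>
      refine ⟨κ, le_rfl, h.le, ?_, by simp, fun T hT => TrS.of_mem hT⟩
      intro z hz hzM
      have ht := h.triv.acl
      obtain ⟨c, hc, hlt⟩ := h.good z hzM (ht.le hz)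
      have := ht.eq_zero (sub_mem hz (le_acl _ hc)) hlt
      rw [sub_eq_zero] at this
      rwa [this]
    | insert x S _ ih =>
      obtain ⟨A, kA, AM, rac, hSA, hT⟩ := ih fun s hs => hS s (Finset.mem_insert_of_mem hs)
      by_cases hx : x ∈ A
      · refine ⟨A, kA, AM, rac, fun s hs => ?_, hT⟩
        rcases Finset.mem_insert.1 hs with rfl | hs
        · exact hx
        · exact hSA s hs
      have st : Stp p κ M A x := ⟨h, nt, kA, AM, rac, hS x (Finset.mem_insert_self _ _), hx⟩
      refine ⟨nx M A x, kA.trans (A_le_nx AM x), inf_le_right, fun z hz hz' => nx_rac hz hz', fun s hs => ?_, ?_⟩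
      · rcases Finset.mem_insert.1 hs with rfl | hs
        · exact mem_nx_self A st.xM
        · exact A_le_nx AM x (hSA s hs)
      · intro T hTn
        exact TrS.trans kA (st.trS_nx T hTn) hT
  obtain ⟨A, _, _, _, hSA, hT⟩ := main
  exact hT S hSA

/-- rank one result for good subfields -/
theorem Good.trS {p : ℕ} [hp : ExpChar W p] [IsAlgClosed W] [CompleteSpace W] {κ K : Subfield W}
    (ht : TrivN κ) (hperf : ∀ c ∈ κ, ∃ d ∈ κ, d ^ p = c) (hle : κ ≤ K) (hg : Good κ K)
    (nt : ∃ x ∈ K, 1 < ‖x‖) (S : Finset W) (hS : ∀ s ∈ S, s ∈ K) :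
    TrS.{u, w} {y | ‖y‖ < 1} κ S := by
  obtain ⟨M, hKM, hM⟩ := exists_maxGood ht hperf hle hg
  obtain ⟨x, hx, hx1⟩ := nt
  exact hM.trS ⟨x, hKM hx, hx1⟩ S fun s hs => hKM (hS s hs)

end P8e

section P9
universe u w

theorem exists_completion (K : Type u) [NontriviallyNormedField K] [IsUltrametricDist K] :
    ∃ (W : Type u) (_ : NontriviallyNormedField W) (_ : IsUltrametricDist W) (_ : CompleteSpace W) (e : K →+* W),
      (∀ x, ‖e x‖ = ‖x‖) ∧ DenseRange e := by
  let W := UniformSpace.Completion K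
  have hn : ∀ x : K, ‖(x : W)‖ = ‖x‖ := UniformSpace.Completion.norm_coe
  letI : NontriviallyNormedField W :=
    { (inferInstance : NormedField W) with
      non_trivial := by
        obtain ⟨x, hx⟩ := NontriviallyNormedField.non_trivial (α := K)
        exact ⟨x, by rwa [hn]⟩ }
  haveI : IsUltrametricDist W := by
    apply IsUltrametricDist.isUltrametricDist_of_forall_norm_add_le_max_norm
    intro x y
    induction x, y using UniformSpace.Completion.induction_on₂ with
    | hp => exact isClosed_le (by fun_prop) (by fun_prop)
    | ih a b =>
      rw [← UniformSpace.Completion.coe_add, hn, hn, hn]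
      exact IsUltrametricDist.norm_add_le_max _ _
  exact ⟨W, inferInstance, inferInstance, inferInstance, UniformSpace.Completion.coeRingHom, hn,
    UniformSpace.Completion.denseRange_coe⟩

theorem exists_algClosure (K : Type u) [NontriviallyNormedField K] [IsUltrametricDist K] [CompleteSpace K] :
    ∃ (W : Type u) (_ : NontriviallyNormedField W) (_ : IsUltrametricDist W) (_ : IsAlgClosed W) (e : K →+* W),
      ∀ x, ‖e x‖ = ‖x‖ := by
  let W := AlgebraicClosure K
  letI i1 : NontriviallyNormedField W := spectralNorm.nontriviallyNormedField K W
  have hn : ∀ x : K, ‖algebraMap K W x‖ = ‖x‖ := spectralNorm_extends (K := K) (L := W)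
  haveI : IsUltrametricDist W := by
    apply IsUltrametricDist.isUltrametricDist_of_isNonarchimedean_norm
    exact isNonarchimedean_spectralNorm (K := K) (L := W)
  exact ⟨W, i1, inferInstance, inferInstanceAs (IsAlgClosed (AlgebraicClosure K)), algebraMap K W, hn⟩

theorem exists_normed_W (K : Type u) [NontriviallyNormedField K] [IsUltrametricDist K] :
    ∃ (W : Type u) (_ : NormedField W) (_ : IsUltrametricDist W) (_ : IsAlgClosed W) (_ : CompleteSpace W)
      (e : K →+* W), ∀ x, ‖e x‖ = ‖x‖ := by
  obtain ⟨K1, _, _, _, e1, h1, -⟩ := exists_completion K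
  obtain ⟨K2, _, _, _, e2, h2⟩ := exists_algClosure K1
  obtain ⟨K3, _, _, _, e3, h3, d3⟩ := exists_completion K2
  obtain ⟨K4, _, _, _, e4, h4⟩ := exists_algClosure K3
  refine ⟨K3, inferInstance, inferInstance, ?_, inferInstance, e3.comp (e2.comp e1), fun x => by simp [h1, h2, h3]⟩
  let E : Subfield K4 := (e4.comp e3).fieldRange
  have hE : acl E = E := by
    apply le_antisymm _ (le_acl E)
    intro w hw
    let f := minpoly E w
    have hintg := (mem_acl_iff_isAlgebraic.1 hw).isIntegral
    haveI : IsAlgClosed E := IsAlgClosed.of_ringEquiv K2 E (e4.comp e3).rangeRestrictFieldEquiv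
    have h5 := IsAlgClosed.degree_eq_one_of_irreducible E (minpoly.irreducible hintg)
    obtain ⟨y, hy⟩ := minpoly.mem_range_of_degree_eq_one E w h5
    rw [← hy]
    exact y.2
  have hiso : Isometry e4 := AddMonoidHomClass.isometry_of_norm e4 h4
  have hcl : ∀ w ∈ E.topologicalClosure, ∃ x, e4 x = w := by
    intro w hw
    have h5 : IsClosed (Set.range e4) := hiso.isClosedEmbedding.isClosed_range
    have h6 : (E : Set K4) ⊆ Set.range e4 := by
      rintro _ ⟨x, rfl⟩
      exact ⟨e3 x, rfl⟩
    exact closure_minimal h6 h5 hw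
  have hcl' : ∀ x, e4 x ∈ E.topologicalClosure := by
    intro x
    have h5 : e4 x ∈ closure (e4 '' Set.range e3) :=
      image_closure_subset_closure_image hiso.continuous ⟨x, d3 x, rfl⟩
    refine closure_mono ?_ h5
    rintro _ ⟨_, ⟨y, rfl⟩, rfl⟩
    exact ⟨y, rfl⟩
  apply IsAlgClosed.of_exists_root
  intro f hf hirr
  obtain ⟨w, hw⟩ := IsAlgClosed.exists_root (f.map e4) (by
    rw [degree_map]; exact hirr.degree_pos.ne')
  have h6 : w ∈ acl E.topologicalClosure := by
    refine root_mem_acl (g := f.map e4) ?_ ?_ hw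
    · exact (Polynomial.map_ne_zero hf.ne_zero)
    · intro i
      rw [coeff_map]
      exact le_acl _ (hcl' _)
  obtain ⟨x, rfl⟩ := hcl w (acl_topologicalClosure hE h6)
  refine ⟨x, ?_⟩
  rw [IsRoot, eval_map_apply] at hw
  exact e4.injective (by rw [hw, map_zero])

theorem archi_of_max {K : Type u} [Field K] {O : ValuationSubring K}
    (hmax : ∀ O' : ValuationSubring K, O ≤ O' → O' ≠ O → O' = ⊤) {x : K} (hx : 1 < O.valuation x) (y : K) :
    ∃ n : ℕ, O.valuation y ≤ O.valuation x ^ n := by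
  let R : Subring K :=
    { carrier := {y | ∃ n : ℕ, O.valuation y ≤ O.valuation x ^ n}
      mul_mem' := by
        rintro a b ⟨n, hn⟩ ⟨m, hm⟩
        exact ⟨n + m, by rw [map_mul, pow_add]; exact mul_le_mul' hn hm⟩
      one_mem' := ⟨0, by simp⟩
      add_mem' := by
        rintro a b ⟨n, hn⟩ ⟨m, hm⟩
        refine ⟨max n m, (O.valuation.map_add a b).trans (max_le (hn.trans ?_) (hm.trans ?_))⟩
        · exact pow_le_pow_right₀ hx.le (le_max_left _ _)
        · exact pow_le_pow_right₀ hx.le (le_max_right _ _)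
      zero_mem' := ⟨0, by simp⟩
      neg_mem' := by
        rintro a ⟨n, hn⟩
        exact ⟨n, by rwa [Valuation.map_neg]⟩ }
  have hle : O.toSubring ≤ R := fun a ha => ⟨0, by
    rw [pow_zero]; exact (O.valuation_le_one_iff a).2 ha⟩
  let O' : ValuationSubring K := ValuationSubring.ofLE O R hle
  have hO' : O' = ⊤ := by
    apply hmax O' hle
    intro h
    have h1 : x ∈ O' := ⟨1, by simp⟩
    rw [h, ← O.valuation_le_one_iff] at h1
    exact absurd hx h1.not_gt
  have : y ∈ O' := hO' ▸ ValuationSubring.mem_top y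
  exact this

theorem exists_W (K : Type u) [Field K] (O : ValuationSubring K) (hO : O ≠ ⊤)
    (hmax : ∀ O' : ValuationSubring K, O ≤ O' → O' ≠ O → O' = ⊤) :
    ∃ (W : Type u) (_ : NormedField W) (_ : IsUltrametricDist W) (_ : IsAlgClosed W) (_ : CompleteSpace W)
      (e : K →+* W), ∀ x, ‖e x‖ ≤ 1 ↔ x ∈ O := by
  haveI : MulArchimedean O.ValueGroup := by
    constructor
    intro a b hb
    obtain ⟨x, rfl⟩ := O.valuation_surjective a
    obtain ⟨y, rfl⟩ := O.valuation_surjective b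
    exact archi_of_max hmax hb x
  obtain ⟨x0, hx0⟩ : ∃ x, x ∉ O := by
    by_contra! hc
    exact hO (top_unique fun x _ => hc x)
  have hx1 : 1 < O.valuation x0 := by
    rw [← not_le]
    rwa [O.valuation_le_one_iff]
  haveI : O.valuation.IsNontrivial := ⟨⟨x0, (zero_lt_one.trans hx1).ne', hx1.ne'⟩⟩
  have hA : MulArchimedean (MonoidWithZeroHom.ValueGroup₀ (.ofClass O.valuation)) :=
    MulArchimedean.comap MonoidWithZeroHom.ValueGroup₀.embedding.toMonoidHom MonoidWithZeroHom.ValueGroup₀.embedding_strictMono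
  rw [← Valuation.nonempty_rankOne_iff_mulArchimedean] at hA
  obtain ⟨hr⟩ := hA
  letI : Valued K O.ValueGroup := Valued.mk' O.valuation
  letI : Valuation.RankOne (Valued.v (R := K) (Γ₀ := O.ValueGroup)) := hr
  letI : NontriviallyNormedField K := Valued.toNontriviallyNormedField K O.ValueGroup
  haveI : IsUltrametricDist K := 
    IsUltrametricDist.isUltrametricDist_of_isNonarchimedean_norm (Valued.isNonarchimedean_norm K O.ValueGroup)
  obtain ⟨W, i1, i2, i3, i4, e, he⟩ := exists_normed_W K
  refine ⟨W, i1, i2, i3, i4, e, fun x => ?_⟩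
  rw [he, ← O.valuation_le_one_iff]
  exact Valued.toNormedField.norm_le_one_iff

end P9

section P10a
universe u w

/-- pulling back transfer along a field embedding -/
theorem TrS.comap {K W : Type u} [Field K] [Field W] (e : K →+* W) {m' : Set W} {m : Set K}
    (hm : ∀ x, e x ∈ m' ↔ x ∈ m) {k : Subfield K} {S : Finset K} {S' : Finset W} (hS : ∀ s ∈ S, e s ∈ S')
    (h : TrS.{u, w} m' (k.map e) S') : TrS.{u, w} m k S := by
  classical
  obtain ⟨T', hT', h1⟩ := h
  refine ⟨T'.preimage e e.injective.injOn, ?_, ?_⟩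
  · intro t ht
    obtain ⟨y, hy, hye⟩ := hT' _ (Finset.mem_preimage.1 ht)
    rwa [← e.injective hye]
  intro A0 hA0 hT F _ O hO hO' i hi
  let E : A0 ≃+* A0.map e := Subring.equivMapOfInjective A0 e e.injective
  have hE : ∀ a, (E a : W) = e a := fun a => rfl
  have hEs : ∀ b : A0.map e, e (E.symm b : K) = b := fun b => by
    rw [← hE, RingEquiv.apply_symm_apply]
  obtain ⟨B, hB, ψ, e1, e2, e3⟩ := h1 (A0.map e) (by
      rintro _ ⟨y, hy, rfl⟩
      exact ⟨y, hA0 hy, rfl⟩) (by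
      intro t ht
      obtain ⟨y, hy, hye⟩ := hT' t ht
      exact ⟨y, hT y (Finset.mem_preimage.2 (by rwa [hye])), hye⟩) F O hO hO'
      (i.comp (E.symm : A0.map e →+* A0)) (by
      intro t ht htm
      refine hi (E.symm t) ?_ ?_
      · rw [Finset.mem_preimage, hEs]; exact ht
      · rw [← hm, hEs]; exact htm)
  refine ⟨B.comap e, fun a ha => hB ⟨a, ha, rfl⟩, ψ.comp ((e.comp (B.comap e).subtype).codRestrict B fun x => x.2),
    ?_, fun s hs => e2 _ (hS s hs), fun s hs hsm => e3 ⟨e s, s.2⟩ (hS _ hs) ((hm _).2 hsm)⟩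
  intro a
  have h2 := e1 (E a)
  rw [RingHom.comp_apply, RingHom.coe_coe, RingEquiv.symm_apply_apply] at h2
  rw [← h2]
  rfl

/-- pushing transfer forward along a field embedding -/
theorem TrS.map {K W : Type u} [Field K] [Field W] (e : K →+* W) {m' : Set W} {m : Set K}
    (hm : ∀ x, e x ∈ m' ↔ x ∈ m) {k : Subfield K} {S : Finset K} {S' : Finset W}
    (hS : ∀ s ∈ S', ∃ s0 ∈ S, e s0 = s)
    (h : TrS.{u, w} m k S) : TrS.{u, w} m' (k.map e) S' := by
  classical
  obtain ⟨T, hT, h1⟩ := h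
  refine ⟨T.image e, ?_, ?_⟩
  · intro t ht
    obtain ⟨y, hy, rfl⟩ := Finset.mem_image.1 ht
    exact ⟨y, hT y hy, rfl⟩
  intro A0 hA0 hTA F _ O hO hO' i hi
  let r : A0.comap e →+* A0 := (e.comp (A0.comap e).subtype).codRestrict A0 fun x => x.2
  obtain ⟨B, hB, ψ, e1, e2, e3⟩ := h1 (A0.comap e) (by
      intro y hy
      obtain ⟨z, hz, hze⟩ := hA0 hy
      rwa [← e.injective hze]) (fun t ht => hTA _ (Finset.mem_image_of_mem e ht)) F O hO hO' (i.comp r) (by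
      intro t ht htm
      exact hi (r t) (Finset.mem_image_of_mem e ht) ((hm _).2 htm))
  let E : B ≃+* B.map e := Subring.equivMapOfInjective B e e.injective
  have hE : ∀ a, (E a : W) = e a := fun a => rfl
  have hEs : ∀ b : B.map e, e (E.symm b : K) = b := fun b => by
    rw [← hE, RingEquiv.apply_symm_apply]
  have hAB : A0 ≤ B.map e := by
    intro a ha
    obtain ⟨z, hz, rfl⟩ := hA0 ha
    exact ⟨z, hB ha, rfl⟩
  refine ⟨B.map e, hAB, ψ.comp (E.symm : B.map e →+* B), ?_, ?_, ?_⟩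
  · intro a
    obtain ⟨z, hz, hza⟩ := hA0 a.2
    have hz' : z ∈ A0.comap e := by
      change e z ∈ A0
      rw [hza]; exact a.2
    have h2 := e1 ⟨z, hz'⟩
    have h3 : r ⟨z, hz'⟩ = a := Subtype.ext hza
    rw [RingHom.comp_apply, h3] at h2
    rw [← h2]
    change ψ (E.symm _) = _
    congr 1
    rw [RingEquiv.symm_apply_eq]
    exact Subtype.ext hza.symm
  · intro s hs
    obtain ⟨s0, hs0, rfl⟩ := hS s hs
    exact ⟨s0, e2 s0 hs0, rfl⟩
  · intro s hs hsm
    obtain ⟨s0, hs0, he⟩ := hS s hs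
    have h4 : (E.symm s : K) = s0 := e.injective (by rw [hEs, he])
    refine e3 (E.symm s) (h4 ▸ hs0) ?_
    rw [h4, ← hm, he]; exact hsm

theorem val_lt_one_iff {K : Type*} [Field K] (O : ValuationSubring K) (x : K) :
    O.valuation x < 1 ↔ x = 0 ∨ x⁻¹ ∉ O := by
  rcases eq_or_ne x 0 with rfl | hx
  · simp
  · rw [← O.valuation_le_one_iff, map_inv₀, not_le, or_iff_right hx, one_lt_inv₀]
    rw [zero_lt_iff, Ne, map_eq_zero]; exact hx

/-- `k` maps onto a coefficient field -/
structure CF {k K : Type*} [Field k] [Field K] (f : k →+* K) (O : ValuationSubring K) : Prop where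
  mem : ∀ c, f c ∈ O
  res : ∀ x ∈ O, ∃ c, O.valuation (x - f c) < 1

theorem CF.eq_zero {k K : Type*} [Field k] [Field K] {f : k →+* K} {O : ValuationSubring K} (h : CF f O) {c : k}
    (hc : O.valuation (f c) < 1) : f c = 0 := by
  rcases (val_lt_one_iff O _).1 hc with h0 | h0
  · exact h0
  · exact absurd (by rw [← map_inv₀]; exact h.mem _) h0

theorem CF.perf {k K : Type*} [Field k] [Field K] {f : k →+* K} {O : ValuationSubring K} (h : CF f O)
    {p : ℕ} [ExpChar K p] (hp : ∀ x : K, ∃ y, y ^ p = x) (c : k) : ∃ d, f d ^ p = f c := by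
  have hp0 : p ≠ 0 := expChar_ne_zero K p
  obtain ⟨y, hy⟩ := hp (f c)
  have hyO : y ∈ O := by
    rw [← O.valuation_le_one_iff]
    by_contra! hlt
    have h1 : 1 < O.valuation y ^ p := one_lt_pow₀ hlt hp0
    rw [← map_pow, hy] at h1
    exact absurd ((O.valuation_le_one_iff _).2 (h.mem c)) h1.not_ge
  obtain ⟨d, hd⟩ := h.res y hyO
  refine ⟨d, ?_⟩
  have h2 : O.valuation (f (c - d ^ p)) < 1 := by
    rw [map_sub, map_pow, ← hy, ← sub_pow_expChar, map_pow]
    exact pow_lt_one₀ zero_le hd hp0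
  have h3 := h.eq_zero h2
  rw [map_sub, sub_eq_zero, map_pow] at h3
  exact h3.symm

/-- rank one case -/
theorem trS_max {k K : Type u} [Field k] [Field K] {f : k →+* K} {O : ValuationSubring K} (h : CF f O)
    {p : ℕ} [ExpChar K p] (hp : ∀ x : K, ∃ y, y ^ p = x) (hO : O ≠ ⊤)
    (hmax : ∀ O' : ValuationSubring K, O ≤ O' → O' ≠ O → O' = ⊤) (S : Finset K) :
    TrS.{u, w} {x | O.valuation x < 1} f.fieldRange S := by
  classical
  obtain ⟨W, _, _, _, _, e, he⟩ := exists_W K O hO hmax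
  haveI : ExpChar W p := expChar_of_injective_ringHom e.injective p
  have he' : ∀ x, ‖e x‖ < 1 ↔ O.valuation x < 1 := by
    intro x
    rw [val_lt_one_iff, ← he, map_inv₀, norm_inv, not_le]
    rcases eq_or_ne x 0 with rfl | hx
    · simp
    · rw [or_iff_right hx, one_lt_inv₀]
      rw [norm_pos_iff, Ne, map_eq_zero]; exact hx
  refine TrS.comap e (m' := {y | ‖y‖ < 1}) he' (S' := S.image e) (fun s hs => Finset.mem_image_of_mem e hs) ?_
  apply Good.trS (p := p) (K := e.fieldRange)
  · rintro _ ⟨_, ⟨c, rfl⟩, rfl⟩ h0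
    have h1 : ∀ c, ‖e (f c)‖ ≤ 1 := fun c => (he _).2 (h.mem c)
    apply le_antisymm (h1 c)
    have h2 := h1 c⁻¹
    rw [map_inv₀, map_inv₀, norm_inv] at h2
    exact (inv_le_one₀ (norm_pos_iff.2 h0)).1 h2
  · rintro _ ⟨_, ⟨c, rfl⟩, rfl⟩
    obtain ⟨d, hd⟩ := h.perf hp c
    exact ⟨_, ⟨_, ⟨d, rfl⟩, rfl⟩, by rw [← map_pow, hd]⟩
  · rintro _ ⟨y, -, rfl⟩
    exact ⟨y, rfl⟩
  · rintro _ ⟨y, rfl⟩ hy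
    obtain ⟨c, hc⟩ := h.res y ((he y).1 hy)
    refine ⟨e (f c), ⟨_, ⟨c, rfl⟩, rfl⟩, ?_⟩
    rw [← map_sub, he']; exact hc
  · obtain ⟨x0, hx0⟩ : ∃ x, x ∉ O := by
      by_contra! hc
      exact hO (top_unique fun x _ => hc x)
    refine ⟨e x0, ⟨x0, rfl⟩, ?_⟩
    rw [← he] at hx0
    exact not_le.1 hx0
  · intro s hs
    obtain ⟨s0, -, rfl⟩ := Finset.mem_image.1 hs
    exact ⟨s0, rfl⟩

end P10a

section P10b
universe u w

theorem val_comap_lt {K K' : Type*} [Field K] [Field K'] (e : K' →+* K) (O : ValuationSubring K) (x : K') :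
    (O.comap e).valuation x < 1 ↔ O.valuation (e x) < 1 := by
  rw [val_lt_one_iff, val_lt_one_iff, map_eq_zero, ← map_inv₀]
  rfl

theorem val_coarse_lt {K : Type*} [Field K] {O O' : ValuationSubring K} (h : O ≤ O') {x : K}
    (hx : O'.valuation x < 1) : O.valuation x < 1 := by
  rw [val_lt_one_iff] at hx ⊢
  exact hx.imp id fun h1 h2 => h1 (h h2)

theorem Hens.coarse {K : Type*} [Field K] {O O' : ValuationSubring K} (hO : Hens O) (h : O ≤ O') : Hens O' := by
  intro q hq
  obtain ⟨V, hV, e⟩ := hO q fun k => val_coarse_lt h (hq k)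
  exact ⟨V, (O'.valuation_le_one_iff V).2 (h ((O.valuation_le_one_iff V).1 hV)), e⟩

theorem Hens.comap {K K' : Type*} [Field K] [Field K'] {O : ValuationSubring K} (hO : Hens O) (e : K' →+* K)
    (hac : ∀ z ∈ acl e.fieldRange, z ∈ e.fieldRange) : Hens (O.comap e) := by
  intro q hq
  obtain ⟨V, hV, h0⟩ := hO (q.map e) fun k => by
    rw [coeff_map, ← val_comap_lt]; exact hq k
  obtain ⟨V0, rfl⟩ : V ∈ e.fieldRange := by
    apply hac
    rw [mem_acl_iff]
    refine ⟨(1 + X + X ^ 2 * q).map e, ?_, ?_, ?_⟩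
    · apply Polynomial.map_ne_zero
      intro h
      have := congrArg (eval 0) h
      simp at this
    · intro i
      rw [coeff_map]
      exact ⟨_, rfl⟩
    · simpa using h0
  refine ⟨V0, ?_, ?_⟩
  · rw [ValuationSubring.valuation_le_one_iff, ValuationSubring.mem_comap, ← O.valuation_le_one_iff]; exact hV
  · apply e.injective
    rw [eval_map_apply] at h0
    simpa using h0

theorem acl_mem_val {K : Type*} [Field K] {O : ValuationSubring K} {k : Subfield K} (hk : ∀ c ∈ k, c ∈ O)
    {z : K} (hz : z ∈ acl k) : z ∈ O := by
  have hm := mpW_monic hz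
  obtain ⟨f0, hf0⟩ := exists_lift_poly (A0 := O.toSubring) (f := mpW k z) fun i => hk _ (mpW_polyIn k z i)
  have hm0 : f0.Monic := by
    apply Polynomial.monic_of_injective (f := O.toSubring.subtype) Subtype.val_injective
    rw [hf0]; exact hm
  have hintg : IsIntegral O z := by
    refine ⟨f0, hm0, ?_⟩
    have h1 := mpW_eval k z
    rw [← hf0, eval_map] at h1
    exact h1
  obtain ⟨y, rfl⟩ := (IsIntegrallyClosed.isIntegral_iff (R := O) (K := K)).1 hintg
  exact y.2

theorem exists_coeff {K : Type*} [Field K] {O : ValuationSubring K} (hO : Hens O) {p : ℕ} [ExpChar K p]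
    (hp : ∀ x : K, ∃ y, y ^ p = x) {k : Subfield K} (hk : ∀ c ∈ k, c ∈ O) :
    ∃ κ : Subfield K, k ≤ κ ∧ CF κ.subtype O ∧ ∀ z ∈ acl κ, z ∈ κ := by
  have hp0 : p ≠ 0 := expChar_ne_zero K p
  obtain ⟨κ, hkκ, hκ⟩ := zorn_le_nonempty₀ {N : Subfield K | ∀ c ∈ N, c ∈ O} (by
    intro c hc hchain y hy
    refine ⟨sSup c, ?_, fun z hz => le_sSup hz⟩
    intro x hx
    rw [Subfield.mem_sSup_of_directedOn ⟨y, hy⟩ hchain.directedOn] at hx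
    obtain ⟨N, hN, hxN⟩ := hx
    exact hc hN x hxN) k hk
  have hκO : ∀ c ∈ κ, c ∈ O := hκ.prop
  have hmax : ∀ N : Subfield K, κ ≤ N → (∀ c ∈ N, c ∈ O) → N ≤ κ := fun N h1 h2 => hκ.le_of_ge h2 h1
  have hac : ∀ z ∈ acl κ, z ∈ κ := hmax _ (le_acl κ) fun c hc => acl_mem_val hκO hc
  refine ⟨κ, hkκ, ⟨fun c => hκO c c.2, ?_⟩, hac⟩
  intro x hx
  let ρ0 : κ →+* O := κ.subtype.codRestrict O fun c => hκO c c.2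
  letI : Algebra κ (ResidueField O) := ((residue O).comp ρ0).toAlgebra
  have halg : algebraMap κ (ResidueField O) = (residue O).comp ρ0 := rfl
  let xO : O := ⟨x, hx⟩
  have hsub : (algebraMap O K).comp ρ0 = κ.subtype := rfl
  have hev : ∀ g : κ[X], algebraMap O K ((g.map ρ0).eval xO) = (g.map κ.subtype).eval x := by
    intro g
    rw [← hsub, ← Polynomial.map_map]
    rw [← eval_map_apply]
    rfl
  have hres : ∀ g : κ[X], residue O ((g.map ρ0).eval xO) = aeval (residue O xO) g := by
    intro g
    rw [aeval_def, halg, ← eval_map, ← Polynomial.map_map, ← eval_map_apply]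
  by_cases hx' : IsAlgebraic κ (residue O xO)
  · have hirr := minpoly.irreducible hx'.isIntegral
    haveI : ExpChar κ p := κ.subtype.expChar κ.subtype.injective p
    haveI : PerfectRing κ p := by
      apply PerfectRing.ofSurjective
      intro c
      obtain ⟨y, hy⟩ := hp c
      have hyκ : y ∈ κ := hac y (pow_mem_acl hp0 (by rw [hy]; exact le_acl κ c.2))
      exact ⟨⟨y, hyκ⟩, Subtype.ext hy⟩
    haveI : PerfectField κ := PerfectRing.toPerfectField κ p
    have hsep := PerfectField.separable_of_irreducible hirr
    set g := minpoly κ (residue O xO) with hg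
    set f1 : O[X] := g.map ρ0 with hf1
    set f : K[X] := g.map κ.subtype with hf
    have hff : f1.map (algebraMap O K) = f := by rw [hf1, Polynomial.map_map, hsub]
    have htay : ∀ j, (taylor x f).coeff j = algebraMap O K ((taylor xO f1).coeff j) := by
      intro j
      rw [← hff, ← Polynomial.coeff_map, taylor_apply, taylor_apply, Polynomial.map_comp]
      simp [xO]
    have hle : ∀ y : O, O.valuation (algebraMap O K y) ≤ 1 := fun y => O.valuation_le_one y
    have h0 : O.valuation ((taylor x f).coeff 0) < 1 := by
      rw [htay]
      apply (O.valuation_lt_one_iff _).1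
      rw [← residue_eq_zero_iff, taylor_coeff_zero, hf1, hres, hg, minpoly.aeval]
    have h1 : O.valuation ((taylor x f).coeff 1) = 1 := by
      rw [htay]
      apply (O.valuation_eq_one_iff _).1
      rw [← residue_ne_zero_iff_isUnit, taylor_coeff_one, hf1, derivative_map, hres]
      exact hsep.aeval_derivative_ne_zero (by rw [hg, minpoly.aeval])
    have h1' : (taylor x f).coeff 1 ≠ 0 := by
      intro hc
      rw [hc, map_zero] at h1
      exact zero_ne_one h1
    obtain ⟨ζ, hζ, hζx⟩ := hO.newton f x h1' (by
      intro j hj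
      rw [map_div₀, map_pow, h1, one_pow, div_one, map_mul, map_pow]
      have h2 : O.valuation ((taylor x f).coeff j) ≤ 1 := by rw [htay]; exact hle _
      have h3 : O.valuation ((taylor x f).coeff 0) ^ (j - 1) < 1 := pow_lt_one₀ zero_le h0 (by omega)
      exact (mul_le_of_le_one_left zero_le h2).trans_lt h3)
    have hζκ : ζ ∈ κ := by
      apply hac
      rw [mem_acl_iff]
      refine ⟨f, Polynomial.map_ne_zero hirr.ne_zero, ?_, hζ⟩
      intro i
      rw [hf, coeff_map]
      exact (g.coeff i).2
    refine ⟨⟨ζ, hζκ⟩, ?_⟩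
    rw [map_div₀, h1, div_one] at hζx
    rw [Valuation.map_sub_swap]
    exact hζx.trans_lt h0
  · have hxκ : adjF κ {x} ≤ κ := by
      apply hmax _ (le_adjF κ _)
      intro w hw
      obtain ⟨a, b, ha, hb, rfl⟩ := mem_adjF_singleton.1 hw
      have hlift : ∀ c : K[X], PolyIn κ c → ∃ c0 : κ[X], c0.map κ.subtype = c := by
        intro c hc
        exact (mem_lifts _).1 ((lifts_iff_coeff_lifts (f := κ.subtype) c).2 (fun n => ⟨⟨_, hc n⟩, rfl⟩))
      obtain ⟨a0, rfl⟩ := hlift a ha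
      obtain ⟨b0, rfl⟩ := hlift b hb
      rw [← hev, ← hev]
      by_cases hb0 : b0 = 0
      · subst hb0
        simp
      have hu : IsUnit ((b0.map ρ0).eval xO) := by
        rw [← residue_ne_zero_iff_isUnit, hres]
        intro hc
        exact hx' ⟨b0, hb0, hc⟩
      obtain ⟨u, hu⟩ := hu
      rw [← hu, div_eq_mul_inv]
      apply mul_mem (Subtype.mem _)
      have : (algebraMap O K (u : O))⁻¹ = algebraMap O K ((u⁻¹ : Oˣ) : O) := by
        rw [inv_eq_iff_eq_inv, ← map_units_inv, inv_inv]
      rw [this]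
      exact Subtype.mem _
    exact ⟨⟨x, hxκ (mem_adjF_self κ x)⟩, by simp⟩

end P10b

section
universe u w

theorem TrS.coarse {K : Type u} [Field K] {O O' : ValuationSubring K} (h : O ≤ O') {A κ : Subfield K} (hA : A ≤ κ)
    (hκ : CF κ.subtype O') (h1 : ∀ S, TrS.{u, w} {x | O'.valuation x < 1} κ S)
    (h2 : ∀ S : Finset K, (∀ s ∈ S, s ∈ κ) → TrS.{u, w} {x | O.valuation x < 1} A S) (S : Finset K) :
    TrS.{u, w} {x | O.valuation x < 1} A S := by
  classical
  have hc : ∀ x : K, ∃ c : K, c ∈ κ ∧ (x ∈ O' → O'.valuation (x - c) < 1) := by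
    intro x
    by_cases hx : x ∈ O'
    · obtain ⟨c, hc⟩ := hκ.res x hx
      exact ⟨c, c.2, fun _ => hc⟩
    · exact ⟨0, κ.zero_mem, fun h => absurd h hx⟩
  choose c hcκ hc using hc
  obtain ⟨T1, hT1, h3⟩ := h1 (S ∪ S.image fun x => x - c x)
  obtain ⟨T, hT, h4⟩ := h2 (T1 ∪ S.image c) (by
    intro s hs
    rcases Finset.mem_union.1 hs with hs | hs
    · exact hT1 s hs
    · obtain ⟨y, _, rfl⟩ := Finset.mem_image.1 hs
      exact hcκ y)
  refine ⟨T, hT, fun A0 hA0 hTA F _ OF hO hO' i hi => ?_⟩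
  obtain ⟨B, hB, ψ, e1, e2, e3⟩ := h4 A0 hA0 hTA F OF hO hO' i hi
  let B1 : Subring K := B ⊓ κ.toSubring
  have hB1 : B1 ≤ B := inf_le_left
  obtain ⟨D, hD, χ, c1, c2, c3⟩ := h3 B1 inf_le_right
    (fun t ht => ⟨e2 t (Finset.mem_union_left _ ht), hT1 t ht⟩) F OF hO hO'
    (ψ.comp (Subring.inclusion hB1)) (by
      intro t ht htm
      have h0 : (t : K) = 0 := hκ.eq_zero (c := ⟨t, t.2.2⟩) htm
      have h0' : t = 0 := Subtype.ext h0
      rw [h0', map_zero, map_zero]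
      exact zero_lt_one)
  have hAB : A0 ≤ B1 := le_inf hB (hA0.trans hA)
  refine ⟨D, hAB.trans hD, χ, fun a => ?_, fun s hs => c2 s (Finset.mem_union_left _ hs), ?_⟩
  · rw [← e1 a]
    exact c1 (Subring.inclusion hAB a)
  intro s hs hsm
  have hsO : (s : K) ∈ O := (O.valuation_le_one_iff _).1 (le_of_lt hsm)
  have hcs := hc s (h hsO)
  have hcT : c s ∈ T1 ∪ S.image c := Finset.mem_union_right _ (Finset.mem_image_of_mem _ hs)
  have hcB : c s ∈ B1 := ⟨e2 _ hcT, hcκ _⟩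
  have hcm : O.valuation (c s) < 1 := by
    have h5 : c (s : K) = s - (s - c s) := by ring
    rw [h5]
    exact lt_of_le_of_lt (Valuation.map_sub _ _ _) (max_lt hsm (val_coarse_lt h hcs))
  have h6 := e3 ⟨c s, hcB.1⟩ hcT hcm
  have hdS : (s : K) - c s ∈ S ∪ S.image fun x => x - c x :=
    Finset.mem_union_right _ (Finset.mem_image_of_mem (fun x => x - c x) hs)
  have h7 := c3 ⟨s - c s, c2 _ hdS⟩ hdS hcs
  have h8 : s = Subring.inclusion hD ⟨c s, hcB⟩ + ⟨s - c s, c2 _ hdS⟩ := by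
    apply Subtype.ext
    change (s : K) = c s + (s - c s)
    ring
  have h9 := c1 ⟨c s, hcB⟩
  rw [h8, map_add, h9]
  exact lt_of_le_of_lt (Valuation.map_add _ _ _) (max_lt h6 h7)

theorem isAlgebraic_mem_acl {k K : Type*} [Field k] [Field K] [Algebra k K] {x : K} (h : IsAlgebraic k x) :
    x ∈ acl (algebraMap k K).fieldRange := by
  obtain ⟨g, hg, h0⟩ := h
  rw [mem_acl_iff]
  refine ⟨g.map (algebraMap k K), (Polynomial.map_ne_zero_iff (algebraMap k K).injective).2 hg, ?_, ?_⟩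
  · intro i
    rw [Polynomial.coeff_map]
    exact ⟨_, rfl⟩
  · rw [eval_map_algebraMap, h0]

theorem H_main (p : ℕ) (n : ℕ) : ∀ (k K : Type u) [Field k] [Field K] [Algebra k K] [ExpChar K p]
    (O : ValuationSubring K), Hens O → (∀ x : K, ∃ y, y ^ p = x) → CF (algebraMap k K) O →
    Algebra.trdeg k K ≤ n → ∀ S : Finset K, TrS.{u, w} {x | O.valuation x < 1} (algebraMap k K).fieldRange S := by
  induction n using Nat.strong_induction_on with
  | _ n ih =>
  intro k K _ _ _ _ O hO hp hcf htr S
  classical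
  have hp0 : p ≠ 0 := expChar_ne_zero K p
  by_cases htop : O = ⊤
  · apply TrS.of_mem
    intro s _
    obtain ⟨c, hc⟩ := hcf.res s (by rw [htop]; trivial)
    rcases (val_lt_one_iff O _).1 hc with h0 | h0
    · exact ⟨c, (sub_eq_zero.1 h0).symm⟩
    · exact absurd (by rw [htop]; trivial) h0
  by_cases hmax : ∀ O' : ValuationSubring K, O ≤ O' → O' ≠ O → O' = ⊤
  · exact trS_max hcf hp htop hmax S
  push Not at hmax
  obtain ⟨O', hOO, hne, hO'⟩ := hmax
  obtain ⟨κ, hkκ, hκ, hac⟩ := exists_coeff (hO.coarse hOO) hp (k := (algebraMap k K).fieldRange) (by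
    rintro _ ⟨c, rfl⟩
    exact hOO (hcf.mem c))
  letI alg : Algebra k κ := ((algebraMap k K).codRestrict κ fun c => hkκ ⟨c, rfl⟩).toAlgebra
  haveI : IsScalarTower k κ K := IsScalarTower.of_algebraMap_eq fun c => rfl
  have hadd := trdeg_add_eq k κ (A := K)
  have hmK : κ.subtype = algebraMap κ K := rfl
  have n1 : Algebra.trdeg k κ ≠ 0 := by
    rw [Ne, trdeg_eq_zero_iff]
    intro hal
    apply hne
    refine le_antisymm ?_ hOO
    intro x hx
    obtain ⟨c, hc⟩ := hκ.res x hx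
    have hcO : (c : K) ∈ O := by
      refine acl_mem_val (k := (algebraMap k K).fieldRange) ?_ (isAlgebraic_mem_acl ?_)
      · rintro _ ⟨c, rfl⟩
        exact hcf.mem c
      · exact (hal.isAlgebraic c).algebraMap
    have h1 : x - c ∈ O := (O.valuation_le_one_iff _).1 (val_coarse_lt hOO hc).le
    have := O.add_mem _ _ h1 hcO
    rwa [sub_add_cancel] at this
  have n2 : Algebra.trdeg κ K ≠ 0 := by
    rw [Ne, trdeg_eq_zero_iff]
    intro hal
    apply hO'
    rw [eq_top_iff]
    intro x _
    refine acl_mem_val (k := κ) (fun c hc => hκ.mem ⟨c, hc⟩) ?_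
    have := isAlgebraic_mem_acl (hal.isAlgebraic x)
    rwa [← hmK, Subfield.fieldRange_subtype] at this
  obtain ⟨a, ha⟩ := Cardinal.lt_aleph0.1 (lt_of_le_of_lt ((le_self_add).trans_eq hadd) (lt_of_le_of_lt htr Cardinal.natCast_lt_aleph0))
  obtain ⟨b, hb⟩ := Cardinal.lt_aleph0.1 (lt_of_le_of_lt ((le_add_self).trans_eq hadd) (lt_of_le_of_lt htr Cardinal.natCast_lt_aleph0))
  rw [← hadd, ha, hb] at htr
  rw [ha] at n1
  rw [hb] at n2
  norm_cast at htr n1 n2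
  refine TrS.coarse hOO hkκ hκ ?_ ?_ S
  · intro S'
    have := ih b (by omega) κ K O' (hO.coarse hOO) hp hκ hb.le S'
    rwa [← hmK, Subfield.fieldRange_subtype] at this
  · intro S' hS'
    haveI : ExpChar κ p := κ.subtype.expChar κ.subtype.injective p
    have h1 := ih a (by omega) k κ (O.comap κ.subtype) (hO.comap _ (by
        rw [Subfield.fieldRange_subtype]; exact hac)) (by
        intro c
        obtain ⟨y, hy⟩ := hp c
        have hyκ : y ∈ κ := hac y (pow_mem_acl hp0 (by rw [hy]; exact le_acl κ c.2))
        exact ⟨⟨y, hyκ⟩, Subtype.ext hy⟩) ⟨fun c => hcf.mem c, fun x hx => by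
          obtain ⟨c, hc⟩ := hcf.res x hx
          refine ⟨c, ?_⟩
          rw [val_comap_lt]
          exact hc⟩ ha.le (S'.preimage κ.subtype κ.subtype.injective.injOn)
    have h2 := h1.map κ.subtype (m' := {x | O.valuation x < 1}) (S' := S') (fun x => (val_comap_lt _ _ _).symm) (by
      intro s hs
      exact ⟨⟨s, hS' s hs⟩, Finset.mem_preimage.2 hs, rfl⟩)
    rw [RingHom.map_fieldRange] at h2
    exact h2

end

section
universe u w

theorem hens_of_henselian {K : Type*} [Field K] (O : ValuationSubring K) [HenselianLocalRing O] : Hens O := by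
  intro q hq
  have hqO : ∀ k, q.coeff k ∈ O := fun k => (O.valuation_le_one_iff _).1 (hq k).le
  set d := q.natDegree
  let r : O[X] := ∑ k ∈ Finset.range (d + 1), C ⟨q.coeff k, hqO k⟩ * X ^ (d - k)
  let f : O[X] := X ^ (d + 2) + (X ^ (d + 1) + r)
  have hrd : r.degree < ((d + 1 : ℕ) : WithBot ℕ) := by
    refine lt_of_le_of_lt (degree_sum_le _ _) ?_
    rw [Finset.sup_lt_iff (WithBot.bot_lt_coe _)]
    intro k hk
    refine lt_of_le_of_lt (degree_C_mul_X_pow_le _ _) ?_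
    exact_mod_cast (by omega : d - k < d + 1)
  have hf : f.Monic := by
    apply monic_X_pow_add
    refine lt_of_le_of_lt (degree_add_le _ _) (max_lt ?_ (hrd.trans ?_))
    · rw [degree_X_pow]; exact_mod_cast (by omega : d + 1 < d + 2)
    · exact_mod_cast (by omega : d + 1 < d + 2)
  have hr : r.map (residue O) = 0 := by
    rw [Polynomial.map_sum]
    apply Finset.sum_eq_zero
    intro k _
    have : residue O ⟨q.coeff k, hqO k⟩ = 0 := by
      rw [residue_eq_zero_iff, O.valuation_lt_one_iff]; exact hq k
    rw [Polynomial.map_mul, map_C, this, C_0, zero_mul]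
  have hfm : f.map (residue O) = X ^ (d + 2) + X ^ (d + 1) := by
    simp [f, hr]
  have h1 : f.eval (-1) ∈ maximalIdeal O := by
    rw [← residue_eq_zero_iff, ← eval_map_apply, hfm]
    simp [pow_succ]
  have h2 : IsUnit (f.derivative.eval (-1)) := by
    rw [← residue_ne_zero_iff_isUnit, ← eval_map_apply, ← derivative_map, hfm]
    have : eval (residue O (-1)) (derivative (X ^ (d + 2) + X ^ (d + 1) : (ResidueField O)[X])) = (-1) ^ (d + 1) := by
      simp [pow_succ]
      ring
    rw [this]
    exact pow_ne_zero _ (neg_ne_zero.2 one_ne_zero)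
  obtain ⟨U, hU, hU1⟩ := HenselianLocalRing.is_henselian f hf (-1) h1 h2
  have hUu : IsUnit U := by
    rw [← residue_ne_zero_iff_isUnit]
    rw [← residue_eq_zero_iff, map_sub, sub_eq_zero] at hU1
    rw [hU1, map_neg, map_one]
    exact neg_ne_zero.2 one_ne_zero
  have hUv : O.valuation (U : K) = 1 := (O.valuation_eq_one_iff U).1 hUu
  have hU0 : (U : K) ≠ 0 := by
    intro h
    rw [h, map_zero] at hUv
    exact zero_ne_one hUv
  refine ⟨(U : K)⁻¹, by rw [map_inv₀, hUv, inv_one], ?_⟩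
  have h3 : (U : K) ^ (d + 2) + ((U : K) ^ (d + 1) + ∑ k ∈ Finset.range (d + 1), q.coeff k * (U : K) ^ (d - k)) = 0 := by
    have h4 := congrArg (algebraMap O K) (show f.eval U = 0 from hU)
    simp only [f, r, eval_add, eval_pow, eval_X, eval_finsetSum, eval_mul, eval_C, map_add, map_pow, map_sum,
      map_mul, map_zero] at h4
    exact h4
  have h5 : (U : K) ^ (d + 2) * (1 + (U : K)⁻¹ + (U : K)⁻¹ ^ 2 * q.eval (U : K)⁻¹) = 0 := by
    rw [← h3, eval_eq_sum_range, mul_add, mul_add, mul_one, add_assoc]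
    congr 2
    · rw [pow_succ (U : K) (d + 1), mul_assoc, mul_inv_cancel₀ hU0, mul_one]
    · rw [Finset.mul_sum, Finset.mul_sum]
      apply Finset.sum_congr rfl
      intro k hk
      have hk' : k ≤ d := by have := Finset.mem_range.1 hk; omega
      have : (U : K) ^ (d + 2) = (U : K) ^ (d - k) * (U : K) ^ k * (U : K) ^ 2 := by
        rw [← pow_add, ← pow_add]; congr 1; omega
      have h6 : (U : K) ^ k * (U : K)⁻¹ ^ k = 1 := by rw [← mul_pow, mul_inv_cancel₀ hU0, one_pow]
      have h7 : (U : K) ^ 2 * (U : K)⁻¹ ^ 2 = 1 := by rw [← mul_pow, mul_inv_cancel₀ hU0, one_pow]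
      rw [this]
      linear_combination (q.coeff k * (U : K) ^ (d - k)) * ((U : K) ^ 2 * (U : K)⁻¹ ^ 2) * h6 +
        (q.coeff k * (U : K) ^ (d - k)) * h7
  exact (mul_eq_zero.1 h5).resolve_left (pow_ne_zero _ hU0)

theorem bot_le_val {K : Type*} [Field K] {O : ValuationSubring K} (h : ringChar K = ringChar (ResidueField O)) :
    ∀ c ∈ (⊥ : Subfield K), c ∈ O := by
  intro c hc
  rw [← Subfield.closure_empty, Subfield.mem_closure_iff] at hc
  obtain ⟨y, hy, z, hz, rfl⟩ := hc
  rw [Subring.closure_empty, Subring.mem_bot] at hy hz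
  obtain ⟨a, rfl⟩ := hy
  obtain ⟨b, rfl⟩ := hz
  by_cases hb : (b : K) = 0
  · rw [hb, div_zero]; exact O.zero_mem
  have h1 : ((b : ℤ) : ResidueField O) ≠ 0 := by
    intro h0
    apply hb
    rw [CharP.intCast_eq_zero_iff _ (ringChar (ResidueField O))] at h0
    rw [CharP.intCast_eq_zero_iff _ (ringChar K), h]
    exact h0
  have h2 : IsUnit (b : O) := by
    rw [← residue_ne_zero_iff_isUnit, map_intCast]; exact h1
  have hbv : O.valuation (b : K) = 1 := by
    have := (O.valuation_eq_one_iff (b : O)).1 h2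
    simpa using this
  rw [← O.valuation_le_one_iff, map_div₀, hbv, div_one, O.valuation_le_one_iff]
  exact intCast_mem O a

theorem mem_pow_iff {K : Type*} [Field K] (O : ValuationSubring K) {n : ℕ} (hn : n ≠ 0) (x : K) : x ^ n ∈ O ↔ x ∈ O := by
  rw [← O.valuation_le_one_iff, ← O.valuation_le_one_iff, map_pow, pow_le_one_iff hn]

theorem common_pow {K K1 : Type*} [Field K] [Field K1] (j : K →+* K1) (p : ℕ) (h : ∀ x : K1, ∃ n y, j y = x ^ p ^ n)
    (Z : Finset K1) : ∃ N, ∀ z ∈ Z, ∃ y, j y = z ^ p ^ N := by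
  choose n y hy using h
  refine ⟨Z.sup n, fun z hz => ⟨y z ^ p ^ (Z.sup n - n z), ?_⟩⟩
  rw [map_pow, hy, ← pow_mul, ← pow_add]
  congr 2
  have := Finset.le_sup (f := n) hz
  omega

/-- the perfect closure of a henselian valued field -/
theorem exists_perf {K : Type u} [Field K] (p : ℕ) [ExpChar K p] {O : ValuationSubring K} (hO : Hens O) :
    ∃ (K1 : Type u) (_ : Field K1) (_ : ExpChar K1 p) (j : K →+* K1) (O1 : ValuationSubring K1),
      (∀ x : K1, ∃ y, y ^ p = x) ∧ (∀ x : K1, ∃ n y, j y = x ^ p ^ n) ∧ O1.comap j = O ∧ Hens O1 := by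
  classical
  have hp0 : p ≠ 0 := expChar_ne_zero K p
  let E := AlgebraicClosure K
  haveI : ExpChar E p := expChar_of_injective_ringHom (algebraMap K E).injective p
  haveI : PerfectRing E p := inferInstance
  let K1 := perfectClosure K E
  let j : K →+* K1 := algebraMap K K1
  haveI : ExpChar K1 p := expChar_of_injective_ringHom j.injective p
  have hj : ∀ x : K1, ∃ n y, j y = x ^ p ^ n := by
    intro x
    obtain ⟨n, y, hy⟩ := (mem_perfectClosure_iff_pow_mem p).1 x.2
    exact ⟨n, y, Subtype.ext hy⟩
  have hpf : ∀ x : K1, ∃ y, y ^ p = x := by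
    haveI : PerfectRing K1 p := inferInstance
    intro x
    obtain ⟨y, hy⟩ := surjective_frobenius K1 p x
    exact ⟨y, hy⟩
  have hpn : ∀ n, p ^ n ≠ 0 := fun n => pow_ne_zero _ hp0
  let O1 : ValuationSubring K1 :=
    { carrier := {x | ∃ n y, y ∈ O ∧ j y = x ^ p ^ n}
      mul_mem' := by
        rintro a b ⟨n, y, hy, e⟩ ⟨m, z, hz, e'⟩
        refine ⟨n + m, y ^ p ^ m * z ^ p ^ n, O.mul_mem _ _ (pow_mem hy _) (pow_mem hz _), ?_⟩
        rw [map_mul, map_pow, map_pow, e, e', mul_pow]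
        ring
      one_mem' := ⟨0, 1, O.one_mem, by simp⟩
      add_mem' := by
        rintro a b ⟨n, y, hy, e⟩ ⟨m, z, hz, e'⟩
        refine ⟨n + m, y ^ p ^ m + z ^ p ^ n, O.add_mem _ _ (pow_mem hy _) (pow_mem hz _), ?_⟩
        rw [map_add, map_pow, map_pow, e, e', add_pow_expChar_pow]
        ring
      zero_mem' := ⟨0, 0, O.zero_mem, by simp⟩
      neg_mem' := by
        rintro a ⟨n, y, hy, e⟩
        refine ⟨n, (-1) ^ p ^ n * y, O.mul_mem _ _ (pow_mem (O.neg_mem _ O.one_mem) _) hy, ?_⟩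
        rw [map_mul, map_pow, map_neg, map_one, e, ← mul_pow, neg_one_mul]
      mem_or_inv_mem' := by
        intro x
        obtain ⟨n, y, hy⟩ := hj x
        rcases O.mem_or_inv_mem y with h | h
        · exact Or.inl ⟨n, y, h, hy⟩
        · exact Or.inr ⟨n, y⁻¹, h, by rw [map_inv₀, hy, inv_pow]⟩ }
  have hcom : O1.comap j = O := by
    ext y
    constructor
    · rintro ⟨n, z, hz, e⟩
      rw [← map_pow] at e
      rw [j.injective e] at hz
      exact (mem_pow_iff O (hpn n) y).1 hz
    · intro hy
      exact ⟨0, y, hy, by simp⟩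
  refine ⟨K1, inferInstance, inferInstance, j, O1, hpf, hj, hcom, ?_⟩
  intro q hq
  obtain ⟨N, hN⟩ := common_pow j p hj q.coeffs
  obtain ⟨q0, hq0⟩ : ∃ q0 : K[X], q0.map j = q.map (iterateFrobenius K1 p N) := by
    have := (lifts_iff_coeff_lifts (f := j) (q.map (iterateFrobenius K1 p N))).2 (by
      intro k
      rw [Polynomial.coeff_map, iterateFrobenius_def]
      by_cases hk : q.coeff k = 0
      · rw [hk, zero_pow (hpn N)]; exact ⟨0, map_zero j⟩
      · exact hN _ (coeff_mem_coeffs hk))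
    exact (mem_lifts _).1 this
  obtain ⟨V0, hV0, e0⟩ := hO q0 (by
    intro k
    rw [← hcom, val_comap_lt, ← Polynomial.coeff_map, hq0, Polynomial.coeff_map, iterateFrobenius_def, map_pow]
    exact pow_lt_one₀ (zero_le) (hq k) (hpn N))
  have hroot : ∀ N, ∀ x : K1, ∃ y, y ^ p ^ N = x := by
    intro N
    induction N with
    | zero => intro x; exact ⟨x, by simp⟩
    | succ N ih =>
      intro x
      obtain ⟨y, hy⟩ := hpf x
      obtain ⟨z, hz⟩ := ih y
      exact ⟨z, by rw [pow_succ, pow_mul, hz, hy]⟩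
  obtain ⟨V, hV⟩ := hroot N (j V0)
  refine ⟨V, ?_, ?_⟩
  · rw [O1.valuation_le_one_iff]
    exact ⟨N, V0, (O.valuation_le_one_iff _).1 hV0, hV.symm⟩
  · have h1 : iterateFrobenius K1 p N (1 + V + V ^ 2 * q.eval V) = 0 := by
      have h2 := congrArg j e0
      rw [map_zero, map_add, map_add, map_mul, map_pow, map_one, ← eval_map_apply, hq0, ← hV,
        ← iterateFrobenius_def, eval_map_apply] at h2
      rw [map_add, map_add, map_mul, map_pow, map_one, h2]
    exact (map_eq_zero _).1 h1

end

section
universe u w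

open IntermediateField.algebraAdjoinAdjoin in
theorem trdeg_fin {k K : Type u} [Field k] [Field K] [Algebra k K] (s : Finset K)
    (h : ∀ z : K, z ∈ acl (adjF ⊥ (s : Set K))) : Algebra.trdeg k K ≤ s.card := by
  let F := IntermediateField.adjoin k (s : Set K)
  have hF : adjF ⊥ (s : Set K) ≤ F.toSubfield :=
    adjF_le_iff.2 ⟨bot_le, IntermediateField.subset_adjoin k _⟩
  haveI : Algebra.IsAlgebraic F K := by
    constructor
    intro z
    have h1 := acl_mono hF (h z)
    exact mem_acl_iff_isAlgebraic.1 h1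
  haveI : Algebra.IsAlgebraic (Algebra.adjoin k (s : Set K)) K :=
    (IsFractionRing.comap_isAlgebraic_iff (A := Algebra.adjoin k (s : Set K)) (K := F) (C := K)).2 inferInstance
  refine (Algebra.IsAlgebraic.trdeg_le_cardinalMk (R := k) (s := (s : Set K))).trans ?_
  simp

theorem transfer_perf {K : Type u} [Field K] {p : ℕ} [ExpChar K p] {O : ValuationSubring K} (hO : Hens O)
    (hp : ∀ x : K, ∃ y, y ^ p = x) (hbot : ∀ c ∈ (⊥ : Subfield K), c ∈ O) (S : Finset K) :
    ∃ T : Finset K, (∀ x ∈ Subring.closure (T : Set K), x ∈ O) ∧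
      ∀ (F : Type w) [Field F] (OF : ValuationSubring F), Hens OF → OF ≠ ⊤ →
      ∀ i : Subring.closure (T : Set K) →+* F, (∀ a, i a ∈ OF) →
      ∃ (B : Subring K) (ψ : B →+* F), (∀ s ∈ S, s ∈ B) ∧
        ∀ s : B, (s : K) ∈ S → ((s : K) ∈ O → ψ s ∈ OF) ∧ (O.valuation (s : K) < 1 → OF.valuation (ψ s) < 1) := by
  classical
  have hp0 : p ≠ 0 := expChar_ne_zero K p
  set A : Subfield K := adjF ⊥ (S : Set K) with hA
  set K0 : Subfield K := acl A with hK0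
  have hSK : ∀ s ∈ S, s ∈ K0 := fun s hs => le_acl A (subset_adjF _ _ hs)
  haveI : ExpChar K0 p := K0.subtype.expChar K0.subtype.injective p
  have hac : ∀ z ∈ acl K0, z ∈ K0 := fun z hz => by rwa [hK0, acl_acl] at hz
  set O0 := O.comap K0.subtype with hO0
  have hH0 : Hens O0 := hO.comap _ (by rw [Subfield.fieldRange_subtype]; exact hac)
  have hp' : ∀ x : K0, ∃ y, y ^ p = x := by
    intro c
    obtain ⟨y, hy⟩ := hp c
    have hyκ : y ∈ K0 := hac y (pow_mem_acl hp0 (by rw [hy]; exact le_acl K0 c.2))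
    exact ⟨⟨y, hyκ⟩, Subtype.ext hy⟩
  have hbot0 : ∀ c ∈ (⊥ : Subfield K0), c ∈ O0 := by
    intro c hc
    have h1 : (⊥ : Subfield K0) ≤ (⊥ : Subfield K).comap K0.subtype := bot_le
    exact hbot _ (h1 hc)
  obtain ⟨k, _, hcf, _⟩ := exists_coeff hH0 hp' hbot0
  set s0 : Finset K0 := S.preimage K0.subtype K0.subtype.injective.injOn with hs0
  have halg : ∀ z : K0, z ∈ acl (adjF ⊥ (s0 : Set K0)) := by
    intro z
    have hle : A ≤ (adjF ⊥ (s0 : Set K0)).map K0.subtype := by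
      refine adjF_le_iff.2 ⟨bot_le, ?_⟩
      intro s hs
      refine ⟨⟨s, hSK s hs⟩, subset_adjF _ _ ?_, rfl⟩
      exact Finset.mem_preimage.2 hs
    obtain ⟨g, hg, hgA, h0⟩ := mem_acl_iff.1 z.2
    obtain ⟨g0, hg0⟩ : ∃ g0 : K0[X], g0.map K0.subtype = g := by
      have := (lifts_iff_coeff_lifts (f := K0.subtype) g).2 (fun n => ⟨⟨_, le_acl A (hgA n)⟩, rfl⟩)
      exact (mem_lifts _).1 this
    refine mem_acl_iff.2 ⟨g0, ?_, ?_, ?_⟩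
    · rintro rfl
      exact hg (by rw [← hg0, Polynomial.map_zero])
    · intro i
      have h1 := hgA i
      rw [← hg0, Polynomial.coeff_map] at h1
      obtain ⟨y, hy, e⟩ := hle h1
      rwa [K0.subtype.injective e] at hy
    · apply K0.subtype.injective
      rw [map_zero, ← eval_map_apply, hg0]
      exact h0
  have htr := trdeg_fin (k := k) s0 halg
  set κ : Subfield K := k.map K0.subtype with hκ
  have hκO : ∀ c ∈ κ, c ∈ O := by
    rintro _ ⟨y, hy, rfl⟩
    exact hcf.mem ⟨y, hy⟩
  have hκ0 : ∀ c ∈ κ, O.valuation c < 1 → c = 0 := by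
    intro c hc h
    rcases (val_lt_one_iff O c).1 h with h0 | h0
    · exact h0
    · exact absurd (hκO _ (κ.inv_mem hc)) h0
  have hc : ∀ x : K, ∃ c : K, c ∈ κ ∧ (x ∈ K0 → x ∈ O → O.valuation (x - c) < 1) := by
    intro x
    by_cases hx : x ∈ K0 ∧ x ∈ O
    · obtain ⟨c, hc⟩ := hcf.res ⟨x, hx.1⟩ hx.2
      refine ⟨c, ⟨c, c.2, rfl⟩, fun _ _ => ?_⟩
      rw [hO0, val_comap_lt] at hc
      exact hc
    · exact ⟨0, κ.zero_mem, fun h h' => absurd ⟨h, h'⟩ hx⟩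
  choose c hcκ hc using hc
  have hκK : κ ≤ K0 := by
    rintro _ ⟨y, hy, rfl⟩
    exact y.2
  set S1 : Finset K := S ∪ S.image c ∪ S.image fun x => x - c x with hS1
  have hS1K : ∀ s ∈ S1, s ∈ K0 := by
    intro s hs
    rcases Finset.mem_union.1 hs with hs | hs
    · rcases Finset.mem_union.1 hs with hs | hs
      · exact hSK s hs
      · obtain ⟨y, _, rfl⟩ := Finset.mem_image.1 hs
        exact hκK (hcκ y)
    · obtain ⟨y, hy, rfl⟩ := Finset.mem_image.1 hs
      exact K0.sub_mem (hSK y hy) (hκK (hcκ y))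
  have h1 := H_main.{u, w} p s0.card k K0 O0 hH0 hp' hcf htr (S1.preimage K0.subtype K0.subtype.injective.injOn)
  have h2 := h1.map K0.subtype (m' := {x | O.valuation x < 1}) (S' := S1) (fun x => (val_comap_lt _ _ _).symm) (by
    intro s hs
    exact ⟨⟨s, hS1K s hs⟩, Finset.mem_preimage.2 hs, rfl⟩)
  have hmk : (algebraMap k K0).fieldRange = k := Subfield.fieldRange_subtype k
  rw [hmk, ← hκ] at h2
  obtain ⟨T, hT, h3⟩ := h2
  have hTκ : Subring.closure ((T ∪ S.image c : Finset K) : Set K) ≤ κ.toSubring := by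
    rw [Subring.closure_le]
    intro t ht
    rcases Finset.mem_union.1 (Finset.mem_coe.1 ht) with ht | ht
    · exact hT t ht
    · obtain ⟨y, _, rfl⟩ := Finset.mem_image.1 ht
      exact hcκ y
  have hsub : ∀ t ∈ T ∪ S.image c, t ∈ Subring.closure ((T ∪ S.image c : Finset K) : Set K) := fun t ht =>
    Subring.subset_closure (Finset.mem_coe.2 ht)
  refine ⟨T ∪ S.image c, fun x hx => hκO x (hTκ hx), ?_⟩
  intro F _ OF hOF hOF' i hi
  obtain ⟨B, hB, ψ, e1, e2, e3⟩ := h3 _ hTκ (fun t ht => hsub t (Finset.mem_union_left _ ht)) F OF hOF hOF' i (by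
    intro t ht htm
    have h0 : t = 0 := Subtype.ext (hκ0 _ (hT _ ht) htm)
    rw [h0, map_zero, map_zero]
    exact zero_lt_one)
  have hSS : ∀ s ∈ S, s ∈ S1 := fun s hs => Finset.mem_union_left _ (Finset.mem_union_left _ hs)
  refine ⟨B, ψ, fun s hs => e2 s (hSS s hs), ?_⟩
  intro s hs
  refine ⟨fun hsO => ?_, fun hsm => e3 s (hSS _ hs) hsm⟩
  have hcA : c s ∈ Subring.closure ((T ∪ S.image c : Finset K) : Set K) :=
    hsub _ (Finset.mem_union_right _ (Finset.mem_image_of_mem _ hs))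
  have hd : (s : K) - c s ∈ S1 := Finset.mem_union_right _ (Finset.mem_image_of_mem (fun x => x - c x) hs)
  have h8 : s = Subring.inclusion hB ⟨c s, hcA⟩ + ⟨s - c s, e2 _ hd⟩ := by
    apply Subtype.ext
    change (s : K) = c s + (s - c s)
    ring
  rw [h8, map_add, e1]
  refine OF.add_mem _ _ (hi _) ?_
  exact (OF.valuation_le_one_iff _).1 (e3 ⟨s - c s, e2 _ hd⟩ hd (hc _ (hSK _ hs) hsO)).le

end

section
universe u w

/-- every finitely generated subring of `k` maps to `l` -/
def RTr (k : Type*) (l : Type*) [Field k] [Field l] : Prop :=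
  ∀ T : Finset k, ∃ B : Subring k, (∀ t ∈ T, t ∈ B) ∧ Nonempty (B →+* l)

theorem RTr.ringChar_eq {k : Type*} {l : Type*} [Field k] [Field l] (h : RTr k l) : ringChar k = ringChar l := by
  symm
  have key : ∀ n : ℕ, (n : l) = 0 ↔ (n : k) = 0 := by
    intro n
    obtain ⟨B, hB, ⟨χ⟩⟩ := h {(n : k)⁻¹}
    constructor
    · intro hn
      by_contra h0
      let b : B := ⟨(n : k)⁻¹, hB _ (Finset.mem_singleton_self _)⟩
      have h1 : (n : B) * b = 1 := Subtype.ext (by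
        change ((n : B) : k) * (n : k)⁻¹ = 1
        rw [Subring.coe_natCast, mul_inv_cancel₀ h0])
      have h2 := congrArg χ h1
      rw [map_mul, map_natCast, hn, zero_mul, map_one] at h2
      exact zero_ne_one h2
    · intro hn
      have h1 : (n : B) = 0 := Subtype.ext (by simpa using hn)
      have h2 := congrArg χ h1
      rwa [map_natCast, map_zero] at h2
  haveI : CharP l (ringChar k) := ⟨fun n => by rw [key, ringChar.spec]⟩
  exact ringChar.eq l (ringChar k)

theorem lift_inj {R K K1 : Type*} [CommRing R] [Field K] [Field K1] (j : K →+* K1) (g : R →+* K1)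
    (h : ∀ r, ∃ y, j y = g r) : ∃ f : R →+* K, ∀ r, j (f r) = g r := by
  let e : K ≃+* j.range := RingEquiv.ofBijective j.rangeRestrict
    ⟨fun a b hab => j.injective (congrArg Subtype.val hab), j.rangeRestrict_surjective⟩
  refine ⟨(e.symm : j.range →+* K).comp (g.codRestrict j.range fun r => h r), fun r => ?_⟩
  have h1 : ∀ z : j.range, j (e.symm z) = z := by
    intro z
    have : (e (e.symm z) : K1) = z := by rw [RingEquiv.apply_symm_apply]
    exact this
  exact h1 _

theorem exists_res_lift {L L1 : Type*} [Field L] [Field L1] {OL : ValuationSubring L} {O1 : ValuationSubring L1}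
    (j : L →+* L1) (hcom : O1.comap j = OL) (hO : Hens O1) {p : ℕ} [ExpChar L1 p] (hp : ∀ x : L1, ∃ y, y ^ p = x)
    (hbot : ∀ c ∈ (⊥ : Subfield L1), c ∈ O1) : ∃ ι : ResidueField OL →+* L1, ∀ y, ι y ∈ O1 := by
  subst hcom
  set OL := O1.comap j
  obtain ⟨κ, _, hκ, _⟩ := exists_coeff hO hp hbot
  let ρ : κ →+* ResidueField O1 := (residue O1).comp (κ.subtype.codRestrict O1 fun c => hκ.mem c)
  have hρ : Function.Bijective ρ := by
    refine ⟨ρ.injective, fun z => ?_⟩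
    obtain ⟨x, rfl⟩ := residue_surjective z
    obtain ⟨c, hc⟩ := hκ.res x x.2
    refine ⟨c, ?_⟩
    symm
    rw [← sub_eq_zero]
    change residue O1 x - residue O1 _ = 0
    rw [← map_sub, residue_eq_zero_iff, O1.valuation_lt_one_iff]
    exact hc
  let e : κ ≃+* ResidueField O1 := RingEquiv.ofBijective ρ hρ
  let f : OL →+* O1 := (j.comp OL.subtype).codRestrict O1 fun x => x.2
  let g : ResidueField OL →+* ResidueField O1 := Ideal.Quotient.lift (maximalIdeal OL) ((residue O1).comp f) (by
    intro a ha
    rw [RingHom.comp_apply, residue_eq_zero_iff, O1.valuation_lt_one_iff]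
    rw [ValuationSubring.valuation_lt_one_iff, val_comap_lt] at ha
    exact ha)
  exact ⟨κ.subtype.comp ((e.symm : ResidueField O1 →+* κ).comp g), fun y => hκ.mem _⟩

theorem map_bot_le {K K1 : Type*} [Field K] [Field K1] {O : ValuationSubring K} {O1 : ValuationSubring K1} (j : K →+* K1)
    (hcom : O1.comap j = O) (hbot : ∀ c ∈ (⊥ : Subfield K), c ∈ O) : ∀ c ∈ (⊥ : Subfield K1), c ∈ O1 := by
  intro c hc
  have h1 : (⊥ : Subfield K1) ≤ (⊥ : Subfield K).map j := bot_le
  obtain ⟨y, hy, rfl⟩ := h1 hc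
  have := hbot y hy
  rwa [← hcom] at this

theorem transfer {K : Type u} {L : Type w} [Field K] [Field L] {O : ValuationSubring K} {OL : ValuationSubring L}
    (hO : Hens O) (hOL : Hens OL) (hK : ringChar K = ringChar (ResidueField O))
    (hL : ringChar L = ringChar (ResidueField OL)) (hLnt : OL ≠ ⊤)
    (hkl : RTr (ResidueField O) (ResidueField OL)) (S : Finset K) :
    ∃ (B : Subring K) (ψ : B →+* L), (∀ s ∈ S, s ∈ B) ∧
      ∀ s : B, (s : K) ∈ S → ((s : K) ∈ O → ψ s ∈ OL) ∧ (O.valuation (s : K) < 1 → OL.valuation (ψ s) < 1) := by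
  classical
  obtain ⟨p, hpK⟩ : ∃ p, ExpChar K p := ⟨_, ringExpChar.expChar K⟩
  have hpL : ExpChar L p := by
    have h1 : ringChar K = ringChar L := by rw [hK, hL, hkl.ringChar_eq]
    have h2 : ringExpChar L = p := by rw [ringExpChar, ← h1]; exact ringExpChar.eq K p
    rw [← h2]
    exact ringExpChar.expChar L
  have hp0 : p ≠ 0 := expChar_ne_zero K p
  have hpn : ∀ n, p ^ n ≠ 0 := fun n => pow_ne_zero _ hp0
  obtain ⟨K1, _, _, j, O1, hp, hj, hcom, hO1⟩ := exists_perf p hO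
  obtain ⟨L1, _, _, jL, OL1, hpL, hjL, hcomL, hOL1⟩ := exists_perf p hOL
  have hbK := map_bot_le j hcom (bot_le_val hK)
  have hbL := map_bot_le jL hcomL (bot_le_val hL)
  have hLnt1 : OL1 ≠ ⊤ := by
    rintro rfl
    apply hLnt
    rw [← hcomL]
    rfl
  have memj : ∀ x, j x ∈ O1 ↔ x ∈ O := fun x => by rw [← hcom]; rfl
  have memjL : ∀ x, jL x ∈ OL1 ↔ x ∈ OL := fun x => by rw [← hcomL]; rfl
  have vj : ∀ x, O1.valuation (j x) < 1 ↔ O.valuation x < 1 := fun x => by rw [← hcom, val_comap_lt]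
  have vjL : ∀ x, OL1.valuation (jL x) < 1 ↔ OL.valuation x < 1 := fun x => by rw [← hcomL, val_comap_lt]
  obtain ⟨ι, hι⟩ := exists_res_lift jL hcomL hOL1 hpL hbL
  obtain ⟨T, hTO, hT⟩ := transfer_perf.{u, w} hO1 hp hbK (S.image j)
  set A0 := Subring.closure (T : Set K1) with hA0
  obtain ⟨N, hN⟩ := common_pow j p hj T
  have hA0N : A0 ≤ j.range.comap (iterateFrobenius K1 p N) := by
    rw [hA0, Subring.closure_le]
    intro t ht
    obtain ⟨y, hy⟩ := hN t ht
    exact ⟨y, by rw [hy, iterateFrobenius_def]⟩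
  obtain ⟨f, hf⟩ := lift_inj j ((iterateFrobenius K1 p N).comp A0.subtype) fun a => hA0N a.2
  have hfO : ∀ a, f a ∈ O := by
    intro a
    rw [← memj, hf, RingHom.comp_apply, iterateFrobenius_def]
    exact pow_mem (hTO _ a.2) _
  let θ : A0 →+* ResidueField O := (residue O).comp (f.codRestrict O hfO)
  have hTA : ∀ t ∈ T, t ∈ A0 := fun t ht => Subring.subset_closure ht
  obtain ⟨B', hB', ⟨χ⟩⟩ := hkl (T.attach.image fun t : {x // x ∈ T} => θ ⟨t, hTA t t.2⟩)
  have hθ : ∀ a, θ a ∈ B' := by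
    have h1 : A0 ≤ (B'.comap θ).map A0.subtype := by
      conv_lhs => rw [hA0]
      rw [Subring.closure_le]
      intro t ht
      refine ⟨⟨t, hTA t ht⟩, ?_, rfl⟩
      exact hB' _ (Finset.mem_image.2 ⟨⟨t, ht⟩, Finset.mem_attach _ _, rfl⟩)
    intro a
    obtain ⟨b, hb, e⟩ := h1 a.2
    have : b = a := Subtype.ext e
    rwa [this] at hb
  obtain ⟨B, ψ, e1, e2⟩ := hT L1 OL1 hOL1 hLnt1 ((ι.comp χ).comp (θ.codRestrict B' hθ)) (fun a => hι _)
  let G : B.comap j →+* L1 := ψ.comp ((j.comp (B.comap j).subtype).codRestrict B fun x => x.2)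
  have hSB : ∀ s ∈ S, s ∈ B.comap j := fun s hs => e1 _ (Finset.mem_image_of_mem _ hs)
  obtain ⟨M, hM⟩ := common_pow jL p hjL (S.attach.image fun s : {x // x ∈ S} => G ⟨s, hSB s s.2⟩)
  let G' := (iterateFrobenius L1 p M).comp G
  let B2 : Subring K := (jL.range.comap G').map (B.comap j).subtype
  have hB2 : ∀ x ∈ B2, x ∈ B.comap j := by
    rintro _ ⟨y, _, rfl⟩
    exact y.2
  have hB2' : ∀ x : B2, ∃ y, jL y = G' ⟨x, hB2 x x.2⟩ := by
    rintro ⟨_, y, hy, rfl⟩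
    exact hy
  obtain ⟨Ψ, hΨ⟩ := lift_inj jL (G'.comp (B2.subtype.codRestrict (B.comap j) fun x => hB2 x x.2)) hB2'
  refine ⟨B2, Ψ, ?_, ?_⟩
  · intro s hs
    refine ⟨⟨s, hSB s hs⟩, ?_, rfl⟩
    obtain ⟨y, hy⟩ := hM _ (Finset.mem_image_of_mem _ (Finset.mem_attach S ⟨s, hs⟩))
    exact ⟨y, hy⟩
  · intro s hs
    have h3 := e2 ⟨j s, hB2 s s.2⟩ (Finset.mem_image_of_mem _ hs)
    have h4 : jL (Ψ s) = ψ ⟨j s, hB2 s s.2⟩ ^ p ^ M := hΨ s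
    constructor
    · intro hsO
      rw [← memjL, h4]
      exact pow_mem (h3.1 ((memj _).2 hsO)) _
    · intro hsm
      rw [← vjL, h4, map_pow]
      exact pow_lt_one₀ (zero_le) (h3.2 ((vj _).2 hsm)) (hpn M)

end

section
universe u w

open FirstOrder.Language in
/-- transfer of existential sentences along partial homomorphisms -/
theorem ex_transfer {𝓛 : FirstOrder.Language} {K : Type*} {L : Type*} [Field K] [Field L] [𝓛.Structure K]
    [𝓛.Structure L] (P : Finset K → ∀ B : Subring K, (B →+* L) → Prop)
    (mono : ∀ S S' B h, S ⊆ S' → P S' B h → P S B h) (hmem : ∀ S B h, P S B h → ∀ s ∈ S, s ∈ B)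
    (hex : ∀ S, ∃ B h, P S B h)
    (hfun : ∀ (B : Subring K) (h : B →+* L) (n : ℕ) (f : 𝓛.Functions n) (y : Fin n → B),
      ∃ b : B, (b : K) = Structure.funMap f (fun i => (y i : K)) ∧ h b = Structure.funMap f (fun i => h (y i)))
    (hrel : ∀ (n : ℕ) (R : 𝓛.Relations n) (x : Fin n → K), ∃ S, ∀ B h, P S B h → ∀ y : Fin n → B,
      (∀ i, (y i : K) = x i) → (Structure.RelMap R x ↔ Structure.RelMap R (fun i => h (y i))))
    (φ : 𝓛.Sentence) (hφ : IsExistentialSentence φ) (hK : Sentence.Realize K φ) : Sentence.Realize L φ := by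
  classical
  obtain ⟨n, ψ, hψ, rfl⟩ := hφ
  rw [Sentence.Realize, BoundedFormula.realize_exs] at hK ⊢
  obtain ⟨x, hx⟩ := hK
  have hterm : ∀ (B : Subring K) (h : B →+* L) (y : Fin n → B) (t : 𝓛.Term (Empty ⊕ Fin n)),
      ∃ b : B, (b : K) = t.realize (Sum.elim default fun i => (y i : K)) ∧
        h b = t.realize (Sum.elim default fun i => h (y i)) := by
    intro B h y t
    induction t with
    | var v =>
      rcases v with v | i
      · exact v.elim
      · exact ⟨y i, rfl, rfl⟩
    | func f ts ih =>
      choose b hb hb' using ih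
      obtain ⟨c, hc, hc'⟩ := hfun B h _ f b
      refine ⟨c, ?_, ?_⟩
      · rw [hc, Term.realize]; congr 1; funext i; exact hb i
      · rw [hc', Term.realize]; congr 1; funext i; exact hb' i
  have key : ∃ S, ∀ B h, P S B h → ∀ y : Fin n → B, (∀ i, (y i : K) = x i) →
      (ψ.Realize default x ↔ ψ.Realize default (fun i => h (y i))) := by
    clear hx
    induction hψ with
    | falsum => exact ⟨∅, fun B h _ y _ => Iff.rfl⟩
    | of_isAtomic ha =>
      rcases ha with ⟨t1, t2⟩ | ⟨R, ts⟩
      · refine ⟨{(t1.realize (Sum.elim default x) - t2.realize (Sum.elim default x))⁻¹}, fun B h hP y hy => ?_⟩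
        have hxy : x = fun i => (y i : K) := funext fun i => (hy i).symm
        have hm := hmem _ _ _ hP _ (Finset.mem_singleton_self _)
        rw [BoundedFormula.realize_bdEqual, BoundedFormula.realize_bdEqual]
        obtain ⟨b1, e1, e1'⟩ := hterm B h y t1
        obtain ⟨b2, e2, e2'⟩ := hterm B h y t2
        rw [hxy, ← e1, ← e2] at hm ⊢
        rw [← e1', ← e2']
        constructor
        · intro hh
          rw [Subtype.ext hh]
        · intro hh
          by_contra hne
          have h1 : (b1 - b2) * ⟨_, hm⟩ = 1 := Subtype.ext (by
            change ((b1 : K) - b2) * ((b1 : K) - b2)⁻¹ = 1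
            exact mul_inv_cancel₀ (sub_ne_zero.2 hne))
          have h2 := congrArg h h1
          rw [map_mul, map_sub, hh, sub_self, zero_mul, map_one] at h2
          exact zero_ne_one h2
      · obtain ⟨S, hS⟩ := hrel _ R (fun i => (ts i).realize (Sum.elim default x))
        refine ⟨S, fun B h hP y hy => ?_⟩
        have hxy : x = fun i => (y i : K) := funext fun i => (hy i).symm
        rw [BoundedFormula.realize_rel, BoundedFormula.realize_rel]
        choose b hb hb' using fun i => hterm B h y (ts i)
        rw [hS B h hP b (fun i => by rw [hb, hxy])]
        simp only [hb']
    | imp _ _ ih1 ih2 =>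
      obtain ⟨S1, h1⟩ := ih1
      obtain ⟨S2, h2⟩ := ih2
      refine ⟨S1 ∪ S2, fun B h hP y hy => ?_⟩
      rw [BoundedFormula.realize_imp, BoundedFormula.realize_imp,
        h1 B h (mono _ _ _ _ Finset.subset_union_left hP) y hy,
        h2 B h (mono _ _ _ _ Finset.subset_union_right hP) y hy]
  obtain ⟨S, hS⟩ := key
  obtain ⟨B, h, hP⟩ := hex (S ∪ Finset.univ.image x)
  have hxB : ∀ i, x i ∈ B := fun i => hmem _ _ _ hP _
    (Finset.mem_union_right _ (Finset.mem_image_of_mem _ (Finset.mem_univ i)))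
  refine ⟨fun i => h ⟨x i, hxB i⟩, ?_⟩
  exact (hS B h (mono _ _ _ _ Finset.subset_union_left hP) (fun i => ⟨x i, hxB i⟩) fun i => rfl).1 hx

open FirstOrder.Language in
theorem ring_fun {K : Type*} {L : Type*} [Field K] [Field L] [CompatibleRing K] [CompatibleRing L]
    (B : Subring K) (h : B →+* L) (n : ℕ) (f : Language.ring.Functions n) (y : Fin n → B) :
    ∃ b : B, (b : K) = Structure.funMap f (fun i => (y i : K)) ∧ h b = Structure.funMap f (fun i => h (y i)) := by
  cases f with
  | add => exact ⟨y 0 + y 1, (CompatibleRing.funMap_add (fun i => (y i : K))).symm, by rw [map_add]; exact (CompatibleRing.funMap_add (fun i => h (y i))).symm⟩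
  | mul => exact ⟨y 0 * y 1, (CompatibleRing.funMap_mul (fun i => (y i : K))).symm, by rw [map_mul]; exact (CompatibleRing.funMap_mul (fun i => h (y i))).symm⟩
  | neg => exact ⟨-y 0, (CompatibleRing.funMap_neg (fun i => (y i : K))).symm, by rw [map_neg]; exact (CompatibleRing.funMap_neg (fun i => h (y i))).symm⟩
  | zero => exact ⟨0, (CompatibleRing.funMap_zero _).symm, by rw [map_zero]; exact (CompatibleRing.funMap_zero _).symm⟩
  | one => exact ⟨1, (CompatibleRing.funMap_one _).symm, by rw [map_one]; exact (CompatibleRing.funMap_one _).symm⟩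

theorem RTr.ex {k : Type*} {l : Type*} [Field k] [Field l] (H : RTr k l) (φ : Language.ring.Sentence)
    (hφ : IsExistentialSentence φ) (hK : RealizeRing k φ) : RealizeRing l φ := by
  letI := compatibleRingOfRing k
  letI := compatibleRingOfRing l
  refine ex_transfer (K := k) (L := l) (fun S B h => ∀ s ∈ S, s ∈ B) (fun S S' B h hs hP s hsS => hP s (hs hsS))
    (fun S B h hP => hP) (fun S => ?_) ring_fun (fun n R => ?_) φ hφ hK
  · obtain ⟨B, hB, ⟨h⟩⟩ := H S
    exact ⟨B, h, hB⟩
  · cases R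

theorem vf_ex {K : Type*} {L : Type*} [Field K] [Field L] (O : ValuationSubring K) (OL : ValuationSubring L)
    (H : ∀ S : Finset K, ∃ (B : Subring K) (ψ : B →+* L), (∀ s ∈ S, s ∈ B) ∧
      ∀ s : B, (s : K) ∈ S → ((s : K) ∈ O → ψ s ∈ OL) ∧ (O.valuation (s : K) < 1 → OL.valuation (ψ s) < 1))
    (φ : vfLang.Sentence) (hφ : IsExistentialSentence φ) (hK : RealizeVF O φ) : RealizeVF OL φ := by
  classical
  letI := vfStructure O
  letI := vfStructure OL
  refine ex_transfer (K := K) (L := L) (fun S B ψ => (∀ s ∈ S, s ∈ B) ∧ ∀ s : B, (s : K) ∈ S →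
      ((s : K) ∈ O → ψ s ∈ OL) ∧ (O.valuation (s : K) < 1 → OL.valuation (ψ s) < 1))
    (fun S S' B h hs hP => ⟨fun s hsS => hP.1 s (hs hsS), fun s hsS => hP.2 s (hs hsS)⟩)
    (fun S B h hP => hP.1) H (fun B h n f y => ?_) (fun n R x => ?_) φ hφ hK
  · rcases f with f | f
    · letI := compatibleRingOfRing K
      letI := compatibleRingOfRing L
      exact ring_fun B h n f y
    · exact Empty.elim f
  · rcases R with R | R
    · cases R
    cases R with
    | o =>
    by_cases hr : ∃ c ∈ O, x 0 = c * x 1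
    · obtain ⟨c, hc, e⟩ := hr
      refine ⟨{c}, fun B h hP y hy => ?_⟩
      refine iff_of_true ⟨c, hc, e⟩ ?_
      have hcB := hP.1 c (Finset.mem_singleton_self _)
      refine ⟨h ⟨c, hcB⟩, (hP.2 ⟨c, hcB⟩ (Finset.mem_singleton_self _)).1 hc, ?_⟩
      rw [← map_mul]
      refine congrArg h (?_ : y 0 = _)
      apply Subtype.ext
      change (y 0 : K) = c * (y 1 : K)
      rw [hy, hy, e]
    · have h0 : x 0 ≠ 0 := fun h0 => hr ⟨0, O.zero_mem, by rw [h0, zero_mul]⟩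
      have hv : O.valuation (x 1 / x 0) < 1 := by
        rw [val_lt_one_iff]
        by_cases h1 : x 1 = 0
        · left; rw [h1, zero_div]
        · right
          intro hm
          rw [inv_div] at hm
          exact hr ⟨_, hm, (div_mul_cancel₀ _ h1).symm⟩
      refine ⟨{x 1 / x 0, (x 0)⁻¹}, fun B h hP y hy => ?_⟩
      refine iff_of_false hr ?_
      have m1 : x 1 / x 0 ∈ ({x 1 / x 0, (x 0)⁻¹} : Finset K) := by simp
      have m2 : (x 0)⁻¹ ∈ ({x 1 / x 0, (x 0)⁻¹} : Finset K) := by simp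
      have hv' := (hP.2 ⟨_, hP.1 _ m1⟩ m1).2 hv
      rintro ⟨d, hd, e⟩
      have e1 : y 1 = ⟨_, hP.1 _ m1⟩ * y 0 := by
        apply Subtype.ext
        change (y 1 : K) = x 1 / x 0 * (y 0 : K)
        rw [hy, hy, div_mul_cancel₀ _ h0]
      have e2 : y 0 * ⟨_, hP.1 _ m2⟩ = 1 := by
        apply Subtype.ext
        change (y 0 : K) * (x 0)⁻¹ = 1
        rw [hy, mul_inv_cancel₀ h0]
      have hy0 : h (y 0) ≠ 0 := by
        intro hz
        have := congrArg h e2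
        rw [map_mul, hz, zero_mul, map_one] at this
        exact zero_ne_one this
      have e3 : h (y 0) = d * h (y 1) := e
      rw [e1, map_mul, ← mul_assoc] at e3
      have e4 : d * h ⟨_, hP.1 _ m1⟩ = 1 := mul_right_cancel₀ hy0 (by rw [one_mul]; exact e3.symm)
      have e5 := congrArg OL.valuation e4
      rw [map_mul, map_one] at e5
      have hd' := (OL.valuation_le_one_iff d).2 hd
      exact absurd e5 ((mul_le_of_le_one_left zero_le' hd').trans_lt hv').ne

end

section

open FirstOrder.Language in
theorem foldr_qf {𝓛 : FirstOrder.Language} {α : Type*} {n : ℕ} (l : List (𝓛.BoundedFormula α n))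
    (h : ∀ φ ∈ l, φ.IsQF) : (l.foldr (· ⊓ ·) ⊤).IsQF := by
  induction l with
  | nil => exact BoundedFormula.IsQF.top
  | cons φ l ih =>
    exact (h φ (by simp)).inf (ih fun ψ hψ => h ψ (by simp [hψ]))

theorem free_ker (n : ℕ) {k : Type*} [Field k] (θ : FreeCommRing (Fin n) →+* k) :
    ∃ F : Finset (FreeCommRing (Fin n)), Ideal.span (F : Set (FreeCommRing (Fin n))) = RingHom.ker θ := by
  have : IsNoetherianRing (FreeCommRing (Fin n)) :=
    isNoetherianRing_of_ringEquiv _ (freeCommRingEquivMvPolynomialInt (Fin n)).symm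
  exact (isNoetherianRing_iff_ideal_fg _).1 this (RingHom.ker θ)

theorem rtr_of_lift {k : Type*} {l : Type*} [Field k] [Field l]
    (H : ∀ (n : ℕ) (x : Fin n → k) (F : Finset (FreeCommRing (Fin n))),
      (∀ p ∈ F, FreeCommRing.lift x p = 0) → ∃ y : Fin n → l, ∀ p ∈ F, FreeCommRing.lift y p = 0) : RTr k l := by
  intro T
  let e := T.equivFin
  let x : Fin T.card → k := fun i => (e.symm i : k)
  obtain ⟨F, hF⟩ := free_ker T.card (FreeCommRing.lift x)
  have hF' : ∀ p ∈ F, FreeCommRing.lift x p = 0 := by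
    intro p hp
    rw [← RingHom.mem_ker, ← hF]
    exact Ideal.subset_span hp
  obtain ⟨y, hy⟩ := H _ x F hF'
  have hker : RingHom.ker (FreeCommRing.lift x) ≤ RingHom.ker (FreeCommRing.lift y) := by
    rw [← hF, Ideal.span_le]
    intro p hp
    exact hy p hp
  obtain ⟨B, hB, ψ, -⟩ := exists_lift_range (FreeCommRing.lift x) (FreeCommRing.lift y) (fun r hr => hker hr)
  refine ⟨B, fun t ht => ?_, ⟨ψ⟩⟩
  have := hB (FreeCommRing.of (e ⟨t, ht⟩))
  rwa [FreeCommRing.lift_of, show x (e ⟨t, ht⟩) = t by simp [x] ] at this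

open FirstOrder.Language in
theorem rtr_of_ring {k : Type*} {l : Type*} [Field k] [Field l]
    (H : ∀ φ : Language.ring.Sentence, IsExistentialSentence φ → RealizeRing k φ → RealizeRing l φ) : RTr k l := by
  classical
  letI := compatibleRingOfRing k
  letI := compatibleRingOfRing l
  apply rtr_of_lift
  intro n x F hF
  let f : FreeCommRing (Fin n) → Language.ring.BoundedFormula Empty n := fun p =>
    ((termOfFreeCommRing p).relabel Sum.inr).bdEqual ((termOfFreeCommRing 0).relabel Sum.inr)
  have hf : ∀ (m : Type _) [Field m] [CompatibleRing m] (z : Fin n → m) (p), (f p).Realize default z ↔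
      FreeCommRing.lift z p = 0 := by
    intro m _ _ z p
    simp only [f, BoundedFormula.realize_bdEqual, Term.realize_relabel, Sum.elim_comp_inr,
      realize_termOfFreeCommRing, map_zero]
  have hf' : ∀ (m : Type _) [Field m] [CompatibleRing m] (z : Fin n → m) (p), (f p).Realize default z ↔
      FreeCommRing.lift z p = 0 := by
    intro m _ _ z p
    simp only [f, BoundedFormula.realize_bdEqual, Term.realize_relabel, Sum.elim_comp_inr,
      realize_termOfFreeCommRing, map_zero]
  let ψ := (F.toList.map f).foldr (· ⊓ ·) ⊤
  have hψ : ψ.IsQF := by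
    apply foldr_qf
    intro φ hφ
    obtain ⟨p, -, rfl⟩ := List.mem_map.1 hφ
    exact (BoundedFormula.IsAtomic.equal _ _).isQF
  have h1 := H ψ.exs ⟨n, ψ, hψ, rfl⟩ (by
    change Sentence.Realize k _
    rw [Sentence.Realize, BoundedFormula.realize_exs]
    refine ⟨x, ?_⟩
    rw [BoundedFormula.realize_foldr_inf]
    intro φ hφ
    obtain ⟨p, hp, rfl⟩ := List.mem_map.1 hφ
    exact (hf k x p).2 (hF p (Finset.mem_toList.1 hp)))
  change Sentence.Realize l _ at h1
  rw [Sentence.Realize, BoundedFormula.realize_exs] at h1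
  obtain ⟨y, hy⟩ := h1
  rw [BoundedFormula.realize_foldr_inf] at hy
  exact ⟨y, fun p hp => (hf' l y p).1 (hy _ (List.mem_map.2 ⟨p, Finset.mem_toList.2 hp, rfl⟩))⟩

open FirstOrder.Language in
/-- ring terms as valued field terms -/
noncomputable def vfTerm {α : Type*} (t : Language.ring.Term α) : vfLang.Term α :=
  (LHom.sumInl : Language.ring →ᴸ Language.ring.sum ⟨fun _ => Empty, DivRel⟩).onTerm t

open FirstOrder.Language in
theorem vfTerm_realize {α : Type*} {K : Type*} [Field K] (O : ValuationSubring K) (p : FreeCommRing α) (v : α → K) :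
    letI := vfStructure O
    (vfTerm (termOfFreeCommRing p)).realize v = FreeCommRing.lift v p := by
  letI i1 := compatibleRingOfRing K
  letI := vfStructure O
  rw [← realize_termOfFreeCommRing]
  generalize termOfFreeCommRing p = t
  induction t with
  | var _ => rfl
  | func f ts ih =>
    have h2 : (fun i => (vfTerm (ts i)).realize v) = fun i => (ts i).realize v := funext ih
    change Structure.funMap f (fun i => (vfTerm (ts i)).realize v) = _
    rw [h2]
    rfl

/-- the divisibility symbol -/
def divSym : vfLang.Relations 2 := (Sum.inr DivRel.o : _ ⊕ _)

open FirstOrder.Language in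
/-- the divisibility relation as a formula -/
noncomputable def divF {n : ℕ} (p q : FreeCommRing (Fin n)) : vfLang.BoundedFormula Empty n :=
  Relations.boundedFormula₂ (L := vfLang) divSym
    ((vfTerm (termOfFreeCommRing p)).relabel Sum.inr) ((vfTerm (termOfFreeCommRing q)).relabel Sum.inr)

open FirstOrder.Language in
theorem divF_realize {n : ℕ} {K : Type*} [Field K] (O : ValuationSubring K) (p q : FreeCommRing (Fin n))
    (z : Fin n → K) : letI := vfStructure O
    ((divF p q).Realize default z ↔ ∃ c ∈ O, FreeCommRing.lift z p = c * FreeCommRing.lift z q) := by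
  letI := vfStructure O
  rw [divF, BoundedFormula.realize_rel₂]
  change (∃ c ∈ O, Term.realize _ _ = c * Term.realize _ _) ↔ _
  have h1 := vfTerm_realize O p z
  have h2 := vfTerm_realize O q z
  rw [Term.realize_relabel, Term.realize_relabel, Sum.elim_comp_inr, h1, h2]

theorem lift_residue {n : ℕ} {K : Type*} [Field K] (O : ValuationSubring K) (z : Fin n → O) (p : FreeCommRing (Fin n)) :
    FreeCommRing.lift (fun i => residue O (z i)) p = residue O (FreeCommRing.lift z p) ∧
    FreeCommRing.lift (fun i => (z i : K)) p = (FreeCommRing.lift z p : O) := by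
  constructor
  · have : FreeCommRing.lift (fun i => residue O (z i)) = (residue O).comp (FreeCommRing.lift z) := by
      ext i; simp
    rw [this]; rfl
  · have : FreeCommRing.lift (fun i => (z i : K)) = O.subtype.comp (FreeCommRing.lift z) := by
      ext i; simp
    rw [this]; rfl

theorem residue_zero_iff {K : Type*} [Field K] (O : ValuationSubring K) (a : O) :
    residue O a = 0 ↔ ¬ ∃ c ∈ O, (1 : K) = c * a := by
  rw [residue_eq_zero_iff, mem_maximalIdeal, mem_nonunits_iff, not_iff_not, isUnit_iff_exists_inv']
  constructor
  · rintro ⟨c, hc⟩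
    exact ⟨c, c.2, by rw [← O.coe_mul, hc]; rfl⟩
  · rintro ⟨c, hc, e⟩
    exact ⟨⟨c, hc⟩, Subtype.ext e.symm⟩

open FirstOrder.Language in
theorem rtr_of_vf {K : Type*} {L : Type*} [Field K] [Field L] (O : ValuationSubring K) (OL : ValuationSubring L)
    (H : ∀ φ : vfLang.Sentence, IsExistentialSentence φ → RealizeVF O φ → RealizeVF OL φ) :
    RTr (ResidueField O) (ResidueField OL) := by
  classical
  letI := vfStructure O
  letI := vfStructure OL
  apply rtr_of_lift
  intro n x F hF
  choose X hX using fun i => residue_surjective (x i)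
  obtain rfl : x = fun i => residue O (X i) := funext fun i => (hX i).symm
  let ψ : vfLang.BoundedFormula Empty n := ((F.toList.map fun p => (divF 1 p).not) ++
    ((Finset.univ : Finset (Fin n)).toList.map fun i => divF (FreeCommRing.of i) 1)).foldr (· ⊓ ·) ⊤
  have hψ : ψ.IsQF := by
    apply foldr_qf
    intro φ hφ
    rcases List.mem_append.1 hφ with h | h
    · obtain ⟨p, -, rfl⟩ := List.mem_map.1 h
      exact (BoundedFormula.IsAtomic.rel _ _).isQF.not
    · obtain ⟨p, -, rfl⟩ := List.mem_map.1 h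
      exact (BoundedFormula.IsAtomic.rel _ _).isQF
  have h1 := H ψ.exs ⟨n, ψ, hψ, rfl⟩ (by
    change Sentence.Realize K _
    rw [Sentence.Realize, BoundedFormula.realize_exs]
    refine ⟨fun i => (X i : K), ?_⟩
    rw [BoundedFormula.realize_foldr_inf]
    intro φ hφ
    rcases List.mem_append.1 hφ with h | h
    · obtain ⟨p, hp, rfl⟩ := List.mem_map.1 h
      rw [BoundedFormula.realize_not]
      refine mt (divF_realize O _ _ _).1 ?_
      have h3 := hF p (Finset.mem_toList.1 hp)
      rw [(lift_residue O X p).1, residue_zero_iff] at h3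
      rwa [map_one, (lift_residue O X p).2]
    · obtain ⟨i, -, rfl⟩ := List.mem_map.1 h
      refine (divF_realize O _ _ _).2 ⟨X i, (X i).2, ?_⟩
      rw [map_one, mul_one, FreeCommRing.lift_of])
  change Sentence.Realize L _ at h1
  rw [Sentence.Realize, BoundedFormula.realize_exs] at h1
  obtain ⟨y, hy⟩ := h1
  rw [BoundedFormula.realize_foldr_inf] at hy
  have hyO : ∀ i, y i ∈ OL := by
    intro i
    have h2 := hy _ (List.mem_append_right _ (List.mem_map.2 ⟨i, by simp, rfl⟩))
    obtain ⟨c, hc, e⟩ := (divF_realize OL _ _ _).1 h2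
    rw [map_one, mul_one, FreeCommRing.lift_of] at e
    rwa [e]
  let Y : Fin n → OL := fun i => ⟨y i, hyO i⟩
  refine ⟨fun i => residue OL (Y i), fun p hp => ?_⟩
  have h2 := hy _ (List.mem_append_left _ (List.mem_map.2 ⟨p, Finset.mem_toList.2 hp, rfl⟩))
  rw [BoundedFormula.realize_not] at h2
  replace h2 := mt (divF_realize OL _ _ _).2 h2
  rw [(lift_residue OL Y p).1, residue_zero_iff]
  rw [map_one] at h2
  rwa [← (lift_residue OL Y p).2]

end

/-- Existential Ax–Kochen–Ershov principle: two equicharacteristic henselian nontrivially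
valued fields satisfy the same existential sentences in the language of valued fields if and
only if their residue fields satisfy the same existential sentences in the language of rings. -/
theorem existential_AKE (K : Type*) [Field K] (OK : ValuationSubring K)
    (L : Type*) [Field L] (OL : ValuationSubring L)
    [HenselianLocalRing ↥OK] [HenselianLocalRing ↥OL]
    (hK : IsEquicharacteristic OK) (hL : IsEquicharacteristic OL)
    (hKnt : OK ≠ ⊤) (hLnt : OL ≠ ⊤) :
    (∀ φ : vfLang.Sentence, IsExistentialSentence φ → (RealizeVF OK φ ↔ RealizeVF OL φ)) ↔
      (∀ φ : Language.ring.Sentence, IsExistentialSentence φ →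
        (RealizeRing (ResidueField ↥OK) φ ↔ RealizeRing (ResidueField ↥OL) φ)) := by
  constructor
  · intro H φ hφ
    exact ⟨(rtr_of_vf OK OL fun φ hφ => (H φ hφ).1).ex φ hφ, (rtr_of_vf OL OK fun φ hφ => (H φ hφ).2).ex φ hφ⟩
  · intro H φ hφ
    have h1 := rtr_of_ring fun φ hφ => (H φ hφ).1
    have h2 := rtr_of_ring fun φ hφ => (H φ hφ).2
    have hOK := hens_of_henselian OK
    have hOL := hens_of_henselian OL
    exact ⟨vf_ex OK OL (fun S => transfer hOK hOL hK hL hLnt h1 S) φ hφ,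
      vf_ex OL OK (fun S => transfer hOL hOK hL hK hKnt h2 S) φ hφ⟩
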